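/- (Poonen) There exist computable (recursive) sets T₁ and T₂ of prime numbers, each of natural density zero and with T₁ ∩ T₂ = ∅, such that for every set S of primes with T₁ ⊆ S and S ∩ T₂ = ∅, there is a Diophantine model of ℤ over the ring O_{ℚ,S}: there exist k ∈ ℕ and an injective map φ : ℤ → (O_{ℚ,S})^k such that the sets {(φ(a), φ(b), φ(a+b)) : a, b ∈ ℤ} and {(φ(a), φ(b), φ(a·b)) : a, b ∈ ℤ} are Diophantine over O_{ℚ,S}, and the image of every Diophantine subset of ℤ^m under φ is Diophantine over O_{ℚ,S}. -/

import Mathlib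

/-- A subset `A ⊆ R^ι` (for a finite index type `ι`) is *Diophantine* over a commutative
ring `R` if there are `k ∈ ℕ` and a polynomial `p` with coefficients in `R` such that a
tuple `t` lies in `A` iff `p(t, x) = 0` has a solution `x ∈ R^k`. -/
def IsDiophantine (R : Type*) [CommRing R] (ι : Type) [Fintype ι] (A : Set (ι → R)) : Prop :=
  ∃ (k : ℕ) (p : MvPolynomial (ι ⊕ Fin k) R),
    ∀ t : ι → R, t ∈ A ↔ ∃ x : Fin k → R, MvPolynomial.eval (Sum.elim t x) p = 0

/-- The subring `O_{ℚ,S}` of `ℚ` consisting of all rationals whose reduced denominator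
is divisible only by primes belonging to `S`. -/
def ringOfPrimes (S : Set ℕ) : Subring ℚ where
  carrier := {x : ℚ | ∀ p : ℕ, p.Prime → p ∣ x.den → p ∈ S}
  zero_mem' := by intro p hp hdvd; rw [Rat.den_zero] at hdvd; exact absurd (Nat.dvd_one.mp hdvd) hp.ne_one
  one_mem' := by intro p hp hdvd; rw [Rat.den_one] at hdvd; exact absurd (Nat.dvd_one.mp hdvd) hp.ne_one
  add_mem' := by
    intro x y hx hy p hp hdvd
    have := hdvd.trans (Rat.add_den_dvd x y)
    rcases (Nat.Prime.dvd_mul hp).1 this with h | h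
    · exact hx p hp h
    · exact hy p hp h
  mul_mem' := by
    intro x y hx hy p hp hdvd
    have := hdvd.trans (Rat.mul_den_dvd x y)
    rcases (Nat.Prime.dvd_mul hp).1 this with h | h
    · exact hx p hp h
    · exact hy p hp h
  neg_mem' := by
    intro x hx p hp hdvd
    rw [Rat.neg_den] at hdvd
    exact hx p hp hdvd

open scoped Classical in
/-- The finset of primes `p ≤ X` belonging to `S`. -/
noncomputable def primesUpTo (S : Set ℕ) (X : ℕ) : Finset ℕ :=
  (Finset.range (X + 1)).filter fun p => p.Prime ∧ p ∈ S

/-- A set `S` of primes has natural density `d` if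
`#{p ∈ S : p ≤ X} / #{p prime : p ≤ X} → d` as `X → ∞`. -/
def HasNatDensity (S : Set ℕ) (d : ℝ) : Prop :=
  Filter.Tendsto
    (fun X : ℕ => ((primesUpTo S X).card : ℝ) / ((primesUpTo Set.univ X).card : ℝ))
    Filter.atTop (nhds d)

/-- The elliptic curve `y² = x³ - 25x` (of conductor 800) over a field. -/
def EC (F : Type*) [Field F] : WeierstrassCurve.Affine F := ⟨0, 0, 0, -25, 0⟩

section Curve
variable {F : Type*} [Field F]

@[simp] lemma EC_a₁ : (EC F).a₁ = 0 := rfl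
@[simp] lemma EC_a₂ : (EC F).a₂ = 0 := rfl
@[simp] lemma EC_a₃ : (EC F).a₃ = 0 := rfl
@[simp] lemma EC_a₄ : (EC F).a₄ = -25 := rfl
@[simp] lemma EC_a₆ : (EC F).a₆ = 0 := rfl

lemma EC_equation_iff (x y : F) : (EC F).Equation x y ↔ y ^ 2 = x ^ 3 - 25 * x := by
  rw [WeierstrassCurve.Affine.equation_iff]
  simp only [EC_a₁, EC_a₂, EC_a₃, EC_a₄, EC_a₆]
  constructor <;> intro h <;> linear_combination h

lemma EC_nonsingular_iff (h10 : (10 : F) ≠ 0) (x y : F) :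
    (EC F).Nonsingular x y ↔ y ^ 2 = x ^ 3 - 25 * x := by
  have h2 : (2 : F) ≠ 0 := fun h => h10 (by linear_combination 5 * h)
  have h5 : (5 : F) ≠ 0 := fun h => h10 (by linear_combination 2 * h)
  rw [WeierstrassCurve.Affine.nonsingular_iff, EC_equation_iff]
  simp only [EC_a₁, EC_a₂, EC_a₃, EC_a₄]
  refine ⟨fun h => h.1, fun h => ⟨h, ?_⟩⟩
  by_contra! hc
  obtain ⟨ha, hb⟩ := hc
  have hy : y = 0 := by
    have : 2 * y = 0 := by linear_combination hb
    simpa [h2] using this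
  subst hy
  have h3 : x * (x ^ 2 - 25) = 0 := by linear_combination -h
  have h4 : 3 * x ^ 2 = 25 := by linear_combination -ha
  rcases mul_eq_zero.1 h3 with hx | hx
  · subst hx; apply h5; apply pow_eq_zero_iff (two_ne_zero) |>.1; linear_combination -h4
  · apply h10; apply pow_eq_zero_iff (n := 3) (by norm_num) |>.1
    have : (50 : F) = 0 := by linear_combination h4 - 3 * hx
    linear_combination 20 * this

end Curve

namespace EC
open WeierstrassCurve.Affine

/-- Rational points. -/
abbrev Q := (EC ℚ).Point

lemma nonsing {x y : ℚ} : (EC ℚ).Nonsingular x y ↔ y ^ 2 = x ^ 3 - 25 * x :=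
  EC_nonsingular_iff (by norm_num) x y

/-- The coordinates `s, c, d` of the model `5s² + c² = 1`, `d² = 1 + 5s²`. -/
def s : Q → ℚ
  | .zero => 0
  | .some x y _ => 2 * y / (x ^ 2 + 25)

/-- The coordinate `c` of the model `5s² + c² = 1`, `d² = 1 + 5s²`. -/
def c : Q → ℚ
  | .zero => 1
  | .some x _ _ => (x ^ 2 - 10 * x - 25) / (x ^ 2 + 25)

/-- The coordinate `d` of the model `5s² + c² = 1`, `d² = 1 + 5s²`. -/
def d : Q → ℚ
  | .zero => 1
  | .some x _ _ => (x ^ 2 + 10 * x - 25) / (x ^ 2 + 25)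

@[simp] lemma s_zero : s 0 = 0 := rfl
@[simp] lemma c_zero : c 0 = 1 := rfl
@[simp] lemma d_zero : d 0 = 1 := rfl
lemma s_some {x y : ℚ} (h) : s (.some x y h) = 2 * y / (x ^ 2 + 25) := rfl
lemma c_some {x y : ℚ} (h) : c (.some x y h) = (x ^ 2 - 10 * x - 25) / (x ^ 2 + 25) := rfl
lemma d_some {x y : ℚ} (h) : d (.some x y h) = (x ^ 2 + 10 * x - 25) / (x ^ 2 + 25) := rfl

lemma c_sq (A : Q) : c A ^ 2 = 1 - 5 * s A ^ 2 := by
  rcases A with _ | ⟨x, y, h⟩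
  · simp [c, s]
  · have hy := nonsing.1 h
    have : x ^ 2 + 25 ≠ 0 := by positivity
    rw [c_some, s_some]; field_simp
    linear_combination 20 * hy

lemma d_sq (A : Q) : d A ^ 2 = 1 + 5 * s A ^ 2 := by
  rcases A with _ | ⟨x, y, h⟩
  · simp [d, s]
  · have hy := nonsing.1 h
    have : x ^ 2 + 25 ≠ 0 := by positivity
    rw [d_some, s_some]; field_simp
    linear_combination -20 * hy

lemma s_neg (A : Q) : s (-A) = - s A := by
  rcases A with _ | ⟨x, y, h⟩
  · change s (-0) = - s 0; simp
  · rw [Point.neg_some, s_some, s_some]; simp [negY]; ring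

lemma c_neg (A : Q) : c (-A) = c A := by
  rcases A with _ | ⟨x, y, h⟩
  · change c (-0) = _; simp; rfl
  · rw [Point.neg_some, c_some, c_some]

lemma d_neg (A : Q) : d (-A) = d A := by
  rcases A with _ | ⟨x, y, h⟩
  · change d (-0) = _; simp; rfl
  · rw [Point.neg_some, d_some, d_some]

lemma ext_scd {A B : Q} (hs : s A = s B) (hc : c A = c B) (hd : d A = d B) : A = B := by
  rcases A with _ | ⟨x, y, h⟩ <;> rcases B with _ | ⟨x', y', h'⟩
  · rfl
  · have : x' ^ 2 + 25 ≠ 0 := by positivity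
    rw [c_some] at hc; rw [d_some] at hd; simp only [c, d] at hc hd
    field_simp at hc hd; linarith
  · have : x ^ 2 + 25 ≠ 0 := by positivity
    rw [c_some] at hc; rw [d_some] at hd; simp only [c, d] at hc hd
    field_simp at hc hd; linarith
  · have h1 : x ^ 2 + 25 ≠ 0 := by positivity
    have h2 : x' ^ 2 + 25 ≠ 0 := by positivity
    rw [c_some, c_some, div_eq_div_iff h1 h2] at hc
    rw [d_some, d_some, div_eq_div_iff h1 h2] at hd
    have e1 : x * (x' ^ 2 + 25) = x' * (x ^ 2 + 25) := by linarith
    have e2 : (x ^ 2 + 25) = (x' ^ 2 + 25) := by nlinarith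
    have hx : x = x' := by rw [e2] at e1; exact mul_right_cancel₀ h2 e1
    subst hx
    rw [s_some, s_some] at hs
    field_simp at hs
    subst hs; rfl


lemma chord_aux (x1 x2 y1 y2 : ℚ) (h1 : y1 ^ 2 = x1 ^ 3 - 25 * x1)
    (h2 : y2 ^ 2 = x2 ^ 3 - 25 * x2) (hx : x1 ≠ x2) {l x3 y3 : ℚ} (hl : l = (y1 - y2) / (x1 - x2))
    (hx3 : x3 = l ^ 2 - x1 - x2) (hy3 : y3 = -(l * (x3 - x1) + y1)) :
    x3 = ((x1 * x2 - 25) * (x1 + x2) - 2 * y1 * y2) / (x1 - x2) ^ 2 ∧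
    y3 = -((y1 - y2) * (((x1 * x2 - 25) * (x1 + x2) - 2 * y1 * y2) - x1 * (x1 - x2) ^ 2)
      + y1 * (x1 - x2) ^ 3) / (x1 - x2) ^ 3 := by
  have hD : x1 - x2 ≠ 0 := sub_ne_zero.2 hx
  have h : x3 = ((x1 * x2 - 25) * (x1 + x2) - 2 * y1 * y2) / (x1 - x2) ^ 2 := by
    rw [hx3, hl]; field_simp; linear_combination h1 + h2
  refine ⟨h, ?_⟩
  rw [hy3, h, hl]; field_simp

lemma chord_s (x1 x2 y1 y2 : ℚ) (h1 : y1 ^ 2 = x1 ^ 3 - 25 * x1)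
    (h2 : y2 ^ 2 = x2 ^ 3 - 25 * x2) (hx : x1 ≠ x2) {l x3 y3 : ℚ} (hl : l = (y1 - y2) / (x1 - x2))
    (hx3 : x3 = l ^ 2 - x1 - x2) (hy3 : y3 = -(l * (x3 - x1) + y1)) :
    2 * y3 / (x3 ^ 2 + 25) * ((x1 ^ 2 + 25) ^ 2 * (x2 ^ 2 + 25) ^ 2 + 400 * y1 ^ 2 * y2 ^ 2) =
      2 * (y1 * (x1 ^ 2 + 25) * ((x2 ^ 2 - 25) ^ 2 - 100 * x2 ^ 2) +
        y2 * (x2 ^ 2 + 25) * ((x1 ^ 2 - 25) ^ 2 - 100 * x1 ^ 2)) ∧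
    (x3 ^ 2 - 10 * x3 - 25) / (x3 ^ 2 + 25) *
        ((x1 ^ 2 + 25) ^ 2 * (x2 ^ 2 + 25) ^ 2 + 400 * y1 ^ 2 * y2 ^ 2) =
      (x1 ^ 2 - 10 * x1 - 25) * (x2 ^ 2 - 10 * x2 - 25) * (x1 ^ 2 + 25) * (x2 ^ 2 + 25) -
      20 * y1 * y2 * (x1 ^ 2 + 10 * x1 - 25) * (x2 ^ 2 + 10 * x2 - 25) ∧
    (x3 ^ 2 + 10 * x3 - 25) / (x3 ^ 2 + 25) *
        ((x1 ^ 2 + 25) ^ 2 * (x2 ^ 2 + 25) ^ 2 + 400 * y1 ^ 2 * y2 ^ 2) =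
      (x1 ^ 2 + 10 * x1 - 25) * (x2 ^ 2 + 10 * x2 - 25) * (x1 ^ 2 + 25) * (x2 ^ 2 + 25) +
      20 * y1 * y2 * (x1 ^ 2 - 10 * x1 - 25) * (x2 ^ 2 - 10 * x2 - 25) := by
  have hD : x1 - x2 ≠ 0 := sub_ne_zero.2 hx
  obtain ⟨hx3', hy3'⟩ := chord_aux x1 x2 y1 y2 h1 h2 hx hl hx3 hy3
  set X3 := (x1 * x2 - 25) * (x1 + x2) - 2 * y1 * y2 with hX3
  have hQ : X3 ^ 2 + 25 * (x1 - x2) ^ 4 ≠ 0 := by positivity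
  have hQ' : x3 ^ 2 + 25 = (X3 ^ 2 + 25 * (x1 - x2) ^ 4) / (x1 - x2) ^ 4 := by
    rw [hx3']; field_simp
  have e1 : y1 ^ 3 = y1 * (x1 ^ 3 - 25 * x1) := by rw [← h1]; ring
  have e2 : y2 ^ 3 = y2 * (x2 ^ 3 - 25 * x2) := by rw [← h2]; ring
  have e3 : y1 ^ 4 = (x1 ^ 3 - 25 * x1) ^ 2 := by rw [← h1]; ring
  have e4 : y2 ^ 4 = (x2 ^ 3 - 25 * x2) ^ 2 := by rw [← h2]; ring
  refine ⟨?_, ?_, ?_⟩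
  · have : 2 * y3 / (x3 ^ 2 + 25) = 2 * (-((y1 - y2) * (X3 - x1 * (x1 - x2) ^ 2)
      + y1 * (x1 - x2) ^ 3)) * (x1 - x2) / (X3 ^ 2 + 25 * (x1 - x2) ^ 4) := by
      rw [hQ', hy3']; field_simp
    rw [this, div_mul_eq_mul_div, div_eq_iff hQ, hX3]
    ring_nf
    simp only [h1, h2, e1, e2, e3, e4]
    ring
  · have : (x3 ^ 2 - 10 * x3 - 25) / (x3 ^ 2 + 25) = (X3 ^ 2 - 10 * X3 * (x1 - x2) ^ 2
      - 25 * (x1 - x2) ^ 4) / (X3 ^ 2 + 25 * (x1 - x2) ^ 4) := by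
      rw [hQ', hx3']; field_simp
    rw [this, div_mul_eq_mul_div, div_eq_iff hQ, hX3]
    ring_nf
    simp only [h1, h2, e1, e2, e3, e4]
    ring
  · have : (x3 ^ 2 + 10 * x3 - 25) / (x3 ^ 2 + 25) = (X3 ^ 2 + 10 * X3 * (x1 - x2) ^ 2
      - 25 * (x1 - x2) ^ 4) / (X3 ^ 2 + 25 * (x1 - x2) ^ 4) := by
      rw [hQ', hx3']; field_simp
    rw [this, div_mul_eq_mul_div, div_eq_iff hQ, hX3]
    ring_nf
    simp only [h1, h2, e1, e2, e3, e4]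
    ring

lemma tangent_s (x y : ℚ) (h1 : y ^ 2 = x ^ 3 - 25 * x) (hy : y ≠ 0) {l x3 y3 : ℚ}
    (hl : l = (3 * x ^ 2 - 25) / (2 * y))
    (hx3 : x3 = l ^ 2 - x - x) (hy3 : y3 = -(l * (x3 - x) + y)) :
    2 * y3 / (x3 ^ 2 + 25) * ((x ^ 2 + 25) ^ 4 + 400 * y ^ 4) =
      4 * y * (x ^ 2 + 25) * ((x ^ 2 - 25) ^ 2 - 100 * x ^ 2) ∧
    (x3 ^ 2 - 10 * x3 - 25) / (x3 ^ 2 + 25) * ((x ^ 2 + 25) ^ 4 + 400 * y ^ 4) =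
      (x ^ 2 - 10 * x - 25) ^ 2 * (x ^ 2 + 25) ^ 2 - 20 * y ^ 2 * (x ^ 2 + 10 * x - 25) ^ 2 ∧
    (x3 ^ 2 + 10 * x3 - 25) / (x3 ^ 2 + 25) * ((x ^ 2 + 25) ^ 4 + 400 * y ^ 4) =
      (x ^ 2 + 10 * x - 25) ^ 2 * (x ^ 2 + 25) ^ 2 + 20 * y ^ 2 * (x ^ 2 - 10 * x - 25) ^ 2 := by
  have hx3' : x3 = (x ^ 2 + 25) ^ 2 / (4 * y ^ 2) := by
    rw [hx3, hl]; field_simp; linear_combination -32 * x * h1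
  have hy3' : y3 = -((3 * x ^ 2 - 25) * ((x ^ 2 + 25) ^ 2 - 4 * y ^ 2 * x) + 8 * y ^ 4)
      / (8 * y ^ 3) := by
    rw [hy3, hx3', hl]; field_simp; ring
  have hQ : (x ^ 2 + 25) ^ 4 + 400 * y ^ 4 ≠ 0 := by positivity
  have hQ' : x3 ^ 2 + 25 = ((x ^ 2 + 25) ^ 4 + 400 * y ^ 4) / (16 * y ^ 4) := by
    rw [hx3']; field_simp; ring
  have e3 : y ^ 4 = (x ^ 3 - 25 * x) ^ 2 := by rw [← h1]; ring
  refine ⟨?_, ?_, ?_⟩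
  · have : 2 * y3 / (x3 ^ 2 + 25) = -4 * y * ((3 * x ^ 2 - 25) * ((x ^ 2 + 25) ^ 2 - 4 * y ^ 2 * x)
      + 8 * y ^ 4) / ((x ^ 2 + 25) ^ 4 + 400 * y ^ 4) := by
      rw [hQ', hy3']; field_simp; ring
    rw [this, div_mul_cancel₀ _ hQ, e3, h1]
    ring
  · have : (x3 ^ 2 - 10 * x3 - 25) / (x3 ^ 2 + 25) = ((x ^ 2 + 25) ^ 4 - 40 * (x ^ 2 + 25) ^ 2 * y ^ 2
      - 400 * y ^ 4) / ((x ^ 2 + 25) ^ 4 + 400 * y ^ 4) := by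
      rw [hQ', hx3']; field_simp; ring
    rw [this, div_mul_cancel₀ _ hQ, e3, h1]
    ring
  · have : (x3 ^ 2 + 10 * x3 - 25) / (x3 ^ 2 + 25) = ((x ^ 2 + 25) ^ 4 + 40 * (x ^ 2 + 25) ^ 2 * y ^ 2
      - 400 * y ^ 4) / ((x ^ 2 + 25) ^ 4 + 400 * y ^ 4) := by
      rw [hQ', hx3']; field_simp; ring
    rw [this, div_mul_cancel₀ _ hQ, e3, h1]
    ring

/-- The denominator of the addition law in the coordinates `s, c, d`. -/
def Δ (A B : Q) : ℚ := 1 + 25 * s A ^ 2 * s B ^ 2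

lemma Δ_pos (A B : Q) : 0 < Δ A B := by unfold Δ; positivity

theorem add_law (A B : Q) :
    s (A + B) * Δ A B = s A * c B * d B + s B * c A * d A ∧
    c (A + B) * Δ A B = c A * c B - 5 * s A * s B * d A * d B ∧
    d (A + B) * Δ A B = d A * d B + 5 * s A * s B * c A * c B := by
  unfold Δ
  rcases A with _ | ⟨x1, y1, h1⟩
  · change s (0 + B) * (1 + 25 * s 0 ^ 2 * s B ^ 2) = s 0 * c B * d B + s B * c 0 * d 0 ∧
      c (0 + B) * (1 + 25 * s 0 ^ 2 * s B ^ 2) = c 0 * c B - 5 * s 0 * s B * d 0 * d B ∧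
      d (0 + B) * (1 + 25 * s 0 ^ 2 * s B ^ 2) = d 0 * d B + 5 * s 0 * s B * c 0 * c B
    simp
  rcases B with _ | ⟨x2, y2, h2⟩
  · set A : Q := Point.some x1 y1 h1
    change s (A + 0) * (1 + 25 * s A ^ 2 * s 0 ^ 2) = s A * c 0 * d 0 + s 0 * c A * d A ∧
      c (A + 0) * (1 + 25 * s A ^ 2 * s 0 ^ 2) = c A * c 0 - 5 * s A * s 0 * d A * d 0 ∧
      d (A + 0) * (1 + 25 * s A ^ 2 * s 0 ^ 2) = d A * d 0 + 5 * s A * s 0 * c A * c 0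
    simp
  have e1 := nonsing.1 h1
  have e2 := nonsing.1 h2
  have q1 : x1 ^ 2 + 25 ≠ 0 := by positivity
  have q2 : x2 ^ 2 + 25 ≠ 0 := by positivity
  by_cases hx : x1 = x2
  · subst hx
    by_cases hy : y1 = - y2
    · rw [Point.add_of_Y_eq rfl (by simp [negY, hy])]
      have hc := c_sq (.some x1 y2 h2)
      have hd := d_sq (.some x1 y2 h2)
      have hs1 : s (.some x1 y1 h1) = - s (.some x1 y2 h2) := by
        rw [s_some, s_some, hy]; ring
      have hc1 : c (.some x1 y1 h1) = c (.some x1 y2 h2) := rfl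
      have hd1 : d (.some x1 y1 h1) = d (.some x1 y2 h2) := rfl
      simp only [s_zero, c_zero, d_zero, hs1, hc1, hd1]
      refine ⟨by ring, ?_, ?_⟩
      · linear_combination -hc - 5 * s (.some x1 y2 h2) ^ 2 * hd
      · linear_combination -hd + 5 * s (.some x1 y2 h2) ^ 2 * hc
    · have hy' : y1 ≠ negY (EC ℚ) x1 y2 := by simpa [negY] using hy
      have hyy : y1 = y2 := by
        have : (y1 - y2) * (y1 + y2) = 0 := by linear_combination e1 - e2
        rcases mul_eq_zero.1 this with h | h
        · linarith
        · exact absurd (by linarith) hy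
      subst hyy
      have hy0 : y1 ≠ 0 := fun h => hy (by simp [h])
      rw [Point.add_of_Y_ne hy']
      have hl : slope (EC ℚ) x1 x1 y1 y1 = (3 * x1 ^ 2 - 25) / (2 * y1) := by
        rw [slope_of_Y_ne rfl hy']; simp [negY]; ring_nf
      obtain ⟨t1, t2, t3⟩ := tangent_s x1 y1 e1 hy0 hl (x3 := _) (y3 := _)
        (show addX (EC ℚ) x1 x1 (slope (EC ℚ) x1 x1 y1 y1) = _ by simp [addX])
        (show addY (EC ℚ) x1 x1 y1 (slope (EC ℚ) x1 x1 y1 y1) = _ by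
          simp [addY, negAddY, negY])
      simp only [s_some, c_some, d_some]
      refine ⟨?_, ?_, ?_⟩
      · rw [← mul_left_inj' (pow_ne_zero 4 q1)]
        refine Eq.trans ?_ (t1.trans ?_) <;> field_simp <;> ring
      · rw [← mul_left_inj' (pow_ne_zero 4 q1)]
        refine Eq.trans ?_ (t2.trans ?_) <;> field_simp <;> ring
      · rw [← mul_left_inj' (pow_ne_zero 4 q1)]
        refine Eq.trans ?_ (t3.trans ?_) <;> field_simp <;> ring
  · rw [Point.add_of_X_ne hx]
    have hl : slope (EC ℚ) x1 x2 y1 y2 = (y1 - y2) / (x1 - x2) := slope_of_X_ne hx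
    obtain ⟨t1, t2, t3⟩ := chord_s x1 x2 y1 y2 e1 e2 hx hl (x3 := _) (y3 := _)
        (show addX (EC ℚ) x1 x2 (slope (EC ℚ) x1 x2 y1 y2) = _ by simp [addX])
        (show addY (EC ℚ) x1 x2 y1 (slope (EC ℚ) x1 x2 y1 y2) = _ by
          simp [addY, negAddY, negY])
    simp only [s_some, c_some, d_some]
    have q12 := mul_ne_zero (pow_ne_zero 2 q1) (pow_ne_zero 2 q2)
    refine ⟨?_, ?_, ?_⟩
    · rw [← mul_left_inj' q12]
      refine Eq.trans ?_ (t1.trans ?_) <;> field_simp <;> ring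
    · rw [← mul_left_inj' q12]
      refine Eq.trans ?_ (t2.trans ?_) <;> field_simp <;> ring
    · rw [← mul_left_inj' q12]
      refine Eq.trans ?_ (t3.trans ?_) <;> field_simp <;> ring

end EC

namespace EC
open WeierstrassCurve.Affine

lemma exists_int_of_sq {q : ℚ} {n : ℤ} (h : q ^ 2 = n) : ∃ m : ℤ, q = m := by
  have h1 : (q ^ 2).den = 1 := by rw [h]; rfl
  rw [Rat.den_pow] at h1
  have h2 : q.den = 1 := by simpa using h1
  exact ⟨q.num, (Rat.coe_int_num_of_den_eq_one h2).symm⟩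

/-- The denominator of the coordinate `s`. -/
def Z (A : Q) : ℤ := (s A).den
/-- The numerator of the coordinate `s`. -/
def T (A : Q) : ℤ := (s A).num

lemma Z_pos (A : Q) : 0 < Z A := by unfold Z; exact_mod_cast (s A).pos

lemma Zq_pos (A : Q) : (0 : ℚ) < Z A := by exact_mod_cast Z_pos A

lemma s_eq (A : Q) : s A = T A / Z A := by
  unfold T Z; exact_mod_cast (Rat.num_div_den (s A)).symm

lemma exists_X (A : Q) : ∃ m : ℤ, c A * Z A = m := by
  apply exists_int_of_sq (n := Z A ^ 2 - 5 * T A ^ 2)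
  have := (Zq_pos A).ne'
  rw [mul_pow, c_sq, s_eq]; push_cast; field_simp

lemma exists_Y (A : Q) : ∃ m : ℤ, d A * Z A = m := by
  apply exists_int_of_sq (n := Z A ^ 2 + 5 * T A ^ 2)
  have := (Zq_pos A).ne'
  rw [mul_pow, d_sq, s_eq]; push_cast; field_simp

/-- The numerator of the coordinate `c` over the denominator of `s`. -/
noncomputable def X (A : Q) : ℤ := (exists_X A).choose
/-- The numerator of the coordinate `d` over the denominator of `s`. -/
noncomputable def Y (A : Q) : ℤ := (exists_Y A).choose

lemma c_eq (A : Q) : c A = X A / Z A := by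
  rw [eq_div_iff (Zq_pos A).ne']; exact (exists_X A).choose_spec

lemma d_eq (A : Q) : d A = Y A / Z A := by
  rw [eq_div_iff (Zq_pos A).ne']; exact (exists_Y A).choose_spec

lemma X_sq (A : Q) : X A ^ 2 = Z A ^ 2 - 5 * T A ^ 2 := by
  have h := c_sq A
  have := (Zq_pos A).ne'
  rw [c_eq, s_eq] at h; field_simp at h; exact_mod_cast h

lemma Y_sq (A : Q) : Y A ^ 2 = Z A ^ 2 + 5 * T A ^ 2 := by
  have h := d_sq A
  have := (Zq_pos A).ne'
  rw [d_eq, s_eq] at h; field_simp at h; exact_mod_cast h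

lemma not_dvd_TZ (A : Q) {p : ℕ} (hp : p.Prime) (h1 : (p : ℤ) ∣ T A) : ¬ (p : ℤ) ∣ Z A := by
  intro h2
  have h3 := (s A).reduced
  have : p ∣ Nat.gcd (s A).num.natAbs (s A).den :=
    Nat.dvd_gcd (Int.natCast_dvd.1 h1) (Int.natCast_dvd_natCast.1 h2)
  rw [h3] at this
  exact hp.one_lt.ne' (Nat.dvd_one.1 this)

lemma not_five_dvd_Z (A : Q) : ¬ (5 : ℤ) ∣ Z A := by
  intro h
  have h5 : Prime (5 : ℤ) := by norm_num
  have hX : (5 : ℤ) ∣ X A := h5.dvd_of_dvd_pow (n := 2) (by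
    rw [X_sq]; exact dvd_sub (dvd_pow h two_ne_zero) (dvd_mul_right _ _))
  obtain ⟨a, ha⟩ := h
  obtain ⟨b, hb⟩ := hX
  have h1 := X_sq A
  have : (5 : ℤ) ∣ T A := h5.dvd_of_dvd_pow (n := 2) ⟨a ^ 2 - b ^ 2, by rw [ha, hb] at h1; linarith⟩
  exact not_dvd_TZ A (p := 5) (by norm_num) (by exact_mod_cast this) ⟨a, by exact_mod_cast ha⟩

lemma parity_aux {t z x y : ℤ} (hx : x ^ 2 = z ^ 2 - 5 * t ^ 2) (hy : y ^ 2 = z ^ 2 + 5 * t ^ 2)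
    (h : ¬ (t % 2 = 0 ∧ z % 2 = 0)) : t % 2 = 0 ∧ z % 2 = 1 := by
  have key : ∀ a : ℤ, ∃ k, (a % 2 = 0 ∧ a ^ 2 = 4 * k) ∨ (a % 2 = 1 ∧ a ^ 2 = 8 * k + 1) := by
    intro a
    rcases Int.emod_two_eq_zero_or_one a with ha | ha
    · exact ⟨(a / 2) ^ 2, Or.inl ⟨ha, by nth_rw 1 [← Int.mul_ediv_add_emod a 2, ha]; ring⟩⟩
    · obtain ⟨k, hk⟩ := Int.even_mul_succ_self (a / 2)
      refine ⟨k, Or.inr ⟨ha, ?_⟩⟩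
      nth_rw 1 [← Int.mul_ediv_add_emod a 2, ha]
      linear_combination 4 * hk
  obtain ⟨a, ha⟩ := key t
  obtain ⟨b, hb⟩ := key z
  obtain ⟨e, he⟩ := key x
  obtain ⟨f, hf⟩ := key y
  omega

lemma parity (A : Q) : T A % 2 = 0 ∧ Z A % 2 = 1 := by
  refine parity_aux (X_sq A) (Y_sq A) fun ⟨h1, h2⟩ => ?_
  exact not_dvd_TZ A Nat.prime_two (by exact_mod_cast Int.dvd_of_emod_eq_zero h1)
    (by exact_mod_cast Int.dvd_of_emod_eq_zero h2)

lemma not_dvd_ZX (A : Q) {p : ℕ} (hp : p.Prime) (h1 : (p : ℤ) ∣ Z A) : ¬ (p : ℤ) ∣ X A := by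
  intro h2
  have hp' : Prime (p : ℤ) := Nat.prime_iff_prime_int.1 hp
  have h : (p : ℤ) ∣ 5 * T A ^ 2 := by
    have : 5 * T A ^ 2 = Z A ^ 2 - X A ^ 2 := by rw [X_sq]; ring
    rw [this]; exact dvd_sub (dvd_pow h1 two_ne_zero) (dvd_pow h2 two_ne_zero)
  rcases hp'.dvd_or_dvd h with h | h
  · have : p ∣ 5 := by exact_mod_cast h
    rw [Nat.prime_dvd_prime_iff_eq hp (by norm_num)] at this
    subst this; exact not_five_dvd_Z A h1
  · exact not_dvd_TZ A hp (hp'.dvd_of_dvd_pow h) h1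

lemma not_dvd_ZY (A : Q) {p : ℕ} (hp : p.Prime) (h1 : (p : ℤ) ∣ Z A) : ¬ (p : ℤ) ∣ Y A := by
  intro h2
  have hp' : Prime (p : ℤ) := Nat.prime_iff_prime_int.1 hp
  have h : (p : ℤ) ∣ 5 * T A ^ 2 := by
    have : 5 * T A ^ 2 = Y A ^ 2 - Z A ^ 2 := by rw [Y_sq]; ring
    rw [this]; exact dvd_sub (dvd_pow h2 two_ne_zero) (dvd_pow h1 two_ne_zero)
  rcases hp'.dvd_or_dvd h with h | h
  · have : p ∣ 5 := by exact_mod_cast h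
    rw [Nat.prime_dvd_prime_iff_eq hp (by norm_num)] at this
    subst this; exact not_five_dvd_Z A h1
  · exact not_dvd_TZ A hp (hp'.dvd_of_dvd_pow h) h1

lemma not_dvd_TX (A : Q) {p : ℕ} (hp : p.Prime) (h1 : (p : ℤ) ∣ T A) : ¬ (p : ℤ) ∣ X A := by
  intro h2
  have hp' : Prime (p : ℤ) := Nat.prime_iff_prime_int.1 hp
  refine not_dvd_TZ A hp h1 (hp'.dvd_of_dvd_pow (n := 2) ?_)
  have : Z A ^ 2 = X A ^ 2 + 5 * T A ^ 2 := by rw [X_sq]; ring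
  rw [this]
  exact dvd_add (dvd_pow h2 two_ne_zero) ((dvd_pow h1 two_ne_zero).mul_left _)

lemma Z_neg (A : Q) : Z (-A) = Z A := by unfold Z; rw [s_neg, Rat.neg_den]

lemma s_mul_s (A B : Q) : s (A + B) * s (A - B) * Δ A B = s A ^ 2 - s B ^ 2 := by
  have h1 := (add_law A B).1
  have h2 := (add_law A (-B)).1
  rw [← sub_eq_add_neg] at h2
  have hD : Δ A (-B) = Δ A B := by simp [Δ, s_neg]
  rw [hD, s_neg, c_neg, d_neg] at h2
  have hne := (Δ_pos A B).ne'
  apply mul_right_cancel₀ hne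
  have : s (A + B) * s (A - B) * Δ A B * Δ A B = (s (A + B) * Δ A B) * (s (A - B) * Δ A B) := by ring
  rw [this, h1, h2]; unfold Δ
  have e1 := c_sq A; have e2 := c_sq B; have e3 := d_sq A; have e4 := d_sq B
  have : (s A * c B * d B + s B * c A * d A) * (s A * c B * d B + -s B * c A * d A) =
    s A ^ 2 * c B ^ 2 * d B ^ 2 - s B ^ 2 * c A ^ 2 * d A ^ 2 := by ring
  rw [this, e1, e2, e3, e4]; ring

lemma c_mul_c (A B : Q) :
    c (A + B) * c (A - B) * Δ A B = 1 - 5 * s A ^ 2 - 5 * s B ^ 2 - 25 * s A ^ 2 * s B ^ 2 := by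
  have h1 := (add_law A B).2.1
  have h2 := (add_law A (-B)).2.1
  rw [← sub_eq_add_neg] at h2
  have hD : Δ A (-B) = Δ A B := by simp [Δ, s_neg]
  rw [hD, s_neg, c_neg, d_neg] at h2
  have hne := (Δ_pos A B).ne'
  apply mul_right_cancel₀ hne
  have : c (A + B) * c (A - B) * Δ A B * Δ A B = (c (A + B) * Δ A B) * (c (A - B) * Δ A B) := by ring
  rw [this, h1, h2]; unfold Δ
  have e1 := c_sq A; have e2 := c_sq B; have e3 := d_sq A; have e4 := d_sq B
  have : (c A * c B - 5 * s A * s B * d A * d B) * (c A * c B - 5 * s A * -s B * d A * d B) =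
    c A ^ 2 * c B ^ 2 - 25 * s A ^ 2 * s B ^ 2 * d A ^ 2 * d B ^ 2 := by ring
  rw [this, e1, e2, e3, e4]; ring

lemma par_dvd (A B : Q) :
    Z (A + B) * Z (A - B) ∣ Z A ^ 2 * Z B ^ 2 + 25 * T A ^ 2 * T B ^ 2 := by
  set N := Z A ^ 2 * Z B ^ 2 + 25 * T A ^ 2 * T B ^ 2 with hN
  have z1 := (Zq_pos A).ne'; have z2 := (Zq_pos B).ne'
  have z3 := (Zq_pos (A + B)).ne'; have z4 := (Zq_pos (A - B)).ne'
  have h1 : Z (A + B) * Z (A - B) ∣ T (A + B) * T (A - B) * N := by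
    have h := s_mul_s A B
    refine ⟨T A ^ 2 * Z B ^ 2 - T B ^ 2 * Z A ^ 2, ?_⟩
    unfold Δ at h
    rw [s_eq, s_eq (A - B), s_eq A, s_eq B] at h
    field_simp at h
    have h' : ((T (A + B) * T (A - B) * N : ℤ) : ℚ) =
      (Z (A + B) * Z (A - B) * (T A ^ 2 * Z B ^ 2 - T B ^ 2 * Z A ^ 2) : ℤ) := by
      rw [hN]; push_cast; linear_combination h
    exact_mod_cast h'
  have h2 : Z (A + B) * Z (A - B) ∣ X (A + B) * X (A - B) * N := by
    have h := c_mul_c A B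
    refine ⟨Z A ^ 2 * Z B ^ 2 - 5 * T A ^ 2 * Z B ^ 2 - 5 * T B ^ 2 * Z A ^ 2
      - 25 * T A ^ 2 * T B ^ 2, ?_⟩
    unfold Δ at h
    rw [c_eq, c_eq (A - B), s_eq A, s_eq B] at h
    field_simp at h
    have h' : ((X (A + B) * X (A - B) * N : ℤ) : ℚ) =
      (Z (A + B) * Z (A - B) * (Z A ^ 2 * Z B ^ 2 - 5 * T A ^ 2 * Z B ^ 2 - 5 * T B ^ 2 * Z A ^ 2
      - 25 * T A ^ 2 * T B ^ 2) : ℤ) := by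
      rw [hN]; push_cast; linear_combination h
    exact_mod_cast h'
  set G := gcd (T (A + B) * T (A - B)) (X (A + B) * X (A - B)) with hG
  have h3 : Z (A + B) * Z (A - B) ∣ G * N := by
    have := dvd_gcd h1 h2
    rw [gcd_mul_right] at this
    exact this.trans (by rw [hG]; exact mul_dvd_mul_left _ (normalize_dvd_iff.2 dvd_rfl))
  refine IsCoprime.dvd_of_dvd_mul_left ?_ h3
  rw [Int.isCoprime_iff_gcd_eq_one]
  by_contra hne
  obtain ⟨p, hp, hpd⟩ := Nat.exists_prime_and_dvd hne
  have hp' : Prime (p : ℤ) := Nat.prime_iff_prime_int.1 hp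
  have hd1 : (p : ℤ) ∣ Z (A + B) * Z (A - B) :=
    (Int.natCast_dvd_natCast.2 hpd).trans (Int.gcd_dvd_left ..)
  have hd2 : (p : ℤ) ∣ G := (Int.natCast_dvd_natCast.2 hpd).trans (Int.gcd_dvd_right ..)
  have hd3 : (p : ℤ) ∣ T (A + B) * T (A - B) := hd2.trans (gcd_dvd_left _ _)
  have hd4 : (p : ℤ) ∣ X (A + B) * X (A - B) := hd2.trans (gcd_dvd_right _ _)
  have key : ∀ C D : Q, (p : ℤ) ∣ Z C → (p : ℤ) ∣ T C * T D → (p : ℤ) ∣ X C * X D → False := by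
    intro C D hz ht hx
    have h5 := (hp'.dvd_or_dvd ht).resolve_left (fun h => not_dvd_TZ C hp h hz)
    have h6 := (hp'.dvd_or_dvd hx).resolve_left (not_dvd_ZX C hp hz)
    exact not_dvd_TX D hp h5 h6
  rcases hp'.dvd_or_dvd hd1 with h | h
  · exact key _ _ h hd3 hd4
  · exact key _ _ h (by rwa [mul_comm]) (by rwa [mul_comm])

lemma five_T_sq_le (A : Q) : 5 * T A ^ 2 ≤ Z A ^ 2 := by
  have := X_sq A; nlinarith [sq_nonneg (X A)]

lemma par_le (A B : Q) : Z (A + B) * Z (A - B) ≤ 2 * Z A ^ 2 * Z B ^ 2 := by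
  have h1 := par_dvd A B
  have hz := Z_pos A; have hz' := Z_pos B
  refine (Int.le_of_dvd (by positivity) h1).trans ?_
  have h2 := five_T_sq_le A
  have h3 := five_T_sq_le B
  have := mul_le_mul h2 h3 (by positivity) (by positivity)
  nlinarith

lemma double_num_den (A : Q) : Z (A + A) = Z A ^ 4 + 25 * T A ^ 4 ∧ T (A + A) = 2 * T A * X A * Y A * Z A := by
  have z1 := (Zq_pos A).ne'
  have h := (add_law A A).1
  have hZ := Z_pos A
  have hN : 0 < Z A ^ 4 + 25 * T A ^ 4 := by positivity
  have hNq : ((Z A : ℚ) ^ 4 + 25 * T A ^ 4) ≠ 0 := by exact_mod_cast hN.ne'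
  have hs : s (A + A) = ((2 * T A * X A * Y A * Z A : ℤ) : ℚ) / ((Z A ^ 4 + 25 * T A ^ 4 : ℤ) : ℚ) := by
    unfold Δ at h
    rw [s_eq A, c_eq A, d_eq A] at h
    push_cast
    rw [eq_div_iff hNq]
    field_simp at h
    linear_combination h
  have hcop : IsCoprime (2 * T A * X A * Y A * Z A : ℤ) (Z A ^ 4 + 25 * T A ^ 4) := by
    rw [Int.isCoprime_iff_gcd_eq_one]
    by_contra hne
    obtain ⟨p, hp, hpd⟩ := Nat.exists_prime_and_dvd hne
    have hp' : Prime (p : ℤ) := Nat.prime_iff_prime_int.1 hp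
    have hd1 : (p : ℤ) ∣ 2 * T A * X A * Y A * Z A :=
      (Int.natCast_dvd_natCast.2 hpd).trans (Int.gcd_dvd_left ..)
    have hd2 : (p : ℤ) ∣ Z A ^ 4 + 25 * T A ^ 4 :=
      (Int.natCast_dvd_natCast.2 hpd).trans (Int.gcd_dvd_right ..)
    have hp5 : ¬ ((p : ℤ) ∣ 5 ∧ (p : ℤ) ∣ Z A) := by
      rintro ⟨h, h'⟩
      have : p ∣ 5 := by exact_mod_cast h
      rw [Nat.prime_dvd_prime_iff_eq hp (by norm_num)] at this
      subst this; exact not_five_dvd_Z A h'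
    have hz : ¬ (p : ℤ) ∣ Z A := by
      intro hz
      have : (p : ℤ) ∣ 25 * T A ^ 4 := (dvd_add_right (dvd_pow hz four_ne_zero)).1 hd2
      rcases hp'.dvd_or_dvd this with h | h
      · exact hp5 ⟨hp'.dvd_of_dvd_pow (n := 2) (by norm_num; exact h), hz⟩
      · exact not_dvd_TZ A hp (hp'.dvd_of_dvd_pow h) hz
    have ht : ¬ (p : ℤ) ∣ T A := fun ht => hz <| hp'.dvd_of_dvd_pow (n := 4) <|
      (dvd_add_left ((dvd_pow ht four_ne_zero).mul_left _)).1 hd2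
    have h2 : ¬ (p : ℤ) ∣ 2 := by
      intro h2
      have : p ∣ 2 := by exact_mod_cast h2
      rw [Nat.prime_dvd_prime_iff_eq hp Nat.prime_two] at this
      subst this
      obtain ⟨h5, h6⟩ := parity A
      have h5 : (2 : ℤ) ∣ T A := Int.dvd_of_emod_eq_zero h5
      exact ht h5
    have h50 : ¬ (p : ℤ) ∣ 50 * T A ^ 4 := by
      intro h
      rw [show (50 : ℤ) * T A ^ 4 = 2 * 5 ^ 2 * T A ^ 4 by ring] at h
      rcases hp'.dvd_or_dvd h with h | h
      · rcases hp'.dvd_or_dvd h with h | h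
        · exact h2 h
        · refine hz (hp'.dvd_of_dvd_pow (n := 4) ((dvd_add_left ?_).1 hd2))
          exact (show (p : ℤ) ∣ 25 by norm_num at h; exact h).mul_right _
      · exact ht (hp'.dvd_of_dvd_pow h)
    rcases hp'.dvd_or_dvd hd1 with h | h
    · rcases hp'.dvd_or_dvd h with h | h
      · rcases hp'.dvd_or_dvd h with h | h
        · rcases hp'.dvd_or_dvd h with h | h
          · exact h2 h
          · exact ht h
        · apply h50
          have e : 50 * T A ^ 4 = (Z A ^ 4 + 25 * T A ^ 4) - X A ^ 2 * (Z A ^ 2 + 5 * T A ^ 2) := by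
            rw [X_sq]; ring
          rw [e]
          exact dvd_sub hd2 ((dvd_pow h two_ne_zero).mul_right _)
      · apply h50
        have e : 50 * T A ^ 4 = (Z A ^ 4 + 25 * T A ^ 4) - Y A ^ 2 * (Z A ^ 2 - 5 * T A ^ 2) := by
          rw [Y_sq]; ring
        rw [e]
        exact dvd_sub hd2 ((dvd_pow h two_ne_zero).mul_right _)
    · exact hz h
  have h1 : ((s (A + A)).den : ℤ) = Z A ^ 4 + 25 * T A ^ 4 := by
    rw [hs, Rat.den_div_eq_of_coprime hN (Int.isCoprime_iff_nat_coprime.1 hcop)]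
  have h2 : (s (A + A)).num = 2 * T A * X A * Y A * Z A := by
    rw [hs, Rat.num_div_eq_of_coprime hN (Int.isCoprime_iff_nat_coprime.1 hcop)]
  exact ⟨h1, h2⟩

lemma Z_double (A : Q) : Z (A + A) = Z A ^ 4 + 25 * T A ^ 4 := (double_num_den A).1

lemma T_double (A : Q) : T (A + A) = 2 * T A * X A * Y A * Z A := (double_num_den A).2

/-- The logarithmic height attached to the denominator of `s`. -/
noncomputable def ht (A : Q) : ℝ := Real.log (Z A)

lemma ht_nonneg (A : Q) : 0 ≤ ht A := Real.log_nonneg (by exact_mod_cast Z_pos A)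

lemma Zr_pos (A : Q) : (0 : ℝ) < Z A := by exact_mod_cast Z_pos A

lemma ht_neg (A : Q) : ht (-A) = ht A := by unfold ht; rw [Z_neg]

lemma ht_add_add_ht_sub_le (A B : Q) : ht (A + B) + ht (A - B) ≤ 2 * ht A + 2 * ht B + Real.log 2 := by
  have h := par_le A B
  have h' : (Z (A + B) * Z (A - B) : ℝ) ≤ 2 * Z A ^ 2 * Z B ^ 2 := by exact_mod_cast h
  have a1 := Zr_pos A; have a2 := Zr_pos B; have a3 := Zr_pos (A + B); have a4 := Zr_pos (A - B)
  have := Real.log_le_log (by positivity) h'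
  rw [Real.log_mul a3.ne' a4.ne', Real.log_mul (by positivity) (by positivity),
    Real.log_mul (by positivity) (by positivity), Real.log_pow, Real.log_pow] at this
  push_cast at this; unfold ht; linarith

lemma four_mul_ht_le (A : Q) : 4 * ht A ≤ ht (A + A) := by
  have h' : (Z A : ℝ) ^ 4 ≤ Z (A + A) := by
    rw [Z_double]; push_cast; nlinarith [sq_nonneg ((T A : ℝ) ^ 2)]
  have := Real.log_le_log (pow_pos (Zr_pos A) 4) h'
  rw [Real.log_pow] at this
  exact_mod_cast this

lemma le_ht_add_add_ht_sub (A B : Q) :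
    2 * ht A + 2 * ht B - Real.log 2 / 2 ≤ ht (A + B) + ht (A - B) := by
  have h := ht_add_add_ht_sub_le (A + B) (A - B)
  have h1 := four_mul_ht_le A
  have h2 := four_mul_ht_le B
  have e1 : A + B + (A - B) = A + A := by abel
  have e2 : A + B - (A - B) = B + B := by abel
  rw [e1, e2] at h
  linarith

end EC

namespace EC
open WeierstrassCurve.Affine

/-- The point `(-4, 6)`, of infinite order. -/
def P : Q := .some (-4) 6 (nonsing.2 (by norm_num))

lemma s_P : s P = 12 / 41 := by unfold P; rw [s_some]; norm_num
lemma c_P : c P = 31 / 41 := by unfold P; rw [c_some]; norm_num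
lemma d_P : d P = -49 / 41 := by unfold P; rw [d_some]; norm_num

lemma Z_P : Z P = 41 := by unfold Z; rw [s_P]; norm_num

lemma ht_P_bounds : 3.5 ≤ ht P ∧ ht P ≤ 4 := by
  have h : ht P = Real.log 41 := by unfold ht; rw [Z_P]; norm_num
  have l2 := Real.log_two_gt_d9
  have l2' := Real.log_two_lt_d9
  have e : Real.log 41 = 5 * Real.log 2 + Real.log (41 / 32) := by
    rw [show (41 : ℝ) = 2 ^ 5 * (41 / 32) by norm_num, Real.log_mul (by norm_num) (by norm_num),
      Real.log_pow]; norm_num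
  have b1 := Real.one_sub_inv_le_log_of_pos (show (0 : ℝ) < 41 / 32 by norm_num)
  have b2 := Real.log_le_sub_one_of_pos (show (0 : ℝ) < 41 / 32 by norm_num)
  rw [h, e]
  norm_num at b1 b2 l2 l2' ⊢
  constructor <;> linarith

@[simp] lemma ht_zero : ht 0 = 0 := by simp [ht, Z]

lemma ht_nsmul_bounds (n : ℕ) : 3 * (n : ℝ) ^ 2 ≤ ht (n • P) ∧ ht (n • P) ≤ 5 * (n : ℝ) ^ 2 := by
  obtain ⟨p1, p2⟩ := ht_P_bounds
  have l2' := Real.log_two_lt_d9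
  have l0 := Real.log_two_gt_d9
  have key : ∀ n : ℕ, 6 * (n : ℝ) + 3 ≤ ht ((n + 1) • P) - ht (n • P) ∧
      ht ((n + 1) • P) - ht (n • P) ≤ 10 * (n : ℝ) + 5 := by
    intro n
    induction n with
    | zero => simp; constructor <;> linarith
    | succ n ih =>
      have h1 := ht_add_add_ht_sub_le ((n + 1) • P) P
      have h2 := le_ht_add_add_ht_sub ((n + 1) • P) P
      have e1 : (n + 1) • P + P = (n + 1 + 1) • P := by rw [succ_nsmul (n := n + 1)]
      have e2 : (n + 1) • P - P = n • P := by rw [succ_nsmul]; abel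
      rw [e1, e2] at h1 h2
      push_cast
      constructor <;> linarith [ih.1, ih.2]
  induction n with
  | zero => simp
  | succ n ih =>
    have := key n
    push_cast
    constructor <;> nlinarith [ih.1, ih.2, this.1, this.2]

lemma ht_zsmul (n : ℤ) : ht (n • P) = ht (n.natAbs • P) := by
  rcases Int.natAbs_eq n with h | h
  · conv_lhs => rw [h, natCast_zsmul]
  · conv_lhs => rw [h, neg_smul, natCast_zsmul, ht_neg]

lemma ht_zsmul_bounds (n : ℤ) : 3 * (n : ℝ) ^ 2 ≤ ht (n • P) ∧ ht (n • P) ≤ 5 * (n : ℝ) ^ 2 := by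
  have h := ht_nsmul_bounds n.natAbs
  rw [ht_zsmul]
  have e : ((n.natAbs : ℝ)) ^ 2 = (n : ℝ) ^ 2 := by
    rw [Nat.cast_natAbs]; push_cast; rw [sq_abs]
  rwa [e] at h

lemma zsmul_P_eq_zero {n : ℤ} (h : n • P = 0) : n = 0 := by
  have := (ht_zsmul_bounds n).1
  rw [h, ht_zero] at this
  have : (n : ℝ) ^ 2 = 0 := le_antisymm (by linarith) (sq_nonneg _)
  exact_mod_cast pow_eq_zero_iff two_ne_zero |>.1 this

lemma zsmul_P_injective : Function.Injective fun n : ℤ => n • P := by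
  intro a b h
  have h : a • P = b • P := h
  have : (a - b) • P = 0 := by rw [sub_smul, h, sub_self]
  linarith [zsmul_P_eq_zero this]

lemma ht_of_s_eq_zero {A : Q} (h : s A = 0) : ht A = 0 := by simp [ht, Z, h]

lemma s_zsmul_P_ne_zero {n : ℤ} (hn : n ≠ 0) : s (n • P) ≠ 0 := by
  intro h
  have := (ht_zsmul_bounds n).1
  rw [ht_of_s_eq_zero h] at this
  have h0 : (0 : ℝ) < (n : ℝ) ^ 2 := by positivity
  linarith

lemma finite_Z_le (B : ℤ) : {A : Q | Z A ≤ B}.Finite := by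
  let g : Q → ℤ × ℤ × ℤ × ℤ := fun A => (Z A, T A, X A, Y A)
  have hg : Function.Injective g := by
    intro A A' h
    simp only [g, Prod.mk.injEq] at h
    obtain ⟨h1, h2, h3, h4⟩ := h
    exact ext_scd (by rw [s_eq, s_eq, h1, h2]) (by rw [c_eq, c_eq, h1, h3])
      (by rw [d_eq, d_eq, h1, h4])
  refine Set.Finite.of_finite_image (f := g) ?_ hg.injOn
  refine (((Set.finite_Icc (0 : ℤ) B).prod ((Set.finite_Icc (-(2 * B)) (2 * B)).prod
    ((Set.finite_Icc (-(2 * B)) (2 * B)).prod (Set.finite_Icc (-(2 * B)) (2 * B)))))).subset ?_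
  rintro _ ⟨A, hA, rfl⟩
  have hA : Z A ≤ B := hA
  have hz := Z_pos A
  have h5 := five_T_sq_le A
  have hx := X_sq A
  have hy := Y_sq A
  have hT : |T A| ≤ |2 * B| := sq_le_sq.1 (by nlinarith [sq_nonneg (T A)])
  have hX : |X A| ≤ |2 * B| := sq_le_sq.1 (by nlinarith [sq_nonneg (T A)])
  have hY : |Y A| ≤ |2 * B| := sq_le_sq.1 (by nlinarith [sq_nonneg (T A)])
  rw [abs_of_pos (show 0 < 2 * B by linarith), abs_le] at hT hX hY
  simp only [g, Set.mem_prod, Set.mem_Icc]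
  exact ⟨⟨hz.le, hA⟩, hT, hX, hY⟩

lemma finite_ht_le (B : ℝ) : {A : Q | ht A ≤ B}.Finite := by
  refine (finite_Z_le ⌈Real.exp B⌉).subset fun A hA => ?_
  have hA : Real.log (Z A) ≤ B := hA
  rw [Real.log_le_iff_le_exp (Zr_pos A)] at hA
  exact_mod_cast hA.trans (Int.le_ceil _)

lemma d_ne_zero (A : Q) : d A ≠ 0 := by
  intro h; have := d_sq A; rw [h] at this; nlinarith [sq_nonneg (s A)]

lemma d_add_pos_iff (A B : Q) : 0 < d (A + B) ↔ 0 < d A * d B := by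
  have h := (add_law A B).2.2
  have hΔ := Δ_pos A B
  have a1 := c_sq A; have a2 := c_sq B; have a3 := d_sq A; have a4 := d_sq B
  have b : (5 * s A * s B * c A * c B) ^ 2 < (d A * d B) ^ 2 := by
    have e1 : (5 * s A * s B * c A * c B) ^ 2 = (5 * s A ^ 2 * (1 - 5 * s A ^ 2)) *
      (5 * s B ^ 2 * (1 - 5 * s B ^ 2)) := by rw [← a1, ← a2]; ring
    have e2 : (d A * d B) ^ 2 = (1 + 5 * s A ^ 2) * (1 + 5 * s B ^ 2) := by rw [← a3, ← a4]; ring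
    rw [e1, e2]
    have k : ∀ t : ℚ, 5 * t ^ 2 * (1 - 5 * t ^ 2) ≤ 1 / 4 := fun t => by
      nlinarith [sq_nonneg (5 * t ^ 2 - 1 / 2)]
    have k0 : ∀ C : Q, 0 ≤ 5 * s C ^ 2 * (1 - 5 * s C ^ 2) := fun C => by
      rw [← c_sq]; positivity
    have := mul_le_mul (k (s A)) (k (s B)) (k0 B) (by norm_num)
    nlinarith [sq_nonneg (s A), sq_nonneg (s B), mul_nonneg (sq_nonneg (s A)) (sq_nonneg (s B))]
  rw [← mul_pos_iff_of_pos_right hΔ, h]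
  have b := sq_lt_sq.1 b
  constructor
  · intro h0
    by_contra hn
    rw [abs_of_nonpos (not_lt.1 hn)] at b
    linarith [le_abs_self (5 * s A * s B * c A * c B)]
  · intro h0
    rw [abs_of_pos h0] at b
    linarith [neg_abs_le (5 * s A * s B * c A * c B)]

lemma d_nsmul_P (n : ℕ) : 0 < d (n • P) ↔ Even n := by
  induction n with
  | zero => simp
  | succ n ih =>
    have hP : d P < 0 := by rw [d_P]; norm_num
    rw [succ_nsmul, d_add_pos_iff, Nat.even_add_one, ← ih, not_lt]
    constructor
    · intro h; nlinarith
    · intro h; exact mul_pos_of_neg_of_neg (lt_of_le_of_ne h (d_ne_zero _)) hP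

lemma d_zsmul_P (n : ℤ) : 0 < d (n • P) ↔ Even n := by
  rw [← Int.natAbs_even, ← d_nsmul_P]
  rcases Int.natAbs_eq n with h | h
  · conv_lhs => rw [h, natCast_zsmul]
  · conv_lhs => rw [h, neg_smul, natCast_zsmul, d_neg]

/-- The `x`-coordinate (zero at infinity). -/
def xc : Q → ℚ
  | .zero => 0
  | .some x _ _ => x
/-- The `y`-coordinate (zero at infinity). -/
def yc : Q → ℚ
  | .zero => 0
  | .some _ y _ => y

@[simp] lemma xc_some {x y : ℚ} (h) : xc (.some x y h) = x := rfl
@[simp] lemma yc_some {x y : ℚ} (h) : yc (.some x y h) = y := rfl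
@[simp] lemma xc_zero : xc 0 = 0 := rfl
@[simp] lemma yc_zero : yc 0 = 0 := rfl
lemma xc_neg (A : Q) : xc (-A) = xc A := by
  rcases A with _ | ⟨x, y, h⟩
  · change xc (-0) = xc 0; simp
  · rw [Point.neg_some]; rfl
lemma yc_neg (A : Q) : yc (-A) = - yc A := by
  rcases A with _ | ⟨x, y, h⟩
  · change yc (-0) = - yc 0; simp
  · rw [Point.neg_some]; simp [negY]

lemma yc_sq (A : Q) : yc A ^ 2 = xc A ^ 3 - 25 * xc A := by
  rcases A with _ | ⟨x, y, h⟩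
  · simp [xc, yc]
  · exact nonsing.1 h

lemma s_of_ne {A : Q} (h : A ≠ 0) : s A = 2 * yc A / (xc A ^ 2 + 25) := by
  rcases A with _ | ⟨x, y, h'⟩
  · exact absurd rfl h
  · rfl
lemma c_of_ne {A : Q} (h : A ≠ 0) : c A = (xc A ^ 2 - 10 * xc A - 25) / (xc A ^ 2 + 25) := by
  rcases A with _ | ⟨x, y, h'⟩
  · exact absurd rfl h
  · rfl
lemma d_of_ne {A : Q} (h : A ≠ 0) : d A = (xc A ^ 2 + 10 * xc A - 25) / (xc A ^ 2 + 25) := by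
  rcases A with _ | ⟨x, y, h'⟩
  · exact absurd rfl h
  · rfl

lemma xc_odd {n : ℤ} (hn : Odd n) : -5 ≤ xc (n • P) ∧ xc (n • P) < 0 := by
  have hd : ¬ 0 < d (n • P) := by rw [d_zsmul_P]; exact Int.not_even_iff_odd.2 hn
  have hn0 : n ≠ 0 := by rintro rfl; simp at hn
  have h0 : n • P ≠ 0 := fun h => hn0 (zsmul_P_eq_zero h)
  have hs := s_zsmul_P_ne_zero hn0
  set A := n • P
  have hy := yc_sq A
  have hq : 0 < xc A ^ 2 + 25 := by positivity
  rw [d_of_ne h0, not_lt, div_le_iff₀ hq, zero_mul] at hd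
  rw [s_of_ne h0] at hs
  have hy0 : yc A ≠ 0 := by rintro h; simp [h] at hs
  have hy1 : 0 < xc A ^ 3 - 25 * xc A := by rw [← hy]; positivity
  have hlt : xc A < 5 := by nlinarith
  have hx0 : xc A < 0 := by
    by_contra h
    nlinarith [mul_nonneg (not_lt.1 h) (show (0 : ℚ) ≤ 25 - xc A ^ 2 by nlinarith)]
  refine ⟨?_, hx0⟩
  by_contra h
  nlinarith [mul_pos (neg_pos.2 hx0) (show (0 : ℚ) < xc A ^ 2 - 25 by nlinarith)]

end EC

namespace EC
open WeierstrassCurve.Affine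

/-- `A` has finite nonzero `x`-coordinate classes `(u, v)` for `(x, x - 5)` modulo squares. -/
def HasClass (x u v : ℚ) : Prop := (∃ a ≠ 0, x = u * a ^ 2) ∧ (∃ b ≠ 0, x - 5 = v * b ^ 2)

lemma add_of_xc_ne {A B : Q} (hA : A ≠ 0) (hB : B ≠ 0) (hx : xc A ≠ xc B) :
    A + B ≠ 0 ∧ xc (A + B) = ((yc A - yc B) / (xc A - xc B)) ^ 2 - xc A - xc B ∧
    yc (A + B) = -((yc A - yc B) / (xc A - xc B) * (xc (A + B) - xc A) + yc A) := by
  rcases A with _ | ⟨x₁, y₁, h₁⟩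
  · exact absurd rfl hA
  rcases B with _ | ⟨x₂, y₂, h₂⟩
  · exact absurd rfl hB
  have hx : x₁ ≠ x₂ := hx
  have hl : slope (EC ℚ) x₁ x₂ y₁ y₂ = (y₁ - y₂) / (x₁ - x₂) := slope_of_X_ne hx
  rw [Point.add_of_X_ne hx]
  refine ⟨Point.some_ne_zero _, ?_, ?_⟩
  · simp [addX, hl]
  · simp [addY, negAddY, negY, addX, hl]

lemma add_self_of_yc_ne {A : Q} (hy : yc A ≠ 0) :
    A + A ≠ 0 ∧ xc (A + A) = ((3 * xc A ^ 2 - 25) / (2 * yc A)) ^ 2 - 2 * xc A ∧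
    yc (A + A) = -((3 * xc A ^ 2 - 25) / (2 * yc A) * (xc (A + A) - xc A) + yc A) := by
  rcases A with _ | ⟨x₁, y₁, h₁⟩
  · exact absurd rfl hy
  have hy : y₁ ≠ 0 := hy
  have hneg : y₁ ≠ negY (EC ℚ) x₁ y₁ := by
    simp only [negY, EC_a₁, EC_a₃]
    intro h; apply hy; linarith
  have hl : slope (EC ℚ) x₁ x₁ y₁ y₁ = (3 * x₁ ^ 2 - 25) / (2 * y₁) := by
    rw [slope_of_Y_ne rfl hneg]
    simp only [negY, EC_a₁, EC_a₃, EC_a₂, EC_a₄]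
    ring_nf
  rw [Point.add_of_Y_ne hneg]
  refine ⟨Point.some_ne_zero _, ?_, ?_⟩
  · simp [addX, hl]; ring
  · simp [addY, negAddY, negY, addX, hl]

lemma ext_xy {A B : Q} (hA : A ≠ 0) (hB : B ≠ 0) (hx : xc A = xc B) (hy : yc A = yc B) : A = B := by
  rcases A with _ | ⟨x₁, y₁, h₁⟩
  · exact absurd rfl hA
  rcases B with _ | ⟨x₂, y₂, h₂⟩
  · exact absurd rfl hB
  have hx : x₁ = x₂ := hx
  have hy : y₁ = y₂ := hy
  subst hx hy; rfl

lemma eq_or_eq_neg_of_xc {A B : Q} (hA : A ≠ 0) (hB : B ≠ 0) (hx : xc A = xc B) :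
    A = B ∨ A = -B := by
  have : yc A = yc B ∨ yc A = - yc B := by
    rw [← sq_eq_sq_iff_eq_or_eq_neg, yc_sq, yc_sq, hx]
  rcases this with h | h
  · exact Or.inl (ext_xy hA hB hx h)
  · exact Or.inr (ext_xy hA (neg_ne_zero.2 hB) (by rw [hx, xc_neg]) (by rw [h, yc_neg]))

/-- The affine point with given coordinates. -/
def pt (x y : ℚ) (h : y ^ 2 = x ^ 3 - 25 * x) : Q := .some x y (nonsing.2 h)
@[simp] lemma xc_pt {x y : ℚ} (h) : xc (pt x y h) = x := rfl
@[simp] lemma yc_pt {x y : ℚ} (h) : yc (pt x y h) = y := rfl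

/-- The two-torsion points. -/
def T0 : Q := .some 0 0 (nonsing.2 (by norm_num))
def T5 : Q := .some 5 0 (nonsing.2 (by norm_num))
def T5' : Q := .some (-5) 0 (nonsing.2 (by norm_num))

lemma two_T0 : T0 + T0 = 0 := Point.add_of_Y_eq rfl (by simp [negY])
lemma two_T5 : T5 + T5 = 0 := Point.add_of_Y_eq rfl (by simp [negY])

lemma third_class {x y a b u v : ℚ} (ha : a ≠ 0) (hb : b ≠ 0) (hu : u ≠ 0) (hv : v ≠ 0)
    (h : y ^ 2 = x ^ 3 - 25 * x) (hxa : x = u * a ^ 2) (hxb : x - 5 = v * b ^ 2) :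
    ∃ e, x + 5 = u * v * e ^ 2 := by
  refine ⟨y / (u * v * a * b), ?_⟩
  field_simp
  rw [h, show x ^ 3 - 25 * x = x * (x - 5) * (x + 5) by ring, hxb]
  linear_combination (-v * b ^ 2 * (x + 5)) * hxa

lemma halve {A : Q} (hA : A ≠ 0) (hc : HasClass (xc A) 1 1) : ∃ R : Q, R + R = A := by
  obtain ⟨⟨a, ha, hxa⟩, b, hb, hxb⟩ := hc
  obtain ⟨e, he⟩ := third_class ha hb one_ne_zero one_ne_zero (yc_sq A) hxa hxb
  simp only [one_mul] at hxa hxb he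
  have n1 : a + b ≠ 0 := fun h => by
    have : (a - b) * (a + b) = 5 := by linarith
    rw [h] at this; norm_num at this
  have n2 : a + e ≠ 0 := fun h => by
    have : (e - a) * (a + e) = 5 := by linarith
    rw [h] at this; norm_num at this
  have n3 : b + e ≠ 0 := fun h => by
    have : (e - b) * (b + e) = 10 := by linarith
    rw [h] at this; norm_num at this
  have e1 : (a + b) * (a + e) - 5 = (a + b) * (b + e) := by linear_combination hxb - hxa
  have e2 : (a + b) * (a + e) + 5 = (a + e) * (b + e) := by linear_combination he - hxa
  have key : ((a + b) * (a + e) * (b + e)) ^ 2 =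
      ((a + b) * (a + e)) ^ 3 - 25 * ((a + b) * (a + e)) := by
    rw [show ((a + b) * (a + e)) ^ 3 - 25 * ((a + b) * (a + e)) =
      (a + b) * (a + e) * ((a + b) * (a + e) - 5) * ((a + b) * (a + e) + 5) by ring, e1, e2]
    ring
  obtain ⟨r0, r1, r2⟩ := add_self_of_yc_ne (A := pt _ _ key)
    (mul_ne_zero (mul_ne_zero n1 n2) n3)
  set R := pt _ _ key
  have hX : xc (R + R) = xc A := by
    have hl : (3 * xc R ^ 2 - 25) / (2 * yc R) = a + b + e := by
      rw [xc_pt, yc_pt, div_eq_iff (by simp [n1, n2, n3])]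
      have : 3 * ((a + b) * (a + e)) ^ 2 - 25 = (a + b) * (a + e) * ((a + b) * (a + e) - 5) +
        (a + b) * (a + e) * ((a + b) * (a + e) + 5) +
        ((a + b) * (a + e) - 5) * ((a + b) * (a + e) + 5) := by ring
      rw [this, e1, e2]
      ring
    rw [r1, hl, xc_pt]
    linear_combination hxa - hxb - he
  rcases eq_or_eq_neg_of_xc r0 hA hX with h | h
  · exact ⟨R, h⟩
  · exact ⟨-R, by rw [← neg_add, h, neg_neg]⟩
lemma _root_.Int.prime_five : Prime (5 : ℤ) := by
  exact_mod_cast Nat.prime_iff_prime_int.1 Nat.prime_five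

lemma eq_gcd_mul_sq {f h w : ℤ} (hf : 0 < f) (e : f * h = w ^ 2) :
    ∃ c : ℤ, c ≠ 0 ∧ f = (Int.gcd f h : ℤ) * c ^ 2 := by
  obtain ⟨f', h', hc, h1, h2⟩ : ∃ f' h' : ℤ, Int.gcd f' h' = 1 ∧ f = f' * (Int.gcd f h : ℤ) ∧ h = h' * (Int.gcd f h : ℤ) :=
    (by
      obtain ⟨f', h', hc, h1, h2⟩ := Int.exists_gcd_one (m := f) (n := h) (Int.gcd_pos_of_ne_zero_left _ hf.ne')
      exact ⟨f', h', hc, by exact_mod_cast h1, by exact_mod_cast h2⟩)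
  have hg : 0 < (Int.gcd f h : ℤ) := by exact_mod_cast Int.gcd_pos_of_ne_zero_left h hf.ne'
  generalize (Int.gcd f h : ℤ) = g at *
  have hf' : 0 < f' := by
    rw [h1] at hf; exact pos_of_mul_pos_left hf hg.le
  have hdvd : g ∣ w := by
    rw [← Int.pow_dvd_pow_iff two_ne_zero, ← e, h1, h2]
    exact ⟨f' * h', by ring⟩
  obtain ⟨w', rfl⟩ := hdvd
  have e' : f' * h' = w' ^ 2 := by
    have : g ^ 2 * (f' * h') = g ^ 2 * w' ^ 2 := by
      rw [h1, h2] at e; linear_combination e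
    exact mul_left_cancel₀ (pow_ne_zero 2 hg.ne') this
  obtain ⟨c, hc | hc⟩ := Int.sq_of_gcd_eq_one hc e'
  · refine ⟨c, ?_, ?_⟩
    · rintro rfl; simp at hc; omega
    · rw [h1, hc]; ring
  · exfalso; nlinarith [sq_nonneg c]

/-- A rational abscissa has square denominator. -/
lemma exists_num_den {x y : ℚ} (h : y ^ 2 = x ^ 3 - 25 * x) (_hx : x ≠ 0) : ∃ a D w : ℤ, 0 < D ∧
    IsCoprime a D ∧ x = a / D ^ 2 ∧ a * (a ^ 2 - 25 * D ^ 4) = w ^ 2 := by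
  have hden : (x.den : ℚ) ≠ 0 := by exact_mod_cast x.den_ne_zero
  obtain ⟨v, hv⟩ : ∃ v : ℤ, y * (x.den : ℚ) ^ 2 = v := by
    apply exists_int_of_sq (n := x.den * (x.num * (x.num ^ 2 - 25 * x.den ^ 2)))
    rw [mul_pow, h]
    push_cast
    have := Rat.mul_den_eq_num x
    rw [← this]; ring
  have hv2 : (x.den : ℤ) * (x.num * (x.num ^ 2 - 25 * x.den ^ 2)) = v ^ 2 := by
    have : (((x.den : ℤ) * (x.num * (x.num ^ 2 - 25 * x.den ^ 2)) : ℤ) : ℚ) = ((v ^ 2 : ℤ) : ℚ) := by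
      push_cast
      rw [← hv, mul_pow, h]
      have := Rat.mul_den_eq_num x
      rw [← this]; ring
    exact_mod_cast this
  have hco : IsCoprime (x.den : ℤ) x.num := by
    have := x.reduced
    rw [isCoprime_comm, Int.isCoprime_iff_gcd_eq_one]
    exact this
  have hco2 : IsCoprime (x.den : ℤ) (x.num * (x.num ^ 2 - 25 * x.den ^ 2)) := by
    refine hco.mul_right ?_
    have : x.num ^ 2 - 25 * (x.den : ℤ) ^ 2 = x.num ^ 2 + x.den * (-25 * x.den) := by ring
    rw [this]
    exact IsCoprime.add_mul_left_right (hco.pow_right) _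
  obtain ⟨c, hc0, hc⟩ := eq_gcd_mul_sq (f := x.den) (by exact_mod_cast x.den_pos) hv2
  rw [Int.isCoprime_iff_gcd_eq_one.1 hco2] at hc
  simp only [Nat.cast_one, one_mul] at hc
  have hc' : (x.den : ℚ) = c ^ 2 := by exact_mod_cast hc
  have hcd : c ∣ v := by
    rw [← Int.pow_dvd_pow_iff two_ne_zero, ← hv2, hc]
    exact ⟨_, rfl⟩
  obtain ⟨w, rfl⟩ := hcd
  refine ⟨x.num, |c|, w, abs_pos.2 hc0, ?_, ?_, ?_⟩
  · have : IsCoprime (c ^ 2) x.num := hc ▸ hco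
    have := (IsCoprime.pow_left_iff (by norm_num)).1 this
    rcases abs_choice c with h | h <;> rw [h]
    · exact this.symm
    · exact this.symm.neg_right
  · push_cast
    rw [sq_abs, ← hc', Rat.num_div_den]
  · rw [show |c| ^ 4 = (|c| ^ 2) ^ 2 by ring, sq_abs]
    rw [hc] at hv2
    have : c ^ 2 * (x.num * (x.num ^ 2 - 25 * (c ^ 2) ^ 2)) = c ^ 2 * w ^ 2 := by rw [hv2]; ring
    exact mul_left_cancel₀ (pow_ne_zero 2 hc0) this

lemma class_five {x y : ℚ} (h : y ^ 2 = x ^ 3 - 25 * x) (hx : 5 < x) :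
    ∃ a : ℚ, a ≠ 0 ∧ (x = a ^ 2 ∨ x = 5 * a ^ 2) := by
  obtain ⟨a, D, w, hD, hco, hxa, hw⟩ := exists_num_den h (by linarith)
  have hDq : (D : ℚ) ≠ 0 := by exact_mod_cast hD.ne'
  have ha : 0 < a := by
    have : (0:ℚ) < a := by
      have h1 : (a : ℚ) = x * D ^ 2 := by rw [hxa]; field_simp
      rw [h1]; positivity
    exact_mod_cast this
  obtain ⟨c, hc0, hc⟩ := eq_gcd_mul_sq ha hw
  have hcq : (c : ℚ) ≠ 0 := by exact_mod_cast hc0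
  have hg : (Int.gcd a (a ^ 2 - 25 * D ^ 4)) ∣ 5 ^ 2 := by
    have h1 : (Int.gcd a (a ^ 2 - 25 * D ^ 4) : ℤ) ∣ 25 * D ^ 4 := by
      have := (Int.gcd_dvd_left a (a ^ 2 - 25 * D ^ 4)).mul_left a
      have := Int.dvd_sub this (Int.gcd_dvd_right a (a ^ 2 - 25 * D ^ 4))
      ring_nf at this ⊢; exact this
    have h2 : IsCoprime (Int.gcd a (a ^ 2 - 25 * D ^ 4) : ℤ) (D ^ 4) :=
      (hco.of_isCoprime_of_dvd_left (Int.gcd_dvd_left _ _)).pow_right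
    have := h2.dvd_of_dvd_mul_right h1
    exact_mod_cast this
  have hx' : ∀ g : ℕ, Int.gcd a (a ^ 2 - 25 * D ^ 4) = g → x = g * (c / D) ^ 2 := by
    intro g hg
    rw [hg] at hc
    rw [hxa, hc]; push_cast; ring
  obtain ⟨k, hk, hk2⟩ := (Nat.dvd_prime_pow Nat.prime_five).1 hg
  interval_cases k
  · exact ⟨c / D, by positivity, Or.inl (by simpa using hx' _ hk2)⟩
  · exact ⟨c / D, by positivity, Or.inr (by simpa using hx' _ hk2)⟩
  · exact ⟨5 * (c / D), by positivity, Or.inl (by rw [hx' _ hk2]; push_cast; ring)⟩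

lemma five_dvd_of_sq {a b : ℤ} (h : (5 : ℤ) ∣ a ^ 2 - 2 * b ^ 2 ∨ (5 : ℤ) ∣ a ^ 2 + 2 * b ^ 2) :
    (5 : ℤ) ∣ a ∧ (5 : ℤ) ∣ b := by
  have key : ∀ a b : ZMod 5, (a ^ 2 - 2 * b ^ 2 = 0 ∨ a ^ 2 + 2 * b ^ 2 = 0) → a = 0 ∧ b = 0 := by
    decide
  have h' : ((a : ZMod 5) ^ 2 - 2 * (b : ZMod 5) ^ 2 = 0 ∨ (a : ZMod 5) ^ 2 + 2 * (b : ZMod 5) ^ 2 = 0) := by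
    rcases h with h | h
    · left; exact_mod_cast (ZMod.intCast_zmod_eq_zero_iff_dvd _ 5).2 h
    · right; exact_mod_cast (ZMod.intCast_zmod_eq_zero_iff_dvd _ 5).2 h
  have := key _ _ h'
  exact ⟨(ZMod.intCast_zmod_eq_zero_iff_dvd _ 5).1 this.1, (ZMod.intCast_zmod_eq_zero_iff_dvd _ 5).1 this.2⟩

lemma class_second {x y u : ℚ} (h : y ^ 2 = x ^ 3 - 25 * x) (hx : 5 < x) (hu : x = u ^ 2) :
    ∃ b : ℚ, b ≠ 0 ∧ (x - 5 = b ^ 2 ∨ x - 5 = 5 * b ^ 2) := by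
  obtain ⟨a, D, w, hD, hco, hxa, hw⟩ := exists_num_den h (by linarith)
  have hDq : (D : ℚ) ≠ 0 := by exact_mod_cast hD.ne'
  have hax : (a : ℚ) = x * D ^ 2 := by rw [hxa]; field_simp
  obtain ⟨α, hα⟩ : ∃ α : ℤ, u * D = α := by
    apply exists_int_of_sq (n := a)
    rw [mul_pow, ← hu, hax]
  have haα : a = α ^ 2 := by
    have : (a : ℚ) = ((α ^ 2 : ℤ) : ℚ) := by push_cast; rw [← hα, hax, hu]; ring
    exact_mod_cast this
  have hpos : 0 < a - 5 * D ^ 2 := by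
    have : (0:ℚ) < a - 5 * D ^ 2 := by
      rw [hax]
      have : 0 < (D : ℚ) ^ 2 := by positivity
      nlinarith
    exact_mod_cast this
  have hα0 : α ≠ 0 := by rintro rfl; nlinarith [sq_nonneg D]
  have hαw : α ∣ w := by
    rw [← Int.pow_dvd_pow_iff two_ne_zero, ← hw, haα]; exact ⟨_, rfl⟩
  obtain ⟨w', rfl⟩ := hαw
  have hw' : (a - 5 * D ^ 2) * (a + 5 * D ^ 2) = w' ^ 2 := by
    have : α ^ 2 * ((a - 5 * D ^ 2) * (a + 5 * D ^ 2)) = α ^ 2 * w' ^ 2 := by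
      rw [← mul_pow, ← hw, ← haα]; ring
    exact mul_left_cancel₀ (pow_ne_zero 2 hα0) this
  obtain ⟨c, hc0, hc⟩ := eq_gcd_mul_sq hpos hw'
  have hcq : (c : ℚ) ≠ 0 := by exact_mod_cast hc0
  have hg : (Int.gcd (a - 5 * D ^ 2) (a + 5 * D ^ 2)) ∣ 10 := by
    set g := Int.gcd (a - 5 * D ^ 2) (a + 5 * D ^ 2) with hgd
    have d1 : (g : ℤ) ∣ a - 5 * D ^ 2 := Int.gcd_dvd_left _ _
    have d2 : (g : ℤ) ∣ a + 5 * D ^ 2 := Int.gcd_dvd_right _ _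
    have e1 : (g : ℤ) ∣ 10 * a := by
      have := (Int.dvd_add d1 d2).mul_left 5
      ring_nf at this ⊢; exact this
    have e2 : (g : ℤ) ∣ 10 * D ^ 2 := by
      have := (Int.dvd_sub d2 d1)
      ring_nf at this ⊢; exact this
    obtain ⟨p, q, hpq⟩ := hco.pow_right (n := 2)
    have : (g : ℤ) ∣ 10 := by
      have := Int.dvd_add (e1.mul_left p) (e2.mul_left q)
      rwa [show p * (10 * a) + q * (10 * D ^ 2) = 10 * (p * a + q * D ^ 2) by ring, hpq, mul_one] at this
    exact_mod_cast this
  have hx' : ∀ g : ℕ, Int.gcd (a - 5 * D ^ 2) (a + 5 * D ^ 2) = g → x - 5 = g * (c / D) ^ 2 := by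
    intro g hg
    rw [hg] at hc
    have : ((a - 5 * D ^ 2 : ℤ) : ℚ) = g * c ^ 2 := by rw [hc]; push_cast; ring
    rw [div_pow, ← mul_div_assoc, ← this, hxa]; push_cast; field_simp
  have hno : ¬ ((5:ℤ) ∣ α ∧ (5:ℤ) ∣ D) := by
    rintro ⟨h1, h2⟩
    have := hco.isUnit_of_dvd' (haα ▸ (h1.pow two_ne_zero : (5:ℤ) ∣ α ^ 2)) h2
    exact absurd (Int.isUnit_iff.1 this) (by norm_num)
  have hmem : Int.gcd (a - 5 * D ^ 2) (a + 5 * D ^ 2) ∈ Nat.divisors 10 := Nat.mem_divisors.2 ⟨hg, by norm_num⟩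
  rw [show Nat.divisors 10 = {1, 2, 5, 10} by decide] at hmem
  simp only [Finset.mem_insert, Finset.mem_singleton] at hmem
  rcases hmem with hk | hk | hk | hk
  · exact ⟨c / D, by positivity, Or.inl (by simpa using hx' _ hk)⟩
  · exfalso
    rw [hk, haα] at hc
    push_cast at hc
    obtain ⟨h1, h2⟩ := five_dvd_of_sq (a := α) (b := c) (Or.inl ⟨D ^ 2, by linarith⟩)
    apply hno ⟨h1, ?_⟩
    obtain ⟨p, rfl⟩ := h1
    obtain ⟨q, rfl⟩ := h2
    exact Int.prime_five.dvd_of_dvd_pow (n := 2) ⟨p ^ 2 - 2 * q ^ 2, by linarith⟩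
  · exact ⟨c / D, by positivity, Or.inr (by simpa using hx' _ hk)⟩
  · exfalso
    rw [hk, haα] at hc
    push_cast at hc
    have h1 : (5:ℤ) ∣ α := by
      exact Int.prime_five.dvd_of_dvd_pow (n := 2) ⟨D ^ 2 + 2 * c ^ 2, by linarith⟩
    obtain ⟨p, rfl⟩ := h1
    obtain ⟨h1, h2⟩ := five_dvd_of_sq (a := D) (b := c) (Or.inr ⟨p ^ 2, by linarith⟩)
    exact hno ⟨⟨p, rfl⟩, h1⟩

end EC

namespace EC
open WeierstrassCurve.Affine

/-- `A` is congruent modulo doubles to a combination of `T0`, `T5` and `P`. -/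
def Good (A : Q) : Prop := ∃ (i j k : ℤ) (R : Q), A = R + R + i • T0 + j • T5 + k • P

lemma Good.of_add {A B : Q} (hB : Good B) (h : Good (A + B)) : Good A := by
  obtain ⟨i, j, k, R, hR⟩ := h
  obtain ⟨i', j', k', R', hR'⟩ := hB
  refine ⟨i - i', j - j', k - k', R - R', ?_⟩
  rw [eq_sub_of_add_eq hR, hR', sub_smul, sub_smul, sub_smul]
  abel

lemma Good.neg {B : Q} (hB : Good B) : Good (-B) := by
  obtain ⟨i', j', k', R', hR'⟩ := hB
  refine ⟨- i', - j', - k', - R', ?_⟩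
  rw [hR', neg_smul, neg_smul, neg_smul]
  abel

lemma good_zero : Good 0 := ⟨0, 0, 0, 0, by simp⟩
lemma good_double (R : Q) : Good (R + R) := ⟨0, 0, 0, R, by simp⟩
lemma good_T0 : Good T0 := ⟨1, 0, 0, 0, by simp⟩
lemma good_T5 : Good T5 := ⟨0, 1, 0, 0, by simp⟩
lemma good_P : Good P := ⟨0, 0, 1, 0, by simp⟩

lemma T0_ne : T0 ≠ 0 := Point.some_ne_zero _
lemma T5_ne : T5 ≠ 0 := Point.some_ne_zero _
lemma T5'_ne : T5' ≠ 0 := Point.some_ne_zero _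
lemma P_ne : P ≠ 0 := Point.some_ne_zero _
@[simp] lemma xc_T0 : xc T0 = 0 := rfl
@[simp] lemma yc_T0 : yc T0 = 0 := rfl
@[simp] lemma xc_T5 : xc T5 = 5 := rfl
@[simp] lemma yc_T5 : yc T5 = 0 := rfl
@[simp] lemma xc_T5' : xc T5' = -5 := rfl
@[simp] lemma yc_T5' : yc T5' = 0 := rfl
@[simp] lemma xc_P : xc P = -4 := rfl
@[simp] lemma yc_P : yc P = 6 := rfl

lemma good_of_yc_eq_zero {A : Q} (h : yc A = 0) : Good A := by
  by_cases hA : A = 0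
  · rw [hA]; exact good_zero
  have h' := yc_sq A
  rw [h] at h'
  have : xc A * (xc A - 5) * (xc A + 5) = 0 := by linear_combination -h'
  rcases mul_eq_zero.1 this with h1 | h1
  · rcases mul_eq_zero.1 h1 with h1 | h1
    · rw [ext_xy hA T0_ne (by rw [h1, xc_T0]) (by rw [h, yc_T0])]; exact good_T0
    · rw [ext_xy hA T5_ne (by rw [xc_T5]; linarith) (by rw [h, yc_T5])]; exact good_T5
  · rw [ext_xy hA T5'_ne (by rw [xc_T5']; linarith) (by rw [h, yc_T5'])]
    apply Good.of_add good_T0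
    obtain ⟨h0, h1, h2⟩ := add_of_xc_ne T5'_ne T0_ne (by simp)
    rw [ext_xy h0 T5_ne (by rw [h1]; simp) (by rw [h2]; simp)]
    exact good_T5

lemma add_T0 {A : Q} (hy : yc A ≠ 0) : A + T0 ≠ 0 ∧ xc (A + T0) = -25 / xc A := by
  have hA : A ≠ 0 := by rintro rfl; exact hy rfl
  have hx : xc A ≠ 0 := fun h => hy (by have := yc_sq A; rw [h] at this; simpa using this)
  obtain ⟨h0, h1, -⟩ := add_of_xc_ne hA T0_ne (by simpa using hx)
  refine ⟨h0, ?_⟩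
  rw [h1, div_pow, xc_T0, yc_T0, sub_zero, sub_zero, yc_sq]
  field_simp; ring

lemma add_T5 {A : Q} (hy : yc A ≠ 0) : A + T5 ≠ 0 ∧ xc (A + T5) = 5 * (xc A + 5) / (xc A - 5) := by
  have hA : A ≠ 0 := by rintro rfl; exact hy rfl
  have hx : xc A - 5 ≠ 0 := fun h => hy (by
    have := yc_sq A; rw [sub_eq_zero.1 h] at this; norm_num at this; simpa using this)
  obtain ⟨h0, h1, -⟩ := add_of_xc_ne hA T5_ne (by rw [xc_T5]; exact sub_ne_zero.1 hx)
  refine ⟨h0, ?_⟩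
  rw [h1, div_pow, xc_T5, yc_T5, sub_zero, yc_sq]
  field_simp; ring

lemma good_of_sq {A : Q} {a b : ℚ} (ha : xc A = a ^ 2) (hb : xc A - 5 = b ^ 2) : Good A := by
  by_cases hA : A = 0
  · rw [hA]; exact good_zero
  by_cases hy : yc A = 0
  · exact good_of_yc_eq_zero hy
  have hy2 := yc_sq A
  have ha0 : a ≠ 0 := by
    rintro rfl; rw [ha] at hy2; apply hy; simpa using hy2
  have hb0 : b ≠ 0 := by
    rintro rfl
    rw [show xc A = 5 by linarith] at hy2; apply hy; norm_num at hy2; simpa using hy2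
  obtain ⟨R, rfl⟩ := halve hA ⟨⟨a, ha0, by rw [ha, one_mul]⟩, b, hb0, by rw [hb, one_mul]⟩
  exact good_double R

lemma good_of_neg_sq {A : Q} {a b : ℚ} (ha0 : a ≠ 0) (hb0 : b ≠ 0)
    (ha : xc A = - a ^ 2) (hb : xc A - 5 = - b ^ 2) : Good A := by
  by_cases hA : A = 0
  · rw [hA]; exact good_zero
  by_cases hx : xc A = -4
  · rcases eq_or_eq_neg_of_xc hA P_ne (by rw [hx, xc_P]) with rfl | rfl
    · exact good_P
    · exact good_P.neg
  obtain ⟨h0, h1, -⟩ := add_of_xc_ne hA P_ne (by simpa using hx)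
  apply Good.of_add good_P
  rw [xc_P, yc_P] at h1
  have hx4 : xc A - -4 ≠ 0 := by rw [sub_neg_eq_add]; intro h; apply hx; linarith
  set l := (yc A - 6) / (xc A - -4) with hl
  have hl' : l * (xc A + 4) = yc A - 6 := by rw [hl]; field_simp; ring
  have hy := yc_sq A
  have hx4' : xc A + 4 ≠ 0 := by simpa using hx4
  refine good_of_sq (a := (6 + 4 * l) / (2 * a)) (b := (5 * l + (6 + 4 * l)) / (3 * b)) ?_ ?_
  · have : xc (A + P) * (xc A * (-4)) = (6 + 4 * l) ^ 2 := by
      rw [h1]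
      apply mul_left_cancel₀ hx4'
      have e1 : yc A = l * (xc A + 4) + 6 := by linarith
      rw [e1] at hy
      linear_combination (-4) * hy
    rw [ha] at this
    field_simp
    linear_combination this
  · have : (xc (A + P) - 5) * ((xc A - 5) * (-9)) = (5 * l + (6 + 4 * l)) ^ 2 := by
      rw [h1]
      apply mul_left_cancel₀ hx4'
      have e1 : yc A = l * (xc A + 4) + 6 := by linarith
      rw [e1] at hy
      linear_combination (-9) * hy
    rw [hb] at this
    field_simp
    linear_combination this

lemma good_of_sq_of_lt {A : Q} {a : ℚ} (hx : 5 < xc A) (ha : xc A = a ^ 2) : Good A := by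
  have hxp : 0 < xc A := by linarith
  have hy2 := yc_sq A
  have hy : yc A ≠ 0 := fun h => by rw [h] at hy2; nlinarith [mul_pos hxp (by linarith : 0 < xc A - 5)]
  obtain ⟨b, hb0, hb | hb⟩ := class_second hy2 hx ha
  · exact good_of_sq ha hb
  · have ha0 : a ≠ 0 := by rintro rfl; rw [ha] at hxp; norm_num at hxp
    obtain ⟨e, he⟩ := third_class ha0 hb0 one_ne_zero (by norm_num : (5:ℚ) ≠ 0) hy2 (by rw [ha, one_mul]) hb
    have he0 : e ≠ 0 := by rintro rfl; norm_num at he; linarith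
    obtain ⟨h0, h1⟩ := add_T0 hy
    apply Good.of_add good_T0
    refine good_of_neg_sq (a := 5 / a) (b := 5 * e / a) (by positivity) (by positivity) ?_ ?_
    · rw [h1, ha]; field_simp; norm_num
    · rw [h1]
      have : xc A + 5 = 5 * e ^ 2 := by rw [he]; ring
      field_simp
      rw [ha] at *
      linear_combination (-5 * a ^ 2) * this

lemma good_of_lt {A : Q} (hx : 5 < xc A) : Good A := by
  have hxp : 0 < xc A := by linarith
  have hy2 := yc_sq A
  have hy : yc A ≠ 0 := fun h => by rw [h] at hy2; nlinarith [mul_pos hxp (by linarith : 0 < xc A - 5)]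
  obtain ⟨a, ha0, ha | ha⟩ := class_five hy2 hx
  · exact good_of_sq_of_lt hx ha
  · obtain ⟨h0, h1⟩ := add_T5 hy
    apply Good.of_add good_T5
    have h5 : 0 < xc A - 5 := by linarith
    refine good_of_sq_of_lt (a := yc A / (a * (xc A - 5))) ?_ ?_
    · rw [h1, lt_div_iff₀ h5]; linarith
    · rw [h1, div_pow, mul_pow, hy2]
      have : a ^ 2 = xc A / 5 := by rw [ha]; ring
      rw [this]
      field_simp; ring

lemma good (A : Q) : Good A := by
  by_cases hy : yc A = 0
  · exact good_of_yc_eq_zero hy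
  have hy2 := yc_sq A
  have hypos : 0 < xc A ^ 3 - 25 * xc A := by rw [← hy2]; positivity
  by_cases hx : 5 < xc A
  · exact good_of_lt hx
  · obtain ⟨h0, h1⟩ := add_T0 hy
    apply Good.of_add good_T0
    apply good_of_lt
    have h2 : xc A < 0 := by
      by_contra h
      push Not at h hx
      nlinarith [mul_nonneg h (by nlinarith : 0 ≤ 25 - xc A ^ 2)]
    have h3 : -5 < xc A := by
      by_contra h
      push Not at h
      nlinarith [mul_nonneg (by linarith : 0 ≤ - xc A) (by nlinarith : 0 ≤ xc A ^ 2 - 25)]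
    rw [h1, lt_div_iff_of_neg h2]
    linarith

/-- Multiples of some positive integer lie in the subgroup generated by `P`. -/
theorem exists_nsmul_mem : ∃ N : ℕ, 0 < N ∧ ∀ A : Q, ∃ m : ℤ, N • A = m • P := by
  have hf : ∀ U : AddSubgroup Q, U.map (nsmulAddMonoidHom (α := Q) 2) ≤ U := by
    rintro U _ ⟨x, hx, rfl⟩
    exact U.nsmul_mem hx 2
  set s : Set Q := Set.range fun t : Fin 2 × Fin 2 × Fin 2 =>
    (t.1 : ℕ) • T0 + (t.2.1 : ℕ) • T5 + (t.2.2 : ℕ) • P with hs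
  have hsf : s.Finite := Set.finite_range _
  obtain ⟨C, hC⟩ := (hsf.image ht).bddAbove
  have : Northcott ht := ⟨fun B => finite_ht_le B⟩
  have fg : AddGroup.FG Q := by
    refine AddGroup.fg_of_descent hf (h := ht) (a := 2) (b := 4) (c := max 0 (2 * C + Real.log 2))
      (by norm_num) (by norm_num) hsf ?_ ?_ ?_
    · rw [Set.eq_univ_iff_forall]
      intro A
      obtain ⟨i, j, k, R, hR⟩ := good A
      have key : ∀ (i : ℤ) (B : Q), ∃ t : Fin 2, i • B = (t : ℕ) • B + (i / 2) • B + (i / 2) • B := by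
        intro i B
        refine ⟨⟨(i % 2).toNat, by omega⟩, ?_⟩
        have : (((i % 2).toNat : ℕ) : ℤ) = i % 2 := Int.toNat_of_nonneg (by omega)
        rw [← natCast_zsmul]
        simp only [this]
        rw [← add_zsmul, ← add_zsmul]
        congr 1; omega
      obtain ⟨t1, h1⟩ := key i T0
      obtain ⟨t2, h2⟩ := key j T5
      obtain ⟨t3, h3⟩ := key k P
      rw [Set.mem_add]
      refine ⟨_, ⟨(t1, t2, t3), rfl⟩, _, ⟨R + (i / 2) • T0 + (j / 2) • T5 + (k / 2) • P, rfl⟩, ?_⟩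
      rw [hR, h1, h2, h3, nsmulAddMonoidHom_apply, two_nsmul]
      dsimp only
      abel
    · intro g hg x
      have h1 := ht_add_add_ht_sub_le (g + x) g
      rw [add_sub_cancel_left] at h1
      have h2 := hC ⟨g, hg, rfl⟩
      have h3 := ht_nonneg (g + x + g)
      have := le_max_right 0 (2 * C + Real.log 2)
      linarith
    · intro x
      rw [nsmulAddMonoidHom_apply, two_nsmul]
      have := four_mul_ht_le x
      have := le_max_left 0 (2 * C + Real.log 2)
      linarith
  set H : Submodule ℤ Q := Submodule.span ℤ {T0, T5, P} with hH
  have : Module.Finite ℤ Q := Module.Finite.iff_addGroup_fg.2 fg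
  have hfg : (⊤ : Submodule ℤ (Q ⧸ H)).FG := Module.Finite.fg_top
  obtain ⟨r, hr1, hr2⟩ := Submodule.exists_sub_one_mem_and_smul_eq_zero_of_fg_of_le_smul
    (Ideal.span {(2 : ℤ)}) (⊤ : Submodule ℤ (Q ⧸ H)) hfg (by
      rintro q -
      obtain ⟨A, rfl⟩ := H.mkQ_surjective q
      obtain ⟨i, j, k, R, hR⟩ := good A
      have : H.mkQ A = (2 : ℤ) • H.mkQ R := by
        rw [← map_smul, ← sub_eq_zero, ← map_sub, Submodule.mkQ_apply, Submodule.Quotient.mk_eq_zero,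
          hR, two_zsmul]
        have : R + R + i • T0 + j • T5 + k • P - (R + R) = i • T0 + j • T5 + k • P := by abel
        rw [this]
        refine H.add_mem (H.add_mem ?_ ?_) ?_ <;> apply H.smul_mem <;> apply Submodule.subset_span <;> simp
      rw [this]
      exact Submodule.smul_mem_smul (Ideal.mem_span_singleton_self 2) trivial)
  have hr0 : r ≠ 0 := by
    rintro rfl
    rw [Ideal.mem_span_singleton] at hr1
    omega
  have hrA : ∀ A : Q, ∃ m : ℤ, ((2 : ℤ) * r) • A = m • P := by
    intro A
    have := hr2 (H.mkQ A) trivial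
    rw [← map_smul, Submodule.mkQ_apply, Submodule.Quotient.mk_eq_zero, hH, Submodule.mem_span_triple] at this
    obtain ⟨a, b, c, h⟩ := this
    refine ⟨2 * c, ?_⟩
    rw [mul_zsmul, ← h, two_zsmul]
    have h1 : a • T0 + a • T0 = 0 := by rw [← zsmul_add, two_T0, zsmul_zero]
    have h2 : b • T5 + b • T5 = 0 := by rw [← zsmul_add, two_T5, zsmul_zero]
    calc _ = (a • T0 + a • T0) + (b • T5 + b • T5) + (c • P + c • P) := by abel
      _ = _ := by rw [h1, h2, mul_zsmul, two_zsmul]; abel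
  refine ⟨(2 * r).natAbs, by omega, fun A => ?_⟩
  obtain ⟨m, hm⟩ := hrA A
  rw [← natCast_zsmul]
  rcases Int.natAbs_eq (2 * r) with h | h
  · exact ⟨m, by rw [← h, hm]⟩
  · refine ⟨-m, ?_⟩
    rw [neg_zsmul, ← hm, ← neg_zsmul]
    congr 1; omega
end EC

namespace EC
open WeierstrassCurve.Affine

section field
variable {F : Type*} [Field F]

lemma addP_x {X Y D : F} (hD : D ≠ 0) (hW : X + 4 * D ^ 2 ≠ 0) (hE : Y ^ 2 = X ^ 3 - 25 * X * D ^ 4) :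
    ((Y - 6 * D ^ 3) / (D * (X + 4 * D ^ 2))) ^ 2 - X / D ^ 2 - -4 =
      (-4 * X ^ 2 - 9 * X * D ^ 2 - 12 * Y * D + 100 * D ^ 4) / (X + 4 * D ^ 2) ^ 2 := by
  obtain ⟨W, h⟩ : ∃ W, X + 4 * D ^ 2 = W := ⟨_, rfl⟩
  obtain rfl : X = W - 4 * D ^ 2 := by rw [← h]; ring
  rw [h] at hW ⊢
  field_simp
  linear_combination hE

lemma addP_y {X Y D : F} (hD : D ≠ 0) (hW : X + 4 * D ^ 2 ≠ 0) :
    -((Y - 6 * D ^ 3) / (D * (X + 4 * D ^ 2)) *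
      ((-4 * X ^ 2 - 9 * X * D ^ 2 - 12 * Y * D + 100 * D ^ 4) / (X + 4 * D ^ 2) ^ 2 - -4) + 6) =
    -((Y - 6 * D ^ 3) * (23 * X * D - 12 * Y + 164 * D ^ 3) + 6 * (X + 4 * D ^ 2) ^ 3)
      / (X + 4 * D ^ 2) ^ 3 := by
  obtain ⟨W, h⟩ : ∃ W, X + 4 * D ^ 2 = W := ⟨_, rfl⟩
  obtain rfl : X = W - 4 * D ^ 2 := by rw [← h]; ring
  rw [h] at hW ⊢
  field_simp
  ring

lemma addP_x' {X Y D : F} (hD : D ≠ 0) (hW : Y + 6 * D ^ 3 ≠ 0) :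
    ((X ^ 2 - 4 * X * D ^ 2 - 9 * D ^ 4) / (D * (Y + 6 * D ^ 3))) ^ 2 - X / D ^ 2 - -4 =
      ((X ^ 2 - 4 * X * D ^ 2 - 9 * D ^ 4) ^ 2 - (X - 4 * D ^ 2) * (Y + 6 * D ^ 3) ^ 2) /
      (D * (Y + 6 * D ^ 3)) ^ 2 := by
  obtain ⟨W, h⟩ : ∃ W, Y + 6 * D ^ 3 = W := ⟨_, rfl⟩
  rw [h] at hW ⊢
  field_simp
  ring

lemma addP_y' {X Y D : F} (hD : D ≠ 0) (hW : Y + 6 * D ^ 3 ≠ 0) :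
    -((X ^ 2 - 4 * X * D ^ 2 - 9 * D ^ 4) / (D * (Y + 6 * D ^ 3)) *
      (((X ^ 2 - 4 * X * D ^ 2 - 9 * D ^ 4) ^ 2 - (X - 4 * D ^ 2) * (Y + 6 * D ^ 3) ^ 2) /
      (D * (Y + 6 * D ^ 3)) ^ 2 - -4) + 6) =
    -((X ^ 2 - 4 * X * D ^ 2 - 9 * D ^ 4) *
      (((X ^ 2 - 4 * X * D ^ 2 - 9 * D ^ 4) ^ 2 - (X - 4 * D ^ 2) * (Y + 6 * D ^ 3) ^ 2)
        + 4 * (D * (Y + 6 * D ^ 3)) ^ 2) + 6 * (D * (Y + 6 * D ^ 3)) ^ 3) /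
      (D * (Y + 6 * D ^ 3)) ^ 3 := by
  have hW' : D * (Y + 6 * D ^ 3) ≠ 0 := mul_ne_zero hD hW
  obtain ⟨W, h⟩ : ∃ W, D * (Y + 6 * D ^ 3) = W := ⟨_, rfl⟩
  rw [h] at hW' ⊢
  field_simp
  ring

variable [DecidableEq F]

lemma some_add_of_X_ne {x₁ x₂ y₁ y₂ : F} {h₁ : (EC F).Nonsingular x₁ y₁} {h₂ : (EC F).Nonsingular x₂ y₂}
    (hx : x₁ ≠ x₂) {x₃ y₃ : F} (e₁ : x₃ = ((y₁ - y₂) / (x₁ - x₂)) ^ 2 - x₁ - x₂)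
    (e₂ : y₃ = -((y₁ - y₂) / (x₁ - x₂) * (x₃ - x₁) + y₁)) :
    ∃ h₃, Point.some x₁ y₁ h₁ + .some x₂ y₂ h₂ = .some x₃ y₃ h₃ := by
  have hl : slope (EC F) x₁ x₂ y₁ y₂ = (y₁ - y₂) / (x₁ - x₂) := slope_of_X_ne hx
  rw [Point.add_of_X_ne hx]
  have a1 : addX (EC F) x₁ x₂ (slope (EC F) x₁ x₂ y₁ y₂) = x₃ := by rw [e₁]; simp [addX, hl]
  have a2 : addY (EC F) x₁ x₂ y₁ (slope (EC F) x₁ x₂ y₁ y₂) = y₃ := by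
    rw [e₂, ← a1]; simp [addY, negAddY, negY, addX, hl]
  subst a1 a2
  exact ⟨_, rfl⟩

lemma some_add_self {x₁ y₁ : F} {h₁ : (EC F).Nonsingular x₁ y₁} (hy : 2 * y₁ ≠ 0)
    {x₃ y₃ : F} (e₁ : x₃ = ((3 * x₁ ^ 2 - 25) / (2 * y₁)) ^ 2 - 2 * x₁)
    (e₂ : y₃ = -((3 * x₁ ^ 2 - 25) / (2 * y₁) * (x₃ - x₁) + y₁)) :
    ∃ h₃, Point.some x₁ y₁ h₁ + .some x₁ y₁ h₁ = .some x₃ y₃ h₃ := by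
  have hneg : y₁ ≠ negY (EC F) x₁ y₁ := by
    simp only [negY, EC_a₁, EC_a₃]
    intro h; apply hy; linear_combination h
  have hl : slope (EC F) x₁ x₁ y₁ y₁ = (3 * x₁ ^ 2 - 25) / (2 * y₁) := by
    rw [slope_of_Y_ne rfl hneg]
    simp only [negY, EC_a₁, EC_a₃, EC_a₂, EC_a₄]
    ring_nf
  rw [Point.add_of_Y_ne hneg]
  have a1 : addX (EC F) x₁ x₁ (slope (EC F) x₁ x₁ y₁ y₁) = x₃ := by
    rw [e₁]; simp [addX, hl]; ring
  have a2 : addY (EC F) x₁ x₁ y₁ (slope (EC F) x₁ x₁ y₁ y₁) = y₃ := by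
    rw [e₂, ← a1]; simp [addY, negAddY, negY, addX, hl]
  subst a1 a2
  exact ⟨_, rfl⟩

end field

variable (p : ℕ) [Fact p.Prime]

/-- The point `B` modulo `p` is the reduction of the rational point `A`. -/
def Red (A : Q) (B : (EC (ZMod p)).Point) : Prop :=
  (A = 0 ∧ B = 0) ∨ A ≠ 0 ∧ ∃ X Y D : ℤ, D ≠ 0 ∧ xc A = X / D ^ 2 ∧ yc A = Y / D ^ 3 ∧
    (((D : ZMod p) = 0 ∧ (X : ZMod p) ≠ 0 ∧ B = 0) ∨
      ((D : ZMod p) ≠ 0 ∧ ∃ h, B = .some ((X : ZMod p) / D ^ 2) ((Y : ZMod p) / D ^ 3) h))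

variable {p}

lemma int_eq {A : Q} (X Y D : ℤ) (hD : D ≠ 0) (hx : xc A = X / D ^ 2)
    (hy : yc A = Y / D ^ 3) : Y ^ 2 = X ^ 3 - 25 * X * D ^ 4 := by
  have hDq : (D : ℚ) ≠ 0 := by exact_mod_cast hD
  have h := yc_sq A
  rw [hx, hy] at h
  field_simp at h
  have h' : (Y : ℚ) ^ 2 = X ^ 3 - 25 * X * D ^ 4 := by linear_combination h
  exact_mod_cast h'

lemma Red.add_P {A : Q} {B Pb : (EC (ZMod p)).Point} (h10 : (10 : ZMod p) ≠ 0) (h3 : (3 : ZMod p) ≠ 0)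
    (hPb : ∃ h, Pb = .some (-4) 6 h) (hAB : Red p A B) : Red p (A + P) (B + Pb) := by
  have h2 : (2 : ZMod p) ≠ 0 := fun h => h10 (by linear_combination 5 * h)
  have h12 : (12 : ZMod p) ≠ 0 := by
    intro h
    have : (2 : ZMod p) * 2 * 3 = 0 := by linear_combination h
    simp [h2, h3] at this
  obtain ⟨hn, rfl⟩ := hPb
  rcases hAB with ⟨rfl, rfl⟩ | ⟨hA, X, Y, D, hD, hx, hy, hB⟩
  · rw [zero_add, zero_add]
    exact Or.inr ⟨P_ne, -4, 6, 1, by norm_num, by simp, by simp, Or.inr ⟨by simp, by simpa using hn, by simp⟩⟩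
  have hE := int_eq X Y D hD hx hy
  have hEp : (Y : ZMod p) ^ 2 = X ^ 3 - 25 * X * D ^ 4 := by exact_mod_cast congrArg (Int.cast : ℤ → ZMod p) hE
  have hDq : (D : ℚ) ≠ 0 := by exact_mod_cast hD
  by_cases hxP : xc A = -4
  · have hX : X = -4 * D ^ 2 := by
      rw [hx] at hxP
      have : (X : ℚ) = -4 * D ^ 2 := by field_simp at hxP; linear_combination hxP
      exact_mod_cast this
    have hDp : (D : ZMod p) ≠ 0 := by
      rcases hB with ⟨h1, h2, -⟩ | h
      · intro _; apply h2; rw [hX]; push_cast; rw [h1]; ring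
      · exact h.1
    have hB' : ∃ h, B = .some ((X : ZMod p) / D ^ 2) ((Y : ZMod p) / D ^ 3) h := by
      rcases hB with ⟨h1, h2, -⟩ | h
      · exact absurd h1 hDp
      · exact h.2
    obtain ⟨hh, rfl⟩ := hB'
    have hXp : (X : ZMod p) / D ^ 2 = -4 := by rw [hX]; push_cast; field_simp
    rcases eq_or_eq_neg_of_xc hA P_ne (by rw [hxP, xc_P]) with rfl | rfl
    · have hYp : (Y : ZMod p) / D ^ 3 = 6 := by
        have : Y = 6 * D ^ 3 := by
          rw [yc_P] at hy
          have : (Y : ℚ) = 6 * D ^ 3 := by field_simp at hy; linear_combination -hy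
          exact_mod_cast this
        rw [this]; push_cast; field_simp
      obtain ⟨a0, a1, a2⟩ := add_self_of_yc_ne (A := P) (by simp)
      have a1' : xc (P + P) = 1681 / 144 := by rw [a1, xc_P, yc_P]; norm_num
      refine Or.inr ⟨a0, 1681, -62279, 12, by norm_num, by rw [a1']; norm_num, by rw [a2, a1', xc_P, yc_P]; norm_num,
        Or.inr ⟨by exact_mod_cast h12, ?_⟩⟩
      simp only [hXp, hYp]
      have h26 : (2 : ZMod p) * 6 ≠ 0 := fun h => h12 (by linear_combination h)
      apply some_add_self h26
      · push_cast
        rw [show (2 : ZMod p) * 6 = 12 by norm_num]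
        field_simp; norm_num
      · push_cast
        rw [show (2 : ZMod p) * 6 = 12 by norm_num]
        field_simp; norm_num
    · have hYp : (Y : ZMod p) / D ^ 3 = -6 := by
        have : Y = -6 * D ^ 3 := by
          rw [yc_neg, yc_P] at hy
          have : (Y : ℚ) = -6 * D ^ 3 := by field_simp at hy; linear_combination -hy
          exact_mod_cast this
        rw [this]; push_cast; field_simp
      left
      refine ⟨by simp, ?_⟩
      simp only [hXp, hYp]
      apply Point.add_of_Y_eq rfl
      simp [negY]
  obtain ⟨a0, a1, a2⟩ := add_of_xc_ne hA P_ne (by simpa using hxP)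
  have hXq : (X : ℚ) + 4 * D ^ 2 ≠ 0 := by
    intro h; apply hxP; rw [hx]; field_simp; linarith
  have hEq : (Y : ℚ) ^ 2 = X ^ 3 - 25 * X * D ^ 4 := by exact_mod_cast hE
  have hXD : (X : ℚ) / D ^ 2 - -4 ≠ 0 := by
    intro h; apply hxP; rw [hx]; linarith
  have f1 : xc (A + P) = (-4 * X ^ 2 - 9 * X * D ^ 2 - 12 * Y * D + 100 * D ^ 4 : ℤ) / (X + 4 * D ^ 2 : ℤ) ^ 2 := by
    have : ((Y : ℚ) / D ^ 3 - 6) / (X / D ^ 2 - -4) = (Y - 6 * D ^ 3) / (D * (X + 4 * D ^ 2)) := by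
      field_simp; ring
    rw [a1, hx, hy, xc_P, yc_P, this]; push_cast
    exact addP_x hDq hXq hEq
  have f2 : yc (A + P) = (-((Y - 6 * D ^ 3) * (23 * X * D - 12 * Y + 164 * D ^ 3) + 6 * (X + 4 * D ^ 2) ^ 3) : ℤ)
      / (X + 4 * D ^ 2 : ℤ) ^ 3 := by
    have : ((Y : ℚ) / D ^ 3 - 6) / (X / D ^ 2 - -4) = (Y - 6 * D ^ 3) / (D * (X + 4 * D ^ 2)) := by
      field_simp; ring
    have h' : yc (A + P) = -((yc A - yc P) / (xc A - xc P) * (xc (A + P) - xc P) + yc P) := by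
      rw [a2]
      have : xc A - xc P ≠ 0 := by rw [hx, xc_P]; exact hXD
      field_simp; ring
    rw [h', f1, hx, hy, xc_P, yc_P, this]; push_cast
    exact addP_y hDq hXq
  have hXZ : X + 4 * D ^ 2 ≠ 0 := by exact_mod_cast hXq
  rcases hB with ⟨h1, hX0, rfl⟩ | ⟨hDp, hh, rfl⟩
  · refine Or.inr ⟨a0, _, _, _, hXZ, f1, f2, Or.inr ?_⟩
    push_cast
    rw [zero_add]
    have hs : (X : ZMod p) + 4 * D ^ 2 ≠ 0 := by rw [h1]; simpa using hX0
    refine ⟨hs, ?_⟩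
    have e1 : (-4 * X ^ 2 - 9 * X * D ^ 2 - 12 * Y * D + 100 * D ^ 4 : ZMod p) / (X + 4 * D ^ 2) ^ 2 = -4 := by
      rw [div_eq_iff (pow_ne_zero 2 hs), h1]; ring
    have e2 : -((Y - 6 * D ^ 3) * (23 * X * D - 12 * Y + 164 * D ^ 3) + 6 * (X + 4 * D ^ 2) ^ 3 : ZMod p)
      / (X + 4 * D ^ 2) ^ 3 = 6 := by
      rw [div_eq_iff (pow_ne_zero 3 hs)]; rw [h1] at hEp ⊢; linear_combination 12 * hEp
    simp only [e1, e2]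
    exact ⟨hn, trivial⟩
  by_cases hs : (X : ZMod p) + 4 * D ^ 2 = 0
  swap
  · refine Or.inr ⟨a0, _, _, _, hXZ, f1, f2, Or.inr ?_⟩
    push_cast
    have hXD' : (X : ZMod p) / D ^ 2 ≠ -4 := by
      intro h; apply hs; field_simp at h; linear_combination h
    refine ⟨hs, ?_⟩
    have : ((Y : ZMod p) / D ^ 3 - 6) / (X / D ^ 2 - -4) = (Y - 6 * D ^ 3) / (D * (X + 4 * D ^ 2)) := by
      have : (X : ZMod p) / D ^ 2 - -4 ≠ 0 := sub_ne_zero.2 hXD'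
      rw [div_eq_div_iff this (mul_ne_zero hDp hs)]
      field_simp; ring
    apply some_add_of_X_ne hXD'
    · rw [this]; exact (addP_x hDp hs hEp).symm
    · rw [← addP_y hDp hs, this]
      have : (Y : ZMod p) / D ^ 3 - 6 = (Y - 6 * D ^ 3) / (D * (X + 4 * D ^ 2)) * (X / D ^ 2 - -4) := by
        rw [← this, div_mul_cancel₀ _ (sub_ne_zero.2 hXD')]
      linear_combination this
  have hXp : (X : ZMod p) = -4 * D ^ 2 := by linear_combination hs
  have hYY : ((Y : ZMod p) - 6 * D ^ 3) * (Y + 6 * D ^ 3) = 0 := by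
    rw [hXp] at hEp; linear_combination hEp
  have hX4 : (X : ZMod p) / D ^ 2 = -4 := by rw [hXp]; field_simp
  by_cases hW : (Y : ZMod p) + 6 * D ^ 3 = 0
  · have hYp : (Y : ZMod p) = -6 * D ^ 3 := by linear_combination hW
    have hY6 : (Y : ZMod p) / D ^ 3 = -6 := by rw [hYp]; field_simp
    refine Or.inr ⟨a0, _, _, _, hXZ, f1, f2, Or.inl ⟨?_, ?_, ?_⟩⟩
    · push_cast; exact hs
    · push_cast
      rw [hXp, hYp]
      intro h
      have : (12 * D ^ 2 : ZMod p) ^ 2 = 0 := by linear_combination h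
      simp [h12, hDp] at this
    · simp only [hX4, hY6]
      apply Point.add_of_Y_eq rfl
      simp [negY]
  have hYp : (Y : ZMod p) = 6 * D ^ 3 := by
    have := (mul_eq_zero.1 hYY).resolve_right hW
    linear_combination this
  have hY6 : (Y : ZMod p) / D ^ 3 = 6 := by rw [hYp]; field_simp
  have hWZ : D * (Y + 6 * D ^ 3) ≠ 0 := by
    intro h
    rcases mul_eq_zero.1 h with h | h
    · exact hD h
    · apply hW; exact_mod_cast congrArg (Int.cast : ℤ → ZMod p) h
  have hWq : (Y : ℚ) + 6 * D ^ 3 ≠ 0 := by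
    have := (mul_ne_zero_iff.1 hWZ).2; exact_mod_cast this
  have hsl : ((Y : ℚ) / D ^ 3 - 6) / (X / D ^ 2 - -4) = (X ^ 2 - 4 * X * D ^ 2 - 9 * D ^ 4) / (D * (Y + 6 * D ^ 3)) := by
    rw [div_eq_div_iff hXD (by positivity)]
    field_simp
    linear_combination hEq
  have f1 : xc (A + P) = ((X ^ 2 - 4 * X * D ^ 2 - 9 * D ^ 4) ^ 2 - (X - 4 * D ^ 2) * (Y + 6 * D ^ 3) ^ 2 : ℤ) /
      (D * (Y + 6 * D ^ 3) : ℤ) ^ 2 := by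
    rw [a1, hx, hy, xc_P, yc_P, hsl]; push_cast
    exact addP_x' hDq hWq
  have f2 : yc (A + P) = (-((X ^ 2 - 4 * X * D ^ 2 - 9 * D ^ 4) *
      (((X ^ 2 - 4 * X * D ^ 2 - 9 * D ^ 4) ^ 2 - (X - 4 * D ^ 2) * (Y + 6 * D ^ 3) ^ 2)
        + 4 * (D * (Y + 6 * D ^ 3)) ^ 2) + 6 * (D * (Y + 6 * D ^ 3)) ^ 3) : ℤ) /
      (D * (Y + 6 * D ^ 3) : ℤ) ^ 3 := by
    have h' : yc (A + P) = -((yc A - yc P) / (xc A - xc P) * (xc (A + P) - xc P) + yc P) := by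
      rw [a2]
      have : xc A - xc P ≠ 0 := by rw [hx, xc_P]; exact hXD
      field_simp; ring
    rw [h', f1, hx, hy, xc_P, yc_P, hsl]; push_cast
    exact addP_y' hDq hWq
  have hWp : (D : ZMod p) * (Y + 6 * D ^ 3) ≠ 0 := mul_ne_zero hDp hW
  refine Or.inr ⟨a0, _, _, _, hWZ, f1, f2, Or.inr ⟨by push_cast; exact hWp, ?_⟩⟩
  push_cast
  simp only [hX4, hY6]
  have h26 : (2 : ZMod p) * 6 ≠ 0 := fun h => h12 (by linear_combination h)
  have hW' : (Y : ZMod p) + 6 * D ^ 3 = 12 * D ^ 3 := by rw [hYp]; ring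
  apply some_add_self h26
  · rw [hW', hXp, show (2 : ZMod p) * 6 = 12 by norm_num]
    field_simp; ring
  · rw [hW', hXp, show (2 : ZMod p) * 6 = 12 by norm_num]
    field_simp; ring
end EC

namespace EC
open WeierstrassCurve.Affine

section
variable {p : ℕ} [Fact p.Prime]

lemma Red.zero : Red p 0 0 := Or.inl ⟨rfl, rfl⟩

/-- The set of affine points over a finite field. -/
noncomputable def pointEquiv (F : Type*) [Field F] (h10 : (10 : F) ≠ 0) :
    (EC F).Point ≃ Option {z : F × F // z.2 ^ 2 = z.1 ^ 3 - 25 * z.1} where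
  toFun B := match B with
    | .zero => none
    | .some x y h => some ⟨(x, y), (EC_nonsingular_iff h10 _ _).1 h⟩
  invFun z := match z with
    | none => .zero
    | some z => .some z.1.1 z.1.2 ((EC_nonsingular_iff h10 _ _).2 z.2)
  left_inv B := by cases B <;> rfl
  right_inv z := by cases z <;> rfl

lemma ten_ne_zero (hp : 5 < p) : (10 : ZMod p) ≠ 0 := by
  intro h
  have : ((10 : ℕ) : ZMod p) = 0 := by exact_mod_cast h
  rw [ZMod.natCast_eq_zero_iff] at this
  have h2 := (Nat.Prime.dvd_mul (Fact.out : p.Prime)).1 (show p ∣ 2 * 5 by simpa using this)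
  rcases h2 with h2 | h2 <;> have := Nat.le_of_dvd (by norm_num) h2 <;> omega

lemma three_ne_zero' (hp : 5 < p) : (3 : ZMod p) ≠ 0 := by
  intro h
  have : ((3 : ℕ) : ZMod p) = 0 := by exact_mod_cast h
  rw [ZMod.natCast_eq_zero_iff] at this
  have := Nat.le_of_dvd (by norm_num) this
  omega

variable (p) in
/-- The reduction of the point `P` modulo a prime `p > 5`. -/
noncomputable def Pbar (hp : 5 < p) : (EC (ZMod p)).Point :=
  .some (-4) 6 ((EC_nonsingular_iff (ten_ne_zero hp) _ _).2 (by norm_num))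

lemma red_nsmul (hp : 5 < p) (n : ℕ) : Red p (n • P) (n • Pbar p hp) := by
  induction n with
  | zero => simpa using Red.zero
  | succ n ih =>
    rw [succ_nsmul, succ_nsmul]
    exact ih.add_P (ten_ne_zero hp) (three_ne_zero' hp) ⟨_, rfl⟩

lemma Red.dvd_den_iff {A : Q} {B : (EC (ZMod p)).Point} (h : Red p A B) (hA : A ≠ 0) :
    p ∣ (xc A).den ↔ B = 0 := by
  rcases h with ⟨h, -⟩ | ⟨-, X, Y, D, hD, hx, hy, h⟩
  · exact absurd h hA
  have hDq : (D : ℚ) ≠ 0 := by exact_mod_cast hD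
  have key : (xc A).num * D ^ 2 = X * (xc A).den := by
    have h1 : (xc A).num / (xc A).den = (X : ℚ) / D ^ 2 := by rw [Rat.num_div_den, hx]
    have : ((xc A).den : ℚ) ≠ 0 := by exact_mod_cast (xc A).den_nz
    rw [div_eq_div_iff this (pow_ne_zero 2 hDq)] at h1
    exact_mod_cast h1
  have keyp := congrArg (Int.cast : ℤ → ZMod p) key
  push_cast at keyp
  rw [← ZMod.natCast_eq_zero_iff]
  rcases h with ⟨h1, h2, h3⟩ | ⟨h1, hh, h3⟩
  · refine ⟨fun _ => h3, fun _ => ?_⟩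
    rw [h1] at keyp
    simpa [h2] using keyp.symm
  · constructor
    · intro h
      exfalso
      rw [h, mul_zero] at keyp
      have hn : ((xc A).num : ZMod p) = 0 := by simpa [h1] using keyp
      rw [ZMod.intCast_zmod_eq_zero_iff_dvd] at hn
      rw [ZMod.natCast_eq_zero_iff] at h
      have h4 : p ∣ Nat.gcd (xc A).num.natAbs (xc A).den :=
        Nat.dvd_gcd (Int.natCast_dvd.1 hn) h
      rw [(xc A).reduced] at h4
      exact (Fact.out : p.Prime).one_lt.ne' (Nat.dvd_one.1 h4)
    · intro h; rw [h3] at h; exact absurd h (by simp)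

end

lemma nsmul_P_ne_zero {n : ℕ} (hn : n ≠ 0) : n • P ≠ 0 := by
  intro h
  have : (n : ℤ) • P = 0 := by rw [natCast_zsmul]; exact h
  exact hn (by exact_mod_cast (zsmul_P_eq_zero this))

/-- The denominator of the `x`-coordinate of `n • P`. -/
noncomputable def dn (n : ℕ) : ℕ := (xc (n • P)).den

/-- The order of the point `P` modulo the prime `p`. -/
noncomputable def ord (p : ℕ) : ℕ := sInf {n | 0 < n ∧ p ∣ dn n}

section
variable {p : ℕ} [Fact p.Prime]

lemma dvd_dn_iff_smul (hp : 5 < p) {n : ℕ} (hn : n ≠ 0) : p ∣ dn n ↔ n • Pbar p hp = 0 :=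
  (red_nsmul hp n).dvd_den_iff (nsmul_P_ne_zero hn)

lemma finite_point (hp : 5 < p) : Finite (EC (ZMod p)).Point :=
  Finite.of_equiv _ (pointEquiv (ZMod p) (ten_ne_zero hp)).symm

lemma ord_eq (hp : 5 < p) : ord p = addOrderOf (Pbar p hp) := by
  have := finite_point hp
  have h0 : 0 < addOrderOf (Pbar p hp) := addOrderOf_pos _
  apply le_antisymm
  · apply Nat.sInf_le
    exact ⟨h0, (dvd_dn_iff_smul hp h0.ne').2 (addOrderOf_nsmul_eq_zero _)⟩
  · apply le_csInf
    · exact ⟨_, h0, (dvd_dn_iff_smul hp h0.ne').2 (addOrderOf_nsmul_eq_zero _)⟩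
    · rintro n ⟨hn, h⟩
      exact addOrderOf_le_of_nsmul_eq_zero hn ((dvd_dn_iff_smul hp hn.ne').1 h)

lemma ord_pos' (hp : 5 < p) : 0 < ord p := by
  have := finite_point hp
  rw [ord_eq hp]; exact addOrderOf_pos _

lemma dvd_dn_iff' (hp : 5 < p) {n : ℕ} (hn : n ≠ 0) : p ∣ dn n ↔ ord p ∣ n := by
  rw [dvd_dn_iff_smul hp hn, ord_eq hp, addOrderOf_dvd_iff_nsmul_eq_zero]

lemma ord_dvd_card (hp : 5 < p) : ord p ∣ Nat.card (EC (ZMod p)).Point := by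
  rw [ord_eq hp]; exact addOrderOf_dvd_natCard _

lemma card_point (hp : 5 < p) : Nat.card (EC (ZMod p)).Point =
    (Finset.univ.filter fun z : ZMod p × ZMod p => z.2 ^ 2 = z.1 ^ 3 - 25 * z.1).card + 1 := by
  rw [Nat.card_congr (pointEquiv (ZMod p) (ten_ne_zero hp)), Nat.card_eq_fintype_card, Fintype.card_option,
    Fintype.card_subtype]

lemma card_point_le (hp : 5 < p) : Nat.card (EC (ZMod p)).Point ≤ 2 * p + 1 := by
  rw [card_point hp]
  have : (Finset.univ.filter fun z : ZMod p × ZMod p => z.2 ^ 2 = z.1 ^ 3 - 25 * z.1).card ≤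
      2 * (Finset.univ : Finset (ZMod p)).card := by
    apply Finset.card_le_mul_card_image_of_maps_to (f := Prod.fst) (fun _ _ => Finset.mem_univ _)
    intro a _
    by_contra hcon
    push Not at hcon
    obtain ⟨⟨u1, u2⟩, ⟨v1, v2⟩, ⟨w1, w2⟩, hu, hv, hw, huv, huw, hvw⟩ := Finset.two_lt_card_iff.1 hcon
    simp only [Finset.mem_filter, Finset.mem_univ, true_and] at hu hv hw
    obtain ⟨hu, rfl⟩ := hu
    obtain ⟨hv, rfl⟩ := hv
    obtain ⟨hw, rfl⟩ := hw
    simp only [ne_eq, Prod.mk.injEq, true_and] at *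
    have e1 := sq_eq_sq_iff_eq_or_eq_neg.1 (hu.trans hv.symm)
    have e2 := sq_eq_sq_iff_eq_or_eq_neg.1 (hu.trans hw.symm)
    have e1' := e1.resolve_left huv
    have e2' := e2.resolve_left huw
    exact hvw (neg_injective (e1'.symm.trans e2'))
  rw [Finset.card_univ, ZMod.card] at this
  omega

end

lemma ord_pos {p : ℕ} (h : p.Prime) (hp : 5 < p) : 0 < ord p :=
  have := Fact.mk h; ord_pos' hp

lemma dvd_dn_iff {p : ℕ} (h : p.Prime) (hp : 5 < p) {n : ℕ} (hn : n ≠ 0) : p ∣ dn n ↔ ord p ∣ n :=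
  have := Fact.mk h; dvd_dn_iff' hp hn

lemma ord_le {p : ℕ} (h : p.Prime) (hp : 5 < p) : ord p ≤ 2 * p + 1 := by
  have := Fact.mk h
  have := finite_point hp
  exact (Nat.le_of_dvd (Nat.card_pos) (ord_dvd_card hp)).trans (card_point_le hp)

/-- If the order of `P` mod `p` is odd then `p ≡ 1 mod 4`. -/
lemma mod_four_of_odd_ord {p : ℕ} (h : p.Prime) (hp : 5 < p) (ho : Odd (ord p)) : p % 4 = 1 := by
  have := Fact.mk h
  obtain ⟨k, hk⟩ := ho
  have h0 : ord p • Pbar p hp = 0 := by rw [ord_eq hp]; exact addOrderOf_nsmul_eq_zero _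
  set R := (k + 1) • Pbar p hp with hRd
  have hR : R + R = Pbar p hp := by
    have : R + R = (2 * k + 1) • Pbar p hp + Pbar p hp := by rw [hRd]; module
    rw [this, ← hk, h0, zero_add]
  have h2 : (2 : ZMod p) ≠ 0 := fun h => ten_ne_zero (p := p) hp (by linear_combination 5 * h)
  suffices hsq : IsSquare (-1 : ZMod p) by
    have := (ZMod.exists_sq_eq_neg_one_iff (p := p)).1 hsq
    have := h.eq_two_or_odd
    omega
  rcases hRe : R with _ | ⟨r, t, hrt⟩
  · rw [hRe] at hR
    exact absurd (hR.symm.trans (add_zero (0 : (EC (ZMod p)).Point))) (by simp [Pbar])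
  rw [hRe] at hR
  by_cases ht : t = 0
  · rw [Point.add_of_Y_eq rfl (by simp [negY, ht])] at hR
    exact absurd hR (by simp [Pbar])
  have h2t : 2 * t ≠ 0 := mul_ne_zero h2 ht
  obtain ⟨h3, h4⟩ := some_add_self (h₁ := hrt) h2t rfl rfl
  rw [h4, Pbar, Point.some.injEq] at hR
  have heq := (EC_nonsingular_iff (ten_ne_zero hp) _ _).1 hrt
  have h5 : ((r ^ 2 + 25) / (2 * t)) ^ 2 = -4 := by
    rw [← hR.1]; field_simp; ring_nf; simp only [heq]; ring
  refine ⟨(r ^ 2 + 25) / (2 * t) / 2, ?_⟩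
  rw [← sq, div_pow, h5]; field_simp; norm_num

end EC

namespace EC
open WeierstrassCurve.Affine

section
variable {p : ℕ} [Fact p.Prime]

lemma padicInt_coe_ofNat (n : ℕ) [n.AtLeastTwo] :
    ((OfNat.ofNat n : ℤ_[p]) : ℚ_[p]) = OfNat.ofNat n := PadicInt.coe_natCast n

lemma exists_inv_one_add {π : ℤ_[p]} (hπ : ‖π‖ < 1) (w : ℤ_[p]) : ∃ e : ℤ_[p], (1 + π * w) * e = 1 := by
  have h : ‖π * w‖ < 1 := by
    rw [norm_mul]
    calc ‖π‖ * ‖w‖ ≤ ‖π‖ * 1 := by gcongr; exact PadicInt.norm_le_one w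
      _ < 1 := by simpa
  have : IsUnit (1 + π * w) := by
    rw [PadicInt.isUnit_iff]
    rw [PadicInt.norm_add_eq_max_of_ne (by rw [norm_one]; exact h.ne'), norm_one, max_eq_left h.le]
  obtain ⟨v, hv⟩ := this
  exact ⟨↑v⁻¹, by rw [← hv]; simp⟩

lemma scd_nsmul {B : Q} {π S g₁ d₁ t : ℤ_[p]} (hπ : ‖π‖ < 1) (hs : ((s B : ℚ) : ℚ_[p]) = S)
    (hc : ((c B : ℚ) : ℚ_[p]) = (1 + π * g₁ : ℤ_[p])) (hd : ((d B : ℚ) : ℚ_[p]) = (1 + π * d₁ : ℤ_[p]))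
    (h5 : 5 * S ^ 2 = π * t) (k : ℕ) :
    ∃ u g e : ℤ_[p], ((s (k • B) : ℚ) : ℚ_[p]) = (S * (k + π * u) : ℤ_[p]) ∧
      ((c (k • B) : ℚ) : ℚ_[p]) = (1 + π * g : ℤ_[p]) ∧ ((d (k • B) : ℚ) : ℚ_[p]) = (1 + π * e : ℤ_[p]) := by
  have n5 : ((5 : ℤ_[p]) : ℚ_[p]) = 5 := padicInt_coe_ofNat 5
  have n25 : ((25 : ℤ_[p]) : ℚ_[p]) = 25 := padicInt_coe_ofNat 25
  induction k with
  | zero => exact ⟨0, 0, 0, by simp, by simp, by simp⟩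
  | succ k ih =>
    obtain ⟨u, g, d', h1, h2, h3⟩ := ih
    obtain ⟨e, he⟩ := exists_inv_one_add hπ (5 * t * (k + π * u) ^ 2 * S ^ 2)
    set w := 5 * t * (k + π * u) ^ 2 * S ^ 2 with hw
    obtain ⟨a1, a2, a3⟩ := add_law (k • B) B
    have b0 : ((Δ (k • B) B : ℚ) : ℚ_[p]) = (1 + π * w : ℤ_[p]) := by
      have : (1 + π * w : ℤ_[p]) = 1 + 25 * (S * (k + π * u)) ^ 2 * S ^ 2 := by
        rw [hw]; linear_combination -5 * (k + π * u) ^ 2 * S ^ 2 * h5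
      rw [this, Δ]; push_cast; rw [h1, hs, n25]; push_cast; ring
    have he' : ((1 + π * w : ℤ_[p]) : ℚ_[p]) * e = 1 := by exact_mod_cast congrArg (Subtype.val) he
    have b1 := congrArg (fun x : ℚ => (x : ℚ_[p])) a1
    have b2 := congrArg (fun x : ℚ => (x : ℚ_[p])) a2
    have b3 := congrArg (fun x : ℚ => (x : ℚ_[p])) a3
    simp only [Rat.cast_mul, Rat.cast_add, Rat.cast_sub, Rat.cast_ofNat, b0, h1, h2, h3, hs, hc, hd] at b1 b2 b3
    rw [succ_nsmul]
    refine ⟨e * (u * (1 + π * g₁) * (1 + π * d₁) + k * (g₁ + d₁ + π * g₁ * d₁) + g + d' + π * g * d' - (k + 1) * w),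
      e * (g + g₁ + π * g * g₁ - t * (k + π * u) * (1 + π * d') * (1 + π * d₁) - w),
      e * (d' + d₁ + π * d' * d₁ + t * (k + π * u) * (1 + π * g) * (1 + π * g₁) - w), ?_, ?_, ?_⟩
    · have h : (S * ((k + 1 : ℕ) + π * (e * (u * (1 + π * g₁) * (1 + π * d₁) + k * (g₁ + d₁ + π * g₁ * d₁) + g + d' + π * g * d' - (k + 1) * w))) : ℤ_[p])
        = e * (S * (k + π * u) * (1 + π * g₁) * (1 + π * d₁) + S * (1 + π * g) * (1 + π * d')) := by
        push_cast
        linear_combination -(S * (k + 1)) * he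
      rw [h]
      push_cast at b1 he' ⊢
      linear_combination (e : ℚ_[p]) * b1 - (s (k • B + B) : ℚ_[p]) * he'
    · have h : (1 + π * (e * (g + g₁ + π * g * g₁ - t * (k + π * u) * (1 + π * d') * (1 + π * d₁) - w)) : ℤ_[p])
        = e * ((1 + π * g) * (1 + π * g₁) - 5 * (S * (k + π * u)) * S * (1 + π * d') * (1 + π * d₁)) := by
        linear_combination -he + e * (k + π * u) * (1 + π * d') * (1 + π * d₁) * h5
      rw [h]
      push_cast at b2 he' ⊢
      rw [n5]
      linear_combination (e : ℚ_[p]) * b2 - (c (k • B + B) : ℚ_[p]) * he'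
    · have h : (1 + π * (e * (d' + d₁ + π * d' * d₁ + t * (k + π * u) * (1 + π * g) * (1 + π * g₁) - w)) : ℤ_[p])
        = e * ((1 + π * d') * (1 + π * d₁) + 5 * (S * (k + π * u)) * S * (1 + π * g) * (1 + π * g₁)) := by
        linear_combination -he - e * (k + π * u) * (1 + π * g) * (1 + π * g₁) * h5
      rw [h]
      push_cast at b3 he' ⊢
      rw [n5]
      linear_combination (e : ℚ_[p]) * b3 - (d (k • B + B) : ℚ_[p]) * he'

lemma norm_natCast_add {π : ℤ_[p]} (hπ : ‖π‖ < 1) (u : ℤ_[p]) {k : ℕ} (hk : ¬ p ∣ k) : ‖(k : ℤ_[p]) + π * u‖ = 1 := by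
  have h : ‖π * u‖ < 1 := by
    rw [norm_mul]
    calc ‖π‖ * ‖u‖ ≤ ‖π‖ * 1 := by gcongr; exact PadicInt.norm_le_one u
      _ < 1 := by simpa
  have hk' : ‖(k : ℤ_[p])‖ = 1 := by
    apply le_antisymm (PadicInt.norm_le_one _)
    by_contra hcon
    push Not at hcon
    have := (PadicInt.norm_int_lt_one_iff_dvd (p := p) (k : ℤ)).1 (by exact_mod_cast hcon)
    exact hk (by exact_mod_cast this)
  rw [PadicInt.norm_add_eq_max_of_ne (by rw [hk']; exact h.ne'), hk', max_eq_left h.le]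

lemma norm_s_nsmul_of_not_dvd {B : Q} {π S g₁ d₁ t : ℤ_[p]} (hπ : ‖π‖ < 1) (hs : ((s B : ℚ) : ℚ_[p]) = S)
    (hc : ((c B : ℚ) : ℚ_[p]) = (1 + π * g₁ : ℤ_[p])) (hd : ((d B : ℚ) : ℚ_[p]) = (1 + π * d₁ : ℤ_[p]))
    (h5 : 5 * S ^ 2 = π * t) {k : ℕ} (hk : ¬ p ∣ k) :
    ‖((s (k • B) : ℚ) : ℚ_[p])‖ = ‖((s B : ℚ) : ℚ_[p])‖ := by
  obtain ⟨u, g, e, h1, -, -⟩ := scd_nsmul hπ hs hc hd h5 k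
  rw [h1, hs, PadicInt.coe_mul, norm_mul, ← PadicInt.norm_def, ← PadicInt.norm_def, norm_natCast_add hπ u hk, mul_one]

lemma norm_s_nsmul_p {B : Q} {S g₁ d₁ t : ℤ_[p]} (hs : ((s B : ℚ) : ℚ_[p]) = S)
    (hc : ((c B : ℚ) : ℚ_[p]) = (1 + p ^ 2 * g₁ : ℤ_[p])) (hd : ((d B : ℚ) : ℚ_[p]) = (1 + p ^ 2 * d₁ : ℤ_[p]))
    (h5 : 5 * S ^ 2 = p ^ 2 * t) :
    ‖((s (p • B) : ℚ) : ℚ_[p])‖ = ‖((s B : ℚ) : ℚ_[p])‖ * ‖(p : ℚ_[p])‖ := by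
  have hp : ‖(p : ℤ_[p])‖ < 1 := (by simpa using inv_lt_one_of_one_lt₀ (by exact_mod_cast (Fact.out : p.Prime).one_lt))
  have hπ : ‖(p : ℤ_[p]) ^ 2‖ < 1 := by
    rw [norm_pow]; exact pow_lt_one₀ (norm_nonneg _) hp two_ne_zero
  obtain ⟨u, g, e, h1, -, -⟩ := scd_nsmul hπ hs hc hd h5 p
  have : ((p : ℤ_[p]) + p ^ 2 * u) = p * ((1 : ℕ) + p * u) := by push_cast; ring
  rw [h1, hs, PadicInt.coe_mul, norm_mul, this, PadicInt.coe_mul, norm_mul, ← PadicInt.norm_def,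
    ← PadicInt.norm_def, ← PadicInt.norm_def,
    norm_natCast_add hp u (fun h => (Fact.out : p.Prime).one_lt.ne' (Nat.dvd_one.1 h)), mul_one]
  simp

lemma Red.kernel {A : Q} {B : (EC (ZMod p)).Point} (hp : 5 < p) (h : Red p A B) (hA : A ≠ 0)
    (hden : p ∣ (xc A).den) :
    ‖((s A : ℚ) : ℚ_[p])‖ ^ 2 = ‖((xc A).den : ℚ_[p])‖ ∧
    ∃ S g d₁ t : ℤ_[p], ((s A : ℚ) : ℚ_[p]) = S ∧ ((c A : ℚ) : ℚ_[p]) = (1 + p ^ 2 * g : ℤ_[p]) ∧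
      ((d A : ℚ) : ℚ_[p]) = (1 + p ^ 2 * d₁ : ℤ_[p]) ∧ 5 * S ^ 2 = p ^ 2 * t := by
  have hB := (h.dvd_den_iff hA).1 hden
  rcases h with ⟨h, -⟩ | ⟨-, X, Y, D, hD, hx, hy, h⟩
  · exact absurd h hA
  have hDq : (D : ℚ) ≠ 0 := by exact_mod_cast hD
  rcases h with ⟨h1, h2, h3⟩ | ⟨h1, hh, h3⟩
  swap
  · rw [hB] at h3; exact absurd h3 (by simp)
  have hE := int_eq X Y D hD hx hy
  rw [ZMod.intCast_zmod_eq_zero_iff_dvd] at h1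
  rw [Ne, ZMod.intCast_zmod_eq_zero_iff_dvd] at h2
  have hpp : Prime (p : ℤ) := Nat.prime_iff_prime_int.1 Fact.out
  have hY : ¬ (p : ℤ) ∣ Y := by
    intro hY
    apply h2
    have : (p : ℤ) ∣ X ^ 3 := by
      have : X ^ 3 = Y * Y + D * (25 * X * D ^ 3) := by linear_combination -hE
      rw [this]; exact dvd_add (hY.mul_right _) (h1.mul_right _)
    exact hpp.dvd_of_dvd_pow this
  obtain ⟨D', rfl⟩ := h1
  have hu : ∀ n : ℤ, ¬ (p : ℤ) ∣ n → ‖(n : ℤ_[p])‖ = 1 := by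
    intro n hn
    apply le_antisymm (PadicInt.norm_le_one _)
    by_contra hcon
    push Not at hcon
    exact hn ((PadicInt.norm_int_lt_one_iff_dvd (p := p) n).1 hcon)
  set D := (p : ℤ) * D' with hDd
  have hN : ¬ (p : ℤ) ∣ X ^ 2 + 25 * D ^ 4 := by
    intro hN
    apply h2
    have : (p : ℤ) ∣ X ^ 2 := by
      have : X ^ 2 = (X ^ 2 + 25 * D ^ 4) - p * (25 * D' * D ^ 3) := by rw [hDd]; ring
      rw [this]; exact dvd_sub hN (dvd_mul_right _ _)
    exact hpp.dvd_of_dvd_pow this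
  have hNu : IsUnit ((X ^ 2 + 25 * D ^ 4 : ℤ) : ℤ_[p]) := by rw [PadicInt.isUnit_iff]; exact hu _ hN
  obtain ⟨v, hv⟩ := hNu
  have hv1 : ((X ^ 2 + 25 * D ^ 4 : ℤ) : ℤ_[p]) * ↑v⁻¹ = 1 := by rw [← hv]; simp
  generalize (↑v⁻¹ : ℤ_[p]) = w at hv1
  have hv2 : ((X : ℚ_[p]) ^ 2 + 25 * D ^ 4) * w = 1 := by
    have := congrArg (Subtype.val) hv1
    exact_mod_cast this
  have hNq : (X : ℚ) ^ 2 + 25 * D ^ 4 ≠ 0 := by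
    intro h
    apply hN
    have : X ^ 2 + 25 * D ^ 4 = 0 := by exact_mod_cast h
    rw [this]; exact dvd_zero _
  have es : s A * (X ^ 2 + 25 * D ^ 4) = 2 * Y * D := by
    rw [s_of_ne hA, hx, hy]; field_simp
  have ec : c A * (X ^ 2 + 25 * D ^ 4) = X ^ 2 - 10 * X * D ^ 2 - 25 * D ^ 4 := by
    rw [c_of_ne hA, hx]; field_simp
  have ed : d A * (X ^ 2 + 25 * D ^ 4) = X ^ 2 + 10 * X * D ^ 2 - 25 * D ^ 4 := by
    rw [d_of_ne hA, hx]; field_simp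
  have es' : (s A : ℚ_[p]) * (X ^ 2 + 25 * D ^ 4) = 2 * Y * D := by exact_mod_cast congrArg (fun x : ℚ => (x : ℚ_[p])) es
  have ec' : (c A : ℚ_[p]) * (X ^ 2 + 25 * D ^ 4) = X ^ 2 - 10 * X * D ^ 2 - 25 * D ^ 4 := by
    exact_mod_cast congrArg (fun x : ℚ => (x : ℚ_[p])) ec
  have ed' : (d A : ℚ_[p]) * (X ^ 2 + 25 * D ^ 4) = X ^ 2 + 10 * X * D ^ 2 - 25 * D ^ 4 := by
    exact_mod_cast congrArg (fun x : ℚ => (x : ℚ_[p])) ed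
  have hDp : (D : ℚ_[p]) = p * D' := by rw [hDd]; push_cast; ring
  have hwn : ‖(w : ℚ_[p])‖ = 1 := by
    have := congrArg norm hv1
    rw [norm_mul, hu _ hN, one_mul, norm_one] at this
    rwa [← PadicInt.norm_def]
  have hu' : ∀ n : ℤ, ¬ (p : ℤ) ∣ n → ‖(n : ℚ_[p])‖ = 1 := by
    intro n hn; have := hu n hn; rw [PadicInt.norm_def] at this; simpa using this
  have s1 : (s A : ℚ_[p]) = 2 * Y * D * w := by linear_combination (-(s A : ℚ_[p])) * hv2 + w * es'
  have h2p : ¬ (p : ℤ) ∣ 2 := by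
    intro h; have := Int.le_of_dvd (by norm_num) h; omega
  constructor
  · have key : (xc A).num * D ^ 2 = X * (xc A).den := by
      have h1 : (xc A).num / (xc A).den = (X : ℚ) / D ^ 2 := by rw [Rat.num_div_den, hx]
      have : ((xc A).den : ℚ) ≠ 0 := by exact_mod_cast (xc A).den_nz
      rw [div_eq_div_iff this (pow_ne_zero 2 hDq)] at h1
      exact_mod_cast h1
    have hnum : ¬ (p : ℤ) ∣ (xc A).num := by
      intro h
      have h4 : p ∣ Nat.gcd (xc A).num.natAbs (xc A).den := Nat.dvd_gcd (Int.natCast_dvd.1 h) hden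
      rw [(xc A).reduced] at h4
      exact (Fact.out : p.Prime).one_lt.ne' (Nat.dvd_one.1 h4)
    have := congrArg (fun n : ℤ => ‖(n : ℚ_[p])‖) key
    simp only [Int.cast_mul, Int.cast_pow, Int.cast_natCast, norm_mul, norm_pow, hu' _ hnum, hu' _ h2, one_mul] at this
    have h2' := hu' 2 h2p
    rw [s1, norm_mul, norm_mul, norm_mul, hwn, hu' _ hY, ← this]
    rw [show ‖(2 : ℚ_[p])‖ = 1 by exact_mod_cast h2']; ring
  · refine ⟨2 * Y * (p * D') * w, (-10 * X * D' ^ 2 - 50 * D' ^ 2 * D ^ 2) * w, (10 * X * D' ^ 2 - 50 * D' ^ 2 * D ^ 2) * w,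
      20 * Y ^ 2 * D' ^ 2 * w ^ 2, ?_, ?_, ?_, ?_⟩
    · rw [s1, hDp]; push_cast; rfl
    · have h : (1 + p ^ 2 * ((-10 * X * D' ^ 2 - 50 * D' ^ 2 * D ^ 2) * w) : ℤ_[p]) =
          ((X ^ 2 - 10 * X * D ^ 2 - 25 * D ^ 4 : ℤ) : ℤ_[p]) * w := by
        rw [hDd] at hv1 ⊢
        push_cast at hv1 ⊢
        linear_combination -hv1
      rw [h]; rw [PadicInt.coe_mul, PadicInt.coe_intCast]; push_cast
      linear_combination (-(c A : ℚ_[p])) * hv2 + w * ec'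
    · have h : (1 + p ^ 2 * ((10 * X * D' ^ 2 - 50 * D' ^ 2 * D ^ 2) * w) : ℤ_[p]) =
          ((X ^ 2 + 10 * X * D ^ 2 - 25 * D ^ 4 : ℤ) : ℤ_[p]) * w := by
        rw [hDd] at hv1 ⊢
        push_cast at hv1 ⊢
        linear_combination -hv1
      rw [h]; rw [PadicInt.coe_mul, PadicInt.coe_intCast]; push_cast
      linear_combination (-(d A : ℚ_[p])) * hv2 + w * ed'
    · ring

lemma norm_dn_mul (hp : 5 < p) {b : ℕ} (hb : b ≠ 0) (h : p ∣ dn b) {k : ℕ} (hk : ¬ p ∣ k) :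
    ‖(dn (k * b) : ℚ_[p])‖ = ‖(dn b : ℚ_[p])‖ := by
  obtain ⟨h1, S, g, d₁, t, hs, hc, hd, h5⟩ := (red_nsmul hp b).kernel hp (nsmul_P_ne_zero hb) h
  have hk0 : k * b ≠ 0 := mul_ne_zero (by rintro rfl; simp at hk) hb
  have h' : p ∣ dn (k * b) := by
    rw [dvd_dn_iff' hp hk0]; exact ((dvd_dn_iff' hp hb).1 h).mul_left k
  obtain ⟨h2, -⟩ := (red_nsmul hp (k * b)).kernel hp (nsmul_P_ne_zero hk0) h'
  have hπ : ‖(p : ℤ_[p]) ^ 2‖ < 1 := by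
    rw [norm_pow]; exact pow_lt_one₀ (norm_nonneg _) (by simpa using inv_lt_one_of_one_lt₀ (by exact_mod_cast (Fact.out : p.Prime).one_lt)) two_ne_zero
  rw [dn, dn, ← h1, ← h2, mul_nsmul', norm_s_nsmul_of_not_dvd hπ hs hc hd h5 hk]

lemma norm_dn_mul_p (hp : 5 < p) {b : ℕ} (hb : b ≠ 0) (h : p ∣ dn b) :
    ‖(dn (p * b) : ℚ_[p])‖ = ‖(dn b : ℚ_[p])‖ * ‖(p : ℚ_[p])‖ ^ 2 := by
  obtain ⟨h1, S, g, d₁, t, hs, hc, hd, h5⟩ := (red_nsmul hp b).kernel hp (nsmul_P_ne_zero hb) h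
  have hk0 : p * b ≠ 0 := mul_ne_zero (Nat.Prime.ne_zero Fact.out) hb
  have h' : p ∣ dn (p * b) := by
    rw [dvd_dn_iff' hp hk0]; exact ((dvd_dn_iff' hp hb).1 h).mul_left p
  obtain ⟨h2, -⟩ := (red_nsmul hp (p * b)).kernel hp (nsmul_P_ne_zero hk0) h'
  rw [dn, dn, ← h1, ← h2, mul_nsmul', norm_s_nsmul_p hs hc hd h5]; ring

end

end EC

namespace EC
open WeierstrassCurve.Affine

section
variable {p : ℕ} [Fact p.Prime]

lemma exists_padicInt {q : ℚ} (h : ¬ p ∣ q.den) : ∃ S : ℤ_[p], (q : ℚ_[p]) = S :=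
  ⟨⟨q, Padic.norm_rat_le_one h⟩, rfl⟩

lemma norm_s_nsmul_of_den {B : Q} {π : ℕ} (hπ0 : π ≠ 0) (hπ : p ∣ π) (hs : ¬ p ∣ (s B).den)
    (hc : ¬ p ∣ ((c B - 1) / π).den) (hd : ¬ p ∣ ((d B - 1) / π).den)
    (h5 : ¬ p ∣ (5 * (s B) ^ 2 / π).den) {k : ℕ} (hk : ¬ p ∣ k) :
    ‖((s (k • B) : ℚ) : ℚ_[p])‖ = ‖((s B : ℚ) : ℚ_[p])‖ := by
  obtain ⟨S, hS⟩ := exists_padicInt hs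
  obtain ⟨g, hg⟩ := exists_padicInt hc
  obtain ⟨e, he⟩ := exists_padicInt hd
  obtain ⟨t, ht⟩ := exists_padicInt h5
  have hπq : (π : ℚ_[p]) ≠ 0 := by exact_mod_cast hπ0
  have n5 : ((5 : ℤ_[p]) : ℚ_[p]) = 5 := padicInt_coe_ofNat 5
  push_cast at hg he ht
  have hlt : ‖((π : ℕ) : ℤ_[p])‖ < 1 := by
    have := (PadicInt.norm_int_lt_one_iff_dvd (p := p) (π : ℤ)).2 (by exact_mod_cast hπ)
    exact_mod_cast this
  refine norm_s_nsmul_of_not_dvd (π := (π : ℤ_[p])) (g₁ := g) (d₁ := e) (t := t) hlt hS ?_ ?_ ?_ hk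
  · push_cast; rw [← hg]; field_simp; ring
  · push_cast; rw [← he]; field_simp; ring
  · apply Subtype.coe_injective
    push_cast
    rw [n5, ← hS, ← ht]; field_simp

lemma norm_s_le {A : Q} {k : ℕ} (hk : k ≠ 0) (h : ((p ^ k : ℕ) : ℤ) ∣ T A) :
    ‖((s A : ℚ) : ℚ_[p])‖ ≤ (p : ℝ) ^ (-(k : ℤ)) := by
  have hp : (p : ℤ) ∣ T A := (by exact_mod_cast dvd_pow_self p hk : (p : ℤ) ∣ ((p ^ k : ℕ) : ℤ)).trans h
  have hz := not_dvd_TZ A Fact.out hp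
  have hz1 : ‖((Z A : ℤ) : ℚ_[p])‖ = 1 := by
    apply le_antisymm (Padic.norm_int_le_one _)
    by_contra hcon
    exact hz ((Padic.norm_intCast_lt_one_iff).1 (not_le.1 hcon))
  rw [s_eq]; push_cast
  rw [norm_div, hz1, div_one]
  exact (Padic.norm_int_le_pow_iff_dvd _ _).2 h

lemma lt_norm_of_eq {q : ℚ} {a b : ℤ} {k : ℕ} (h : q * b = a) (hd : ¬ ((p ^ k : ℕ) : ℤ) ∣ a) :
    (p : ℝ) ^ (-(k : ℤ)) < ‖(q : ℚ_[p])‖ := by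
  by_contra hcon
  push Not at hcon
  apply hd
  have h' : (q : ℚ_[p]) * b = a := by exact_mod_cast congrArg (fun x : ℚ => (x : ℚ_[p])) h
  rw [Nat.cast_pow, ← Padic.norm_int_le_pow_iff_dvd, ← h', norm_mul]
  calc _ ≤ ‖(q : ℚ_[p])‖ * 1 := by gcongr; exact Padic.norm_int_le_one _
    _ ≤ _ := by simpa using hcon

end

lemma s_P2 : s (P + P) = -1494696 / 3344161 ∧ c (P + P) = -113279 / 3344161 ∧ d (P + P) = 4728001 / 3344161 := by
  obtain ⟨h1, h2, h3⟩ := add_law P P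
  have hΔ : Δ P P = 3344161 / 2825761 := by unfold Δ; rw [s_P]; norm_num
  rw [hΔ] at h1 h2 h3; simp only [s_P, c_P, d_P] at h1 h2 h3
  refine ⟨?_, ?_, ?_⟩ <;> linarith

lemma not_five_dvd_T {a : ℕ} (h : ¬ 5 ∣ a) : ¬ (5 : ℤ) ∣ T (a • P) := by
  have : Fact (Nat.Prime 5) := ⟨by norm_num⟩
  intro hT
  have h1 := norm_s_le (p := 5) (A := a • P) (k := 1) one_ne_zero (by simpa using hT)
  rw [norm_s_nsmul_of_den (π := 5) (by norm_num) (by norm_num) (by rw [s_P]; norm_num) (by rw [c_P]; norm_num) (by rw [d_P]; norm_num) (by rw [s_P]; norm_num) h] at h1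
  refine absurd h1 (not_le.2 (lt_norm_of_eq (a := 12) (b := 41) (by rw [s_P]; norm_num) (by norm_num)))

lemma T_nsmul_P2 (a : ℕ) : T (a • (P + P)) = 2 * T (a • P) * X (a • P) * Y (a • P) * Z (a • P) := by
  rw [nsmul_add, T_double]

lemma not_nine_dvd_T {a : ℕ} (h : ¬ 3 ∣ a) : ¬ (9 : ℤ) ∣ T (a • P) := by
  have : Fact (Nat.Prime 3) := ⟨by norm_num⟩
  intro hT
  obtain ⟨e1, e2, e3⟩ := s_P2
  have h1 := norm_s_le (p := 3) (A := a • (P + P)) (k := 2) two_ne_zero (by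
    rw [T_nsmul_P2, mul_assoc, mul_assoc, mul_assoc]
    exact (Dvd.dvd.mul_right (by simpa using hT) _).mul_left _)
  rw [norm_s_nsmul_of_den (π := 9) (by norm_num) (by norm_num) (by rw [e1]; norm_num) (by rw [e2]; norm_num) (by rw [e3]; norm_num) (by rw [e1]; norm_num) h] at h1
  refine absurd h1 (not_le.2 (lt_norm_of_eq (a := -1494696) (b := 3344161) (by rw [e1]; norm_num) (by norm_num)))

lemma not_eight_dvd_T {a : ℕ} (h : ¬ 2 ∣ a) : ¬ (8 : ℤ) ∣ T (a • P) := by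
  have : Fact (Nat.Prime 2) := ⟨by norm_num⟩
  intro hT
  obtain ⟨e1, e2, e3⟩ := s_P2
  have h1 := norm_s_le (p := 2) (A := a • (P + P)) (k := 4) four_ne_zero (by
    rw [T_nsmul_P2, show 2 * T (a • P) * X (a • P) * Y (a • P) * Z (a • P) = (T (a • P) * 2) * (X (a • P) * Y (a • P) * Z (a • P)) by ring]
    refine Dvd.dvd.mul_right ?_ _
    exact (by norm_num : ((2 ^ 4 : ℕ) : ℤ) = 8 * 2) ▸ mul_dvd_mul hT dvd_rfl)
  rw [norm_s_nsmul_of_den (π := 2) (by norm_num) (by norm_num) (by rw [e1]; norm_num) (by rw [e2]; norm_num) (by rw [e3]; norm_num) (by rw [e1]; norm_num) h] at h1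
  refine absurd h1 (not_le.2 (lt_norm_of_eq (a := -1494696) (b := 3344161) (by rw [e1]; norm_num) (by norm_num)))


lemma s_ne_zero_of_nsmul {n : ℕ} (hn : n ≠ 0) : s (n • P) ≠ 0 := by
  have := s_zsmul_P_ne_zero (n := (n : ℤ)) (by exact_mod_cast hn)
  rwa [natCast_zsmul] at this

lemma dn_pos (n : ℕ) : 0 < dn n := (xc (n • P)).pos

lemma dn_dvd {n : ℕ} (hn : n ≠ 0) : (dn n : ℤ) ∣ Y (n • P) - Z (n • P) ∧ Y (n • P) - Z (n • P) ≠ 0 := by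
  have hs := s_ne_zero_of_nsmul hn
  have h0 := nsmul_P_ne_zero hn
  have hz := (Zq_pos (n • P)).ne'
  have hd : d (n • P) - 1 ≠ 0 := by
    intro h
    have := d_sq (n • P)
    rw [sub_eq_zero.1 h] at this
    apply hs
    have : s (n • P) ^ 2 = 0 := by linarith
    exact pow_eq_zero_iff two_ne_zero |>.1 this
  have hne : (Y (n • P) : ℚ) - Z (n • P) ≠ 0 := by
    intro h; apply hd; rw [d_eq, sub_eq_zero.1 h, div_self hz, sub_self]
  have hx : xc (n • P) = ((5 * (Z (n • P) + X (n • P)) : ℤ) : ℚ) / ((Y (n • P) - Z (n • P) : ℤ) : ℚ) := by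
    have hcd : xc (n • P) * (d (n • P) - 1) = 5 * (1 + c (n • P)) := by
      rw [d_of_ne h0, c_of_ne h0]
      have : xc (n • P) ^ 2 + 25 ≠ 0 := by positivity
      field_simp
      ring
    rw [d_eq, c_eq] at hcd
    push_cast
    rw [eq_div_iff hne]
    field_simp at hcd
    linear_combination hcd
  refine ⟨?_, by exact_mod_cast hne⟩
  have := Rat.den_dvd (5 * (Z (n • P) + X (n • P))) (Y (n • P) - Z (n • P))
  rw [Rat.divInt_eq_div, ← hx] at this
  exact this

lemma dn_dvd_T {n : ℕ} (hn : n ≠ 0) : (dn n : ℤ) ∣ 5 * T (n • P) ^ 2 := by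
  have h : 5 * T (n • P) ^ 2 = (Y (n • P) - Z (n • P)) * (Y (n • P) + Z (n • P)) := by
    linear_combination - Y_sq (n • P)
  rw [h]
  exact (dn_dvd hn).1.mul_right _

lemma dn_le_Z {n : ℕ} (hn : n ≠ 0) : (dn n : ℤ) ≤ 3 * Z (n • P) := by
  obtain ⟨h1, h2⟩ := dn_dvd hn
  have h3 := Int.le_of_dvd (abs_pos.2 h2) ((dvd_abs _ _).2 h1)
  have h4 := Y_sq (n • P)
  have h5 := five_T_sq_le (n • P)
  have h6 := Z_pos (n • P)
  have h7 : |Y (n • P)| ≤ 2 * Z (n • P) := by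
    apply abs_le_of_sq_le_sq _ (by positivity)
    nlinarith
  have := abs_sub (Y (n • P)) (Z (n • P))
  rw [abs_of_pos h6] at this
  linarith

lemma Z_le_dn {n : ℕ} (hn : Odd n) : Z (n • P) ≤ 50 * (dn n : ℤ) ^ 2 := by
  have hn0 : n ≠ 0 := by rintro rfl; simp at hn
  have h0 := nsmul_P_ne_zero hn0
  have hx := xc_odd (n := (n : ℤ)) (by exact_mod_cast hn)
  rw [natCast_zsmul] at hx
  have hz := (Zq_pos (n • P)).ne'
  set a := (xc (n • P)).num
  set D := (xc (n • P)).den with hD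
  have hDdn : dn n = D := rfl
  have hD0 : (0 : ℚ) < D := by exact_mod_cast (xc (n • P)).pos
  have hxe : xc (n • P) = a / D := (Rat.num_div_den _).symm
  have hde := d_of_ne h0
  have hc : Y (n • P) * (a ^ 2 + 25 * D ^ 2) = Z (n • P) * (a ^ 2 + 10 * a * D - 25 * D ^ 2) := by
    have : (Y (n • P) : ℚ) * (a ^ 2 + 25 * D ^ 2) = Z (n • P) * (a ^ 2 + 10 * a * D - 25 * D ^ 2) := by
      rw [d_eq, hxe] at hde
      have h1 : ((a : ℚ) / D) ^ 2 + 25 ≠ 0 := by positivity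
      have h2 : (a : ℚ) ^ 2 + 25 * D ^ 2 ≠ 0 := by positivity
      field_simp at hde
      linear_combination hde
    exact_mod_cast this
  have hcop : IsCoprime (Z (n • P)) (Y (n • P)) := by
    rw [Int.isCoprime_iff_gcd_eq_one]
    by_contra hne
    obtain ⟨p, hp, hpd⟩ := Nat.exists_prime_and_dvd hne
    exact not_dvd_ZY _ hp ((Int.natCast_dvd_natCast.2 hpd).trans (Int.gcd_dvd_left ..))
      ((Int.natCast_dvd_natCast.2 hpd).trans (Int.gcd_dvd_right ..))
  have hdv : Z (n • P) ∣ a ^ 2 + 25 * D ^ 2 := hcop.dvd_of_dvd_mul_left (hc ▸ dvd_mul_right _ _)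
  have hDp : 0 < (D : ℤ) := by exact_mod_cast hD0
  have h1 := Int.le_of_dvd (by positivity) hdv
  have h2 : a ^ 2 ≤ 25 * (D : ℤ) ^ 2 := by
    have : (a : ℚ) ^ 2 ≤ 25 * D ^ 2 := by
      have : (a : ℚ) = xc (n • P) * D := by rw [hxe]; field_simp
      rw [this, mul_pow]
      gcongr
      nlinarith
    exact_mod_cast this
  rw [hDdn]; linarith

lemma log_dn_le {n : ℕ} (hn : n ≠ 0) : Real.log (dn n) ≤ 5 * (n : ℝ) ^ 2 + 2 := by
  have h1 : (dn n : ℝ) ≤ 3 * Z (n • P) := by exact_mod_cast dn_le_Z hn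
  have h2 := (ht_nsmul_bounds n).2
  have h3 : (0 : ℝ) < dn n := by exact_mod_cast dn_pos n
  have h4 := Real.log_le_log h3 h1
  rw [Real.log_mul (by norm_num) (Zr_pos _).ne'] at h4
  have h5 : Real.log 3 ≤ 2 := by
    have := Real.log_le_sub_one_of_pos (show (0:ℝ) < 3 by norm_num)
    linarith
  have h6 : ht (n • P) = Real.log (Z (n • P)) := rfl
  linarith

lemma le_log_dn {n : ℕ} (hn : Odd n) : (3 * (n : ℝ) ^ 2 - 5) / 2 ≤ Real.log (dn n) := by
  have h1 : (Z (n • P) : ℝ) ≤ 50 * (dn n : ℝ) ^ 2 := by exact_mod_cast Z_le_dn hn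
  have h2 := (ht_nsmul_bounds n).1
  have h3 : (0 : ℝ) < dn n := by exact_mod_cast dn_pos n
  have h4 := Real.log_le_log (Zr_pos _) h1
  rw [Real.log_mul (by norm_num) (by positivity), Real.log_pow] at h4
  have h5 : Real.log 50 ≤ 5 := by
    rw [Real.log_le_iff_le_exp (by norm_num)]
    have := Real.add_one_le_exp (1 : ℝ)
    have e : Real.exp 5 = Real.exp 1 ^ 5 := by rw [← Real.exp_nat_mul]; norm_num
    rw [e]
    have := Real.exp_one_gt_d9
    calc (50:ℝ) ≤ 2.7 ^ 5 := by norm_num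
      _ ≤ _ := by gcongr; linarith
  have h6 : ht (n • P) = Real.log (Z (n • P)) := rfl
  push_cast at h4
  linarith

end EC

namespace EC

lemma card_ord_dvd_le {a : ℕ} (ha : a ≠ 0) {F : Finset ℕ} (hF : ∀ p ∈ F, p.Prime ∧ 5 < p ∧ ord p ∣ a) :
    (F.card : ℝ) ≤ 5 * (a : ℝ) ^ 2 + 2 := by
  have h1 : ∏ p ∈ F, p ∣ dn a := by
    apply Finset.prod_primes_dvd
    · intro p hp; exact (hF p hp).1.prime
    · intro p hp; obtain ⟨h, h5, h'⟩ := hF p hp; exact (dvd_dn_iff h h5 ha).2 h'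
  have h2 : 5 ^ F.card ≤ ∏ p ∈ F, p := by
    rw [← Finset.prod_const]
    exact Finset.prod_le_prod' fun p hp => (hF p hp).2.1.le
  have h3 : (5 : ℝ) ^ F.card ≤ dn a := by exact_mod_cast h2.trans (Nat.le_of_dvd (dn_pos a) h1)
  have h4 := Real.log_le_log (by positivity) h3
  rw [Real.log_pow] at h4
  have h5 : (1 : ℝ) ≤ Real.log 5 := by
    rw [Real.le_log_iff_exp_le (by norm_num)]
    have := Real.exp_one_lt_d9
    linarith
  have := log_dn_le ha
  have : (F.card : ℝ) * 1 ≤ F.card * Real.log 5 := by gcongr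
  linarith

lemma pow_dvd_of_pow_dvd_sq {p : ℕ} (hp : p.Prime) (j : ℕ) : ∀ t : ℤ, (p : ℤ) ^ (2 * j + 1) ∣ t ^ 2 → (p : ℤ) ^ (j + 1) ∣ t := by
  have hp' : Prime (p : ℤ) := Nat.prime_iff_prime_int.1 hp
  induction j with
  | zero => intro t h; simpa using hp'.dvd_of_dvd_pow (by simpa using h)
  | succ j ih =>
    intro t h
    have h1 : (p : ℤ) ∣ t := hp'.dvd_of_dvd_pow ((dvd_pow_self _ (by omega)).trans h)
    obtain ⟨u, rfl⟩ := h1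
    have h2 : (p : ℤ) ^ (2 * j + 1) ∣ u ^ 2 := by
      have e : (p : ℤ) ^ (2 * (j + 1) + 1) = p ^ 2 * p ^ (2 * j + 1) := by ring
      rw [e, mul_pow] at h
      exact (mul_dvd_mul_iff_left (pow_ne_zero 2 hp'.ne_zero)).1 h
    rw [pow_succ' (p : ℤ) (j + 1)]
    exact mul_dvd_mul_left _ (ih u h2)

lemma pow_dvd_of_dvd_dn {p k a : ℕ} (hp : p.Prime) (hp5 : p ≤ 5) (ha : a ≠ 0) (h2 : ¬ 2 ∣ a) (h3 : ¬ 3 ∣ a)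
    (h5 : ¬ 5 ∣ a) (h : p ^ k ∣ dn a) : p ^ k ∣ 720 := by
  have hT : ((p : ℤ) ^ k) ∣ 5 * T (a • P) ^ 2 :=
    (by exact_mod_cast h : ((p : ℤ) ^ k) ∣ (dn a : ℤ)).trans (dn_dvd_T ha)
  have hpr : p = 2 ∨ p = 3 ∨ p = 5 := by
    interval_cases p <;> first | omega | (exfalso; revert hp; norm_num)
  rcases hpr with rfl | rfl | rfl
  · have hk : k ≤ 4 := by
      by_contra hk
      have : (2 : ℤ) ^ (2 * 2 + 1) ∣ 5 * T (a • P) ^ 2 := (pow_dvd_pow _ (by omega)).trans hT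
      have := pow_dvd_of_pow_dvd_sq Nat.prime_two 2 _ ((show IsCoprime ((2 : ℤ) ^ (2 * 2 + 1)) 5 by norm_num).dvd_of_dvd_mul_left this)
      exact not_eight_dvd_T h2 (by simpa using this)
    exact (pow_dvd_pow 2 hk).trans (by norm_num)
  · have hk : k ≤ 2 := by
      by_contra hk
      have : (3 : ℤ) ^ (2 * 1 + 1) ∣ 5 * T (a • P) ^ 2 := (pow_dvd_pow _ (by omega)).trans hT
      have := pow_dvd_of_pow_dvd_sq Nat.prime_three 1 _ ((show IsCoprime ((3 : ℤ) ^ (2 * 1 + 1)) 5 by norm_num).dvd_of_dvd_mul_left this)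
      exact not_nine_dvd_T h3 (by simpa using this)
    exact (pow_dvd_pow 3 hk).trans (by norm_num)
  · have hk : k ≤ 1 := by
      by_contra hk
      have : (5 : ℤ) * 5 ∣ 5 * T (a • P) ^ 2 := by
        have : (5 : ℤ) ^ 2 ∣ 5 * T (a • P) ^ 2 := (pow_dvd_pow _ (by omega)).trans hT
        simpa [sq] using this
      have := (mul_dvd_mul_iff_left (by norm_num)).1 this
      exact not_five_dvd_T h5 (Int.prime_five.dvd_of_dvd_pow this)
    exact (pow_dvd_pow 5 hk).trans (by norm_num)

lemma pow_dvd_sq_mul_dn {p k q b : ℕ} (hp : p.Prime) (hp5 : 5 < p) (hq : q.Prime) (hb : b ≠ 0) (hd : p ∣ dn b)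
    (h : p ^ k ∣ dn (q * b)) : p ^ k ∣ q ^ 2 * dn b := by
  have : Fact p.Prime := ⟨hp⟩
  have h' : ((p : ℤ) ^ k) ∣ (dn (q * b) : ℤ) := by exact_mod_cast h
  rw [← Padic.norm_int_le_pow_iff_dvd] at h'
  suffices ((p : ℤ) ^ k) ∣ ((q ^ 2 * dn b : ℕ) : ℤ) by exact_mod_cast this
  rw [← Padic.norm_int_le_pow_iff_dvd]
  push_cast at h' ⊢
  rw [norm_mul, norm_pow]
  by_cases hpq : p ∣ q
  · obtain rfl := (Nat.prime_dvd_prime_iff_eq hp hq).1 hpq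
    rw [norm_dn_mul_p hp5 hb hd] at h'
    linarith
  · rw [norm_dn_mul hp5 hb hd hpq] at h'
    have h1 : ‖(q : ℚ_[p])‖ ≤ 1 := by exact_mod_cast Padic.norm_int_le_one (p := p) (q : ℤ)
    have h2 : ‖(q : ℚ_[p])‖ ^ 2 ≤ 1 := pow_le_one₀ (norm_nonneg _) h1
    calc _ ≤ 1 * ‖(dn b : ℚ_[p])‖ := by gcongr
      _ ≤ _ := by rw [one_mul]; exact h'

theorem exists_prime_ord_eq {a : ℕ} (ha1 : 1 < a) (hr : ∀ q : ℕ, q.Prime → q ∣ a → 101 ≤ q) :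
    ∃ p : ℕ, p.Prime ∧ 5 < p ∧ ord p = a := by
  by_contra hcon
  push Not at hcon
  have ha0 : a ≠ 0 := by omega
  have hsm : ∀ q : ℕ, q.Prime → q < 101 → ¬ q ∣ a := fun q hq h1 h2 => by have := hr q hq h2; omega
  have h2 := hsm 2 (by norm_num) (by norm_num)
  have hodd : Odd a := by rw [← Nat.not_even_iff_odd, even_iff_two_dvd]; exact h2
  have hdvd : dn a ∣ 720 * ∏ q ∈ a.primeFactors, (q ^ 2 * dn (a / q)) := by
    rw [Nat.dvd_iff_prime_pow_dvd_dvd]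
    intro p k hp h
    rcases Nat.eq_zero_or_pos k with rfl | hk
    · simp
    by_cases hp5 : p ≤ 5
    · exact (pow_dvd_of_dvd_dn hp hp5 ha0 h2 (hsm 3 (by norm_num) (by norm_num)) (hsm 5 (by norm_num) (by norm_num)) h).mul_right _
    push Not at hp5
    have hpd : p ∣ dn a := (dvd_pow_self p hk.ne').trans h
    obtain ⟨e, he⟩ := (dvd_dn_iff hp hp5 ha0).1 hpd
    have he1 : e ≠ 1 := by rintro rfl; exact hcon p hp hp5 (by rw [he, mul_one])
    obtain ⟨f, hf⟩ := e.minFac_dvd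
    have hq := Nat.minFac_prime he1
    have haq : a = e.minFac * (ord p * f) := by
      calc a = ord p * (e.minFac * f) := by rw [← hf, ← he]
        _ = _ := by ring
    have hb0 : ord p * f ≠ 0 := by intro h0; rw [h0, mul_zero] at haq; exact ha0 haq
    have hdiv : a / e.minFac = ord p * f := by
      conv_lhs => rw [haq]
      exact Nat.mul_div_cancel_left _ hq.pos
    have h3 : p ^ k ∣ e.minFac ^ 2 * dn (a / e.minFac) := by
      rw [hdiv]
      apply pow_dvd_sq_mul_dn hp hp5 hq hb0
      · exact (dvd_dn_iff hp hp5 hb0).2 (dvd_mul_right _ _)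
      · rwa [← haq]
    refine (h3.trans ?_).mul_left _
    apply Finset.dvd_prod_of_mem (fun q => q ^ 2 * dn (a / q))
    exact Nat.mem_primeFactors.2 ⟨hq, haq ▸ dvd_mul_right _ _, ha0⟩
  have hpos : ∀ q ∈ a.primeFactors, q ^ 2 * dn (a / q) ≠ 0 := fun q hq =>
    mul_ne_zero (pow_ne_zero 2 (Nat.prime_of_mem_primeFactors hq).ne_zero) (dn_pos _).ne'
  have hle := Nat.le_of_dvd (Nat.pos_of_ne_zero (mul_ne_zero (by norm_num) (Finset.prod_ne_zero_iff.2 hpos))) hdvd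
  have hle' : (dn a : ℝ) ≤ 720 * ∏ q ∈ a.primeFactors, ((q : ℝ) ^ 2 * dn (a / q)) := by exact_mod_cast hle
  have hlog := Real.log_le_log (by exact_mod_cast dn_pos a) hle'
  have hpos' : ∀ q ∈ a.primeFactors, (q : ℝ) ^ 2 * dn (a / q) ≠ 0 := fun q hq => by exact_mod_cast hpos q hq
  rw [Real.log_mul (by norm_num) (Finset.prod_ne_zero_iff.2 hpos'), Real.log_prod hpos'] at hlog
  have hterm : ∀ q ∈ a.primeFactors, Real.log ((q : ℝ) ^ 2 * dn (a / q)) ≤ 3 * Real.log q + 5 * (a : ℝ) ^ 2 * ((q : ℝ) ^ 2)⁻¹ := by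
    intro q hq
    have hqp := Nat.prime_of_mem_primeFactors hq
    have hqa := Nat.dvd_of_mem_primeFactors hq
    have hq101 := hr q hqp hqa
    have hq0 : (0 : ℝ) < q := by exact_mod_cast hqp.pos
    have hb0 : a / q ≠ 0 := by
      have := Nat.div_pos (Nat.le_of_dvd (by omega) hqa) hqp.pos
      omega
    rw [Real.log_mul (by positivity) (by exact_mod_cast (dn_pos _).ne'), Real.log_pow]
    have h1 := log_dn_le hb0
    rw [Nat.cast_div hqa hq0.ne', div_pow] at h1
    have h4 : (2 : ℝ) ≤ Real.log q := by
      rw [Real.le_log_iff_exp_le hq0]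
      have e : Real.exp 2 = Real.exp 1 ^ 2 := by rw [← Real.exp_nat_mul]; norm_num
      have h3 : (101 : ℝ) ≤ q := by exact_mod_cast hq101
      have := Real.exp_one_lt_d9
      rw [e]
      calc _ ≤ (2.8 : ℝ) ^ 2 := by gcongr; linarith
        _ ≤ _ := by norm_num; linarith
    push_cast
    rw [div_eq_mul_inv] at h1
    linarith
  have hsum := Finset.sum_le_sum hterm
  rw [Finset.sum_add_distrib, ← Finset.mul_sum, ← Finset.mul_sum] at hsum
  have hs1 : ∑ q ∈ a.primeFactors, Real.log q ≤ Real.log a := by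
    rw [← Real.log_prod (fun q hq => by exact_mod_cast (Nat.prime_of_mem_primeFactors hq).ne_zero)]
    apply Real.log_le_log
    · apply Finset.prod_pos; intro q hq; exact_mod_cast (Nat.prime_of_mem_primeFactors hq).pos
    · have := Nat.le_of_dvd (by omega) (Nat.prod_primeFactors_dvd a)
      rw [← Nat.cast_prod]
      exact_mod_cast this
  have ha101 : 101 ≤ a := (hr _ (Nat.minFac_prime (by omega)) a.minFac_dvd).trans (Nat.minFac_le (by omega))
  have hs2 : ∑ q ∈ a.primeFactors, ((q : ℝ) ^ 2)⁻¹ ≤ 2 / ((100 : ℕ) + 1) := by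
    refine le_trans (Finset.sum_le_sum_of_subset_of_nonneg ?_ fun i _ _ => by positivity) (sum_Ioo_inv_sq_le 100 (a + 1))
    intro q hq
    have hqp := Nat.prime_of_mem_primeFactors hq
    have hqa := Nat.dvd_of_mem_primeFactors hq
    have := hr q hqp hqa
    have := Nat.le_of_dvd (by omega) hqa
    simp; omega
  have hlow := le_log_dn hodd
  have hla : Real.log a ≤ a := by
    have := Real.log_le_sub_one_of_pos (show (0:ℝ) < a by positivity); linarith
  have h720 : Real.log 720 ≤ 719 := by
    have := Real.log_le_sub_one_of_pos (show (0:ℝ) < 720 by norm_num); linarith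
  have ha' : (101 : ℝ) ≤ a := by exact_mod_cast ha101
  push_cast at hs2
  have h10 : 5 * (a : ℝ) ^ 2 * ∑ q ∈ a.primeFactors, ((q : ℝ) ^ 2)⁻¹ ≤ 5 * (a : ℝ) ^ 2 * (2 / (100 + 1)) := by gcongr
  nlinarith

end EC

namespace EC

lemma abs_s_le (A : Q) : |s A| ≤ 1 / 2 := by
  apply abs_le_of_sq_le_sq _ (by norm_num)
  nlinarith [c_sq A, sq_nonneg (c A)]

lemma abs_c_le (A : Q) : |c A| ≤ 1 := by
  apply abs_le_of_sq_le_sq _ (by norm_num)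
  nlinarith [c_sq A, sq_nonneg (s A)]

lemma abs_d_le (A : Q) : |d A| ≤ 3 / 2 := by
  apply abs_le_of_sq_le_sq _ (by norm_num)
  nlinarith [d_sq A, c_sq A, sq_nonneg (c A)]

lemma abs_le_of_mul_le {x D b : ℚ} (hD : 1 ≤ D) (h : |x * D| ≤ b) : |x| ≤ b := by
  rw [abs_mul, abs_of_nonneg (by linarith : 0 ≤ D)] at h
  nlinarith [abs_nonneg x]

lemma one_le_Δ (A B : Q) : 1 ≤ Δ A B := by
  have : 0 ≤ 25 * s A ^ 2 * s B ^ 2 := by positivity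
  unfold Δ; linarith

lemma abs_mul_le {x y a b : ℚ} (hx : |x| ≤ a) (hy : |y| ≤ b) : |x * y| ≤ a * b := by
  rw [abs_mul]
  exact mul_le_mul hx hy (abs_nonneg _) ((abs_nonneg _).trans hx)

/-- `A` is `η`-close to the origin. -/
def Near (η : ℚ) (A : Q) : Prop := |s A| ≤ η ∧ |c A - 1| ≤ η ∧ |d A - 1| ≤ η

lemma near_sub {A B : Q} {η : ℚ} (h1 : |s A - s B| ≤ η) (h2 : |c A - c B| ≤ η) (h3 : |d A - d B| ≤ η) :
    Near (20 * η) (A - B) := by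
  obtain ⟨e1, e2, e3⟩ := add_law A (-B)
  rw [s_neg, c_neg, d_neg, ← sub_eq_add_neg] at e1 e2 e3
  have hD := one_le_Δ A (-B)
  have eD : Δ A (-B) = 1 + 25 * s A ^ 2 * s B ^ 2 := by unfold Δ; rw [s_neg]; ring
  have sA := abs_s_le A
  have sB := abs_s_le B
  have cA := abs_c_le A
  have cB := abs_c_le B
  have dA := abs_d_le A
  have dB := abs_d_le B
  have hη : 0 ≤ η := (abs_nonneg _).trans h1
  have k1 := c_sq B
  have k2 := d_sq B
  refine ⟨abs_le_of_mul_le hD ?_, abs_le_of_mul_le hD ?_, abs_le_of_mul_le hD ?_⟩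
  · rw [e1, show s A * c B * d B + -s B * c A * d A =
      (s A - s B) * (c B * d B) + (-(s B * (c B * (d A - d B))) + -(s B * (d A * (c A - c B)))) by ring]
    have a1 := abs_mul_le h1 (abs_mul_le cB dB)
    have a2 := abs_mul_le sB (abs_mul_le cB h3)
    have a3 := abs_mul_le sB (abs_mul_le dA h2)
    rw [abs_le] at a1 a2 a3 ⊢
    constructor <;> linarith
  · rw [sub_mul, e2, eD, show c A * c B - 5 * s A * -s B * d A * d B - 1 * (1 + 25 * s A ^ 2 * s B ^ 2) =
      (c A - c B) * c B + 5 * (s B * (d B * (s A * (d A - d B)))) + 5 * (s B * (d B * (d B * (s A - s B))))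
        - 25 * (s B * (s B * (s A * (s A - s B)))) - 25 * (s B * (s B * (s B * (s A - s B)))) by
        linear_combination k1 + 5 * s B ^ 2 * k2]
    have a1 := abs_mul_le h2 cB
    have a2 := abs_mul_le sB (abs_mul_le dB (abs_mul_le sA h3))
    have a3 := abs_mul_le sB (abs_mul_le dB (abs_mul_le dB h1))
    have a4 := abs_mul_le sB (abs_mul_le sB (abs_mul_le sA h1))
    have a5 := abs_mul_le sB (abs_mul_le sB (abs_mul_le sB h1))
    rw [abs_le] at a1 a2 a3 a4 a5 ⊢
    constructor <;> linarith
  · rw [sub_mul, e3, eD, show d A * d B + 5 * s A * -s B * c A * c B - 1 * (1 + 25 * s A ^ 2 * s B ^ 2) =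
      (d A - d B) * d B - 5 * (s B * (c B * (s A * (c A - c B)))) - 5 * (s B * (c B * (c B * (s A - s B))))
        - 25 * (s B * (s B * (s A * (s A - s B)))) - 25 * (s B * (s B * (s B * (s A - s B)))) by
        linear_combination k2 - 5 * s B ^ 2 * k1]
    have a1 := abs_mul_le h3 dB
    have a2 := abs_mul_le sB (abs_mul_le cB (abs_mul_le sA h2))
    have a3 := abs_mul_le sB (abs_mul_le cB (abs_mul_le cB h1))
    have a4 := abs_mul_le sB (abs_mul_le sB (abs_mul_le sA h1))
    have a5 := abs_mul_le sB (abs_mul_le sB (abs_mul_le sB h1))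
    rw [abs_le] at a1 a2 a3 a4 a5 ⊢
    constructor <;> linarith

lemma abs_sub_le_of_floor_eq {n : ℕ} (hn : 0 < n) {x y : ℚ} (h : ⌊n * x⌋ = ⌊n * y⌋) : |x - y| ≤ 1 / n := by
  have h1 := Int.abs_sub_lt_one_of_floor_eq_floor h
  have hn' : (0 : ℚ) < n := by exact_mod_cast hn
  rw [← mul_sub, abs_mul, abs_of_pos hn'] at h1
  rw [le_div_iff₀ hn']; linarith

lemma floor_mem_Icc {n : ℕ} {x : ℚ} (h : |x| ≤ 3 / 2) : ⌊n * x⌋ ∈ Finset.Icc (-(2 * n : ℤ)) (2 * n) := by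
  have hn' : (0 : ℚ) ≤ n := by positivity
  rw [abs_le] at h
  rw [Finset.mem_Icc, Int.le_floor]
  constructor
  · push_cast; nlinarith
  · have : (⌊n * x⌋ : ℚ) ≤ 2 * n := (Int.floor_le _).trans (by nlinarith)
    exact_mod_cast this

open Classical in
theorem card_near {η : ℚ} (hη : 0 < η) : ∃ K : ℕ, ∀ (B : Q) (J : ℕ),
    J ≤ K * ((Finset.range J).filter fun j => Near η (j • B)).card := by
  obtain ⟨n, hn⟩ := exists_nat_gt (20 / η)
  have hn0' : (0 : ℚ) < n := lt_trans (by positivity) hn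
  have hn0 : 0 < n := by exact_mod_cast hn0'
  let I := Finset.Icc (-(2 * n : ℤ)) (2 * n)
  let box := I ×ˢ I ×ˢ I
  refine ⟨box.card, fun B J => ?_⟩
  rcases Nat.eq_zero_or_pos J with rfl | hJ
  · simp
  let f : ℕ → ℤ × ℤ × ℤ := fun j => (⌊n * s (j • B)⌋, ⌊n * c (j • B)⌋, ⌊n * d (j • B)⌋)
  have hf : ∀ j ∈ Finset.range J, f j ∈ box := by
    intro j _
    simp only [box, Finset.mem_product, f]
    exact ⟨floor_mem_Icc ((abs_s_le _).trans (by norm_num)), floor_mem_Icc ((abs_c_le _).trans (by norm_num)),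
      floor_mem_Icc (abs_d_le _)⟩
  have hbox : box.Nonempty := ⟨_, hf 0 (Finset.mem_range.2 hJ)⟩
  have hsum := Finset.card_eq_sum_card_fiberwise hf
  rw [Finset.card_range] at hsum
  obtain ⟨b, hb, hmax⟩ := Finset.exists_max_image box (fun b => ((Finset.range J).filter fun j => f j = b).card) hbox
  have h1 : J ≤ box.card * ((Finset.range J).filter fun j => f j = b).card := by
    conv_lhs => rw [hsum]
    exact Finset.sum_le_card_nsmul _ _ _ hmax
  refine h1.trans (Nat.mul_le_mul_left _ ?_)
  set F := (Finset.range J).filter fun j => f j = b with hF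
  have hFne : F.Nonempty := by
    rw [← Finset.card_pos]
    by_contra h0
    have : F.card = 0 := by omega
    rw [this] at h1; omega
  have hmin := F.min'_mem hFne
  set j₀ := F.min' hFne
  apply Finset.card_le_card_of_injOn (fun j => j - j₀)
  · intro j hj
    have hle : j₀ ≤ j := F.min'_le j hj
    rw [Finset.mem_coe, hF, Finset.mem_filter, Finset.mem_range] at hj
    rw [hF, Finset.mem_filter] at hmin
    simp only [Finset.coe_filter, Finset.mem_range, Set.mem_ofPred_eq]
    refine ⟨by omega, ?_⟩
    have e := hj.2.trans hmin.2.symm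
    simp only [f, Prod.mk.injEq] at e
    obtain ⟨e1, e2, e3⟩ := e
    have := near_sub (abs_sub_le_of_floor_eq hn0 e1) (abs_sub_le_of_floor_eq hn0 e2) (abs_sub_le_of_floor_eq hn0 e3)
    rw [sub_nsmul _ hle, ← sub_eq_add_neg]
    have hle : 20 * (1 / (n : ℚ)) ≤ η := by
      rw [div_lt_iff₀ hη] at hn
      rw [mul_one_div, div_le_iff₀ hn0']; linarith
    exact ⟨this.1.trans hle, this.2.1.trans hle, this.2.2.trans hle⟩
  · intro a ha b hb hab
    have h1 : j₀ ≤ a := F.min'_le a ha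
    have h2 : j₀ ≤ b := F.min'_le b hb
    simp only at hab
    omega

lemma le_of_sq_le_sq' {a b : ℚ} (h : a ^ 2 ≤ b ^ 2) (hb : 0 ≤ b) : a ≤ b :=
  le_of_abs_le (abs_le_of_sq_le_sq h hb)

lemma small_bounds {A : Q} (hA : |s A| ≤ 1 / 10) (cA : 0 < c A) (dA : 0 < d A) :
    s A ^ 2 ≤ 1 / 100 ∧ 9 / 10 ≤ c A ∧ c A ≤ 1 ∧ 1 ≤ d A ∧ d A ≤ 11 / 10 := by
  have a1 := c_sq A
  have a2 := d_sq A
  have h0 : 0 ≤ s A ^ 2 := sq_nonneg _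
  have sA2 : s A ^ 2 ≤ 1 / 100 := by
    have := sq_le_sq' (by linarith [abs_nonneg (s A)]) hA
    rw [sq_abs] at this; linarith
  refine ⟨sA2, ?_, (abs_le.1 (abs_c_le A)).2, ?_, ?_⟩
  · exact le_of_sq_le_sq' (by linarith) cA.le
  · exact le_of_sq_le_sq' (by linarith) dA.le
  · exact le_of_sq_le_sq' (by linarith) (by norm_num)

lemma step_bounds {A B : Q} {β : ℚ} (hβ : β ≤ 1 / 10) (hA : 0 ≤ s A) (hA' : s A ≤ β) (hB : 0 < s B)
    (hB' : s B ≤ 1 / 10) (cA : 0 < c A) (dA : 0 < d A) (cB : 0 < c B) (dB : 0 < d B) :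
    s A + s B / 2 ≤ s (A + B) ∧ s (A + B) ≤ s A + s B ∧ 0 < c (A + B) ∧ 0 < d (A + B) := by
  obtain ⟨e1, e2, e3⟩ := add_law A B
  have hD := one_le_Δ A B
  have sA1 : s A ≤ 1 / 10 := hA'.trans hβ
  obtain ⟨sA2, cA', -, dA', dA''⟩ := small_bounds (by rwa [abs_of_nonneg hA]) cA dA
  obtain ⟨sB2', cB', -, dB', dB''⟩ := small_bounds (by rwa [abs_of_pos hB]) cB dB
  have hu : (c A * d A) ^ 2 = 1 - 25 * s A ^ 4 := by rw [mul_pow, c_sq, d_sq]; ring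
  have hw : (c B * d B) ^ 2 = 1 - 25 * s B ^ 4 := by rw [mul_pow, c_sq, d_sq]; ring
  have u0 : 0 < c A * d A := mul_pos cA dA
  have w0 : 0 < c B * d B := mul_pos cB dB
  have u1 : c A * d A ≤ 1 := le_of_sq_le_sq' (by rw [hu]; linarith [pow_nonneg hA 4]) zero_le_one
  have w1 : c B * d B ≤ 1 := le_of_sq_le_sq' (by rw [hw]; linarith [pow_nonneg hB.le 4]) zero_le_one
  have u2 : 9 / 10 ≤ c A * d A := by
    calc (9 / 10 : ℚ) = 9 / 10 * 1 := by norm_num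
      _ ≤ c A * d A := by gcongr
  have hB2 : s B ^ 2 ≤ s B / 10 := by
    rw [sq]; linarith [mul_le_mul_of_nonneg_left hB' hB.le]
  have hB4 : s B ^ 4 ≤ s B / 1000 := by
    calc s B ^ 4 = s B ^ 2 * s B ^ 2 := by ring
      _ ≤ s B / 10 * (1 / 100) := by gcongr
      _ = s B / 1000 := by ring
  have w2 : 1 - 25 * s B ^ 4 ≤ c B * d B := by
    rw [← hw, sq]; linarith [mul_le_mul_of_nonneg_left w1 w0.le]
  have hΔ : Δ A B ≤ 1 + s B / 40 := by
    have : s A ^ 2 * s B ^ 2 ≤ 1 / 100 * (s B / 10) := by gcongr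
    unfold Δ; linarith
  have hDp := Δ_pos A B
  have hss : s A * s B ≤ 1 / 10 * (1 / 10) := by gcongr
  have hss0 : 0 ≤ s A * s B := by positivity
  refine ⟨?_, ?_, ?_, ?_⟩
  · have : (s A + s B / 2) * Δ A B ≤ s (A + B) * Δ A B := by
      rw [e1]
      have h1 : (s A + s B / 2) * Δ A B ≤ (s A + s B / 2) * (1 + s B / 40) := by gcongr
      have h2 : s A * (1 - s B / 4) ≤ s A * c B * d B := by
        rw [mul_assoc]; gcongr; linarith
      have h3 : s B * (9 / 10) ≤ s B * c A * d A := by rw [mul_assoc]; gcongr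
      have h4 : s B * s A ≤ s B * (1 / 10) := by gcongr
      have h5 : s B * s B ≤ s B * (1 / 10) := by gcongr
      linarith
    exact le_of_mul_le_mul_right this hDp
  · have : s (A + B) * Δ A B ≤ (s A + s B) * Δ A B := by
      rw [e1]
      have h2 : s A * c B * d B ≤ s A * 1 := by rw [mul_assoc]; gcongr
      have h3 : s B * c A * d A ≤ s B * 1 := by rw [mul_assoc]; gcongr
      have h4 : (s A + s B) * 1 ≤ (s A + s B) * Δ A B := by gcongr
      linarith
    exact le_of_mul_le_mul_right this hDp
  · have : 0 < c (A + B) * Δ A B := by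
      rw [e2]
      have h1 : 9 / 10 * (9 / 10) ≤ c A * c B := by gcongr
      have h2 : d A * d B ≤ 11 / 10 * (11 / 10) := by gcongr
      have h3 : (s A * s B) * (d A * d B) ≤ 1 / 100 * (121 / 100) := by gcongr <;> linarith
      linarith
    exact pos_of_mul_pos_left this hDp.le
  · have : 0 < d (A + B) * Δ A B := by rw [e3]; positivity
    exact pos_of_mul_pos_left this hDp.le

lemma exists_nsmul_mem_Ioo {α β : ℚ} (hα : 0 < α) (hβ : β ≤ 1 / 10) {B : Q} (hB : 0 < s B)
    (hB' : s B < β - α) (cB : 0 < c B) (dB : 0 < d B) :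
    ∃ j : ℕ, α < s (j • B) ∧ s (j • B) < β ∧ 0 < c (j • B) ∧ 0 < d (j • B) := by
  by_contra hcon
  push Not at hcon
  have key : ∀ j : ℕ, j * (s B / 2) ≤ s (j • B) ∧ s (j • B) ≤ α ∧ 0 < c (j • B) ∧ 0 < d (j • B) := by
    intro j
    induction j with
    | zero => simp [s_zero, c_zero, d_zero, hα.le]
    | succ j ih =>
      obtain ⟨h1, h2, h3, h4⟩ := ih
      have h0 : 0 ≤ s (j • B) := le_trans (by positivity) h1
      obtain ⟨g1, g2, g3, g4⟩ := step_bounds (β := α) (by linarith) h0 h2 hB (by linarith) h3 h4 cB dB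
      rw [succ_nsmul]
      refine ⟨by push_cast; linarith, ?_, g3, g4⟩
      by_contra hlt
      push Not at hlt
      have := hcon (j + 1)
      rw [succ_nsmul] at this
      exact absurd (this hlt (by linarith) g3) (not_le.2 g4)
  obtain ⟨j, hj⟩ := exists_nat_gt (α / (s B / 2))
  rw [div_lt_iff₀ (by positivity)] at hj
  have := key j
  linarith

lemma near_add {A C : Q} {η : ℚ} (hη : η ≤ 1 / 100) (hA : |s A| ≤ 1 / 10) (cA : 0 < c A) (dA : 0 < d A)
    (hC : Near η C) : |s (A + C) - s A| ≤ 10 * η ∧ 0 < c (A + C) ∧ 0 < d (A + C) := by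
  obtain ⟨e1, e2, e3⟩ := add_law A C
  have hD := one_le_Δ A C
  have hDp := Δ_pos A C
  obtain ⟨h1, h2, h3⟩ := hC
  have hη0 : 0 ≤ η := (abs_nonneg _).trans h1
  obtain ⟨sA2, cA', -, dA', -⟩ := small_bounds hA cA dA
  have acA := abs_c_le A
  have adA := abs_d_le A
  have adC := abs_d_le C
  have ha := abs_le.1 h2
  have hb := abs_le.1 h3
  have b1 := abs_mul_le hA h2
  have b2 := abs_mul_le (abs_mul_le hA h3) (abs_c_le C)
  have b3 := abs_mul_le hA (abs_mul_le (abs_mul_le hA hA) (abs_mul_le h1 (abs_s_le C)))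
  have b4 := abs_mul_le h1 (abs_mul_le acA adA)
  have b5 := abs_mul_le (abs_mul_le hA h1) (abs_mul_le adA adC)
  have b6 := abs_mul_le (abs_mul_le hA h1) (abs_mul_le acA (abs_c_le C))
  refine ⟨abs_le_of_mul_le hD ?_, ?_, ?_⟩
  · rw [sub_mul, e1, show s A * c C * d C + s C * c A * d A - s A * Δ A C = s A * (c C - 1) + s A * (d C - 1) * c C
      - 25 * (s A * (s A * s A * (s C * s C))) + s C * (c A * d A) by unfold Δ; ring]
    rw [abs_le] at b1 b2 b3 b4 ⊢
    constructor <;> linarith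
  · have : 0 < c (A + C) * Δ A C := by
      rw [e2]
      rw [abs_le] at b5
      have : 89 / 100 ≤ c A * c C := by
        calc (89 / 100 : ℚ) ≤ 9 / 10 * (99 / 100) := by norm_num
          _ ≤ c A * c C := by gcongr; linarith
      linarith
    exact pos_of_mul_pos_left this hDp.le
  · have : 0 < d (A + C) * Δ A C := by
      rw [e3]
      rw [abs_le] at b6
      have : 9 / 10 ≤ d A * d C := by
        calc (9 / 10 : ℚ) ≤ 1 * (99 / 100) := by norm_num
          _ ≤ d A * d C := by gcongr; linarith
      linarith
    exact pos_of_mul_pos_left this hDp.le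

end EC

namespace EC

open Classical in
theorem density_s {α β : ℚ} (hα : 0 < α) (hαβ : α < β) (hβ : β ≤ 1 / 10) : ∃ K : ℕ, ∀ W : ℕ, 0 < W →
    ∃ t : ℕ, W ∣ t ∧ ∀ J : ℕ, J ≤ K * ((Finset.range J).filter fun j =>
      α < |s ((t + j * W) • P)| ∧ |s ((t + j * W) • P)| < β ∧ 0 < c ((t + j * W) • P) ∧
        0 < d ((t + j * W) • P)).card := by
  obtain ⟨η, hη⟩ : ∃ η : ℚ, η = (β - α) / 60 := ⟨_, rfl⟩
  have hη0 : 0 < η := by rw [hη]; apply div_pos <;> linarith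
  obtain ⟨K, hK⟩ := card_near hη0
  refine ⟨K, fun W hW => ?_⟩
  obtain ⟨j, hj0, hj⟩ : ∃ j : ℕ, 0 < j ∧ Near η (j • (W • P)) := by
    by_contra hcon
    push Not at hcon
    have h1 := hK (W • P) (K + 1)
    have h2 : ((Finset.range (K + 1)).filter fun j => Near η (j • (W • P))).card ≤ 1 := by
      rw [Finset.card_le_one]
      intro a ha b hb
      rw [Finset.mem_filter] at ha hb
      have ha0 : a = 0 := by
        by_contra h; exact hcon a (Nat.pos_of_ne_zero h) ha.2
      have hb0 : b = 0 := by
        by_contra h; exact hcon b (Nat.pos_of_ne_zero h) hb.2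
      rw [ha0, hb0]
    nlinarith
  have hs0 : s (j • (W • P)) ≠ 0 := by
    rw [← mul_nsmul']
    have := s_zsmul_P_ne_zero (n := ((j * W : ℕ) : ℤ)) (by positivity)
    rwa [natCast_zsmul] at this
  obtain ⟨B, hB, hsB⟩ : ∃ B : Q, (B = j • (W • P) ∨ B = -(j • (W • P))) ∧ 0 < s B := by
    rcases lt_or_gt_of_ne hs0 with h | h
    · exact ⟨_, Or.inr rfl, by rw [s_neg]; linarith⟩
    · exact ⟨_, Or.inl rfl, h⟩
  have hBN : s B ≤ η ∧ 0 < c B ∧ 0 < d B := by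
    obtain ⟨h1, h2, h3⟩ := hj
    rw [abs_le] at h1 h2 h3
    rcases hB with rfl | rfl
    · exact ⟨h1.2, by linarith, by linarith⟩
    · rw [s_neg, c_neg, d_neg]; exact ⟨by linarith, by linarith, by linarith⟩
  obtain ⟨i, i1, i2, i3, i4⟩ := exists_nsmul_mem_Ioo (α := α + 10 * η) (β := β - 10 * η) (by linarith)
    (by linarith) hsB (by linarith [hBN.1]) hBN.2.1 hBN.2.2
  refine ⟨i * j * W, Dvd.intro_left _ rfl, fun J => (hK (W • P) J).trans ?_⟩
  refine Nat.mul_le_mul_left _ (Finset.card_le_card ?_)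
  intro l hl
  rw [Finset.mem_filter] at hl ⊢
  refine ⟨hl.1, ?_⟩
  have e : (i * j * W + l * W) • P = (i * j * W) • P + l • (W • P) := by
    rw [add_nsmul, mul_nsmul' P l W]
  have e2 : (i * j * W) • P = i • (j • (W • P)) := by
    rw [mul_assoc, mul_nsmul', mul_nsmul']
  have key : α + 10 * η < |s ((i * j * W) • P)| ∧ |s ((i * j * W) • P)| < β - 10 * η ∧
      0 < c ((i * j * W) • P) ∧ 0 < d ((i * j * W) • P) := by
    rw [e2]
    rcases hB with rfl | rfl
    · rw [abs_of_pos (by linarith)]; exact ⟨i1, i2, i3, i4⟩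
    · rw [neg_nsmul, s_neg] at i1 i2
      rw [neg_nsmul, c_neg] at i3
      rw [neg_nsmul, d_neg] at i4
      rw [abs_of_neg (by linarith)]; exact ⟨i1, i2, i3, i4⟩
  obtain ⟨k1, k2, k3⟩ := near_add (by linarith) (by linarith) key.2.2.1 key.2.2.2 hl.2
  rw [e]
  have k4 := abs_abs_sub_abs_le (s ((i * j * W) • P + l • W • P)) (s ((i * j * W) • P))
  have k5 := abs_le.1 (k4.trans k1)
  exact ⟨by linarith, by linarith, k2, k3⟩

/-- The condition that `(y / x) ^ 2 = x - 25 / x` is within `1` of `g`, together with `0 < x`. -/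
def Tgt (g : ℚ) (A : Q) : Prop := 0 < xc A ∧ |xc A - 25 / xc A - g| < 1

lemma div_anti {u w : ℚ} (hu : 10 ≤ u) (hw : u ≤ w) :
    4 * w / (w ^ 2 + 100) ≤ 4 * u / (u ^ 2 + 100) := by
  rw [div_le_div_iff₀ (by positivity) (by positivity)]
  have h1 : 10 * 10 ≤ u * w := by gcongr; linarith
  nlinarith [mul_nonneg (sub_nonneg.2 hw) (sub_nonneg.2 h1)]

lemma tgt_of_s {g : ℚ} (hg : 401 ≤ g) {A : Q} (hA : A ≠ 0) {α β : ℚ} (hα : 0 < α)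
    (hα' : 4 * (g + 1) / ((g + 1) ^ 2 + 100) ≤ α ^ 2) (hβ' : β ^ 2 ≤ 4 * (g - 1) / ((g - 1) ^ 2 + 100))
    (h1 : α < |s A|) (h2 : |s A| < β) (h3 : 0 < c A) (h4 : 0 < d A) : Tgt g A := by
  have e1 := s_of_ne hA
  rw [c_of_ne hA] at h3
  rw [d_of_ne hA] at h4
  have hy := yc_sq A
  have hx2 : 0 < xc A ^ 2 + 25 := by positivity
  have h3' := (div_pos_iff_of_pos_right hx2).1 h3
  have h4' := (div_pos_iff_of_pos_right hx2).1 h4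
  have hx : 0 < xc A := by
    by_contra hx
    push Not at hx
    have : xc A * (xc A ^ 2 - 25) < 0 := by
      apply mul_neg_of_neg_of_pos _ (by linarith)
      rcases hx.lt_or_eq with h | h
      · exact h
      · rw [h] at h3'; norm_num at h3'
    nlinarith [sq_nonneg (yc A)]
  obtain ⟨V, hV⟩ : ∃ V, V = xc A - 25 / xc A := ⟨_, rfl⟩
  have hVx : V * xc A = xc A ^ 2 - 25 := by rw [hV]; field_simp
  have hV10 : 10 ≤ V := by
    by_contra h
    push Not at h
    nlinarith
  have hs : s A ^ 2 = 4 * V / (V ^ 2 + 100) := by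
    rw [e1, div_pow, mul_pow, hy, div_eq_div_iff (by positivity) (by positivity)]
    have e2 : (xc A ^ 2 + 25) ^ 2 = xc A ^ 2 * (V ^ 2 + 100) := by
      linear_combination (-(V * xc A) - (xc A ^ 2 - 25)) * hVx
    rw [e2]
    linear_combination (-4 * xc A * (V ^ 2 + 100)) * hVx
  rw [← sq_abs] at hs
  have hs1 : α ^ 2 < |s A| ^ 2 := by gcongr
  have hs2 : |s A| ^ 2 < β ^ 2 := by gcongr
  refine ⟨hx, ?_⟩
  rw [← hV, abs_lt]
  constructor
  · by_contra h
    push Not at h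
    have := div_anti hV10 (w := g - 1) (by linarith)
    linarith
  · by_contra h
    push Not at h
    have := div_anti (u := g + 1) (w := V) (by linarith) (by linarith)
    linarith

lemma exists_rat_sq_between {a b : ℚ} (ha : 0 ≤ a) (hab : a < b) : ∃ x : ℚ, 0 < x ∧ a < x ^ 2 ∧ x ^ 2 < b := by
  have h : Real.sqrt a < Real.sqrt b := Real.sqrt_lt_sqrt (by exact_mod_cast ha) (by exact_mod_cast hab)
  obtain ⟨x, h1, h2⟩ := exists_rat_btwn h
  have hx0 : (0 : ℝ) < x := lt_of_le_of_lt (Real.sqrt_nonneg _) h1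
  refine ⟨x, by exact_mod_cast hx0, ?_, ?_⟩
  · have := (Real.sqrt_lt' hx0).1 h1
    exact_mod_cast this
  · have := (Real.lt_sqrt hx0.le).1 h2
    exact_mod_cast this

open Classical in
theorem density_tgt {g : ℚ} (hg : 3000 ≤ g) : ∃ K : ℕ, ∀ W : ℕ, 0 < W →
    ∃ t : ℕ, W ∣ t ∧ ∀ J : ℕ, J ≤ K * ((Finset.range J).filter fun j => Tgt g ((t + j * W) • P)).card := by
  have h1 : 4 * (g + 1) / ((g + 1) ^ 2 + 100) < 4 * (g - 1) / ((g - 1) ^ 2 + 100) := by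
    rw [div_lt_div_iff₀ (by positivity) (by positivity)]
    nlinarith
  obtain ⟨α, a0, a1, a2⟩ := exists_rat_sq_between (by apply div_nonneg <;> nlinarith) h1
  obtain ⟨β, b0, b1, b2⟩ := exists_rat_sq_between (sq_nonneg α) a2
  have hβ : β ≤ 1 / 10 := by
    refine le_of_sq_le_sq' (b2.le.trans ?_) (by norm_num)
    rw [div_le_iff₀ (by positivity)]
    nlinarith
  obtain ⟨K, hK⟩ := density_s a0 (le_of_sq_le_sq' b1.le b0.le |>.lt_of_ne (by rintro rfl; exact lt_irrefl _ b1)) hβ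
  refine ⟨K, fun W hW => ?_⟩
  obtain ⟨t, ht, h⟩ := hK W hW
  refine ⟨t, ht, fun J => (h J).trans (Nat.mul_le_mul_left _ (Finset.card_le_card ?_))⟩
  intro j hj
  rw [Finset.mem_filter] at hj ⊢
  refine ⟨hj.1, tgt_of_s (by linarith) ?_ a0 a1.le b2.le hj.2.1 hj.2.2.1 hj.2.2.2.1 hj.2.2.2.2⟩
  intro h0
  rw [h0, s_zero, abs_zero] at hj
  linarith [hj.2.1]

end EC

namespace EC

lemma prime_dvd_dn_one {p : ℕ} (hp : p.Prime) (h5 : 5 < p) : 1 < ord p := by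
  have h0 := ord_pos hp h5
  rcases Nat.lt_or_ge 1 (ord p) with h | h
  · exact h
  · have : ord p ∣ 1 := by rw [show ord p = 1 by omega]
    rw [← dvd_dn_iff hp h5 one_ne_zero, dn, one_nsmul, xc_P] at this
    norm_num at this
    omega

/-- The primes `p > 5` for which `P` has order `a` modulo `p`. -/
noncomputable def ordSet (a : ℕ) : Finset ℕ := (dn a).primeFactors.filter fun p => 5 < p ∧ ord p = a

lemma mem_ordSet {a p : ℕ} (ha : a ≠ 0) : p ∈ ordSet a ↔ p.Prime ∧ 5 < p ∧ ord p = a := by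
  rw [ordSet, Finset.mem_filter, Nat.mem_primeFactors]
  constructor
  · rintro ⟨⟨h1, -, -⟩, h2, h3⟩; exact ⟨h1, h2, h3⟩
  · rintro ⟨h1, h2, h3⟩
    exact ⟨⟨h1, (dvd_dn_iff h1 h2 ha).2 (by rw [h3]), (dn_pos a).ne'⟩, h2, h3⟩

/-- The weight of an integer `a`, penalising divisors `a` of `m ± 1`. -/
noncomputable def wt (a : ℕ) : ℝ := (a : ℝ) ^ (-(1 / 4) : ℝ) + ∑ p ∈ ordSet a, (p : ℝ) ^ (-(7 / 8) : ℝ)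

lemma wt_nonneg (a : ℕ) : 0 ≤ wt a := by unfold wt; positivity

lemma rpow_div_le {a p : ℕ} (ha : 0 < a) (hp : 0 < p) :
    (p : ℝ) ^ (-(7 / 8) : ℝ) / a ≤ (p : ℝ) ^ (-(9 / 8) : ℝ) + (a : ℝ) ^ (-(9 / 2) : ℝ) := by
  have ha' : (0 : ℝ) < a := by exact_mod_cast ha
  have hp' : (0 : ℝ) < p := by exact_mod_cast hp
  rcases le_or_gt ((p : ℝ) ^ (1 / 4 : ℝ)) a with h | h
  · refine le_add_of_le_of_nonneg ?_ (by positivity)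
    calc (p : ℝ) ^ (-(7 / 8) : ℝ) / a ≤ (p : ℝ) ^ (-(7 / 8) : ℝ) / (p : ℝ) ^ (1 / 4 : ℝ) := by gcongr
      _ = _ := by rw [← Real.rpow_sub hp']; norm_num
  · refine le_add_of_nonneg_of_le (by positivity) ?_
    have h4 : (a : ℝ) ^ (4 : ℝ) ≤ p := by
      calc (a : ℝ) ^ (4 : ℝ) ≤ ((p : ℝ) ^ (1 / 4 : ℝ)) ^ (4 : ℝ) := by gcongr
        _ = p := by rw [← Real.rpow_mul hp'.le]; norm_num
    have h5 : (p : ℝ) ^ (-(7 / 8) : ℝ) ≤ (a : ℝ) ^ (-(7 / 2) : ℝ) := by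
      calc (p : ℝ) ^ (-(7 / 8) : ℝ) ≤ ((a : ℝ) ^ (4 : ℝ)) ^ (-(7 / 8) : ℝ) :=
            Real.rpow_le_rpow_of_nonpos (by positivity) h4 (by norm_num)
        _ = _ := by rw [← Real.rpow_mul ha'.le]; norm_num
    calc (p : ℝ) ^ (-(7 / 8) : ℝ) / a ≤ (a : ℝ) ^ (-(7 / 2) : ℝ) / a := by gcongr
      _ = _ := by
        nth_rw 2 [← Real.rpow_one (a : ℝ)]
        rw [← Real.rpow_sub ha']; norm_num

lemma card_ordSet_le {a : ℕ} (ha : a ≠ 0) : ((ordSet a).card : ℝ) ≤ 7 * (a : ℝ) ^ 2 := by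
  have h := card_ord_dvd_le ha (F := ordSet a) (fun p hp => by
    obtain ⟨h1, h2, h3⟩ := (mem_ordSet ha).1 hp
    exact ⟨h1, h2, by rw [h3]⟩)
  have : (1 : ℝ) ≤ a := by exact_mod_cast Nat.one_le_iff_ne_zero.2 ha
  nlinarith

theorem summable_wt : Summable fun a : ℕ => wt a / a := by
  have hS : Summable fun n : ℕ => (n : ℝ) ^ (-(9 / 8) : ℝ) :=
    Real.summable_nat_rpow.2 (by norm_num)
  have h2 : Summable fun a : ℕ => if a = 0 then 0 else ∑ p ∈ ordSet a, (p : ℝ) ^ (-(9 / 8) : ℝ) := by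
    refine summable_of_sum_range_le (c := ∑' n : ℕ, (n : ℝ) ^ (-(9 / 8) : ℝ)) (fun n => by
      split_ifs <;> positivity) (fun n => ?_)
    rw [← Finset.sum_filter_of_ne (p := fun a => a ≠ 0) (by
      intro a _ h h0; exact h (by simp [h0]))]
    have e : ∀ a ∈ (Finset.range n).filter (fun a => a ≠ 0),
        (if a = 0 then 0 else ∑ p ∈ ordSet a, (p : ℝ) ^ (-(9 / 8) : ℝ)) = ∑ p ∈ ordSet a, (p : ℝ) ^ (-(9 / 8) : ℝ) := by
      intro a ha; rw [if_neg (Finset.mem_filter.1 ha).2]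
    rw [Finset.sum_congr rfl e, ← Finset.sum_biUnion]
    · exact hS.sum_le_tsum _ (fun i _ => by positivity)
    · intro a ha b hb hab
      rw [Finset.mem_coe, Finset.mem_filter] at ha hb
      rw [Function.onFun, Finset.disjoint_left]
      intro p h1 h2
      exact hab (((mem_ordSet ha.2).1 h1).2.2.symm.trans ((mem_ordSet hb.2).1 h2).2.2)
  have h1 : Summable fun a : ℕ => (a : ℝ) ^ (-(5 / 4) : ℝ) := Real.summable_nat_rpow.2 (by norm_num)
  have h3 : Summable fun a : ℕ => 7 * (a : ℝ) ^ (-(5 / 2) : ℝ) := (Real.summable_nat_rpow.2 (by norm_num)).mul_left 7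
  refine Summable.of_nonneg_of_le (fun a => div_nonneg (wt_nonneg a) (by positivity)) (fun a => ?_) ((h1.add h2).add h3)
  rcases Nat.eq_zero_or_pos a with rfl | ha
  · simp only [Nat.cast_zero, div_zero]; positivity
  have ha' : (0 : ℝ) < a := by exact_mod_cast ha
  rw [wt, add_div, add_assoc, if_neg ha.ne']
  refine add_le_add ?_ ?_
  · nth_rw 2 [← Real.rpow_one (a : ℝ)]
    rw [← Real.rpow_sub ha']; norm_num
  · rw [Finset.sum_div]
    calc ∑ p ∈ ordSet a, (p : ℝ) ^ (-(7 / 8) : ℝ) / a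
        ≤ ∑ p ∈ ordSet a, ((p : ℝ) ^ (-(9 / 8) : ℝ) + (a : ℝ) ^ (-(9 / 2) : ℝ)) :=
          Finset.sum_le_sum fun p hp => rpow_div_le ha ((mem_ordSet ha.ne').1 hp).1.pos
      _ = ∑ p ∈ ordSet a, (p : ℝ) ^ (-(9 / 8) : ℝ) + (ordSet a).card * (a : ℝ) ^ (-(9 / 2) : ℝ) := by
          rw [Finset.sum_add_distrib, Finset.sum_const, nsmul_eq_mul]
      _ ≤ _ := by
          refine add_le_add_right ?_ _
          calc ((ordSet a).card : ℝ) * (a : ℝ) ^ (-(9 / 2) : ℝ) ≤ 7 * (a : ℝ) ^ 2 * (a : ℝ) ^ (-(9 / 2) : ℝ) := by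
                gcongr; exact card_ordSet_le ha.ne'
            _ = _ := by
                rw [mul_assoc, ← Real.rpow_natCast, ← Real.rpow_add ha']; norm_num

lemma exists_tail_le {f : ℕ → ℝ} (hf : Summable f) {ε : ℝ} (hε : 0 < ε) :
    ∃ M : ℕ, ∀ s : Finset ℕ, (∀ n ∈ s, M ≤ n) → ∑ n ∈ s, f n ≤ ε := by
  obtain ⟨t, ht⟩ := summable_iff_vanishing_norm.1 hf ε hε
  refine ⟨t.sup id + 1, fun s hs => ?_⟩
  have := ht s (by
    rw [Finset.disjoint_left]
    intro a ha hat
    have h1 := Finset.le_sup (f := id) hat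
    have h2 := hs a ha
    simp only [id] at h1; omega)
  exact (le_abs_self _).trans this.le

lemma card_dvd_le {a W : ℕ} (hW : a.Coprime W) (t e : ℤ) (J : ℕ) :
    ((Finset.range J).filter fun j : ℕ => (a : ℤ) ∣ t + j * W + e).card ≤ J / a + 1 := by
  rw [← Finset.card_range (J / a + 1)]
  apply Finset.card_le_card_of_injOn (fun j => j / a)
  · intro j hj
    simp only [Finset.coe_filter, Finset.mem_range, Set.mem_ofPred_eq] at hj
    simp only [Finset.coe_range, Set.mem_Iio]
    exact Nat.lt_succ_of_le (Nat.div_le_div_right hj.1.le)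
  · intro j hj k hk hjk
    simp only [Finset.coe_filter, Finset.mem_range, Set.mem_ofPred_eq] at hj hk hjk
    have h : (a : ℤ) ∣ (j - k) * W := by
      have := dvd_sub hj.2 hk.2
      rwa [show (t + j * W + e - (t + k * W + e) : ℤ) = (j - k) * W by ring] at this
    have h2 : (a : ℤ) ∣ j - k := (Nat.isCoprime_iff_coprime.2 hW).dvd_of_dvd_mul_right h
    have h3 : j % a = k % a := ((Nat.modEq_iff_dvd.2 h2).symm)
    rw [← Nat.div_add_mod j a, ← Nat.div_add_mod k a, hjk, h3]

end EC

namespace EC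

/-- `a` divides a neighbour of `m`. -/
def Nbr (m a : ℕ) : Prop := a ∣ m - 1 ∨ a ∣ m + 1

instance (m a : ℕ) : Decidable (Nbr m a) := by unfold Nbr; infer_instance

def CondP (m : ℕ) : Prop :=
  ∀ X : ℕ, ((Finset.range (X + 1)).filter fun p => p.Prime ∧ 5 < p ∧ Nbr m (ord p)).card ^ 8 ≤ X ^ 7

def CondA (m : ℕ) : Prop :=
  ∀ Y : ℕ, ((Finset.range (Y + 1)).filter fun a => 1 < a ∧ Nbr m a).card ^ 4 ≤ Y

def CondN (m : ℕ) : Prop := ∀ n : ℕ, 1 < n → n ≠ m - 1 → Nbr m n → ¬ Nbr m (n + 2)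

lemma Nbr.le {m a : ℕ} (h : Nbr m a) (hm : 2 ≤ m) : a ≤ m + 1 := by
  rcases h with h | h
  · have := Nat.le_of_dvd (by omega) h; omega
  · exact Nat.le_of_dvd (by omega) h

lemma Nbr.coprime {m a W : ℕ} (h : Nbr m a) (hm : 1 ≤ m) (hW : W ∣ m) : a.Coprime W := by
  have key : ∀ k, k ∣ a → k ∣ W → k = 1 := by
    intro k h1 h2
    rcases h with h | h
    · have h3 := Nat.dvd_sub (h2.trans hW) (h1.trans h)
      rw [Nat.sub_sub_self hm] at h3
      exact Nat.dvd_one.1 h3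
    · exact Nat.dvd_one.1 ((Nat.dvd_add_right (h2.trans hW)).1 (h1.trans h))
  exact key _ (Nat.gcd_dvd_left _ _) (Nat.gcd_dvd_right _ _)

lemma Nbr.le_of_rough {m a W z : ℕ} (h : Nbr m a) (hm : 1 ≤ m) (hW : W ∣ m) (ha : 1 < a)
    (hz : ∀ q, q.Prime → q < z → q ∣ W) : z ≤ a := by
  have hc := h.coprime hm hW
  by_contra hlt
  push Not at hlt
  have hq := Nat.minFac_prime ha.ne'
  have := Nat.dvd_gcd (Nat.minFac_dvd a) (hz _ hq ((Nat.minFac_le (by omega)).trans_lt hlt))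
  rw [hc] at this
  exact hq.one_lt.ne' (Nat.dvd_one.1 this)

/-- The total weight of the divisors of `m ± 1`. -/
noncomputable def pen (m : ℕ) : ℝ := ∑ a ∈ (Finset.range (m + 2)).filter (fun a => 1 < a ∧ Nbr m a), wt a

lemma condA_of_pen {m : ℕ} (hm : 2 ≤ m) (h : pen m ≤ 1) : CondA m := by
  intro Y
  set S := (Finset.range (Y + 1)).filter fun a => 1 < a ∧ Nbr m a with hS
  rcases Nat.eq_zero_or_pos Y with rfl | hY
  · have : S = ∅ := by
      rw [hS, Finset.filter_eq_empty_iff]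
      intro a ha; rw [Finset.mem_range] at ha; omega
    rw [this]; norm_num
  have hY' : (0 : ℝ) < Y := by exact_mod_cast hY
  have h1 : (S.card : ℝ) * (Y : ℝ) ^ (-(1 / 4) : ℝ) ≤ 1 := by
    calc (S.card : ℝ) * (Y : ℝ) ^ (-(1 / 4) : ℝ) = ∑ a ∈ S, (Y : ℝ) ^ (-(1 / 4) : ℝ) := by
          rw [Finset.sum_const, nsmul_eq_mul]
      _ ≤ ∑ a ∈ S, wt a := by
          refine Finset.sum_le_sum fun a ha => ?_
          rw [hS, Finset.mem_filter, Finset.mem_range] at ha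
          unfold wt
          refine le_add_of_le_of_nonneg ?_ (by positivity)
          refine Real.rpow_le_rpow_of_nonpos (by exact_mod_cast (by omega : 0 < a)) ?_ (by norm_num)
          exact_mod_cast (by omega : a ≤ Y)
      _ ≤ pen m := by
          refine Finset.sum_le_sum_of_subset_of_nonneg ?_ (fun a _ _ => wt_nonneg a)
          intro a ha
          rw [hS, Finset.mem_filter, Finset.mem_range] at ha
          rw [Finset.mem_filter, Finset.mem_range]
          have := ha.2.2.le hm
          exact ⟨by omega, ha.2⟩
      _ ≤ 1 := h
  have h2 : (S.card : ℝ) ≤ (Y : ℝ) ^ (1 / 4 : ℝ) := by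
    rw [Real.rpow_neg hY'.le, ← div_eq_mul_inv, div_le_one (by positivity)] at h1
    exact h1
  have h3 : (S.card : ℝ) ^ 4 ≤ (Y : ℝ) := by
    calc (S.card : ℝ) ^ 4 ≤ ((Y : ℝ) ^ (1 / 4 : ℝ)) ^ 4 := by gcongr
      _ = (Y : ℝ) := by rw [← Real.rpow_natCast, ← Real.rpow_mul hY'.le]; norm_num
  exact_mod_cast h3

lemma pairwiseDisjoint_ordSet {s : Set ℕ} (hs : ∀ a ∈ s, a ≠ 0) : s.PairwiseDisjoint ordSet := by
  intro a ha b hb hab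
  rw [Function.onFun, Finset.disjoint_left]
  intro p h1 h2
  exact hab (((mem_ordSet (hs a ha)).1 h1).2.2.symm.trans ((mem_ordSet (hs b hb)).1 h2).2.2)

lemma condP_of_pen {m : ℕ} (hm : 2 ≤ m) (h : pen m ≤ 1) : CondP m := by
  intro X
  set S := (Finset.range (X + 1)).filter fun p => p.Prime ∧ 5 < p ∧ Nbr m (ord p) with hS
  rcases Nat.eq_zero_or_pos X with rfl | hX
  · have : S = ∅ := by
      rw [hS, Finset.filter_eq_empty_iff]
      intro a ha; rw [Finset.mem_range] at ha; omega
    rw [this]; norm_num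
  have hX' : (0 : ℝ) < X := by exact_mod_cast hX
  have h1 : (S.card : ℝ) * (X : ℝ) ^ (-(7 / 8) : ℝ) ≤ 1 := by
    calc (S.card : ℝ) * (X : ℝ) ^ (-(7 / 8) : ℝ) = ∑ a ∈ S, (X : ℝ) ^ (-(7 / 8) : ℝ) := by
          rw [Finset.sum_const, nsmul_eq_mul]
      _ ≤ ∑ p ∈ S, (p : ℝ) ^ (-(7 / 8) : ℝ) := by
          refine Finset.sum_le_sum fun a ha => ?_
          rw [hS, Finset.mem_filter, Finset.mem_range] at ha
          refine Real.rpow_le_rpow_of_nonpos (by exact_mod_cast (by omega : 0 < a)) ?_ (by norm_num)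
          exact_mod_cast (by omega : a ≤ X)
      _ ≤ ∑ p ∈ ((Finset.range (m + 2)).filter (fun a => 1 < a ∧ Nbr m a)).biUnion ordSet,
            (p : ℝ) ^ (-(7 / 8) : ℝ) := by
          refine Finset.sum_le_sum_of_subset_of_nonneg ?_ (fun a _ _ => by positivity)
          intro p hp
          rw [hS, Finset.mem_filter] at hp
          rw [Finset.mem_biUnion]
          refine ⟨ord p, ?_, (mem_ordSet (ord_pos hp.2.1 hp.2.2.1).ne').2 ⟨hp.2.1, hp.2.2.1, rfl⟩⟩
          rw [Finset.mem_filter, Finset.mem_range]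
          have := hp.2.2.2.le hm
          exact ⟨by omega, prime_dvd_dn_one hp.2.1 hp.2.2.1, hp.2.2.2⟩
      _ = ∑ a ∈ (Finset.range (m + 2)).filter (fun a => 1 < a ∧ Nbr m a),
            ∑ p ∈ ordSet a, (p : ℝ) ^ (-(7 / 8) : ℝ) := by
          refine Finset.sum_biUnion (pairwiseDisjoint_ordSet ?_)
          intro a ha
          rw [Finset.mem_coe, Finset.mem_filter] at ha
          omega
      _ ≤ pen m := by
          refine Finset.sum_le_sum fun a _ => ?_
          unfold wt
          exact le_add_of_nonneg_left (by positivity)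
      _ ≤ 1 := h
  have h2 : (S.card : ℝ) ≤ (X : ℝ) ^ (7 / 8 : ℝ) := by
    rw [Real.rpow_neg hX'.le, ← div_eq_mul_inv, div_le_one (by positivity)] at h1
    exact h1
  have h3 : (S.card : ℝ) ^ 8 ≤ (X : ℝ) ^ 7 := by
    calc (S.card : ℝ) ^ 8 ≤ ((X : ℝ) ^ (7 / 8 : ℝ)) ^ 8 := by gcongr
      _ = (X : ℝ) ^ 7 := by
        rw [← Real.rpow_natCast, ← Real.rpow_mul hX'.le, ← Real.rpow_natCast]; norm_num
  exact_mod_cast h3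

lemma card_nbr_le {a W t : ℕ} (hc : a.Coprime W) (J : ℕ) :
    ((Finset.range J).filter fun j => 0 < t + j * W ∧ Nbr (t + j * W) a).card ≤ 2 * (J / a + 1) := by
  have h1 := card_dvd_le hc t (-1) J
  have h2 := card_dvd_le hc t 1 J
  refine le_trans (Finset.card_le_card (t := ((Finset.range J).filter fun j : ℕ => (a : ℤ) ∣ t + j * W + (-1)) ∪
    ((Finset.range J).filter fun j : ℕ => (a : ℤ) ∣ t + j * W + 1)) ?_) ((Finset.card_union_le _ _).trans (by omega))
  intro j hj
  rw [Finset.mem_filter] at hj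
  rw [Finset.mem_union, Finset.mem_filter, Finset.mem_filter]
  rcases hj.2.2 with h | h
  · left
    refine ⟨hj.1, ?_⟩
    have := Int.natCast_dvd_natCast.2 h
    rw [Nat.cast_sub hj.2.1] at this
    push_cast at this
    exact this
  · right
    refine ⟨hj.1, ?_⟩
    have := Int.natCast_dvd_natCast.2 h
    push_cast at this
    exact this

lemma sum_pen_le {W t z J : ℕ} (ht : W ∣ t) (hz : ∀ q, q.Prime → q < z → q ∣ W) :
    ∑ j ∈ (Finset.range J).filter (fun j => 0 < t + j * W), pen (t + j * W) ≤
      2 * J * ∑ a ∈ (Finset.range (t + J * W + 2)).filter (fun a => z ≤ a), wt a / a +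
      2 * ∑ a ∈ Finset.range (t + J * W + 2), wt a := by
  set Y := t + J * W + 2 with hY
  have hWm : ∀ j, W ∣ t + j * W := fun j => dvd_add ht (Dvd.intro_left _ rfl)
  calc ∑ j ∈ (Finset.range J).filter (fun j => 0 < t + j * W), pen (t + j * W)
      ≤ ∑ j ∈ (Finset.range J).filter (fun j => 0 < t + j * W), ∑ a ∈ Finset.range Y,
          if 1 < a ∧ Nbr (t + j * W) a then wt a else 0 := by
        refine Finset.sum_le_sum fun j hj => ?_
        rw [Finset.mem_filter, Finset.mem_range] at hj
        rw [← Finset.sum_filter, pen]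
        refine Finset.sum_le_sum_of_subset_of_nonneg ?_ (fun a _ _ => wt_nonneg a)
        refine Finset.filter_subset_filter _ (Finset.range_subset_range.2 ?_)
        have : j * W ≤ J * W := Nat.mul_le_mul_right _ hj.1.le
        omega
    _ = ∑ a ∈ Finset.range Y, ∑ j ∈ (Finset.range J).filter (fun j => 0 < t + j * W),
          if 1 < a ∧ Nbr (t + j * W) a then wt a else 0 := Finset.sum_comm
    _ ≤ ∑ a ∈ Finset.range Y, ((if z ≤ a then 2 * J * (wt a / a) else 0) + 2 * wt a) := by
        refine Finset.sum_le_sum fun a _ => ?_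
        have hw := wt_nonneg a
        rw [← Finset.sum_filter, Finset.sum_const, nsmul_eq_mul, Finset.filter_filter]
        rcases Finset.eq_empty_or_nonempty ((Finset.range J).filter
          fun j => 0 < t + j * W ∧ 1 < a ∧ Nbr (t + j * W) a) with he | ⟨j, hj⟩
        · rw [he, Finset.card_empty, Nat.cast_zero, zero_mul]
          split_ifs <;> positivity
        · rw [Finset.mem_filter] at hj
          obtain ⟨_, h0, h1, h2⟩ := hj
          rw [if_pos (h2.le_of_rough h0 (hWm j) h1 hz)]
          have h3 : ((Finset.range J).filter fun j => 0 < t + j * W ∧ 1 < a ∧ Nbr (t + j * W) a).card ≤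
              2 * (J / a + 1) := by
            refine le_trans (Finset.card_le_card ?_) (card_nbr_le (h2.coprime h0 (hWm j)) J (t := t))
            intro i hi
            rw [Finset.mem_filter] at hi ⊢
            exact ⟨hi.1, hi.2.1, hi.2.2.2⟩
          have h4 : (((Finset.range J).filter fun j => 0 < t + j * W ∧ 1 < a ∧ Nbr (t + j * W) a).card : ℝ) ≤
              2 * ((J : ℝ) / a + 1) := by
            have h5 : ((J / a : ℕ) : ℝ) ≤ (J : ℝ) / a := Nat.cast_div_le
            calc _ ≤ ((2 * (J / a + 1) : ℕ) : ℝ) := by exact_mod_cast h3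
              _ ≤ _ := by push_cast; linarith
          calc _ ≤ 2 * ((J : ℝ) / a + 1) * wt a := by gcongr
            _ = _ := by ring
    _ = _ := by
        rw [Finset.sum_add_distrib, ← Finset.sum_filter, Finset.mul_sum, Finset.mul_sum]

lemma sq_le_of_nbr {m n : ℕ} (hm : 0 < m) (h2 : 2 ∣ m) (hn : 1 < n) (hne : n ≠ m - 1) (h : Nbr m n)
    (h' : Nbr m (n + 2)) : n * n ≤ m + 1 := by
  by_contra hlt
  push Not at hlt
  have hodd : ¬ 2 ∣ n := by
    intro h3
    have := Nat.dvd_gcd h3 (dvd_refl 2)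
    rw [h.coprime hm h2] at this
    omega
  have hn3 : 3 ≤ n := by
    by_contra h3
    have : n = 2 := by omega
    exact hodd (by rw [this])
  have key : ∀ k k' : ℕ, ∀ δ : ℤ, (n : ℤ) * k = (n + 2) * k' + δ → (δ = 0 ∨ δ = 2 ∨ δ = -2) → 0 < k' →
      (n + 2) * k' ≤ m + 1 → k = k' ∧ 2 * (k' : ℤ) = - δ := by
    intro k k' δ e hδ hk' hle
    have hk'n : k' + 1 < n := by
      by_contra h3
      have : n ≤ k' + 1 := by omega
      nlinarith
    have e1 : (n : ℤ) * (k - k') = 2 * k' + δ := by linarith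
    have hb : (0 : ℤ) ≤ 2 * k' + δ := by omega
    have hb2 : 2 * (k' : ℤ) + δ < 2 * n := by omega
    have h3 : (k : ℤ) - k' < 2 := by
      by_contra h4
      push Not at h4
      nlinarith
    have h5 : 0 ≤ (k : ℤ) - k' := by
      by_contra h4
      push Not at h4
      nlinarith
    have h6 : (k : ℤ) - k' = 0 ∨ (k : ℤ) - k' = 1 := by omega
    rcases h6 with h6 | h6
    · rw [h6] at e1
      exact ⟨by omega, by omega⟩
    · rw [h6] at e1
      exfalso
      apply hodd
      omega
  have hm2 : 2 ≤ m := by omega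
  rcases h with ⟨k, hk⟩ | ⟨k, hk⟩ <;> rcases h' with ⟨k', hk'⟩ | ⟨k', hk'⟩
  · have h0 : 0 < k' := Nat.pos_of_ne_zero (by rintro rfl; omega)
    obtain ⟨h1, h3⟩ := key k k' 0 (by zify [show 1 ≤ m by omega] at hk hk'; linarith) (by simp) h0 (by omega)
    omega
  · have h0 : 0 < k' := Nat.pos_of_ne_zero (by rintro rfl; omega)
    obtain ⟨h1, h3⟩ := key k k' (-2) (by zify [show 1 ≤ m by omega] at hk hk'; linarith) (by simp) h0 (by omega)
    have h4 : k' = 1 := by omega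
    rw [h1, h4] at hk
    omega
  · have h0 : 0 < k' := Nat.pos_of_ne_zero (by rintro rfl; omega)
    obtain ⟨h1, h3⟩ := key k k' 2 (by zify [show 1 ≤ m by omega] at hk hk'; linarith) (by simp) h0 (by omega)
    omega
  · have h0 : 0 < k' := Nat.pos_of_ne_zero (by rintro rfl; omega)
    obtain ⟨h1, h3⟩ := key k k' 0 (by zify at hk hk'; linarith) (by simp) h0 (by omega)
    omega

end EC

namespace EC

lemma card_dvd_dvd_le {a b W : ℕ} (hW : a.Coprime W) (hW' : b.Coprime W) (hab : a.Coprime b) (t e e' : ℤ) (J : ℕ) :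
    ((Finset.range J).filter fun j : ℕ => (a : ℤ) ∣ t + j * W + e ∧ (b : ℤ) ∣ t + j * W + e').card ≤
      J / (a * b) + 1 := by
  rw [← Finset.card_range (J / (a * b) + 1)]
  apply Finset.card_le_card_of_injOn (fun j => j / (a * b))
  · intro j hj
    simp only [Finset.coe_filter, Finset.mem_range, Set.mem_ofPred_eq] at hj
    simp only [Finset.coe_range, Set.mem_Iio]
    exact Nat.lt_succ_of_le (Nat.div_le_div_right hj.1.le)
  · intro j hj k hk hjk
    simp only [Finset.coe_filter, Finset.mem_range, Set.mem_ofPred_eq] at hj hk hjk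
    have key : ∀ (a : ℕ) (e : ℤ), a.Coprime W → (a : ℤ) ∣ t + j * W + e → (a : ℤ) ∣ t + k * W + e →
        k ≡ j [MOD a] := by
      intro a e hW h1 h2
      have h : (a : ℤ) ∣ (j - k) * W := by
        have := dvd_sub h1 h2
        rwa [show (t + j * W + e - (t + k * W + e) : ℤ) = (j - k) * W by ring] at this
      exact Nat.modEq_iff_dvd.2 ((Nat.isCoprime_iff_coprime.2 hW).dvd_of_dvd_mul_right h)
    have h3 : k % (a * b) = j % (a * b) := (Nat.modEq_and_modEq_iff_modEq_mul hab).1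
      ⟨key a e hW hj.2.1 hk.2.1, key b e' hW' hj.2.2 hk.2.2⟩
    rw [← Nat.div_add_mod j (a * b), ← Nat.div_add_mod k (a * b), hjk, h3]

open Classical in
lemma card_not_condN_le {W t z J : ℕ} (ht : W ∣ t) (hW2 : 2 ∣ W) (hz : ∀ q, q.Prime → q < z → q ∣ W) :
    ((((Finset.range J).filter fun j => 0 < t + j * W ∧ ¬ CondN (t + j * W)).card : ℕ) : ℝ) ≤
      4 * J * ∑ n ∈ (Finset.range (Nat.sqrt (t + J * W + 1) + 1)).filter (fun n => z ≤ n), 1 / (n : ℝ) ^ 2 +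
        4 * (Nat.sqrt (t + J * W + 1) + 1) := by
  set R := Nat.sqrt (t + J * W + 1) + 1 with hR
  have hWm : ∀ j, W ∣ t + j * W := fun j => dvd_add ht (Dvd.intro_left _ rfl)
  let S : ℕ → Finset ℕ := fun n => (Finset.range J).filter fun j =>
    0 < t + j * W ∧ 1 < n ∧ Nbr (t + j * W) n ∧ Nbr (t + j * W) (n + 2)
  have hsub : ((Finset.range J).filter fun j => 0 < t + j * W ∧ ¬ CondN (t + j * W)) ⊆
      (Finset.range R).biUnion S := by
    intro j hj
    rw [Finset.mem_filter, Finset.mem_range] at hj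
    obtain ⟨hj, h0, h1⟩ := hj
    unfold CondN at h1
    push Not at h1
    obtain ⟨n, hn, hne, h2, h3⟩ := h1
    rw [Finset.mem_biUnion]
    refine ⟨n, ?_, Finset.mem_filter.2 ⟨Finset.mem_range.2 hj, h0, hn, h2, h3⟩⟩
    have := sq_le_of_nbr h0 (hW2.trans (hWm j)) hn hne h2 h3
    have h4 : j * W ≤ J * W := Nat.mul_le_mul_right _ hj.le
    rw [Finset.mem_range, hR, Nat.lt_succ_iff, Nat.le_sqrt]
    omega
  have hS : ∀ n, ((S n).card : ℝ) ≤ (if z ≤ n then 4 * J * (1 / (n : ℝ) ^ 2) else 0) + 4 := by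
    intro n
    rcases Finset.eq_empty_or_nonempty (S n) with he | ⟨j, hj⟩
    · rw [he, Finset.card_empty, Nat.cast_zero]
      split_ifs <;> positivity
    rw [Finset.mem_filter] at hj
    obtain ⟨-, h0, h1, h2, h3⟩ := hj
    rw [if_pos (h2.le_of_rough h0 (hWm j) h1 hz)]
    have hc := h2.coprime h0 (hWm j)
    have hc' := h3.coprime h0 (hWm j)
    have hcc : n.Coprime (n + 2) := by
      rw [Nat.coprime_self_add_right]
      exact Nat.Coprime.coprime_dvd_right hW2 hc
    let U : ℤ → ℤ → Finset ℕ := fun e e' => (Finset.range J).filter fun j : ℕ =>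
      (n : ℤ) ∣ t + j * W + e ∧ ((n + 2 : ℕ) : ℤ) ∣ t + j * W + e'
    have hU : ∀ e e', (U e e').card ≤ J / (n * (n + 2)) + 1 := fun e e' => card_dvd_dvd_le hc hc' hcc t e e' J
    have hSU : S n ⊆ (U (-1) (-1) ∪ U (-1) 1) ∪ (U 1 (-1) ∪ U 1 1) := by
      intro i hi
      rw [Finset.mem_filter] at hi
      obtain ⟨h, h0, -, h4, h5⟩ := hi
      have key : ∀ a : ℕ, Nbr (t + i * W) a → (a : ℤ) ∣ t + i * W + (-1) ∨ (a : ℤ) ∣ t + i * W + 1 := by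
        intro a ha
        rcases ha with ha | ha
        · left
          have := Int.natCast_dvd_natCast.2 ha
          rw [Nat.cast_sub h0] at this
          push_cast at this
          exact this
        · right
          have := Int.natCast_dvd_natCast.2 ha
          push_cast at this
          exact this
      simp only [Finset.mem_union, U, Finset.mem_filter]
      have k1 := key _ h4
      have k2 := key _ h5
      tauto
    have h6 : (S n).card ≤ 4 * (J / (n * (n + 2)) + 1) := by
      refine (Finset.card_le_card hSU).trans ((Finset.card_union_le _ _).trans ?_)
      have a1 := Finset.card_union_le (U (-1) (-1)) (U (-1) 1)
      have a2 := Finset.card_union_le (U 1 (-1)) (U 1 1)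
      have b1 := hU (-1) (-1)
      have b2 := hU (-1) 1
      have b3 := hU 1 (-1)
      have b4 := hU 1 1
      omega
    have h7 : ((J / (n * (n + 2)) : ℕ) : ℝ) ≤ J * (1 / (n : ℝ) ^ 2) := by
      have hn' : (0 : ℝ) < n := by exact_mod_cast (by omega : 0 < n)
      calc ((J / (n * (n + 2)) : ℕ) : ℝ) ≤ (J : ℝ) / ((n * (n + 2) : ℕ) : ℝ) := Nat.cast_div_le
        _ ≤ J / (n : ℝ) ^ 2 := by
          gcongr; push_cast; nlinarith
        _ = _ := by ring
    calc ((S n).card : ℝ) ≤ ((4 * (J / (n * (n + 2)) + 1) : ℕ) : ℝ) := by exact_mod_cast h6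
      _ ≤ _ := by push_cast; linarith
  calc _ ≤ (((Finset.range R).biUnion S).card : ℝ) := by exact_mod_cast Finset.card_le_card hsub
    _ ≤ ∑ n ∈ Finset.range R, ((S n).card : ℝ) := by exact_mod_cast Finset.card_biUnion_le
    _ ≤ ∑ n ∈ Finset.range R, ((if z ≤ n then 4 * J * (1 / (n : ℝ) ^ 2) else 0) + 4) :=
        Finset.sum_le_sum fun n _ => hS n
    _ = _ := by
        rw [Finset.sum_add_distrib, ← Finset.sum_filter, Finset.mul_sum, Finset.sum_const, Finset.card_range,
          nsmul_eq_mul, hR]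
        push_cast; ring

/-- A sum of nonnegative terms over a range is bounded by a constant plus a small multiple of the length. -/
lemma exists_sum_wt_le {ε : ℝ} (hε : 0 < ε) : ∃ C : ℝ, 0 ≤ C ∧ ∀ Y : ℕ, ∑ a ∈ Finset.range Y, wt a ≤ C + ε * Y := by
  obtain ⟨M, hM⟩ := exists_tail_le summable_wt hε
  refine ⟨∑ a ∈ Finset.range (M + 1), wt a, Finset.sum_nonneg fun a _ => wt_nonneg a, fun Y => ?_⟩
  rw [← Finset.sum_filter_add_sum_filter_not (Finset.range Y) (fun a => a < M + 1)]
  refine add_le_add ?_ ?_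
  · refine Finset.sum_le_sum_of_subset_of_nonneg ?_ (fun a _ _ => wt_nonneg a)
    intro a ha
    rw [Finset.mem_filter] at ha
    exact Finset.mem_range.2 ha.2
  · calc ∑ a ∈ (Finset.range Y).filter (fun a => ¬ a < M + 1), wt a
        ≤ ∑ a ∈ (Finset.range Y).filter (fun a => ¬ a < M + 1), wt a / a * Y := by
          refine Finset.sum_le_sum fun a ha => ?_
          rw [Finset.mem_filter, Finset.mem_range] at ha
          have ha0 : (0 : ℝ) < a := by exact_mod_cast (by omega : 0 < a)
          have haY : (a : ℝ) ≤ Y := by exact_mod_cast ha.1.le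
          calc wt a = wt a / a * a := by field_simp
            _ ≤ wt a / a * Y := mul_le_mul_of_nonneg_left haY (div_nonneg (wt_nonneg a) ha0.le)
      _ ≤ ε * Y := by
          rw [← Finset.sum_mul]
          refine mul_le_mul_of_nonneg_right (hM _ fun n hn => ?_) (by positivity)
          rw [Finset.mem_filter] at hn
          omega

theorem exists_choice {N₀ : ℕ} (hN : 0 < N₀) {g : ℚ} (hg : 3000 ≤ g) (z : ℕ) :
    ∃ m : ℕ, 0 < m ∧ N₀ * z.factorial ∣ m ∧ Tgt g (m • P) ∧ CondP m ∧ CondA m ∧ CondN m := by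
  classical
  obtain ⟨K, hK⟩ := density_tgt hg
  obtain ⟨ε, hε⟩ : ∃ ε : ℝ, ε = 1 / (24 * (K + 1)) := ⟨_, rfl⟩
  have hε0 : 0 < ε := by rw [hε]; positivity
  obtain ⟨M₁, hM₁⟩ := exists_tail_le summable_wt hε0
  have hsq : Summable fun n : ℕ => 1 / (n : ℝ) ^ 2 := Real.summable_one_div_nat_pow.2 one_lt_two
  obtain ⟨M₂, hM₂⟩ := exists_tail_le hsq hε0
  obtain ⟨z', hz'⟩ : ∃ z', z' = z + M₁ + M₂ + 2 := ⟨_, rfl⟩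
  obtain ⟨W, hW⟩ : ∃ W, W = N₀ * z'.factorial := ⟨_, rfl⟩
  have hW0 : 0 < W := by rw [hW]; exact mul_pos hN (Nat.factorial_pos _)
  have hzW : ∀ q, q.Prime → q < z' → q ∣ W := fun q hq h => by
    rw [hW]; exact Dvd.dvd.mul_left (Nat.dvd_factorial hq.pos h.le) _
  have hW2 : 2 ∣ W := by rw [hW]; exact Dvd.dvd.mul_left (Nat.dvd_factorial two_pos (by omega)) _
  have hzW' : N₀ * z.factorial ∣ W := by
    rw [hW]; exact Nat.mul_dvd_mul_left _ (Nat.factorial_dvd_factorial (by omega))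
  obtain ⟨t, ht, hJ⟩ := hK W hW0
  by_contra hcon
  push Not at hcon
  obtain ⟨δ, hδ⟩ : ∃ δ : ℝ, δ = ε / W := ⟨_, rfl⟩
  have hWr : (0 : ℝ) < W := by exact_mod_cast hW0
  have hδ0 : 0 < δ := by rw [hδ]; positivity
  have hδW : δ * W = ε := by rw [hδ]; field_simp
  obtain ⟨C, hC0, hC⟩ := exists_sum_wt_le hδ0
  have hWm : ∀ j, W ∣ t + j * W := fun j => dvd_add ht (Dvd.intro_left _ rfl)
  have main : ∀ J : ℕ, (J : ℝ) ≤ (K + 1) * (12 * ε * J + (2 * C + 4 * δ * (t + 2) + 2 / δ + 5)) := by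
    intro J
    have hsub : (Finset.range J).filter (fun j => Tgt g ((t + j * W) • P)) ⊆
        {0} ∪ (((Finset.range J).filter fun j => 0 < t + j * W ∧ ¬ CondN (t + j * W)) ∪
          ((Finset.range J).filter fun j => 0 < t + j * W ∧ 1 < pen (t + j * W))) := by
      intro j hj
      rw [Finset.mem_filter] at hj
      simp only [Finset.mem_union, Finset.mem_singleton, Finset.mem_filter]
      rcases Nat.eq_zero_or_pos (t + j * W) with h0 | h0
      · left
        have : j * W = 0 := by omega
        exact (Nat.mul_eq_zero.1 this).resolve_right hW0.ne'
      · right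
        by_cases hp : 1 < pen (t + j * W)
        · exact Or.inr ⟨hj.1, h0, hp⟩
        · left
          have h2 : 2 ≤ t + j * W := Nat.le_of_dvd h0 (hW2.trans (hWm j))
          push Not at hp
          exact ⟨hj.1, h0, hcon _ h0 (hzW'.trans (hWm j)) hj.2 (condP_of_pen h2 hp) (condA_of_pen h2 hp)⟩
    have h1 := (hJ J).trans (Nat.mul_le_mul_left K (Finset.card_le_card hsub))
    have h2 := Finset.card_union_le {0} (((Finset.range J).filter fun j => 0 < t + j * W ∧ ¬ CondN (t + j * W)) ∪
          ((Finset.range J).filter fun j => 0 < t + j * W ∧ 1 < pen (t + j * W)))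
    have h3 := Finset.card_union_le ((Finset.range J).filter fun j => 0 < t + j * W ∧ ¬ CondN (t + j * W))
          ((Finset.range J).filter fun j => 0 < t + j * W ∧ 1 < pen (t + j * W))
    rw [Finset.card_singleton] at h2
    have hB := card_not_condN_le (J := J) ht hW2 hzW
    have hP := sum_pen_le (J := J) ht hzW
    have hP' : (((Finset.range J).filter fun j => 0 < t + j * W ∧ 1 < pen (t + j * W)).card : ℝ) ≤
        ∑ j ∈ (Finset.range J).filter (fun j => 0 < t + j * W), pen (t + j * W) := by
      rw [← Finset.filter_filter, ← nsmul_one, ← Finset.sum_const]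
      refine (Finset.sum_le_sum fun j hj => (Finset.mem_filter.1 hj).2.le).trans ?_
      refine Finset.sum_le_sum_of_subset_of_nonneg (Finset.filter_subset _ _) fun j _ _ => ?_
      exact Finset.sum_nonneg fun a _ => wt_nonneg a
    have hT1 := hM₁ ((Finset.range (t + J * W + 2)).filter (fun a => z' ≤ a)) (fun n hn => by
      rw [Finset.mem_filter] at hn; omega)
    have hT2 := hM₂ ((Finset.range (Nat.sqrt (t + J * W + 1) + 1)).filter (fun n => z' ≤ n)) (fun n hn => by
      rw [Finset.mem_filter] at hn; omega)
    have hS := hC (t + J * W + 2)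
    push_cast at hS
    have hR : (Nat.sqrt (t + J * W + 1) : ℝ) ≤ δ * (t + J * W + 1) / 2 + 1 / (2 * δ) := by
      have h4 : ((Nat.sqrt (t + J * W + 1) : ℕ) : ℝ) ^ 2 ≤ t + J * W + 1 := by
        exact_mod_cast Nat.sqrt_le' (t + J * W + 1)
      set r : ℝ := (Nat.sqrt (t + J * W + 1) : ℝ)
      have h5 : 0 ≤ (δ * r - 1) ^ 2 := sq_nonneg _
      have h6 : 2 * δ * r ≤ δ ^ 2 * (t + J * W + 1) + 1 := by
        have := mul_le_mul_of_nonneg_left h4 (sq_nonneg δ)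
        linarith
      calc r = 2 * δ * r / (2 * δ) := by field_simp
        _ ≤ (δ ^ 2 * (t + J * W + 1) + 1) / (2 * δ) := by gcongr
        _ = _ := by field_simp
    have hJ0 : (0 : ℝ) ≤ J := by positivity
    have hK0 : (0 : ℝ) ≤ K := by positivity
    have e1 := mul_le_mul_of_nonneg_left hT1 (by positivity : (0 : ℝ) ≤ 2 * J)
    have e2 := mul_le_mul_of_nonneg_left hT2 (by positivity : (0 : ℝ) ≤ 4 * J)
    have e3 : δ * (J * W) = ε * J := by rw [← hδW]; ring
    have e4 : (1 : ℝ) / (2 * δ) = 1 / δ / 2 := by field_simp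
    have e5 : (2 : ℝ) / δ = 2 * (1 / δ) := by ring
    have ht0 : (0 : ℝ) ≤ δ * t := by positivity
    have htot : (1 : ℝ) + (((Finset.range J).filter fun j => 0 < t + j * W ∧ ¬ CondN (t + j * W)).card +
        ((Finset.range J).filter fun j => 0 < t + j * W ∧ 1 < pen (t + j * W)).card) ≤
        12 * ε * J + (2 * C + 4 * δ * (t + 2) + 2 / δ + 5) := by
      rw [e4] at hR
      rw [e5]
      have f1 : δ * (t + J * W + 1) = δ * t + ε * J + δ := by rw [← e3]; ring
      have f2 : δ * (t + J * W + 2) = δ * t + ε * J + 2 * δ := by rw [← e3]; ring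
      have f3 : 0 ≤ ε * J := by positivity
      rw [f1] at hR
      rw [f2] at hS
      linarith
    have h4 : (J : ℝ) ≤ K * (1 + (((Finset.range J).filter fun j => 0 < t + j * W ∧ ¬ CondN (t + j * W)).card +
        ((Finset.range J).filter fun j => 0 < t + j * W ∧ 1 < pen (t + j * W)).card)) := by
      have h5 := h1.trans (Nat.mul_le_mul_left K (h2.trans (Nat.add_le_add_left h3 1)))
      exact_mod_cast h5
    refine h4.trans ((mul_le_mul_of_nonneg_left htot hK0).trans ?_)
    have : 0 ≤ 12 * ε * J + (2 * C + 4 * δ * (t + 2) + 2 / δ + 5) := by positivity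
    linarith
  obtain ⟨J, hJ⟩ := exists_nat_gt (2 * ((K + 1) * (2 * C + 4 * δ * (t + 2) + 2 / δ + 5)))
  have h1 := main J
  have h2 : ((K : ℝ) + 1) * (12 * ε * J) = J / 2 := by rw [hε]; field_simp; ring
  rw [mul_add, h2] at h1
  linarith

end EC

namespace EC

/-- An integer `N` with `N E(ℚ)` contained in the multiples of `P`. -/
noncomputable def N₁ : ℕ := exists_nsmul_mem.choose

lemma N₁_pos : 0 < N₁ := exists_nsmul_mem.choose_spec.1
lemma N₁_spec (A : Q) : ∃ m : ℤ, N₁ • A = m • P := exists_nsmul_mem.choose_spec.2 A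

noncomputable def N₀ : ℕ := N₁ * (101).factorial

lemma N₀_pos : 0 < N₀ := mul_pos N₁_pos (Nat.factorial_pos _)

/-- The target value of `x - 25 / x` at the `i`-th chosen multiple of `P`. -/
def gi (i : ℕ) : ℚ := (60 * (2 * i + 1)) ^ 2

lemma gi_ge (i : ℕ) : 3000 ≤ gi i := by
  unfold gi
  have : (0 : ℚ) ≤ i := by positivity
  nlinarith

def Ok (i z m : ℕ) : Prop :=
  0 < m ∧ N₀ * z.factorial ∣ m ∧ Tgt (gi i) (m • P) ∧ CondP m ∧ CondA m ∧ CondN m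

/-- The least admissible multiple for the `i`-th target all of whose neighbours are `z`-rough. -/
noncomputable def nextM (i z : ℕ) : ℕ := sInf {m | Ok i z m}

lemma nextM_ok (i z : ℕ) : Ok i z (nextM i z) :=
  Nat.sInf_mem (s := {m | Ok i z m}) (exists_choice N₀_pos (gi_ge i) z)

noncomputable def zs : ℕ → ℕ
  | 0 => 101
  | i + 1 => nextM i (zs i) + 4

noncomputable def ms (i : ℕ) : ℕ := nextM i (zs i)

lemma ms_ok (i : ℕ) : Ok i (zs i) (ms i) := nextM_ok _ _

lemma zs_succ (i : ℕ) : zs (i + 1) = ms i + 4 := rfl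

lemma zs_le_ms (i : ℕ) : zs i ≤ ms i := by
  obtain ⟨h0, h1, -⟩ := ms_ok i
  exact (Nat.self_le_factorial _).trans (Nat.le_of_dvd h0 (dvd_trans (Dvd.intro_left _ rfl) h1))

lemma zs_mono : StrictMono zs := strictMono_nat_of_lt_succ fun i => by
  rw [zs_succ]; have := zs_le_ms i; omega

lemma le_zs (i : ℕ) : 101 ≤ zs i := zs_mono.monotone (Nat.zero_le i)

lemma ms_add_lt_zs {i j : ℕ} (h : i < j) : ms i + 3 < zs j := by
  have : zs (i + 1) ≤ zs j := zs_mono.monotone h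
  rw [zs_succ] at this; omega

lemma two_le_ms (i : ℕ) : 2 ≤ ms i := by
  have := zs_le_ms i; have := le_zs i; omega

lemma factorial_dvd_ms (i : ℕ) : (zs i).factorial ∣ ms i := dvd_trans (Dvd.intro_left _ rfl) (ms_ok i).2.1

lemma zs_le_of_nbr {i a : ℕ} (h : Nbr (ms i) a) (ha : 1 < a) : zs i ≤ a := by
  refine h.le_of_rough (by have := two_le_ms i; omega) (factorial_dvd_ms i) ha fun q hq hlt => ?_
  exact Nat.dvd_factorial hq.pos hlt.le

/-- Divisors of the neighbours of the chosen multiples. -/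
def IsU (a : ℕ) : Prop := ∃ i, Nbr (ms i) a

def T₁ : Set ℕ := {p | p.Prime ∧ (p ≤ 5 ∨ IsU (ord p))}

/-- `a` is minimal for divisibility among the rough odd numbers which divide no chosen neighbour. -/
def Blocking (a : ℕ) : Prop := (∀ q, q.Prime → q ∣ a → 101 ≤ q) ∧ ¬ IsU a ∧ ∀ b, b ∣ a → b ≠ a → IsU b

def T₂ : Set ℕ := {p | p.Prime ∧ 5 < p ∧ Blocking (ord p) ∧ ∀ p' < p, p'.Prime → 5 < p' → ord p' ≠ ord p}

lemma T₁_inter_T₂ : T₁ ∩ T₂ = ∅ := by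
  ext p
  simp only [T₁, T₂, Set.mem_inter_iff, Set.mem_ofPred_eq, Set.mem_empty_iff_false, iff_false]
  rintro ⟨⟨-, h⟩, -, h5, hb, -⟩
  rcases h with h | h
  · omega
  · exact hb.2.1 h

lemma isU_one : IsU 1 := ⟨0, Or.inl (one_dvd _)⟩

lemma isU_of_dn {S : Set ℕ} (hS : S ∩ T₂ = ∅) {n : ℕ} (hn : n ≠ 0)
    (hr : ∀ q, q.Prime → q ∣ n → 101 ≤ q) (h : ∀ p, p.Prime → p ∣ dn n → p ∈ S) : IsU n := by
  classical
  by_contra hU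
  have hex : ∃ a, a ∣ n ∧ ¬ IsU a := ⟨n, dvd_rfl, hU⟩
  obtain ⟨ha, haU⟩ := Nat.find_spec hex
  set a := Nat.find hex with hadef
  have hmin : ∀ b, b ∣ a → b ≠ a → IsU b := by
    intro b hb hne
    have hlt : b < a := lt_of_le_of_ne (Nat.le_of_dvd (Nat.pos_of_ne_zero (by
      intro h0; rw [h0] at ha; exact hn (zero_dvd_iff.1 ha))) hb) hne
    have := Nat.find_min hex hlt
    by_contra h'
    exact this ⟨hb.trans ha, h'⟩
  have ha1 : 1 < a := by
    rcases Nat.lt_or_ge 1 a with h1 | h1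
    · exact h1
    · exfalso
      interval_cases h2 : a
      · exact hn (zero_dvd_iff.1 ha)
      · exact haU isU_one
  have har : ∀ q, q.Prime → q ∣ a → 101 ≤ q := fun q hq hqa => hr q hq (hqa.trans ha)
  have hp := exists_prime_ord_eq ha1 har
  obtain ⟨p1, p5, p3⟩ := Nat.find_spec hp
  have hT : Nat.find hp ∈ T₂ := by
    refine ⟨p1, p5, ?_, ?_⟩
    · rw [p3]; exact ⟨har, haU, hmin⟩
    · intro p' hlt h1 h2 h3
      exact Nat.find_min hp hlt ⟨h1, h2, h3.trans p3⟩
  have hpS := h _ p1 ((dvd_dn_iff p1 p5 hn).2 (by rw [p3]; exact ha))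
  exact Set.eq_empty_iff_forall_notMem.1 hS _ ⟨hpS, hT⟩

theorem eq_ms_of_survives {S : Set ℕ} (hS : S ∩ T₂ = ∅) {m : ℕ} (hm : 0 < m) (hdvd : (101).factorial ∣ m)
    (h1 : ∀ p, p.Prime → p ∣ dn (m - 1) → p ∈ S) (h2 : ∀ p, p.Prime → p ∣ dn (m + 1) → p ∈ S) :
    ∃ i, m = ms i := by
  have hm2 : 4 ≤ m := by
    have h4 : 4 ∣ (101).factorial := Nat.dvd_factorial (by norm_num) (by norm_num)
    exact Nat.le_of_dvd hm (h4.trans hdvd)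
  have rough : ∀ n, Nbr m n → ∀ q, q.Prime → q ∣ n → 101 ≤ q := by
    intro n hn q hq hqn
    have : Nbr m q := hn.imp hqn.trans hqn.trans
    exact this.le_of_rough hm hdvd hq.one_lt fun q' hq' hlt => Nat.dvd_factorial hq'.pos hlt.le
  have n1 : Nbr m (m - 1) := Or.inl dvd_rfl
  have n2 : Nbr m (m + 1) := Or.inr dvd_rfl
  obtain ⟨i, hi⟩ := isU_of_dn hS (by omega) (rough _ n1) h1
  obtain ⟨j, hj⟩ := isU_of_dn hS (by omega) (rough _ n2) h2
  have l1 := hi.le (two_le_ms i)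
  have l2 := hj.le (two_le_ms j)
  have z1 := zs_le_of_nbr hi (by omega)
  have z2 := zs_le_of_nbr hj (by omega)
  rcases lt_trichotomy i j with h | h | h
  · have := ms_add_lt_zs h
    omega
  · subst h
    refine ⟨i, ?_⟩
    by_contra hne
    refine (ms_ok i).2.2.2.2.2 (m - 1) (by omega) (by have := two_le_ms i; omega) hi ?_
    rwa [show m - 1 + 2 = m + 1 by omega]
  · have := ms_add_lt_zs h
    omega

lemma mem_T₁_of_dvd {i p n : ℕ} (hp : p.Prime) (hn : n = ms i - 1 ∨ n = ms i + 1) (h : p ∣ dn n) : p ∈ T₁ := by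
  refine ⟨hp, ?_⟩
  rcases Nat.lt_or_ge 5 p with h5 | h5
  · right
    have hn0 : n ≠ 0 := by have := two_le_ms i; omega
    have := (dvd_dn_iff hp h5 hn0).1 h
    rcases hn with rfl | rfl
    · exact ⟨i, Or.inl this⟩
    · exact ⟨i, Or.inr this⟩
  · exact Or.inl h5

lemma dvd_ms (i : ℕ) : N₀ ∣ ms i := (Dvd.intro _ rfl).trans (ms_ok i).2.1

lemma tgt_ms (i : ℕ) : Tgt (gi i) (ms i • P) := (ms_ok i).2.2.1

end EC

lemma card_primesUpTo_univ (X : ℕ) : (primesUpTo Set.univ X).card = Nat.primeCounting X := by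
  rw [Nat.primeCounting, Nat.primeCounting', Nat.count_eq_card_filter_range]
  congr 1
  ext p
  simp [primesUpTo]

lemma eventually_log_pow_mul_rpow_le {r : ℝ} (hr : r < 1) (k : ℕ) (C : ℝ) {ε : ℝ} (hε : 0 < ε) :
    ∀ᶠ X : ℕ in Filter.atTop, C * (Real.log X ^ k * (X : ℝ) ^ r) ≤ ε * (X / Real.log X) := by
  have h0 : 0 < |C| + 1 := by positivity
  have h := ((isLittleO_log_rpow_rpow_atTop (k + 1 : ℝ) (sub_pos.2 hr)).comp_tendsto
    (tendsto_natCast_atTop_atTop (R := ℝ))).bound (div_pos hε h0)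
  filter_upwards [h, Filter.eventually_ge_atTop 3] with X hX h3
  have hX0 : (3 : ℝ) ≤ X := by exact_mod_cast h3
  have hl : 0 < Real.log X := Real.log_pos (by linarith)
  have hXp : (0 : ℝ) < X := by linarith
  simp only [Function.comp] at hX
  rw [Real.norm_of_nonneg (by positivity), Real.norm_of_nonneg (by positivity)] at hX
  have e1 : Real.log X ^ (k + 1 : ℝ) = Real.log X ^ k * Real.log X := by
    rw [← pow_succ, ← Real.rpow_natCast]; push_cast; rfl
  have e2 : (X : ℝ) ^ (1 - r) * (X : ℝ) ^ r = X := by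
    rw [← Real.rpow_add hXp]; norm_num
  rw [e1] at hX
  rw [← mul_div_assoc, le_div_iff₀ hl]
  calc C * (Real.log X ^ k * (X : ℝ) ^ r) * Real.log X
      ≤ (|C| + 1) * (Real.log X ^ k * (X : ℝ) ^ r) * Real.log X := by
        gcongr; linarith [le_abs_self C]
    _ = (|C| + 1) * (Real.log X ^ k * Real.log X) * (X : ℝ) ^ r := by ring
    _ ≤ (|C| + 1) * (ε / (|C| + 1) * (X : ℝ) ^ (1 - r)) * (X : ℝ) ^ r := by gcongr
    _ = ε * ((X : ℝ) ^ (1 - r) * (X : ℝ) ^ r) := by field_simp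
    _ = ε * X := by rw [e2]

lemma eventually_const_le (C : ℝ) {ε : ℝ} (hε : 0 < ε) :
    ∀ᶠ X : ℕ in Filter.atTop, C ≤ ε * (X / Real.log X) := by
  have := eventually_log_pow_mul_rpow_le zero_lt_one 0 C hε
  simpa using this

lemma eventually_le_primeCounting :
    ∀ᶠ X : ℕ in Filter.atTop, (1 / 3) * ((X : ℝ) / Real.log X) ≤ Nat.primeCounting X := by
  have h := eventually_log_pow_mul_rpow_le zero_lt_one 1 2 (ε := 1 / 3) (by norm_num)
  filter_upwards [h, Filter.eventually_ge_atTop 3] with X hX h3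
  have hX0 : (3 : ℝ) ≤ X := by exact_mod_cast h3
  have h2 := Chebyshev.pi_ge X
  refine le_trans ?_ h2
  have hl : 0 < Real.log X := Real.log_pos (by linarith)
  have hl1 : 1 ≤ Real.log X := by
    rw [Real.le_log_iff_exp_le (by linarith)]
    exact Real.exp_one_lt_d9.le.trans (by linarith)
  rw [← mul_div_assoc]
  apply div_le_div_of_nonneg_right _ hl.le
  have h5 : Real.log (X + 1) ≤ 2 * Real.log X := by
    rw [← Real.log_rpow (by linarith)]
    apply Real.log_le_log (by linarith)
    norm_num; nlinarith
  have h4 := Real.log_two_gt_d9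
  rw [pow_one, Real.rpow_zero, mul_one, ← mul_div_assoc, le_div_iff₀ hl] at hX
  have h6 : 2 * Real.log X * 1 ≤ 2 * Real.log X * Real.log X := by gcongr
  nlinarith

theorem hasNatDensity_zero {T : Set ℕ}
    (h : ∀ ε : ℝ, 0 < ε → ∀ᶠ X : ℕ in Filter.atTop, ((primesUpTo T X).card : ℝ) ≤ ε * (X / Real.log X)) :
    HasNatDensity T 0 := by
  unfold HasNatDensity
  rw [Metric.tendsto_nhds]
  intro ε hε
  filter_upwards [h (ε / 4) (by positivity), eventually_le_primeCounting, Filter.eventually_ge_atTop 3] with X h1 h2 h3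
  have hX0 : (3 : ℝ) ≤ X := by exact_mod_cast h3
  have hl : 0 < Real.log X := Real.log_pos (by linarith)
  have hXl : 0 < (X : ℝ) / Real.log X := by positivity
  rw [Real.dist_eq, sub_zero, abs_of_nonneg (by positivity), card_primesUpTo_univ,
    div_lt_iff₀ (by linarith)]
  nlinarith

lemma eventually_natLog_le : ∀ᶠ X : ℕ in Filter.atTop, ((Nat.log 2 (2 * X + 1) : ℝ) + 1) ≤ 3 * Real.log X := by
  filter_upwards [Filter.eventually_ge_atTop 27] with X h3
  have hX0 : (27 : ℝ) ≤ X := by exact_mod_cast h3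
  have h2 := Real.log_two_gt_d9
  have h1 := Real.natLog_le_logb (2 * X + 1) 2
  have hl2 : 3 * 1 ≤ Real.log X := by
    have : Real.exp (3 * 1) ≤ (X : ℝ) := by
      rw [mul_one]
      have : Real.exp 3 = Real.exp 1 ^ 3 := by rw [← Real.exp_nat_mul]; norm_num
      rw [this]
      calc Real.exp 1 ^ 3 ≤ 3 ^ 3 := by gcongr; exact Real.exp_one_lt_three.le
        _ ≤ (X : ℝ) := by norm_num; linarith
    rwa [Real.le_log_iff_exp_le (by linarith)]
  have h4 : Real.logb 2 (2 * X + 1 : ℕ) ≤ (4 / 3 * Real.log X) / Real.log 2 := by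
    unfold Real.logb
    push_cast
    gcongr
    rw [← Real.log_rpow (by linarith)]
    apply Real.log_le_log (by positivity)
    calc (2 * X + 1 : ℝ) ≤ 3 * X := by linarith
      _ ≤ (X : ℝ) ^ (1 / 3 : ℝ) * X := by
        gcongr
        calc (3 : ℝ) = (27 : ℝ) ^ (1 / 3 : ℝ) := by
              rw [show (27 : ℝ) = 3 ^ (3 : ℝ) by norm_num, ← Real.rpow_mul (by norm_num)]; norm_num
          _ ≤ _ := by gcongr
      _ = (X : ℝ) ^ (4 / 3 : ℝ) := by
        nth_rw 2 [← Real.rpow_one (X : ℝ)]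
        rw [← Real.rpow_add (by linarith)]; norm_num
  have h5 : (4 / 3 * Real.log X) / Real.log 2 ≤ 2 * Real.log X := by
    rw [div_le_iff₀ (by linarith)]
    nlinarith
  have h6 : (Nat.log 2 (2 * X + 1) : ℝ) ≤ Real.logb 2 (2 * X + 1 : ℕ) := by exact_mod_cast h1
  linarith

namespace EC

lemma pow_le_zs (i : ℕ) : 2 ^ i ≤ zs i := by
  induction i with
  | zero => simp [zs]
  | succ i ih =>
    rw [zs_succ, pow_succ]
    have h1 : (zs i).factorial ≤ ms i := Nat.le_of_dvd (by have := two_le_ms i; omega) (factorial_dvd_ms i)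
    have h2 : zs i * (zs i - 1) ≤ (zs i).factorial := by
      obtain ⟨k, hk⟩ : ∃ k, zs i = k + 2 := ⟨zs i - 2, by have := le_zs i; omega⟩
      rw [hk, Nat.factorial_succ]
      exact Nat.mul_le_mul_left _ (Nat.self_le_factorial _)
    have h3 : zs i * 2 ≤ zs i * (zs i - 1) := Nat.mul_le_mul_left _ (by have := le_zs i; omega)
    omega

lemma lt_log_of_zs_le {i Y : ℕ} (h : zs i ≤ Y) : i < Nat.log 2 Y + 1 := by
  have h1 := (pow_le_zs i).trans h
  exact Nat.lt_succ_of_le (Nat.le_log_of_pow_le one_lt_two h1)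

open Classical in
lemma card_T₁_le (X : ℕ) : ((primesUpTo T₁ X).card : ℝ) ≤
    6 + ((Nat.log 2 (2 * X + 1) : ℝ) + 1) * (X : ℝ) ^ (7 / 8 : ℝ) := by
  let S : ℕ → Finset ℕ := fun i => (Finset.range (X + 1)).filter fun p => p.Prime ∧ 5 < p ∧ Nbr (ms i) (ord p)
  have hsub : primesUpTo T₁ X ⊆ Finset.range 6 ∪ (Finset.range (Nat.log 2 (2 * X + 1) + 1)).biUnion S := by
    intro p hp
    rw [primesUpTo, Finset.mem_filter] at hp
    obtain ⟨hX, hp, -, h⟩ := hp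
    rw [Finset.mem_union, Finset.mem_range, Finset.mem_biUnion]
    rcases Nat.lt_or_ge 5 p with h5 | h5
    · right
      obtain ⟨i, hi⟩ := h.resolve_left (by omega)
      rw [Finset.mem_range] at hX
      refine ⟨i, ?_, Finset.mem_filter.2 ⟨Finset.mem_range.2 hX, hp, h5, hi⟩⟩
      rw [Finset.mem_range]
      apply lt_log_of_zs_le
      have h1 := zs_le_of_nbr hi (prime_dvd_dn_one hp h5)
      have h2 := ord_le hp h5
      omega
    · left; omega
  have hS : ∀ i, ((S i).card : ℝ) ≤ (X : ℝ) ^ (7 / 8 : ℝ) := by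
    intro i
    have h1 := (ms_ok i).2.2.2.1 X
    have h2 : ((S i).card : ℝ) ^ 8 ≤ (X : ℝ) ^ 7 := by
      have h3 : (S i).card = ((Finset.range (X + 1)).filter fun p => p.Prime ∧ 5 < p ∧ Nbr (ms i) (ord p)).card := by
        congr!
      rw [h3]; exact_mod_cast h1
    calc ((S i).card : ℝ) = (((S i).card : ℝ) ^ 8) ^ (1 / 8 : ℝ) := by
          rw [← Real.rpow_natCast, ← Real.rpow_mul (by positivity)]; norm_num
      _ ≤ ((X : ℝ) ^ 7) ^ (1 / 8 : ℝ) := by gcongr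
      _ = _ := by rw [← Real.rpow_natCast, ← Real.rpow_mul (by positivity)]; norm_num
  calc ((primesUpTo T₁ X).card : ℝ) ≤
        ((Finset.range 6 ∪ (Finset.range (Nat.log 2 (2 * X + 1) + 1)).biUnion S).card : ℝ) := by
        exact_mod_cast Finset.card_le_card hsub
    _ ≤ ((6 + ∑ i ∈ Finset.range (Nat.log 2 (2 * X + 1) + 1), (S i).card : ℕ) : ℝ) := by
        refine Nat.cast_le.2 ((Finset.card_union_le _ _).trans ?_)
        rw [Finset.card_range]
        exact Nat.add_le_add_left Finset.card_biUnion_le _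
    _ ≤ 6 + ∑ i ∈ Finset.range (Nat.log 2 (2 * X + 1) + 1), (X : ℝ) ^ (7 / 8 : ℝ) := by
        push_cast
        gcongr
        exact hS _
    _ = _ := by rw [Finset.sum_const, Finset.card_range, nsmul_eq_mul]; push_cast; ring

theorem hasNatDensity_T₁ : HasNatDensity T₁ 0 := by
  refine hasNatDensity_zero fun ε hε => ?_
  filter_upwards [eventually_natLog_le, eventually_const_le 6 (half_pos hε),
    eventually_log_pow_mul_rpow_le (r := 7 / 8) (by norm_num) 1 3 (half_pos hε)] with X h1 h2 h3
  refine (card_T₁_le X).trans ?_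
  have : ((Nat.log 2 (2 * X + 1) : ℝ) + 1) * (X : ℝ) ^ (7 / 8 : ℝ) ≤ 3 * Real.log X * (X : ℝ) ^ (7 / 8 : ℝ) := by
    gcongr
  rw [pow_one] at h3
  linarith

open Classical in
lemma card_isU_le (Y : ℕ) : (((Finset.range (Y + 1)).filter fun a => 1 < a ∧ IsU a).card : ℝ) ≤
    ((Nat.log 2 Y : ℝ) + 1) * (Y : ℝ) ^ (1 / 4 : ℝ) := by
  let S : ℕ → Finset ℕ := fun i => (Finset.range (Y + 1)).filter fun a => 1 < a ∧ Nbr (ms i) a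
  have hsub : ((Finset.range (Y + 1)).filter fun a => 1 < a ∧ IsU a) ⊆
      (Finset.range (Nat.log 2 Y + 1)).biUnion S := by
    intro a ha
    rw [Finset.mem_filter] at ha
    obtain ⟨hY, h1, i, hi⟩ := ha
    rw [Finset.mem_biUnion]
    refine ⟨i, ?_, Finset.mem_filter.2 ⟨hY, h1, hi⟩⟩
    rw [Finset.mem_range] at hY ⊢
    apply lt_log_of_zs_le
    have h1 := zs_le_of_nbr hi h1
    omega
  have hS : ∀ i, ((S i).card : ℝ) ≤ (Y : ℝ) ^ (1 / 4 : ℝ) := by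
    intro i
    have h1 := (ms_ok i).2.2.2.2.1 Y
    have h2 : ((S i).card : ℝ) ^ 4 ≤ (Y : ℝ) := by
      have h3 : (S i).card = ((Finset.range (Y + 1)).filter fun a => 1 < a ∧ Nbr (ms i) a).card := by
        congr!
      rw [h3]; exact_mod_cast h1
    calc ((S i).card : ℝ) = (((S i).card : ℝ) ^ 4) ^ (1 / 4 : ℝ) := by
          rw [← Real.rpow_natCast, ← Real.rpow_mul (by positivity)]; norm_num
      _ ≤ (Y : ℝ) ^ (1 / 4 : ℝ) := by gcongr
  calc _ ≤ (((Finset.range (Nat.log 2 Y + 1)).biUnion S).card : ℝ) := by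
        exact_mod_cast Finset.card_le_card hsub
    _ ≤ ((∑ i ∈ Finset.range (Nat.log 2 Y + 1), (S i).card : ℕ) : ℝ) :=
        Nat.cast_le.2 Finset.card_biUnion_le
    _ ≤ ∑ i ∈ Finset.range (Nat.log 2 Y + 1), (Y : ℝ) ^ (1 / 4 : ℝ) := by
        push_cast
        gcongr
        exact hS _
    _ = _ := by rw [Finset.sum_const, Finset.card_range, nsmul_eq_mul]; push_cast; ring

lemma ord_injOn_T₂ : Set.InjOn ord T₂ := by
  intro p hp q hq h
  rcases lt_trichotomy p q with h1 | h1 | h1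
  · exact absurd h (hq.2.2.2 p h1 hp.1 hp.2.1)
  · exact h1
  · exact absurd h.symm (hp.2.2.2 q h1 hq.1 hq.2.1)

open Classical in
lemma card_T₂_composite_le (X : ℕ) : ((primesUpTo {p | p ∈ T₂ ∧ ¬ (ord p).Prime} X).card : ℝ) ≤
    (((Nat.log 2 (2 * X + 1) : ℝ) + 1) * ((2 * X + 1 : ℕ) : ℝ) ^ (1 / 4 : ℝ)) ^ 2 := by
  set D := (Finset.range (2 * X + 1 + 1)).filter fun a => 1 < a ∧ IsU a with hD
  have h1 : (primesUpTo {p | p ∈ T₂ ∧ ¬ (ord p).Prime} X).card ≤ (D ×ˢ D).card := by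
    refine Finset.card_le_card_of_injOn (fun p => ((ord p).minFac, ord p / (ord p).minFac)) ?_ ?_
    · intro p hp
      simp only [primesUpTo, Finset.coe_filter, Finset.mem_range, Set.mem_ofPred_eq] at hp
      obtain ⟨hX, hp, ⟨-, h5, hB, -⟩, hnp⟩ := hp
      have hle := ord_le hp h5
      have h1 := prime_dvd_dn_one hp h5
      have hmp : (ord p).minFac.Prime := Nat.minFac_prime (by omega)
      have hmul := Nat.mul_div_cancel' (Nat.minFac_dvd (ord p))
      have hne : (ord p).minFac ≠ ord p := fun h => hnp (h ▸ hmp)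
      have h2 := hmp.two_le
      have h3 : 1 < ord p / (ord p).minFac := by
        by_contra hc
        interval_cases h : ord p / (ord p).minFac <;> omega
      have hml : (ord p).minFac ≤ ord p := Nat.minFac_le (by omega)
      have hdl : ord p / (ord p).minFac ≤ ord p := Nat.div_le_self _ _
      simp only [Finset.coe_product, Set.mem_prod, Finset.mem_coe, hD, Finset.mem_filter, Finset.mem_range]
      refine ⟨⟨by omega, hmp.one_lt, hB.2.2 _ (Nat.minFac_dvd _) hne⟩, by omega, h3,
        hB.2.2 _ (Nat.div_dvd_of_dvd (Nat.minFac_dvd _)) ?_⟩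
      intro h
      rw [h] at hmul
      have : 2 * ord p ≤ (ord p).minFac * ord p := Nat.mul_le_mul_right _ h2
      omega
    · intro p hp q hq h
      simp only [primesUpTo, Finset.coe_filter, Finset.mem_range, Set.mem_ofPred_eq] at hp hq
      refine ord_injOn_T₂ hp.2.2.1 hq.2.2.1 ?_
      simp only [Prod.mk.injEq] at h
      rw [← Nat.mul_div_cancel' (Nat.minFac_dvd (ord p)), ← Nat.mul_div_cancel' (Nat.minFac_dvd (ord q)), h.2, h.1]
  rw [Finset.card_product, ← pow_two] at h1
  have h2 := card_isU_le (2 * X + 1)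
  calc _ ≤ ((D.card ^ 2 : ℕ) : ℝ) := by exact_mod_cast h1
    _ = (D.card : ℝ) ^ 2 := by push_cast; rfl
    _ ≤ _ := by gcongr

lemma eventually_T₂_composite {ε : ℝ} (hε : 0 < ε) : ∀ᶠ X : ℕ in Filter.atTop,
    ((primesUpTo {p | p ∈ T₂ ∧ ¬ (ord p).Prime} X).card : ℝ) ≤ ε * (X / Real.log X) := by
  filter_upwards [eventually_natLog_le, Filter.eventually_ge_atTop 27,
    eventually_log_pow_mul_rpow_le (r := 1 / 2) (by norm_num) 2 27 hε] with X h1 h2 h3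
  refine (card_T₂_composite_le X).trans (le_trans ?_ h3)
  have hX0 : (27 : ℝ) ≤ X := by exact_mod_cast h2
  rw [mul_pow]
  have e1 : (((2 * X + 1 : ℕ) : ℝ) ^ (1 / 4 : ℝ)) ^ 2 ≤ 3 * (X : ℝ) ^ (1 / 2 : ℝ) := by
    rw [← Real.rpow_natCast, ← Real.rpow_mul (by positivity)]
    calc ((2 * X + 1 : ℕ) : ℝ) ^ (1 / 4 * ((2 : ℕ) : ℝ)) ≤ (9 * X : ℝ) ^ (1 / 2 : ℝ) := by
          norm_num
          gcongr
          linarith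
      _ = _ := by
        rw [Real.mul_rpow (by norm_num) (by positivity)]
        congr 1
        rw [show (9 : ℝ) = 3 ^ (2 : ℝ) by norm_num, ← Real.rpow_mul (by norm_num)]; norm_num
  have e2 : ((Nat.log 2 (2 * X + 1) : ℝ) + 1) ^ 2 ≤ (3 * Real.log X) ^ 2 := by gcongr
  calc _ ≤ (3 * Real.log X) ^ 2 * (3 * (X : ℝ) ^ (1 / 2 : ℝ)) := by gcongr
    _ = _ := by ring

end EC

lemma Equiv.mulLeft₀_coe {G : Type*} [GroupWithZero G] (a : G) (ha : a ≠ 0) (x : G) : Equiv.mulLeft₀ a ha x = a * x := rfl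

open Finset in
lemma quadraticChar_sum_mul_shift {F : Type*} [Field F] [Fintype F] [DecidableEq F] (hF : ringChar F ≠ 2) (c : F) :
    ∑ x : F, quadraticChar F x * quadraticChar F (x + c) = if c = 0 then (Fintype.card F : ℤ) - 1 else -1 := by
  set χ := quadraticChar F with hχ
  split_ifs with hc
  · subst hc
    have : ∀ x : F, χ x * χ (x + 0) = if x = 0 then 0 else 1 := by
      intro x
      split_ifs with h
      · simp [h, hχ]
      · rw [add_zero, ← pow_two]; exact quadraticChar_sq_one h
    rw [sum_congr rfl fun x _ => this x, sum_ite, sum_const_zero, zero_add, sum_const, nsmul_eq_mul, mul_one,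
      filter_ne' univ (0 : F), card_erase_of_mem (mem_univ _), card_univ,
      Nat.cast_sub Fintype.card_pos, Nat.cast_one]
  · have h1 := jacobiSum_nontrivial_inv (quadraticChar_ne_one hF)
    rw [(quadraticChar_isQuadratic (F := F)).inv, jacobiSum] at h1
    have h2 : ∑ x : F, χ x * χ (x + c) = ∑ x : F, χ (-1) * (χ x * χ (1 - x)) := by
      refine (Fintype.sum_equiv (Equiv.mulLeft₀ (-c) (neg_ne_zero.2 hc)) _ _ fun x => ?_).symm
      rw [Equiv.mulLeft₀_coe, show -c * x + c = c * (1 - x) by ring, show -c * x = -1 * (c * x) by ring,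
        map_mul, map_mul, map_mul]
      have := quadraticChar_sq_one hc
      linear_combination (-(χ (-1) * χ x * χ (1 - x))) * this
    rw [h2, ← mul_sum, h1]
    have := quadraticChar_sq_one (F := F) (neg_ne_zero.2 one_ne_zero)
    linear_combination -this

open Finset in
lemma sum_comp_sq {F : Type*} [Field F] [Fintype F] [DecidableEq F] (hF : ringChar F ≠ 2) (f : F → ℤ) :
    ∑ t : F, f (t ^ 2) = ∑ x : F, f x * (quadraticChar F x + 1) := by
  rw [← sum_fiberwise univ (fun t : F => t ^ 2)]
  refine sum_congr rfl fun x _ => ?_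
  rw [← quadraticChar_card_sqrts hF x]
  rw [sum_congr rfl (fun t ht => by rw [(mem_filter.1 ht).2] : ∀ t ∈ univ.filter (fun t : F => t ^ 2 = x), f (t ^ 2) = f x),
    sum_const, nsmul_eq_mul, mul_comm]
  congr 3
  ext t; simp

/-- The character sum of the curve `y² = x³ - Dx`. -/
def cubicSum (F : Type*) [Field F] [Fintype F] [DecidableEq F] (D : F) : ℤ :=
  ∑ x : F, quadraticChar F (x ^ 3 - D * x)

section
open Finset
variable {F : Type*} [Field F] [Fintype F] [DecidableEq F]

lemma cubicSum_mul_sq (D : F) {t : F} (ht : t ≠ 0) : cubicSum F (D * t ^ 2) = quadraticChar F t * cubicSum F D := by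
  rw [cubicSum, cubicSum, mul_sum]
  refine (Fintype.sum_equiv (Equiv.mulLeft₀ t ht) _ _ fun x => ?_).symm
  rw [Equiv.mulLeft₀_coe, show (t * x) ^ 3 - D * t ^ 2 * (t * x) = t * (t ^ 2 * (x ^ 3 - D * x)) by ring,
    map_mul, map_mul, quadraticChar_sq_one' ht, one_mul]

lemma cubicSum_zero (hF : ringChar F ≠ 2) : cubicSum F 0 = 0 := by
  rw [cubicSum, ← quadraticChar_sum_zero hF]
  refine sum_congr rfl fun x _ => ?_
  by_cases hx : x = 0
  · simp [hx]
  · rw [show x ^ 3 - 0 * x = x ^ 2 * x by ring, map_mul, quadraticChar_sq_one' hx, one_mul]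

lemma sum_cubicSum_sq (hF : ringChar F ≠ 2) (h1 : quadraticChar F (-1) = 1) :
    ∑ D : F, cubicSum F D ^ 2 = 2 * (Fintype.card F : ℤ) * (Fintype.card F - 1) := by
  have h2 : (2 : F) ≠ 0 := Ring.two_ne_zero hF
  set χ := quadraticChar F with hχ
  have e1 : ∀ D : F, cubicSum F D ^ 2 = ∑ x : F, ∑ y : F, χ (x * y) * (χ (D - x ^ 2) * χ (D - y ^ 2)) := by
    intro D
    rw [cubicSum, pow_two, sum_mul_sum]
    refine sum_congr rfl fun x _ => sum_congr rfl fun y _ => ?_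
    rw [← hχ, ← map_mul, ← map_mul, ← map_mul]
    congr 1; ring
  have e2 : ∀ x y : F, ∑ D : F, χ (D - x ^ 2) * χ (D - y ^ 2) =
      (if x ^ 2 - y ^ 2 = 0 then (Fintype.card F : ℤ) else 0) - 1 := by
    intro x y
    have := quadraticChar_sum_mul_shift hF (x ^ 2 - y ^ 2)
    rw [← Fintype.sum_equiv (Equiv.subRight (x ^ 2)) (fun D => χ (D - x ^ 2) * χ (D - y ^ 2)) _ (fun D => by
      rw [Equiv.subRight_apply]; congr 2; ring)] at this
    rw [this]
    split_ifs <;> ring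
  have e3 : ∀ x : F, ∑ y : F, χ (x * y) * (if x ^ 2 - y ^ 2 = 0 then (Fintype.card F : ℤ) else 0) =
      if x = 0 then 0 else 2 * (Fintype.card F : ℤ) := by
    intro x
    split_ifs with hx
    · simp [hx, hχ]
    · have hne : x ≠ -x := fun h => hx (by
        have : 2 * x = 0 := by linear_combination h
        exact (mul_eq_zero.1 this).resolve_left h2)
      have : ∀ y : F, χ (x * y) * (if x ^ 2 - y ^ 2 = 0 then (Fintype.card F : ℤ) else 0) =
          if y ∈ ({x, -x} : Finset F) then (Fintype.card F : ℤ) else 0 := by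
        intro y
        have hiff : x ^ 2 - y ^ 2 = 0 ↔ y ∈ ({x, -x} : Finset F) := by
          rw [sub_eq_zero, sq_eq_sq_iff_eq_or_eq_neg, mem_insert, mem_singleton, eq_comm (a := x) (b := y), eq_neg_iff_add_eq_zero,
            eq_neg_iff_add_eq_zero, add_comm x y]
        simp only [hiff]
        split_ifs with h
        · rw [mem_insert, mem_singleton] at h
          have : χ (x * y) = 1 := by
            rcases h with rfl | rfl
            · rw [← pow_two]; exact quadraticChar_sq_one' hx
            · rw [show x * -x = -1 * x ^ 2 by ring, map_mul, quadraticChar_sq_one' hx, h1, one_mul]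
          rw [this, one_mul]
        · rw [mul_zero]
      rw [sum_congr rfl fun y _ => this y, sum_ite_mem, univ_inter, sum_const, card_pair hne]
      simp
  have e4 : ∑ x : F, ∑ y : F, χ (x * y) = 0 := by
    simp_rw [map_mul, ← mul_sum]
    rw [quadraticChar_sum_zero hF]; simp
  rw [sum_congr rfl fun D _ => e1 D, sum_comm]
  rw [sum_congr rfl fun x _ => sum_comm]
  simp_rw [← mul_sum, e2, mul_sub, mul_one, sum_sub_distrib, e3]
  rw [e4, sub_zero, sum_ite, sum_const_zero, zero_add, sum_const, nsmul_eq_mul, filter_ne' univ (0 : F),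
    card_erase_of_mem (mem_univ _), card_univ, Nat.cast_sub Fintype.card_pos]
  push_cast; ring

lemma cubicSum_sq_add_sq (hF : ringChar F ≠ 2) (h1 : quadraticChar F (-1) = 1) {r : F} (hr : quadraticChar F r = -1) :
    cubicSum F 1 ^ 2 + cubicSum F r ^ 2 = 4 * Fintype.card F := by
  have hr0 : r ≠ 0 := by rintro rfl; simp at hr
  have a1 := sum_comp_sq hF fun D => cubicSum F D ^ 2
  have a2 := sum_comp_sq hF fun D => cubicSum F (r * D) ^ 2
  have a3 : ∑ x : F, cubicSum F (r * x) ^ 2 * (quadraticChar F x + 1) =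
      ∑ x : F, cubicSum F x ^ 2 * (1 - quadraticChar F x) := by
    refine Fintype.sum_equiv (Equiv.mulLeft₀ r hr0) _ _ fun x => ?_
    rw [Equiv.mulLeft₀_coe, map_mul, hr]; ring
  have a4 : ∀ D : F, ∑ t : F, cubicSum F (D * t ^ 2) ^ 2 = ((Fintype.card F : ℤ) - 1) * cubicSum F D ^ 2 := by
    intro D
    have : ∀ t : F, cubicSum F (D * t ^ 2) ^ 2 = if t = 0 then 0 else cubicSum F D ^ 2 := by
      intro t
      split_ifs with h
      · rw [h, show D * (0 : F) ^ 2 = 0 by ring, cubicSum_zero hF]; rfl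
      · rw [cubicSum_mul_sq D h, mul_pow, quadraticChar_sq_one h, one_mul]
    rw [sum_congr rfl fun t _ => this t, sum_ite, sum_const_zero, zero_add, sum_const, nsmul_eq_mul,
      filter_ne' univ (0 : F), card_erase_of_mem (mem_univ _), card_univ, Nat.cast_sub Fintype.card_pos, Nat.cast_one]
  have a5 := a4 1
  simp only [one_mul] at a5
  have a6 := sum_cubicSum_sq hF h1
  rw [a5] at a1
  rw [a4 r, a3] at a2
  have a7 : ((Fintype.card F : ℤ) - 1) * (cubicSum F 1 ^ 2 + cubicSum F r ^ 2) = ((Fintype.card F : ℤ) - 1) * (4 * Fintype.card F) := by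
    rw [mul_add, a1, a2, ← sum_add_distrib,
      sum_congr rfl fun x _ => (by ring : cubicSum F x ^ 2 * (quadraticChar F x + 1) + cubicSum F x ^ 2 * (1 - quadraticChar F x) = 2 * cubicSum F x ^ 2),
      ← mul_sum, a6]
    ring
  have hcard : (1 : ℤ) < Fintype.card F := by exact_mod_cast Fintype.one_lt_card
  exact mul_left_cancel₀ (by omega) a7

lemma card_affine_points (hF : ringChar F ≠ 2) (D : F) :
    ((univ.filter fun z : F × F => z.2 ^ 2 = z.1 ^ 3 - D * z.1).card : ℤ) = Fintype.card F + cubicSum F D := by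
  have : (univ.filter fun z : F × F => z.2 ^ 2 = z.1 ^ 3 - D * z.1).card =
      ∑ x : F, (univ.filter fun y : F => y ^ 2 = x ^ 3 - D * x).card := by
    simp_rw [card_filter]
    rw [Fintype.sum_prod_type]
  rw [this, Nat.cast_sum, cubicSum, Fintype.card, card_eq_sum_ones, Nat.cast_sum, ← sum_add_distrib]
  refine sum_congr rfl fun x _ => ?_
  rw [← add_comm (quadraticChar F _), Nat.cast_one, ← quadraticChar_card_sqrts hF]
  congr 2
  ext t; simp

end

/-- The number of points of `y² = x³ - 25x` modulo `p ≡ 1 (mod 4)` in terms of a representation of `p` as a sum of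
two squares. -/
theorem EC.exists_sq_add_sq {p : ℕ} [Fact p.Prime] (hp : 5 < p) (h4 : p % 4 = 1) :
    ∃ a b : ℤ, a ^ 2 + b ^ 2 = p ∧ (a + 1) ^ 2 + b ^ 2 = Nat.card (EC (ZMod p)).Point := by
  have hF : ringChar (ZMod p) ≠ 2 := by rw [ZMod.ringChar_zmod_n]; omega
  have h1 : quadraticChar (ZMod p) (-1) = 1 := by
    rw [quadraticChar_neg_one hF, ZMod.card, ZMod.χ₄_nat_one_mod_four h4]
  obtain ⟨r, hr⟩ := quadraticChar_exists_neg_one hF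
  have h5 : (5 : ZMod p) ≠ 0 := by
    intro h
    have := (ZMod.natCast_eq_zero_iff 5 p).1 (by exact_mod_cast h)
    have := Nat.le_of_dvd (by norm_num) this
    omega
  have h2 := cubicSum_sq_add_sq hF h1 hr
  have h3 := cubicSum_mul_sq 1 h5
  have h6 := card_affine_points hF (25 : ZMod p)
  rw [show (1 : ZMod p) * 5 ^ 2 = 25 by norm_num] at h3
  have h7 : cubicSum (ZMod p) 25 ^ 2 + cubicSum (ZMod p) r ^ 2 = 4 * p := by
    rw [h3, mul_pow, quadraticChar_sq_one h5, one_mul, h2, ZMod.card]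
  obtain ⟨⟨a, ha⟩, b, hb⟩ : Even (cubicSum (ZMod p) 25) ∧ Even (cubicSum (ZMod p) r) := by
    have h8 : (cubicSum (ZMod p) 25 ^ 2 + cubicSum (ZMod p) r ^ 2) % 4 = 0 := by omega
    rcases Int.even_or_odd' (cubicSum (ZMod p) 25) with ⟨u, hu | hu⟩ <;>
      rcases Int.even_or_odd' (cubicSum (ZMod p) r) with ⟨v, hv | hv⟩ <;> rw [hu, hv] at h8 ⊢ <;> ring_nf at h8 <;>
      first
      | exact ⟨even_two_mul u, even_two_mul v⟩
      | omega
  refine ⟨a, b, ?_, ?_⟩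
  · rw [ha, hb] at h7; linarith
  · rw [EC.card_point hp]
    rw [ha, ZMod.card] at h6
    rw [ha, hb] at h7
    push_cast
    rw [h6]
    linarith

open Filter Topology in
lemma DirichletCharacter.hasSum_log_norm {N : ℕ} (χ : DirichletCharacter ℂ N) {s : ℂ} (hs : 1 < s.re) :
    HasSum (fun p : Nat.Primes => -Real.log ‖1 - χ p * (p : ℂ) ^ (-s)‖) (Real.log ‖LSeries (χ ·) s‖) := by
  have h := χ.summable_neg_log_one_sub_mul_prime_cpow hs
  have h1 := Complex.hasSum_re h.hasSum
  rw [← DirichletCharacter.LSeries_eulerProduct_exp_log χ hs, Complex.norm_exp, Real.log_exp]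
  refine h1.congr_fun ?_ |> fun h => h
  intro p
  simp [Complex.log_re]

lemma neg_log_one_sub_le {u : ℝ} (h0 : 0 ≤ u) (h1 : u ≤ 1 / 2) : -Real.log (1 - u) ≤ u + 2 * u ^ 2 := by
  have h := Real.one_sub_inv_le_log_of_pos (show 0 < 1 - u by linarith)
  have : (1 - u)⁻¹ ≤ 1 + u + 2 * u ^ 2 := by
    rw [inv_le_iff_one_le_mul₀ (by linarith)]
    nlinarith [mul_nonneg (mul_nonneg h0 h0) (show 0 ≤ 1 - 2 * u by linarith)]
  linarith

/-- The nontrivial Dirichlet character modulo `4`, with complex values. -/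
noncomputable def chi4 : DirichletCharacter ℂ 4 := ZMod.χ₄.ringHomComp (Int.castRingHom ℂ)

lemma chi4_natCast (n : ℕ) : chi4 n = ((ZMod.χ₄ n : ℤ) : ℂ) := rfl

lemma chi4_ne_one : chi4 ≠ 1 := by
  intro h
  have h1 : chi4 ((3 : ℕ) : ZMod 4) = 1 := by
    rw [h]
    exact MulChar.one_apply (by decide)
  rw [chi4_natCast, ZMod.χ₄_nat_three_mod_four (by norm_num)] at h1
  norm_num at h1

lemma log_factor_le {s : ℝ} (h1 : 1 < s) (p : Nat.Primes) :
    -Real.log ‖1 - (1 : DirichletCharacter ℂ 1) p * (p : ℂ) ^ (-(s : ℂ))‖ +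
      -Real.log ‖1 - chi4 p * (p : ℂ) ^ (-(s : ℂ))‖ ≤
    2 * (if (p : ℕ) % 4 = 1 then (p : ℝ) ^ (-s) else 0) + 6 * (p : ℝ) ^ (-(2 : ℝ)) := by
  have hp := p.2
  have hp2 : (2 : ℝ) ≤ (p : ℕ) := by exact_mod_cast hp.two_le
  set u := (p : ℝ) ^ (-s) with hu
  have hu0 : 0 < u := by positivity
  have hu1 : u ≤ 1 / 2 := by
    calc u ≤ (p : ℝ) ^ (-1 : ℝ) := by
          rw [hu]; exact Real.rpow_le_rpow_of_exponent_le (by linarith) (by linarith)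
      _ ≤ _ := by rw [Real.rpow_neg_one, one_div]; exact inv_anti₀ (by norm_num) hp2
  have hu2 : u ^ 2 ≤ (p : ℝ) ^ (-(2 : ℝ)) := by
    rw [hu, ← Real.rpow_natCast, ← Real.rpow_mul (by positivity)]
    exact Real.rpow_le_rpow_of_exponent_le (by linarith) (by push_cast; linarith)
  have hp0 : 0 ≤ (p : ℝ) ^ (-(2 : ℝ)) := by positivity
  have huc : (p : ℂ) ^ (-(s : ℂ)) = (u : ℂ) := by
    rw [hu, Complex.ofReal_cpow (by positivity)]; simp
  have e1 : (1 : DirichletCharacter ℂ 1) (p : ℕ) = 1 := MulChar.one_apply (isUnit_of_subsingleton _)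
  have e2 : ‖(1 : ℂ) - (u : ℂ)‖ = 1 - u := by
    rw [← Complex.ofReal_one, ← Complex.ofReal_sub, Complex.norm_real, Real.norm_of_nonneg (by linarith)]
  have e3 : ‖(1 : ℂ) - (-1) * (u : ℂ)‖ = 1 + u := by
    rw [show (1 : ℂ) - (-1) * (u : ℂ) = ((1 + u : ℝ) : ℂ) by push_cast; ring, Complex.norm_real,
      Real.norm_of_nonneg (by linarith)]
  have hl := neg_log_one_sub_le hu0.le hu1
  rw [huc, e1, one_mul, e2, chi4_natCast, ZMod.χ₄_nat_eq_if_mod_four]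
  by_cases hodd : (p : ℕ) % 2 = 0
  · rw [if_pos hodd, if_neg (by omega)]
    have hpe : (p : ℕ) = 2 := (hp.even_iff).1 (Nat.even_iff.2 hodd)
    simp only [Int.cast_zero, zero_mul, sub_zero, norm_one, Real.log_one, neg_zero, add_zero, mul_zero, zero_add]
    have h4 : ((p : ℕ) : ℝ) ^ (-(2 : ℝ)) = 1 / 4 := by
      rw [hpe, Real.rpow_neg (by norm_num)]; norm_num
    rw [h4] at hu2 ⊢
    linarith
  · rw [if_neg hodd]
    split_ifs with h
    · rw [Int.cast_one, one_mul, e2]; linarith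
    · rw [Int.cast_neg, Int.cast_one, e3]
      have h5 := neg_log_one_sub_le (u := u ^ 2) (by positivity) (by nlinarith)
      have h6 : Real.log (1 - u ^ 2) = Real.log (1 - u) + Real.log (1 + u) := by
        rw [← Real.log_mul (by linarith) (by linarith)]; congr 1; ring
      have h7 : (u ^ 2) ^ 2 ≤ u ^ 2 := pow_le_of_le_one (by positivity) (by nlinarith) two_ne_zero
      linarith

lemma summable_primes_rpow {s : ℝ} (hs : 1 < s) : Summable fun p : Nat.Primes => (p : ℝ) ^ (-s) :=
  Nat.Primes.summable_rpow.2 (by linarith)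

open Filter Topology in
lemma exists_log_le_tsum : ∃ C : ℝ, ∀ᶠ s : ℝ in 𝓝[>] 1,
    Real.log (1 / (s - 1)) ≤ 2 * ∑' p : Nat.Primes, (if (p : ℕ) % 4 = 1 then (p : ℝ) ^ (-s) else 0) + C := by
  have hcont : Tendsto (fun s : ℝ => ‖(DirichletCharacter.LFunction chi4 (s : ℂ))‖) (𝓝[>] 1)
      (𝓝 ‖DirichletCharacter.LFunction chi4 1‖) := by
    have h1 : Continuous fun s : ℝ => ‖DirichletCharacter.LFunction chi4 (s : ℂ)‖ :=
      ((DirichletCharacter.differentiable_LFunction chi4_ne_one).continuous.comp Complex.continuous_ofReal).norm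
    have := h1.tendsto 1
    rw [Complex.ofReal_one] at this
    exact this.mono_left nhdsWithin_le_nhds
  have hpos : 0 < ‖DirichletCharacter.LFunction chi4 1‖ :=
    norm_pos_iff.2 (DirichletCharacter.LFunction_apply_one_ne_zero chi4_ne_one)
  set c := ‖DirichletCharacter.LFunction chi4 1‖
  have hz := tendsto_sub_mul_tsum_nat_rpow
  refine ⟨-Real.log (1 / 2 * (c / 2)) + 6 * ∑' p : Nat.Primes, (p : ℝ) ^ (-(2 : ℝ)), ?_⟩
  filter_upwards [hcont.eventually_const_lt (half_lt_self hpos),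
    hz.eventually_const_lt (show (1 / 2 : ℝ) < 1 by norm_num), self_mem_nhdsWithin] with s h1 h2 h3
  have h3 : 1 < s := h3
  have hre : 1 < (s : ℂ).re := by simpa using h3
  have s1 := (1 : DirichletCharacter ℂ 1).hasSum_log_norm hre
  have s2 := chi4.hasSum_log_norm hre
  have hL : DirichletCharacter.LFunction chi4 (s : ℂ) = LSeries (chi4 ·) s := chi4.LFunction_eq_LSeries hre
  rw [hL] at h1
  have hZ : ‖LSeries ((1 : DirichletCharacter ℂ 1) ·) (s : ℂ)‖ = ∑' n : ℕ, 1 / (n : ℝ) ^ s := by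
    have : LSeries ((1 : DirichletCharacter ℂ 1) ·) (s : ℂ) = ((∑' n : ℕ, 1 / (n : ℝ) ^ s : ℝ) : ℂ) := by
      rw [Complex.ofReal_tsum]
      have hone : (fun n : ℕ => (1 : DirichletCharacter ℂ 1) n) = 1 := by
        ext n; exact MulChar.one_apply (isUnit_of_subsingleton _)
      rw [hone, LSeries_one_eq_riemannZeta hre, zeta_eq_tsum_one_div_nat_cpow hre]
      refine tsum_congr fun n => ?_
      rw [Complex.ofReal_div, Complex.ofReal_cpow (by positivity)]; simp
    rw [this, Complex.norm_real, Real.norm_of_nonneg (tsum_nonneg fun n => by positivity)]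
  rw [hZ] at s1
  set ζ := ∑' n : ℕ, 1 / (n : ℝ) ^ s
  have hs0 : 0 < s - 1 := by linarith
  have hζ : 0 < ζ := by
    by_contra hc
    push Not at hc
    nlinarith
  have hsum := (s1.add s2)
  have hub : Summable fun p : Nat.Primes =>
      2 * (if (p : ℕ) % 4 = 1 then (p : ℝ) ^ (-s) else 0) + 6 * (p : ℝ) ^ (-(2 : ℝ)) := by
    refine Summable.add (Summable.mul_left _ ?_) (Summable.mul_left _ (summable_primes_rpow one_lt_two))
    refine Summable.of_nonneg_of_le (fun p => ?_) (fun p => ?_) (summable_primes_rpow h3)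
    · split_ifs <;> positivity
    · split_ifs
      · exact le_rfl
      · positivity
  have hle := hasSum_le (fun p => log_factor_le h3 p) hsum hub.hasSum
  have hs1 : Summable fun p : Nat.Primes => (if (p : ℕ) % 4 = 1 then (p : ℝ) ^ (-s) else 0) := by
    refine Summable.of_nonneg_of_le (fun p => ?_) (fun p => ?_) (summable_primes_rpow h3)
    · split_ifs <;> positivity
    · split_ifs
      · exact le_rfl
      · positivity
  rw [Summable.tsum_add (hs1.mul_left 2) ((summable_primes_rpow one_lt_two).mul_left 6), tsum_mul_left, tsum_mul_left] at hle
  have hl1 : Real.log (1 / (s - 1)) + Real.log (1 / 2 * (c / 2)) ≤ Real.log ζ + Real.log ‖LSeries (chi4 ·) s‖ := by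
    rw [← Real.log_mul (by positivity) (by positivity), ← Real.log_mul hζ.ne' (by
      have : 0 < c / 2 := by positivity
      linarith)]
    apply Real.log_le_log (by positivity)
    calc 1 / (s - 1) * (1 / 2 * (c / 2)) = (1 / (s - 1) * (1 / 2)) * (c / 2) := by ring
      _ ≤ ζ * ‖LSeries (chi4 ·) s‖ := by
        refine mul_le_mul ?_ h1.le (by positivity) hζ.le
        rw [div_mul_eq_mul_div, div_le_iff₀ hs0]
        linarith
  linarith

/-- The primes `q ≡ 1 (mod 4)` with `K < q ≤ z`. -/
def primesOneModFour (K z : ℕ) : Finset ℕ := (Finset.range (z + 1)).filter fun q => q.Prime ∧ q % 4 = 1 ∧ K < q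

open Filter Topology in
lemma eventually_loglog_le_sum (K : ℕ) : ∀ᶠ z : ℕ in atTop,
    (2 / 5) * Real.log (Real.log z) ≤ ∑ q ∈ primesOneModFour K z, (1 : ℝ) / q := by
  obtain ⟨C, hC⟩ := exists_log_le_tsum
  have hlog : Tendsto (fun z : ℕ => Real.log z) atTop atTop := Real.tendsto_log_atTop.comp tendsto_natCast_atTop_atTop
  have hd : Tendsto (fun z : ℕ => Real.log z ^ (-(9 / 10 : ℝ))) atTop (𝓝 0) :=
    (tendsto_rpow_neg_atTop (by norm_num)).comp hlog
  have hpos : ∀ᶠ z : ℕ in atTop, 0 < Real.log z := hlog.eventually_gt_atTop 0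
  have hs : Tendsto (fun z : ℕ => 1 + Real.log z ^ (-(9 / 10 : ℝ))) atTop (𝓝[>] 1) := by
    refine tendsto_nhdsWithin_iff.2 ⟨by simpa using hd.const_add 1, ?_⟩
    filter_upwards [hpos] with z hz
    have := Real.rpow_pos_of_pos hz (-(9 / 10 : ℝ))
    simpa using this
  have hs2 : Tendsto (fun z : ℕ => 1 + Real.log z ^ (-(9 / 10 : ℝ)) / 2) atTop (𝓝[>] 1) := by
    refine tendsto_nhdsWithin_iff.2 ⟨by simpa using (hd.div_const 2).const_add 1, ?_⟩
    filter_upwards [hpos] with z hz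
    have := Real.rpow_pos_of_pos hz (-(9 / 10 : ℝ))
    simpa using this
  have hexp : Tendsto (fun z : ℕ => (Real.log z ^ (1 / 10 : ℝ)) ^ (9 : ℝ) * Real.exp (-(1 / 2) * Real.log z ^ (1 / 10 : ℝ)))
      atTop (𝓝 0) :=
    (tendsto_rpow_mul_exp_neg_mul_atTop_nhds_zero 9 (1 / 2) (by norm_num)).comp
      ((tendsto_rpow_atTop (by norm_num)).comp hlog)
  have hll : Tendsto (fun z : ℕ => Real.log (Real.log z)) atTop atTop := Real.tendsto_log_atTop.comp hlog
  filter_upwards [hs.eventually hC, hs2.eventually (tendsto_sub_mul_tsum_nat_rpow.eventually_lt_const (show (1 : ℝ) < 2 by norm_num)),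
    hexp.eventually_lt_const one_pos, hpos, eventually_gt_atTop 1,
    hll.eventually_ge_atTop ((K + 5 + C / 2) * 20)] with z h1 h2 h3 h4 h5 h6
  set t := Real.log z with ht
  set δ := t ^ (-(9 / 10 : ℝ)) with hδ
  have hδ0 : 0 < δ := Real.rpow_pos_of_pos h4 _
  have hz0 : (0 : ℝ) < z := by positivity
  have e1 : Real.log (1 / (1 + δ - 1)) = 9 / 10 * Real.log t := by
    rw [add_sub_cancel_left, one_div, Real.log_inv, hδ, Real.log_rpow h4]; ring
  rw [e1] at h1
  set G := ∑ q ∈ primesOneModFour K z, (1 : ℝ) / q with hG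
  have hsum2 : Summable fun n : ℕ => 1 / (n : ℝ) ^ (1 + δ / 2) :=
    Real.summable_one_div_nat_rpow.2 (by linarith)
  set Z := ∑' n : ℕ, 1 / (n : ℝ) ^ (1 + δ / 2) with hZ
  have hZ4 : Z * δ ≤ 4 := by
    have : (1 + δ / 2 - 1) * Z < 2 := h2
    linarith
  have htail : (z : ℝ) ^ (-(δ / 2)) * Z ≤ 4 := by
    have e2 : (z : ℝ) ^ (-(δ / 2)) = Real.exp (-(1 / 2) * t ^ (1 / 10 : ℝ)) := by
      rw [Real.rpow_def_of_pos hz0, ← ht]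
      congr 1
      have : t * δ = t ^ (1 / 10 : ℝ) := by
        rw [hδ]; nth_rw 1 [← Real.rpow_one t]
        rw [← Real.rpow_add h4]; norm_num
      linear_combination (-(1 / 2)) * this
    have e3 : (t ^ (1 / 10 : ℝ)) ^ (9 : ℝ) = 1 / δ := by
      rw [← Real.rpow_mul h4.le, hδ, Real.rpow_neg h4.le, one_div (_⁻¹), inv_inv]; norm_num
    rw [e3, ← e2] at h3
    have hz1 : 0 < (z : ℝ) ^ (-(δ / 2)) := by positivity
    rw [one_div_mul_eq_div, div_lt_one hδ0] at h3
    have hZ0 : 0 ≤ Z := tsum_nonneg fun n => by positivity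
    calc (z : ℝ) ^ (-(δ / 2)) * Z ≤ δ * Z := by gcongr
      _ ≤ 4 := by linarith
  have hle : ∑' p : Nat.Primes, (if (p : ℕ) % 4 = 1 then (p : ℝ) ^ (-(1 + δ)) else 0) ≤ G + K + 4 := by
    let F := primesOneModFour K z
    let g : ℕ → ℝ := fun n => (if n ∈ F ∪ Finset.Icc 1 K then (1 : ℝ) / n else 0) + (z : ℝ) ^ (-(δ / 2)) * (1 / (n : ℝ) ^ (1 + δ / 2))
    have hfin : HasSum (fun n : ℕ => if n ∈ F ∪ Finset.Icc 1 K then (1 : ℝ) / n else 0) (∑ n ∈ F ∪ Finset.Icc 1 K, (1 : ℝ) / n) := by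
      have := hasSum_sum_of_ne_finset_zero (f := fun n : ℕ => if n ∈ F ∪ Finset.Icc 1 K then (1 : ℝ) / n else 0)
        (s := F ∪ Finset.Icc 1 K) (fun n hn => if_neg hn) (L := SummationFilter.unconditional ℕ)
      rwa [Finset.sum_congr rfl (fun n hn => if_pos hn)] at this
    have hg : HasSum g (∑ n ∈ F ∪ Finset.Icc 1 K, (1 : ℝ) / n + (z : ℝ) ^ (-(δ / 2)) * Z) :=
      hfin.add (hsum2.hasSum.mul_left _)
    have hgn : ∀ n, 0 ≤ g n := fun n => by
      refine add_nonneg ?_ (by positivity)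
      split_ifs <;> positivity
    have hgp : Summable fun p : Nat.Primes => g p := hg.summable.subtype _
    have hcmp : ∀ p : Nat.Primes, (if (p : ℕ) % 4 = 1 then (p : ℝ) ^ (-(1 + δ)) else 0) ≤ g p := by
      intro p
      split_ifs with hp4
      · have hp := p.2
        have hp0 : (1 : ℝ) ≤ (p : ℕ) := by exact_mod_cast hp.one_le
        rcases le_or_gt (p : ℕ) z with hz | hz
        · have hm : (p : ℕ) ∈ F ∪ Finset.Icc 1 K := by
            rw [Finset.mem_union, Finset.mem_Icc]
            rcases le_or_gt (p : ℕ) K with hK | hK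
            · exact Or.inr ⟨hp.one_le, hK⟩
            · exact Or.inl (Finset.mem_filter.2 ⟨Finset.mem_range.2 (by omega), hp, hp4, hK⟩)
          have h7 : (p : ℝ) ^ (-(1 + δ)) ≤ 1 / (p : ℕ) := by
            rw [one_div, ← Real.rpow_neg_one]
            exact Real.rpow_le_rpow_of_exponent_le hp0 (by linarith)
          have h8 : 0 ≤ (z : ℝ) ^ (-(δ / 2)) * (1 / ((p : ℕ) : ℝ) ^ (1 + δ / 2)) := by positivity
          simp only [g, if_pos hm]
          linarith
        · have h8 : 0 ≤ (if (p : ℕ) ∈ F ∪ Finset.Icc 1 K then (1 : ℝ) / (p : ℕ) else 0) := by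
            split_ifs <;> positivity
          have h7 : (p : ℝ) ^ (-(1 + δ)) ≤ (z : ℝ) ^ (-(δ / 2)) * (1 / ((p : ℕ) : ℝ) ^ (1 + δ / 2)) := by
            rw [one_div, ← Real.rpow_neg (by positivity), show -(1 + δ) = -(δ / 2) + -(1 + δ / 2) by ring,
              Real.rpow_add (by positivity)]
            gcongr ?_ * _
            exact Real.rpow_le_rpow_of_nonpos hz0 (by exact_mod_cast hz.le) (by linarith)
          simp only [g]
          linarith
      · exact hgn p
    have hsp : Summable fun p : Nat.Primes => (if (p : ℕ) % 4 = 1 then (p : ℝ) ^ (-(1 + δ)) else 0) := by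
      refine Summable.of_nonneg_of_le (fun p => ?_) hcmp hgp
      split_ifs <;> positivity
    calc _ ≤ ∑' p : Nat.Primes, g p := Summable.tsum_le_tsum hcmp hsp hgp
      _ ≤ ∑' n, g n := Summable.tsum_subtype_le g _ hgn hg.summable
      _ = ∑ n ∈ F ∪ Finset.Icc 1 K, (1 : ℝ) / n + (z : ℝ) ^ (-(δ / 2)) * Z := hg.tsum_eq
      _ ≤ (G + K) + 4 := by
        refine add_le_add ?_ htail
        calc _ ≤ G + ∑ n ∈ Finset.Icc 1 K, (1 : ℝ) / n := by
              rw [← Finset.sum_union_inter]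
              exact le_add_of_nonneg_right (Finset.sum_nonneg fun n _ => by positivity)
          _ ≤ G + ∑ n ∈ Finset.Icc 1 K, 1 := by
              gcongr with n hn
              rw [Finset.mem_Icc] at hn
              rw [div_le_one (by exact_mod_cast hn.1)]
              exact_mod_cast hn.1
          _ = G + K := by simp
  linarith

section
open Finset

lemma sum_powerset_filter_card_le {β : Type*} [DecidableEq β] (T : Finset β) {r : ℕ} (hr : Even r) :
    (if T = ∅ then (1 : ℝ) else 0) ≤ ∑ s ∈ T.powerset with s.card ≤ r, (-1 : ℝ) ^ s.card := by
  have h1 : ∑ s ∈ T.powerset with s.card ≤ r, (-1 : ℝ) ^ s.card =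
      ∑ k ∈ range (r + 1), (-1 : ℝ) ^ k * T.card.choose k := by
    rw [← sum_fiberwise_of_maps_to (g := Finset.card) (t := range (r + 1))
      (fun s hs => by rw [mem_filter] at hs; exact mem_range.2 (by omega))]
    refine sum_congr rfl fun k hk => ?_
    rw [mem_range] at hk
    rw [sum_congr rfl (g := fun _ => (-1 : ℝ) ^ k) (fun s hs => by rw [(mem_filter.1 hs).2]), sum_const, nsmul_eq_mul, mul_comm,
      ← card_powersetCard]
    congr 3
    ext s
    simp only [mem_filter, mem_powerset, mem_powersetCard]
    constructor
    · rintro ⟨⟨h1, -⟩, h2⟩; exact ⟨h1, h2⟩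
    · rintro ⟨h1, h2⟩; exact ⟨⟨h1, by omega⟩, h2⟩
  rw [h1]
  split_ifs with hT
  · subst hT
    rw [sum_range_succ']
    simp
  · obtain ⟨n, hn⟩ : ∃ n, T.card = n + 1 := ⟨T.card - 1, by have := card_pos.2 (nonempty_iff_ne_empty.2 hT); omega⟩
    rw [hn]
    have := Int.alternating_sum_range_choose_eq_choose (n := n) (m := r)
    have h2 : ∑ k ∈ range (r + 1), (-1 : ℝ) ^ k * (n + 1).choose k = (-1) ^ r * n.choose r := by exact_mod_cast this
    rw [h2, hr.neg_one_pow]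
    positivity

/-- Brun's pure sieve. -/
theorem card_sifted_le {α β : Type*} [DecidableEq β] (B : Finset α) (Q : Finset β) (bad : β → α → Prop)
    [∀ q x, Decidable (bad q x)] (δ : β → ℝ) (h0 : ∀ q ∈ Q, 0 ≤ δ q) (h1 : ∀ q ∈ Q, δ q ≤ 1) {r : ℕ} (hr : Even r)
    {V E : ℝ} (hV : 0 ≤ V) (hE : 0 ≤ E)
    (hN : ∀ s ⊆ Q, s.card ≤ r → |((B.filter fun x => ∀ q ∈ s, bad q x).card : ℝ) - V * ∏ q ∈ s, δ q| ≤ E) :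
    ((B.filter fun x => ∀ q ∈ Q, ¬ bad q x).card : ℝ) ≤
      V * (Real.exp (-∑ q ∈ Q, δ q) + Real.exp (2 * ∑ q ∈ Q, δ q) / 2 ^ r) + E * (Q.card + 1) ^ r := by
  classical
  set PS := Q.powerset.filter fun s => s.card ≤ r with hPS
  have a1 : ((B.filter fun x => ∀ q ∈ Q, ¬ bad q x).card : ℝ) ≤
      ∑ s ∈ PS, (-1 : ℝ) ^ s.card * (B.filter fun x => ∀ q ∈ s, bad q x).card := by
    have : ∀ x ∈ B, (if ∀ q ∈ Q, ¬ bad q x then (1 : ℝ) else 0) ≤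
        ∑ s ∈ PS, (-1 : ℝ) ^ s.card * (if ∀ q ∈ s, bad q x then 1 else 0) := by
      intro x _
      have h := sum_powerset_filter_card_le (Q.filter fun q => bad q x) hr
      have e1 : (Q.filter fun q => bad q x) = ∅ ↔ ∀ q ∈ Q, ¬ bad q x := filter_eq_empty_iff
      simp only [e1] at h
      refine h.trans (le_of_eq ?_)
      simp_rw [mul_ite, mul_one, mul_zero]
      rw [← sum_filter, hPS, filter_filter]
      refine sum_congr ?_ fun _ _ => rfl
      ext s
      simp only [mem_filter, mem_powerset]
      constructor
      · rintro ⟨h1, h2⟩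
        exact ⟨fun q hq => (mem_filter.1 (h1 hq)).1, h2, fun q hq => (mem_filter.1 (h1 hq)).2⟩
      · rintro ⟨h1, h2, h3⟩
        exact ⟨fun q hq => mem_filter.2 ⟨h1 hq, h3 q hq⟩, h2⟩
    calc ((B.filter fun x => ∀ q ∈ Q, ¬ bad q x).card : ℝ) = ∑ x ∈ B, (if ∀ q ∈ Q, ¬ bad q x then (1 : ℝ) else 0) := by
          rw [card_filter]; push_cast; rfl
      _ ≤ ∑ x ∈ B, ∑ s ∈ PS, (-1 : ℝ) ^ s.card * (if ∀ q ∈ s, bad q x then 1 else 0) := sum_le_sum this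
      _ = _ := by
        rw [sum_comm]
        refine sum_congr rfl fun s _ => ?_
        rw [← mul_sum, card_filter]; push_cast; rfl
  have a2 : ∀ s ∈ PS, (-1 : ℝ) ^ s.card * (B.filter fun x => ∀ q ∈ s, bad q x).card ≤
      V * ((-1 : ℝ) ^ s.card * ∏ q ∈ s, δ q) + E := by
    intro s hs
    rw [hPS, mem_filter, mem_powerset] at hs
    have h := abs_le.1 (hN s hs.1 hs.2)
    rcases neg_one_pow_eq_or ℝ s.card with h3 | h3 <;> rw [h3] <;> linarith [h.1, h.2]
  have a3 : (PS.card : ℝ) ≤ (Q.card + 1) ^ r := by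
    have h3 : PS ⊆ (Fintype.piFinset fun _ : Fin r => insertNone Q).image
        fun f => (univ.image f).eraseNone := by
      intro s hs
      rw [hPS, mem_filter, mem_powerset] at hs
      rw [mem_image]
      let e := s.equivFin
      refine ⟨fun i => if h : (i : ℕ) < s.card then some (e.symm ⟨i, h⟩ : β) else none, ?_, ?_⟩
      · rw [Fintype.mem_piFinset]
        intro i
        split_ifs with h
        · rw [some_mem_insertNone]; exact hs.1 (e.symm ⟨i, h⟩).2
        · exact none_mem_insertNone
      · ext q
        rw [mem_eraseNone, mem_image]
        constructor
        · rintro ⟨i, -, hi⟩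
          split_ifs at hi with h
          rw [← Option.some.inj hi]; exact (e.symm ⟨i, h⟩).2
        · intro hq
          refine ⟨⟨e ⟨q, hq⟩, lt_of_lt_of_le (e ⟨q, hq⟩).2 hs.2⟩, mem_univ _, ?_⟩
          simp
    have := (card_le_card h3).trans card_image_le
    rw [Fintype.card_piFinset, prod_const, card_insertNone, card_univ, Fintype.card_fin] at this
    exact_mod_cast this
  have a4 : ∑ s ∈ PS, (-1 : ℝ) ^ s.card * ∏ q ∈ s, δ q ≤
      Real.exp (-∑ q ∈ Q, δ q) + Real.exp (2 * ∑ q ∈ Q, δ q) / 2 ^ r := by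
    have b1 : ∏ q ∈ Q, (1 - δ q) = ∑ s ∈ Q.powerset, (-1 : ℝ) ^ s.card * ∏ q ∈ s, δ q := by
      simp_rw [sub_eq_add_neg]
      rw [prod_one_add]
      refine sum_congr rfl fun s _ => ?_
      rw [prod_neg]
    have b2 : ∏ q ∈ Q, (1 - δ q) ≤ Real.exp (-∑ q ∈ Q, δ q) := by
      rw [← sum_neg_distrib, Real.exp_sum]
      refine prod_le_prod (fun q hq => by linarith [h1 q hq]) fun q _ => ?_
      linarith [Real.add_one_le_exp (-δ q)]
    have b3 : ∏ q ∈ Q, (1 + 2 * δ q) ≤ Real.exp (2 * ∑ q ∈ Q, δ q) := by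
      rw [mul_sum, Real.exp_sum]
      refine prod_le_prod (fun q hq => by linarith [h0 q hq]) fun q _ => ?_
      linarith [Real.add_one_le_exp (2 * δ q)]
    rw [prod_one_add] at b3
    have b4 := sum_filter_add_sum_filter_not Q.powerset (fun s => s.card ≤ r) fun s => (-1 : ℝ) ^ s.card * ∏ q ∈ s, δ q
    have b5 : -∑ s ∈ Q.powerset with ¬ s.card ≤ r, (-1 : ℝ) ^ s.card * ∏ q ∈ s, δ q ≤
        (∑ s ∈ Q.powerset, ∏ q ∈ s, (2 * δ q)) / 2 ^ r := by
      rw [sum_div, ← sum_neg_distrib]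
      refine (sum_le_sum (g := fun s => (∏ q ∈ s, (2 * δ q)) / 2 ^ r) fun s hs => ?_).trans
        (sum_le_sum_of_subset_of_nonneg (filter_subset _ _) fun s hs _ => ?_)
      · rw [mem_filter, mem_powerset] at hs
        have hp : 0 ≤ ∏ q ∈ s, δ q := prod_nonneg fun q hq => h0 q (hs.1 hq)
        rw [le_div_iff₀ (by positivity), prod_mul_distrib, prod_const]
        have h5 : (2 : ℝ) ^ r ≤ 2 ^ s.card := pow_le_pow_right₀ one_le_two (by omega)
        rcases neg_one_pow_eq_or ℝ s.card with h3 | h3 <;> rw [h3] <;> nlinarith [pow_pos (zero_lt_two' ℝ) r]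
      · rw [mem_powerset] at hs
        exact div_nonneg (prod_nonneg fun q hq => by linarith [h0 q (hs hq)]) (by positivity)
    have b6 : (∑ s ∈ Q.powerset, ∏ q ∈ s, (2 * δ q)) / 2 ^ r ≤ Real.exp (2 * ∑ q ∈ Q, δ q) / 2 ^ r := by gcongr
    rw [← hPS] at b4
    linarith
  calc _ ≤ _ := a1
    _ ≤ ∑ s ∈ PS, (V * ((-1 : ℝ) ^ s.card * ∏ q ∈ s, δ q) + E) := sum_le_sum a2
    _ = V * ∑ s ∈ PS, (-1 : ℝ) ^ s.card * ∏ q ∈ s, δ q + E * PS.card := by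
      rw [sum_add_distrib, ← mul_sum, sum_const, nsmul_eq_mul, mul_comm (PS.card : ℝ)]
    _ ≤ _ := by gcongr

end

section

open Finset

/-- The pairs `(a, b)` for which `q` divides one of the two norms `a² + b²`, `(a + 1)² + b²`. -/
def BadAt (q : ℕ) (x : ℤ × ℤ) : Prop := (q : ℤ) ∣ x.1 ^ 2 + x.2 ^ 2 ∨ (q : ℤ) ∣ (x.1 + 1) ^ 2 + x.2 ^ 2

instance (q : ℕ) (x : ℤ × ℤ) : Decidable (BadAt q x) := by unfold BadAt; infer_instance

open scoped Classical in
/-- The bad residue classes modulo `q`. -/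
noncomputable def badClasses (q : ℕ) [NeZero q] : Finset (ZMod q × ZMod q) :=
  univ.filter fun c => c.1 ^ 2 + c.2 ^ 2 = 0 ∨ (c.1 + 1) ^ 2 + c.2 ^ 2 = 0

theorem badAt_iff {q : ℕ} [NeZero q] (x : ℤ × ℤ) : BadAt q x ↔ ((x.1 : ZMod q), (x.2 : ZMod q)) ∈ badClasses q := by
  simp only [BadAt, badClasses, mem_filter, mem_univ, true_and]
  rw [← ZMod.intCast_zmod_eq_zero_iff_dvd, ← ZMod.intCast_zmod_eq_zero_iff_dvd]
  push_cast
  rfl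

/-- The local density of bad pairs. -/
noncomputable def badDensity (q : ℕ) : ℝ := if h : q = 0 then 0 else
  haveI : NeZero q := ⟨h⟩; ((badClasses q).card : ℝ) / q ^ 2

theorem badDensity_eq (q : ℕ) [h : NeZero q] : badDensity q = ((badClasses q).card : ℝ) / q ^ 2 := by
  rw [badDensity, dif_neg h.out]

theorem badDensity_nonneg (q : ℕ) : 0 ≤ badDensity q := by
  rw [badDensity]; split_ifs <;> positivity

theorem badDensity_le_one (q : ℕ) : badDensity q ≤ 1 := by
  rcases eq_or_ne q 0 with rfl | h
  · simp [badDensity]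
  · have : NeZero q := ⟨h⟩
    rw [badDensity_eq]
    apply div_le_one_of_le₀ _ (by positivity)
    have := card_le_univ (badClasses q)
    rw [Fintype.card_prod, ZMod.card, ← sq] at this
    exact_mod_cast this

theorem le_badDensity {q : ℕ} (hq : q.Prime) (h4 : q % 4 = 1) : 4 / (q : ℝ) - 12 / q ^ 2 ≤ badDensity q := by
  classical
  have : Fact q.Prime := ⟨hq⟩
  have hq5 : 5 ≤ q := by
    have := hq.two_le
    omega
  obtain ⟨i, hi⟩ := ZMod.exists_sq_eq_neg_one_iff.2 (by omega : q % 4 ≠ 3)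
  have h2 : (2 : ZMod q) ≠ 0 := by
    intro h
    have : ((2 : ℕ) : ZMod q) = 0 := by exact_mod_cast h
    rw [ZMod.natCast_eq_zero_iff] at this
    have := Nat.le_of_dvd (by norm_num) this
    omega
  have hi0 : i ≠ 0 := by rintro rfl; simp at hi
  let G : Finset (ZMod q) := univ \ {0, -1, -1 / 2}
  have hG : q - 3 ≤ G.card := by
    have h1 := le_card_sdiff ({0, -1, -1 / 2} : Finset (ZMod q)) univ
    have h2 : ({0, -1, -1 / 2} : Finset (ZMod q)).card ≤ 3 := card_le_three
    rw [card_univ, ZMod.card] at h1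
    exact le_trans (by omega) h1
  have hfib : ∀ a ∈ G, 4 ≤ ((badClasses q).filter fun c => c.1 = a).card := by
    intro a ha
    simp only [G, mem_sdiff, mem_univ, true_and, mem_insert, mem_singleton, not_or] at ha
    obtain ⟨a0, a1, a2⟩ := ha
    have a1' : a + 1 ≠ 0 := fun h => a1 (by linear_combination h)
    have a2' : 2 * a + 1 ≠ 0 := fun h => a2 (by field_simp; linear_combination h)
    have hsub : ({(a, i * a), (a, -(i * a)), (a, i * (a + 1)), (a, -(i * (a + 1)))} : Finset (ZMod q × ZMod q)) ⊆
        (badClasses q).filter fun c => c.1 = a := by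
      intro c hc
      simp only [mem_insert, mem_singleton] at hc
      simp only [badClasses, mem_filter, mem_univ, true_and]
      rcases hc with rfl | rfl | rfl | rfl
      · exact ⟨Or.inl (by dsimp only; linear_combination (-a ^ 2) * hi), rfl⟩
      · exact ⟨Or.inl (by dsimp only; linear_combination (-a ^ 2) * hi), rfl⟩
      · exact ⟨Or.inr (by dsimp only; linear_combination (-(a + 1) ^ 2) * hi), rfl⟩
      · exact ⟨Or.inr (by dsimp only; linear_combination (-(a + 1) ^ 2) * hi), rfl⟩
    refine le_trans (le_of_eq ?_) (card_le_card hsub)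
    have e1 : i * a ≠ -(i * a) := fun h => by
      have : 2 * (i * a) = 0 := by linear_combination h
      simp [h2, hi0, a0] at this
    have e2 : i * a ≠ i * (a + 1) := fun h => hi0 (by linear_combination -h)
    have e3 : i * a ≠ -(i * (a + 1)) := fun h => by
      have : i * (2 * a + 1) = 0 := by linear_combination h
      simp [hi0, a2'] at this
    have e4 : -(i * a) ≠ i * (a + 1) := fun h => by
      have : i * (2 * a + 1) = 0 := by linear_combination -h
      simp [hi0, a2'] at this
    have e5 : -(i * a) ≠ -(i * (a + 1)) := fun h => hi0 (by linear_combination h)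
    have e6 : i * (a + 1) ≠ -(i * (a + 1)) := fun h => by
      have : 2 * (i * (a + 1)) = 0 := by linear_combination h
      simp [h2, hi0, a1'] at this
    rw [card_insert_of_notMem, card_insert_of_notMem, card_insert_of_notMem, card_singleton]
    · simpa using e6
    · simp only [mem_insert, mem_singleton, Prod.mk.injEq, true_and, not_or]; exact ⟨e4, e5⟩
    · simp only [mem_insert, mem_singleton, Prod.mk.injEq, true_and, not_or]; exact ⟨e1, e2, e3⟩
  have hc : 4 * (q - 3) ≤ (badClasses q).card := by
    calc 4 * (q - 3) ≤ G.card * 4 := by omega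
      _ = ∑ a ∈ G, 4 := by simp
      _ ≤ ∑ a ∈ G, ((badClasses q).filter fun c => c.1 = a).card := sum_le_sum hfib
      _ ≤ ∑ a, ((badClasses q).filter fun c => c.1 = a).card :=
        sum_le_sum_of_subset (subset_univ _)
      _ = _ := (card_eq_sum_card_fiberwise (f := Prod.fst) (fun _ _ => mem_coe.2 (mem_univ _))).symm
  have hc' : 4 * ((q : ℝ) - 3) ≤ (badClasses q).card := by
    have : ((4 * (q - 3) : ℕ) : ℝ) ≤ (badClasses q).card := by exact_mod_cast hc
    rwa [Nat.cast_mul, Nat.cast_sub (by omega)] at this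
  have hq0 : (0 : ℝ) < q := by exact_mod_cast hq.pos
  rw [badDensity_eq, le_div_iff₀ (by positivity)]
  calc _ = 4 * ((q : ℝ) - 3) := by field_simp; ring
    _ ≤ _ := hc'

theorem abs_card_modEq_sub_le (u v : ℤ) (L : ℕ) {d : ℕ} (hd : 0 < d) :
    |(((Ico u (u + L)).filter fun x => x ≡ v [ZMOD d]).card : ℝ) - L / d| ≤ 1 := by
  have h := Int.Ico_filter_modEq_card u (u + L) (r := d) (by exact_mod_cast hd) v
  have hd' : (0 : ℚ) < d := by exact_mod_cast hd
  set A := ((((u + L : ℤ) : ℚ) - v) / ((d : ℤ) : ℚ)) with hA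
  set C := (((u : ℚ) - v) / ((d : ℤ) : ℚ)) with hC
  have hAC : A - C = L / d := by rw [hA, hC]; push_cast; field_simp; ring
  have hle : ⌈C⌉ ≤ ⌈A⌉ := Int.ceil_le_ceil (by
    have : (0 : ℚ) ≤ L / d := by positivity
    linarith)
  rw [max_eq_left (by linarith)] at h
  have h' : ((((Ico u (u + L)).filter fun x => x ≡ v [ZMOD d]).card : ℤ) : ℚ) = (⌈A⌉ : ℚ) - ⌈C⌉ := by
    rw [h]; push_cast; ring
  have k1 := Int.le_ceil A
  have k2 := Int.ceil_lt_add_one A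
  have k3 := Int.le_ceil C
  have k4 := Int.ceil_lt_add_one C
  have hq : |((((Ico u (u + L)).filter fun x => x ≡ v [ZMOD d]).card : ℤ) : ℚ) - L / d| ≤ 1 := by
    rw [h', ← hAC, abs_le]; constructor <;> linarith
  have := (Rat.cast_le (K := ℝ)).2 hq
  push_cast at this
  exact this

set_option maxHeartbeats 1000000 in
theorem abs_card_bad_sub_le (u w : ℤ) (L : ℕ) (s : Finset ℕ) (hs : ∀ q ∈ s, q.Prime) :
    |((((Ico u (u + L)) ×ˢ (Ico w (w + L))).filter fun x => ∀ q ∈ s, BadAt q x).card : ℝ) -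
      (L : ℝ) ^ 2 * ∏ q ∈ s, badDensity q| ≤ 2 * L * ((∏ q ∈ s, q : ℕ) : ℝ) + ((∏ q ∈ s, q : ℕ) : ℝ) ^ 2 := by
  classical
  have hne : ∀ i : s, NeZero (i : ℕ) := fun i => ⟨(hs i i.2).ne_zero⟩
  have hco : Pairwise (Function.onFun Nat.Coprime (fun i : s => (i : ℕ))) := fun i j hij =>
    (Nat.coprime_primes (hs i i.2) (hs j j.2)).2 (fun h => hij (Subtype.ext h))
  let e := ZMod.prodEquivPi (fun i : s => (i : ℕ)) hco
  have hd : ∏ i : s, (i : ℕ) = ∏ q ∈ s, q := prod_coe_sort s (fun q => q)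
  set d := ∏ q ∈ s, q with hdd
  have hdpos : 0 < d := prod_pos fun q hq => (hs q hq).pos
  have hNe : NeZero (∏ i : s, (i : ℕ)) := ⟨by rw [hd]; exact hdpos.ne'⟩
  let t : Finset (∀ i : s, ZMod i × ZMod i) := Fintype.piFinset fun i => badClasses i
  let B := (Ico u (u + L)) ×ˢ (Ico w (w + L))
  let f : ℤ × ℤ → (∀ i : s, ZMod i × ZMod i) := fun x i => ((x.1 : ZMod i), (x.2 : ZMod i))
  have hcast : ∀ (x v : ℤ) , (∀ i : s, (x : ZMod i) = (v : ZMod i)) ↔ x ≡ v [ZMOD d] := by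
    intro x v
    rw [← ZMod.intCast_eq_intCast_iff, ← hd, ← e.injective.eq_iff, map_intCast, map_intCast]
    exact ⟨fun h => funext h, fun h i => congrFun h i⟩
  have hlift : ∀ g : (∀ i : s, ZMod i), ∃ v : ℤ, ∀ i : s, (v : ZMod i) = g i := by
    intro g
    refine ⟨((e.symm g).val : ℤ), fun i => ?_⟩
    have : e (((e.symm g).val : ℤ) : ZMod _) = g := by
      rw [Int.cast_natCast, ZMod.natCast_zmod_val, RingEquiv.apply_symm_apply]
    rw [map_intCast] at this
    exact congrFun this i
  have hcount : ∀ c ∈ t, |((((B.filter fun x => ∀ q ∈ s, BadAt q x).filter fun x => f x = c).card : ℝ)) -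
      (L / d) ^ 2| ≤ 2 * (L / d) + 1 := by
    intro c hc
    obtain ⟨v1, hv1⟩ := hlift fun i => (c i).1
    obtain ⟨v2, hv2⟩ := hlift fun i => (c i).2
    have hset : ((B.filter fun x => ∀ q ∈ s, BadAt q x).filter fun x => f x = c) =
        ((Ico u (u + L)).filter fun x => x ≡ v1 [ZMOD d]) ×ˢ ((Ico w (w + L)).filter fun x => x ≡ v2 [ZMOD d]) := by
      ext x
      have hfx : f x = c ↔ x.1 ≡ v1 [ZMOD d] ∧ x.2 ≡ v2 [ZMOD d] := by
        rw [← hcast, ← hcast]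
        constructor
        · intro h
          exact ⟨fun i => by rw [hv1, ← h], fun i => by rw [hv2, ← h]⟩
        · rintro ⟨h1, h2⟩
          funext i
          exact Prod.ext ((h1 i).trans (hv1 i)) ((h2 i).trans (hv2 i))
      simp only [mem_filter, mem_product, hfx, B]
      constructor
      · rintro ⟨⟨⟨h1, h2⟩, -⟩, h3, h4⟩
        exact ⟨⟨h1, h3⟩, h2, h4⟩
      · rintro ⟨⟨h1, h3⟩, h2, h4⟩
        refine ⟨⟨⟨h1, h2⟩, fun q hq => ?_⟩, h3, h4⟩
        have := hne ⟨q, hq⟩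
        have h5 := congrFun (hfx.2 ⟨h3, h4⟩) ⟨q, hq⟩
        rw [badAt_iff (q := q)]
        have h6 := Fintype.mem_piFinset.1 hc ⟨q, hq⟩
        rw [← h5] at h6
        exact h6
    rw [hset, card_product, Nat.cast_mul]
    have h1 := abs_card_modEq_sub_le u v1 L hdpos
    have h2 := abs_card_modEq_sub_le w v2 L hdpos
    set x := (((Ico u (u + L)).filter fun x => x ≡ v1 [ZMOD d]).card : ℝ)
    set y := (((Ico w (w + L)).filter fun x => x ≡ v2 [ZMOD d]).card : ℝ)
    set z : ℝ := (L : ℝ) / d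
    have hz : 0 ≤ z := by positivity
    calc |x * y - z ^ 2| = |(x - z) * (y - z) + z * (x - z) + z * (y - z)| := by congr 1; ring
      _ ≤ |(x - z) * (y - z)| + |z * (x - z)| + |z * (y - z)| := abs_add_three _ _ _
      _ = |x - z| * |y - z| + z * |x - z| + z * |y - z| := by rw [abs_mul, abs_mul, abs_mul, abs_of_nonneg hz]
      _ ≤ 1 * 1 + z * 1 + z * 1 := by gcongr
      _ = 2 * z + 1 := by ring
  have hmaps : Set.MapsTo f ↑(B.filter fun x => ∀ q ∈ s, BadAt q x) ↑t := by
    intro x hx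
    rw [mem_coe, mem_filter] at hx
    rw [mem_coe, Fintype.mem_piFinset]
    exact fun i => (badAt_iff (q := (i : ℕ)) x).1 (hx.2 i i.2)
  have hd0 : (0 : ℝ) < d := by exact_mod_cast hdpos
  have hprod : (L : ℝ) ^ 2 * ∏ q ∈ s, badDensity q = t.card * (L / d) ^ 2 := by
    rw [Fintype.card_piFinset, ← prod_coe_sort s]
    have : ∀ i : s, badDensity i = ((badClasses (i : ℕ)).card : ℝ) / (i : ℕ) ^ 2 := fun i => badDensity_eq _
    rw [prod_congr rfl fun i _ => this i, prod_div_distrib, prod_pow, ← Nat.cast_prod, ← Nat.cast_prod, hd]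
    generalize (∏ i : s, (badClasses (i : ℕ)).card) = N
    rw [div_pow]
    ring
  have htc : (t.card : ℝ) ≤ d ^ 2 := by
    have h1 : t.card ≤ ∏ i : s, (i : ℕ) ^ 2 := by
      rw [Fintype.card_piFinset]
      apply prod_le_prod' 
      intro i _
      have := card_le_univ (badClasses (i : ℕ))
      rwa [Fintype.card_prod, ZMod.card, ← sq] at this
    rw [prod_pow, hd] at h1
    exact_mod_cast h1
  rw [card_eq_sum_card_fiberwise hmaps, hprod, Nat.cast_sum, ← nsmul_eq_mul, ← sum_const, ← sum_sub_distrib]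
  calc _ ≤ ∑ c ∈ t, |((((B.filter fun x => ∀ q ∈ s, BadAt q x).filter fun x => f x = c).card : ℝ)) - (L / d) ^ 2| :=
        abs_sum_le_sum_abs _ _
    _ ≤ ∑ c ∈ t, (2 * ((L : ℝ) / d) + 1) := sum_le_sum hcount
    _ = t.card * (2 * (L / d) + 1) := by rw [sum_const, nsmul_eq_mul]
    _ ≤ d ^ 2 * (2 * (L / d) + 1) := by gcongr
    _ = 2 * L * d + d ^ 2 := by
      clear_value d
      field_simp

end

section

open Finset Filter Topology

theorem exists_sum_badDensity (K z : ℕ) {s : ℝ} (hs : 0 < s) (h : s ≤ ∑ q ∈ primesOneModFour K z, badDensity q) :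
    ∃ y ≤ z, s ≤ ∑ q ∈ primesOneModFour K y, badDensity q ∧ ∑ q ∈ primesOneModFour K y, badDensity q ≤ s + 1 := by
  classical
  have hex : ∃ y, s ≤ ∑ q ∈ primesOneModFour K y, badDensity q := ⟨z, h⟩
  refine ⟨Nat.find hex, Nat.find_min' hex h, Nat.find_spec hex, ?_⟩
  rcases hn : Nat.find hex with _ | n
  · have h0 := Nat.find_spec hex
    rw [hn] at h0
    have : primesOneModFour K 0 = ∅ := by simp [primesOneModFour, Nat.not_prime_zero]
    rw [this] at h0 ⊢
    simp at h0 ⊢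
    linarith
  · have h1 := Nat.find_min hex (m := n) (by omega)
    push Not at h1
    have h2 : primesOneModFour K (n + 1) ⊆ insert (n + 1) (primesOneModFour K n) := by
      intro q hq
      simp only [primesOneModFour, mem_filter, mem_range, mem_insert] at hq ⊢
      by_cases hq' : q = n + 1
      · exact Or.inl hq'
      · exact Or.inr ⟨by omega, hq.2⟩
    calc _ ≤ ∑ q ∈ insert (n + 1) (primesOneModFour K n), badDensity q :=
          sum_le_sum_of_subset_of_nonneg h2 fun q _ _ => badDensity_nonneg q
      _ = badDensity (n + 1) + ∑ q ∈ primesOneModFour K n, badDensity q :=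
          sum_insert (by simp [primesOneModFour])
      _ ≤ s + 1 := by linarith [badDensity_le_one (n + 1)]

theorem le_sum_badDensity (K : ℕ) : ∃ C : ℝ, ∀ z, 4 * ∑ q ∈ primesOneModFour K z, (1 : ℝ) / q - C ≤
    ∑ q ∈ primesOneModFour K z, badDensity q := by
  have hs : Summable fun n : ℕ => (1 : ℝ) / (n : ℝ) ^ 2 := Real.summable_one_div_nat_pow.2 (by norm_num)
  refine ⟨12 * ∑' n : ℕ, (1 : ℝ) / (n : ℝ) ^ 2, fun z => ?_⟩
  have h1 : ∑ q ∈ primesOneModFour K z, (1 : ℝ) / (q : ℝ) ^ 2 ≤ ∑' n : ℕ, (1 : ℝ) / (n : ℝ) ^ 2 :=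
    hs.sum_le_tsum _ fun i _ => by positivity
  have h2 : ∑ q ∈ primesOneModFour K z, (4 / (q : ℝ) - 12 / (q : ℝ) ^ 2) ≤ ∑ q ∈ primesOneModFour K z, badDensity q := by
    apply sum_le_sum
    intro q hq
    simp only [primesOneModFour, mem_filter] at hq
    exact le_badDensity hq.2.1 hq.2.2.1
  have h3 : ∑ q ∈ primesOneModFour K z, (4 / (q : ℝ) - 12 / (q : ℝ) ^ 2) =
      4 * ∑ q ∈ primesOneModFour K z, (1 : ℝ) / q - 12 * ∑ q ∈ primesOneModFour K z, (1 : ℝ) / (q : ℝ) ^ 2 := by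
    rw [mul_sum, mul_sum, ← sum_sub_distrib]
    exact sum_congr rfl fun q _ => by ring
  linarith

/-- An explicit form of the sieve bound for pairs of consecutive norms. -/
theorem card_sifted_norms_le (K z y r L : ℕ) (u w : ℤ) (hy : y ≤ z) (hr : Even r) (hL : 1 ≤ L) {s : ℝ}
    (h1 : s ≤ ∑ q ∈ primesOneModFour K y, badDensity q) (h2 : ∑ q ∈ primesOneModFour K y, badDensity q ≤ s + 1) :
    ((((Ico u (u + L)) ×ˢ (Ico w (w + L))).filter fun x => ∀ q ∈ primesOneModFour K y, ¬ BadAt q x).card : ℝ) ≤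
      (L : ℝ) ^ 2 * (Real.exp (-s) + Real.exp (2 * (s + 1)) / 2 ^ r) + 3 * L * ((z : ℝ) + 2) ^ (3 * r) := by
  set Q := primesOneModFour K y with hQ
  have hQp : ∀ q ∈ Q, q.Prime ∧ q ≤ z := by
    intro q hq
    simp only [hQ, primesOneModFour, mem_filter, mem_range] at hq
    exact ⟨hq.2.1, by omega⟩
  have hcard : (Q.card : ℝ) + 1 ≤ z + 2 := by
    have : Q.card ≤ y + 1 := (card_filter_le _ _).trans (by rw [card_range])
    have : Q.card ≤ z + 1 := by omega
    have : (Q.card : ℝ) ≤ z + 1 := by exact_mod_cast this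
    linarith
  have hL' : (1 : ℝ) ≤ L := by exact_mod_cast hL
  have hZ : (1 : ℝ) ≤ (z : ℝ) + 2 := by linarith [Nat.cast_nonneg (α := ℝ) z]
  have hN : ∀ t ⊆ Q, t.card ≤ r →
      |((((Ico u (u + L)) ×ˢ (Ico w (w + L))).filter fun x => ∀ q ∈ t, BadAt q x).card : ℝ) -
      (L : ℝ) ^ 2 * ∏ q ∈ t, badDensity q| ≤ 3 * L * ((z : ℝ) + 2) ^ (2 * r) := by
    intro t ht htr
    have h := abs_card_bad_sub_le u w L t fun q hq => (hQp q (ht hq)).1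
    have hd : ((∏ q ∈ t, q : ℕ) : ℝ) ≤ ((z : ℝ) + 2) ^ r := by
      rw [Nat.cast_prod]
      calc ∏ q ∈ t, (q : ℝ) ≤ ∏ q ∈ t, ((z : ℝ) + 2) := by
            apply Finset.prod_le_prod
            · intro i _; positivity
            · intro i hi
              have : (i : ℝ) ≤ z := by exact_mod_cast (hQp i (ht hi)).2
              linarith
        _ = ((z : ℝ) + 2) ^ t.card := by rw [prod_const]
        _ ≤ _ := pow_le_pow_right₀ hZ htr
    set D := ((∏ q ∈ t, q : ℕ) : ℝ)
    have hD : 0 ≤ D := Nat.cast_nonneg _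
    have hW : (1 : ℝ) ≤ ((z : ℝ) + 2) ^ r := one_le_pow₀ hZ
    set W := ((z : ℝ) + 2) ^ r with hWd
    have hWW : ((z : ℝ) + 2) ^ (2 * r) = W * W := by rw [hWd, two_mul, pow_add]
    rw [hWW]
    refine h.trans ?_
    calc 2 * L * D + D ^ 2 ≤ 2 * L * (W * W) + 1 * (W * W) := by
          have : D ≤ W * W := hd.trans (le_mul_of_one_le_left (by positivity) hW)
          have : D ^ 2 ≤ W * W := by rw [sq]; gcongr
          have : 2 * L * D ≤ 2 * L * (W * W) := by gcongr
          linarith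
      _ ≤ 2 * L * (W * W) + L * (W * W) := by gcongr
      _ = _ := by ring
  have h := card_sifted_le ((Ico u (u + L)) ×ˢ (Ico w (w + L))) Q BadAt badDensity (fun q _ => badDensity_nonneg q)
    (fun q _ => badDensity_le_one q) hr (by positivity) (by positivity) hN
  refine h.trans ?_
  gcongr ?_ * (Real.exp ?_ + Real.exp (2 * ?_) / _) + ?_
  · linarith
  · calc _ ≤ 3 * L * ((z : ℝ) + 2) ^ (2 * r) * ((z : ℝ) + 2) ^ r := by gcongr
      _ = _ := by ring

end

section

open Finset Filter Topology

theorem tendsto_log_natCast : Tendsto (fun X : ℕ => Real.log (X : ℝ)) atTop atTop :=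
  Real.tendsto_log_atTop.comp tendsto_natCast_atTop_atTop

/-- The logarithm of the size of the sieving primes, as a function of `log X`. -/
theorem eventually_sieve_level (K : ℕ) : ∀ᶠ X : ℕ in atTop,
    (11 / 10) * Real.log (Real.log X) ≤
      ∑ q ∈ primesOneModFour K ⌊Real.exp (Real.log X ^ (4 / 5 : ℝ))⌋₊, badDensity q := by
  obtain ⟨C, hC⟩ := le_sum_badDensity K
  have hu : Tendsto (fun X : ℕ => Real.log (X : ℝ) ^ (4 / 5 : ℝ)) atTop atTop :=
    (tendsto_rpow_atTop (by norm_num)).comp tendsto_log_natCast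
  have hz : Tendsto (fun X : ℕ => ⌊Real.exp (Real.log (X : ℝ) ^ (4 / 5 : ℝ))⌋₊) atTop atTop :=
    tendsto_nat_floor_atTop.comp (Real.tendsto_exp_atTop.comp hu)
  have hll : Tendsto (fun X : ℕ => Real.log (Real.log (X : ℝ))) atTop atTop :=
    Real.tendsto_log_atTop.comp tendsto_log_natCast
  filter_upwards [hz.eventually (eventually_loglog_le_sum K), hu.eventually_ge_atTop 2,
    hll.eventually_ge_atTop ((C + 2) / (18 / 100)), tendsto_log_natCast.eventually_gt_atTop 0] with X h1 h2 h3 h4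
  set u := Real.log (X : ℝ) ^ (4 / 5 : ℝ) with hud
  set z := ⌊Real.exp u⌋₊ with hzd
  have hlogu : Real.log u = 4 / 5 * Real.log (Real.log X) := by rw [hud, Real.log_rpow h4]
  have hzl : Real.exp (u / 2) ≤ z := by
    have ha : Real.exp u < z + 1 := Nat.lt_floor_add_one _
    have hb : Real.exp u = Real.exp (u / 2) * Real.exp (u / 2) := by rw [← Real.exp_add]; ring_nf
    have hc : 2 ≤ Real.exp (u / 2) := by
      have := Real.add_one_le_exp (u / 2)
      linarith
    nlinarith
  have hlz : u / 2 ≤ Real.log z := by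
    rw [Real.le_log_iff_exp_le (lt_of_lt_of_le (Real.exp_pos _) hzl)]
    exact hzl
  have hllz : Real.log u - Real.log 2 ≤ Real.log (Real.log z) := by
    rw [← Real.log_div (by linarith) (by norm_num)]
    exact Real.log_le_log (by linarith) hlz
  have hl2 : Real.log 2 < 0.7 := lt_trans Real.log_two_lt_d9 (by norm_num)
  have h5 := hC z
  rw [div_le_iff₀ (by norm_num)] at h3
  rw [hlogu] at hllz
  linarith

theorem eventually_sifted (K : ℕ) {ε : ℝ} (hε : 0 < ε) : ∀ᶠ X : ℕ in atTop, ∃ y, y ≤ Nat.sqrt X ∧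
    ((((Ico (-(Nat.sqrt X : ℤ)) (Nat.sqrt X + 1)) ×ˢ (Ico (-(Nat.sqrt X : ℤ)) (Nat.sqrt X + 1))).filter fun x =>
      ∀ q ∈ primesOneModFour K y, ¬ BadAt q x).card : ℝ) ≤ ε * (X / Real.log X) := by
  have hll : Tendsto (fun X : ℕ => Real.log (Real.log (X : ℝ))) atTop atTop :=
    Real.tendsto_log_atTop.comp tendsto_log_natCast
  have hA : ∀ᶠ t : ℝ in atTop, Real.log t ≤ (1 / 200) * t ^ (1 / 5 : ℝ) := by
    have := (isLittleO_log_rpow_atTop (r := 1 / 5) (by norm_num)).bound (c := 1 / 200) (by norm_num)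
    filter_upwards [this, eventually_gt_atTop 0] with t h ht
    calc Real.log t ≤ ‖Real.log t‖ := le_abs_self _
      _ ≤ _ := h
      _ = _ := by rw [Real.norm_of_nonneg (by positivity)]
  have hB : Tendsto (fun X : ℕ => Real.log (X : ℝ) ^ (1 / 10 : ℝ)) atTop atTop :=
    (tendsto_rpow_atTop (by norm_num)).comp tendsto_log_natCast
  filter_upwards [eventually_sieve_level K, tendsto_log_natCast.eventually hA, hll.eventually_ge_atTop 10,
    tendsto_log_natCast.eventually_gt_atTop 1, hB.eventually_ge_atTop (9 * (1 + Real.exp 2) / (ε / 2)),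
    eventually_log_pow_mul_rpow_le (r := 3 / 4) (by norm_num) 0 9 (half_pos hε), eventually_gt_atTop 0] with X h1 h2 h3 h4 h5 h6 hX
  set l := Real.log (X : ℝ) with hl
  set z := ⌊Real.exp (l ^ (4 / 5 : ℝ))⌋₊ with hz
  have hX0 : (0 : ℝ) < X := by exact_mod_cast hX
  have hl0 : 0 < l := by linarith
  obtain ⟨y, hyz, hy1, hy2⟩ := exists_sum_badDensity K z (by linarith) h1
  set M := Nat.sqrt X with hM
  have hMX : (M : ℝ) ^ 2 ≤ X := by
    have := Nat.sqrt_le' X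
    exact_mod_cast this
  have hM1 : 1 ≤ M := Nat.le_sqrt'.2 (by omega)
  have hz1 : (z : ℝ) ≤ Real.exp (l ^ (4 / 5 : ℝ)) := Nat.floor_le (Real.exp_pos _).le
  have hlp : l ^ (4 / 5 : ℝ) * l ^ (1 / 5 : ℝ) = l := by
    rw [← Real.rpow_add hl0]; norm_num
  have hu1 : 1 ≤ l ^ (4 / 5 : ℝ) := Real.one_le_rpow h4.le (by norm_num)
  have hv1 : 2000 ≤ l ^ (1 / 5 : ℝ) := by linarith
  set u := l ^ (4 / 5 : ℝ) with hu
  set v := l ^ (1 / 5 : ℝ) with hv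
  set r := 2 * ⌈3 * Real.log l⌉₊ with hr
  have hr1 : (r : ℝ) ≤ 6 * Real.log l + 2 := by
    rw [hr]; push_cast
    have := Nat.ceil_lt_add_one (a := 3 * Real.log l) (by linarith)
    linarith
  have hr2 : 6 * Real.log l ≤ r := by
    rw [hr]; push_cast
    have := Nat.le_ceil (3 * Real.log l)
    linarith
  have hzW : (z : ℝ) + 2 ≤ Real.exp (2 * u) := by
    have ha : Real.exp (2 * u) = Real.exp u * Real.exp u := by rw [← Real.exp_add]; ring_nf
    have hb : 2 ≤ Real.exp u := by
      have := Real.add_one_le_exp u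
      linarith
    nlinarith
  have hexpl : Real.exp l = X := Real.exp_log hX0
  have hW : ((z : ℝ) + 2) ^ (3 * r) ≤ (X : ℝ) ^ (1 / 4 : ℝ) := by
    calc ((z : ℝ) + 2) ^ (3 * r) ≤ Real.exp (2 * u) ^ (3 * r) := by gcongr
      _ = Real.exp ((3 * r : ℕ) * (2 * u)) := by rw [← Real.exp_nat_mul]
      _ ≤ Real.exp (l * (1 / 4)) := by
        apply Real.exp_le_exp.2
        push_cast
        calc 3 * (r : ℝ) * (2 * u) = u * (6 * r) := by ring
          _ ≤ u * (v / 4) := by gcongr; linarith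
          _ = l * (1 / 4) := by rw [← hlp]; ring
      _ = _ := by rw [Real.exp_mul, hexpl]
  have hMs : (M : ℝ) ≤ (X : ℝ) ^ (1 / 2 : ℝ) := by
    rw [← Real.sqrt_eq_rpow]
    exact Real.le_sqrt_of_sq_le hMX
  refine ⟨y, ?_, ?_⟩
  · have hzM : (z : ℝ) < (M : ℝ) + 1 := by
      have ha : Real.sqrt X < (M : ℝ) + 1 := by
        rw [Real.sqrt_lt' (by positivity)]
        have := Nat.lt_succ_sqrt' X
        exact_mod_cast this
      refine lt_of_le_of_lt (hz1.trans ?_) ha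
      rw [Real.sqrt_eq_rpow, ← hexpl, ← Real.exp_mul]
      apply Real.exp_le_exp.2
      rw [← hlp]
      nlinarith
    have : z < M + 1 := by exact_mod_cast hzM
    omega
  · have hL : (-(M : ℤ)) + ((2 * M + 1 : ℕ) : ℤ) = M + 1 := by push_cast; ring
    have h := card_sifted_norms_le K z y r (2 * M + 1) (-(M : ℤ)) (-(M : ℤ)) hyz (by simp [hr]) (by omega) hy1 hy2
    rw [hL] at h
    refine h.trans ?_
    have hL3 : ((2 * M + 1 : ℕ) : ℝ) ≤ 3 * M := by
      have : (1 : ℝ) ≤ M := by exact_mod_cast hM1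
      push_cast; linarith
    have hT1 : Real.exp (-(11 / 10 * Real.log l)) = l⁻¹ * (l ^ (1 / 10 : ℝ))⁻¹ := by
      rw [show -(11 / 10 * Real.log l) = Real.log l * (-1) + Real.log l * (-(1 / 10)) by ring, Real.exp_add, Real.exp_mul, Real.exp_mul,
        Real.exp_log hl0, Real.rpow_neg_one, Real.rpow_neg hl0.le]
    have hT2 : Real.exp (2 * (11 / 10 * Real.log l + 1)) / 2 ^ r ≤ Real.exp 2 * (l⁻¹ * (l ^ (1 / 10 : ℝ))⁻¹) := by
      rw [div_le_iff₀ (by positivity), ← hT1, ← Real.exp_add]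
      have h2r : Real.exp (0.69 * r) ≤ 2 ^ r := by
        calc Real.exp (0.69 * r) ≤ Real.exp (r * Real.log 2) := by
              apply Real.exp_le_exp.2
              rw [mul_comm]
              gcongr
              linarith [Real.log_two_gt_d9]
          _ = _ := by rw [Real.exp_nat_mul, Real.exp_log (by norm_num)]
      calc _ ≤ Real.exp (2 + -(11 / 10 * Real.log l)) * Real.exp (0.69 * r) := by
            rw [← Real.exp_add]
            apply Real.exp_le_exp.2
            linarith
        _ ≤ _ := by gcongr
    have hV : ((2 * M + 1 : ℕ) : ℝ) ^ 2 ≤ 9 * X := by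
      calc _ ≤ (3 * (M : ℝ)) ^ 2 := by gcongr
        _ = 9 * (M : ℝ) ^ 2 := by ring
        _ ≤ _ := by linarith
    have hfirst : ((2 * M + 1 : ℕ) : ℝ) ^ 2 * (Real.exp (-(11 / 10 * Real.log l)) + Real.exp (2 * (11 / 10 * Real.log l + 1)) / 2 ^ r)
        ≤ ε / 2 * (X / l) := by
      have hp : 0 < l ^ (1 / 10 : ℝ) := Real.rpow_pos_of_pos hl0 _
      rw [hT1]
      set m := l ^ (1 / 10 : ℝ)
      rw [div_le_iff₀ (by positivity)] at h5
      calc _ ≤ 9 * X * (l⁻¹ * m⁻¹ + Real.exp 2 * (l⁻¹ * m⁻¹)) := by gcongr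
        _ = (9 * (1 + Real.exp 2)) * (X * l⁻¹ * m⁻¹) := by ring
        _ ≤ (m * (ε / 2)) * (X * l⁻¹ * m⁻¹) := by gcongr
        _ = _ := by field_simp
    have hsecond : 3 * ((2 * M + 1 : ℕ) : ℝ) * ((z : ℝ) + 2) ^ (3 * r) ≤ ε / 2 * (X / l) := by
      calc _ ≤ 3 * (3 * (X : ℝ) ^ (1 / 2 : ℝ)) * (X : ℝ) ^ (1 / 4 : ℝ) := by
            gcongr
            linarith
        _ = 9 * (l ^ 0 * (X : ℝ) ^ (3 / 4 : ℝ)) := by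
            rw [pow_zero, one_mul, show (3 / 4 : ℝ) = 1 / 2 + 1 / 4 by norm_num, Real.rpow_add hX0]
            ring
        _ ≤ _ := h6
    linarith

end

section

open Finset Filter Topology
namespace EC

theorem card_T₂_large_ord_le {η : ℝ} (hη : 0 < η) {X K y : ℕ} (hK : 3 / η ≤ K) (hy : y ≤ Nat.sqrt X)
    (hX : 2 * (Nat.sqrt X : ℝ) + 1 < η * X) :
    (primesUpTo {p | p ∈ T₂ ∧ (ord p).Prime ∧ η * X < ord p} X).card ≤
    (((Ico (-(Nat.sqrt X : ℤ)) (Nat.sqrt X + 1)) ×ˢ (Ico (-(Nat.sqrt X : ℤ)) (Nat.sqrt X + 1))).filter fun x =>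
      ∀ q ∈ primesOneModFour K y, ¬ BadAt q x).card := by
  classical
  refine le_trans (card_le_card ?_) (card_image_le (f := fun x : ℤ × ℤ => (x.1 ^ 2 + x.2 ^ 2).toNat))
  intro p hp
  simp only [primesUpTo, mem_filter, mem_range, Set.mem_ofPred_eq] at hp
  obtain ⟨hpX, hpp, hT, hl, hlX⟩ := hp
  have hpX : p ≤ X := by omega
  obtain ⟨-, h5, hbl, -⟩ := hT
  have : Fact p.Prime := ⟨hpp⟩
  have h101 : 101 ≤ ord p := hbl.1 _ hl dvd_rfl
  have hodd : Odd (ord p) := hl.odd_of_ne_two (by omega)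
  obtain ⟨a, b, hab, hab'⟩ := exists_sq_add_sq h5 (mod_four_of_odd_ord hpp h5 hodd)
  rw [mem_image]
  have hsq : ∀ c : ℤ, c ^ 2 ≤ X → c ∈ Ico (-(Nat.sqrt X : ℤ)) (Nat.sqrt X + 1) := by
    intro c hc
    have : c.natAbs ≤ Nat.sqrt X := by
      rw [Nat.le_sqrt']
      have h : ((c.natAbs ^ 2 : ℕ) : ℤ) ≤ X := by
        push_cast
        rwa [sq_abs]
      exact_mod_cast h
    rw [mem_Ico]
    omega
  have hpX' : (p : ℤ) ≤ X := by exact_mod_cast hpX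
  have hsl : Nat.sqrt X < ord p := by
    have : (Nat.sqrt X : ℝ) < ord p := by
      have := Nat.cast_nonneg (α := ℝ) (Nat.sqrt X)
      linarith
    exact_mod_cast this
  have hsp : Nat.sqrt X < p := by
    have h1 : ((ord p : ℕ) : ℝ) ≤ 2 * p + 1 := by exact_mod_cast ord_le hpp h5
    have : (Nat.sqrt X : ℝ) < p := by linarith
    exact_mod_cast this
  refine ⟨(a, b), ?_, by simp [hab]⟩
  rw [mem_filter, mem_product]
  refine ⟨⟨hsq a ?_, hsq b ?_⟩, ?_⟩
  · linarith [sq_nonneg b]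
  · linarith [sq_nonneg a]
  intro q hq
  simp only [primesOneModFour, mem_filter, mem_range] at hq
  obtain ⟨hqy, hqp, -, hqK⟩ := hq
  rintro (h | h)
  · dsimp only at h
    rw [hab, Int.natCast_dvd_natCast, Nat.prime_dvd_prime_iff_eq hqp hpp] at h
    omega
  · dsimp only at h
    rw [hab', Int.natCast_dvd_natCast] at h
    obtain ⟨k, hk⟩ := ord_dvd_card (p := p) h5
    have hle := card_point_le (p := p) h5
    have hkpos : 0 < k := by
      rcases Nat.eq_zero_or_pos k with rfl | h0
      · exfalso
        have h1 : ((a + 1) ^ 2 + b ^ 2 : ℤ) = 0 := by rw [hab', hk]; simp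
        have h2 : a = -1 := by nlinarith [sq_nonneg (a + 1), sq_nonneg b]
        have h3 : b = 0 := by nlinarith [sq_nonneg (a + 1), sq_nonneg b]
        rw [h2, h3] at hab
        norm_num at hab
        omega
      · exact h0
    rw [hk] at h hle
    rcases (hqp.dvd_mul).1 h with h | h
    · rw [Nat.prime_dvd_prime_iff_eq hqp hl] at h
      omega
    · have hqk := Nat.le_of_dvd hkpos h
      have h1 : ((ord p : ℕ) : ℝ) * k ≤ 2 * p + 1 := by exact_mod_cast hle
      have h2 : (K : ℝ) + 1 ≤ k := by exact_mod_cast (by omega : K + 1 ≤ k)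
      have hX0 : (0 : ℝ) < X := by
        have : 0 < X := by omega
        exact_mod_cast this
      have h3 : (p : ℝ) ≤ X := by exact_mod_cast hpX
      rw [div_le_iff₀ hη] at hK
      have h4 : 3 * X ≤ (η * X) * k := by
        calc 3 * X ≤ K * η * (X : ℝ) := by gcongr
          _ ≤ k * η * X := by gcongr; linarith
          _ = _ := by ring
      have h5 : (η * X) * k < ord p * k := by
        apply mul_lt_mul_of_pos_right hlX
        exact_mod_cast hkpos
      have h6 : (1 : ℝ) ≤ X := by exact_mod_cast (by omega : 1 ≤ X)
      linarith

theorem card_T₂_small_ord_le (η : ℝ) (X : ℕ) :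
    (primesUpTo {p | p ∈ T₂ ∧ (ord p).Prime ∧ (ord p : ℝ) ≤ η * X} X).card ≤ Nat.primeCounting ⌊η * X⌋₊ := by
  classical
  rw [Nat.primeCounting, Nat.primeCounting', Nat.count_eq_card_filter_range]
  apply card_le_card_of_injOn ord
  · intro p hp
    simp only [primesUpTo, coe_filter, mem_range, Set.mem_ofPred_eq] at hp ⊢
    exact ⟨Nat.lt_succ_of_le (Nat.le_floor hp.2.2.2.2), hp.2.2.2.1⟩
  · intro p hp q hq h
    simp only [primesUpTo, coe_filter, mem_range, Set.mem_ofPred_eq] at hp hq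
    exact ord_injOn_T₂ hp.2.2.1 hq.2.2.1 h

theorem eventually_T₂_small_ord {ε : ℝ} (hε : 0 < ε) : ∃ η : ℝ, 0 < η ∧ ∀ᶠ X : ℕ in atTop,
    ((primesUpTo {p | p ∈ T₂ ∧ (ord p).Prime ∧ (ord p : ℝ) ≤ η * X} X).card : ℝ) ≤ ε * (X / Real.log X) := by
  refine ⟨ε / 4, by positivity, ?_⟩
  set η := ε / 4 with hη
  have hη0 : 0 < η := by positivity
  have ht : Tendsto (fun X : ℕ => η * (X : ℝ)) atTop atTop := tendsto_natCast_atTop_atTop.const_mul_atTop hη0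
  filter_upwards [ht.eventually (Chebyshev.eventually_primeCounting_le (ε := 1 / 2) (by norm_num)),
    tendsto_log_natCast.eventually_ge_atTop (1 + 2 * |Real.log η|), eventually_gt_atTop 0] with X h1 h2 h3
  have hX : (0 : ℝ) < X := by exact_mod_cast h3
  have hl : Real.log (η * X) = Real.log η + Real.log X := Real.log_mul hη0.ne' hX.ne'
  have hl2 : Real.log X / 2 ≤ Real.log (η * X) := by
    rw [hl]
    have := neg_abs_le (Real.log η)
    linarith
  have hlX : 0 < Real.log X := by
    have := abs_nonneg (Real.log η)
    linarith
  have h4 : Real.log 4 < 1.4 := by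
    rw [show (4 : ℝ) = 2 * 2 by norm_num, Real.log_mul (by norm_num) (by norm_num)]
    linarith [Real.log_two_lt_d9]
  calc _ ≤ (Nat.primeCounting ⌊η * X⌋₊ : ℝ) := by exact_mod_cast card_T₂_small_ord_le η X
    _ ≤ _ := h1
    _ ≤ 2 * (η * X) / (Real.log X / 2) := by gcongr; linarith
    _ = _ := by rw [hη]; field_simp; ring

theorem hasNatDensity_T₂ : HasNatDensity T₂ 0 := by
  classical
  apply hasNatDensity_zero
  intro ε hε
  obtain ⟨η, hη, hs⟩ := eventually_T₂_small_ord (ε := ε / 3) (by positivity)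
  have hsq : ∀ᶠ X : ℕ in atTop, 2 * (Nat.sqrt X : ℝ) + 1 < η * X := by
    have ht : Tendsto (fun X : ℕ => (X : ℝ)) atTop atTop := tendsto_natCast_atTop_atTop
    filter_upwards [ht.eventually_gt_atTop ((3 / η) ^ 2), eventually_gt_atTop 0] with X h1 h2
    have h3 : (Nat.sqrt X : ℝ) ^ 2 ≤ X := by exact_mod_cast Nat.sqrt_le' X
    have h4 : (1 : ℝ) ≤ X := by exact_mod_cast h2
    have h5 : (Nat.sqrt X : ℝ) ≤ Real.sqrt X := Real.le_sqrt_of_sq_le h3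
    have h6 : 1 ≤ Real.sqrt X := Real.one_le_sqrt.2 h4
    have h7 : 3 / η < Real.sqrt X := Real.lt_sqrt_of_sq_lt h1
    have h8 : Real.sqrt X * Real.sqrt X = X := Real.mul_self_sqrt (by linarith)
    rw [div_lt_iff₀ hη] at h7
    calc 2 * (Nat.sqrt X : ℝ) + 1 ≤ 3 * Real.sqrt X := by linarith
      _ < (Real.sqrt X * η) * Real.sqrt X := by gcongr
      _ = η * (Real.sqrt X * Real.sqrt X) := by ring
      _ = η * X := by rw [h8]
  filter_upwards [hs, hsq, eventually_T₂_composite (ε := ε / 3) (by positivity),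
    eventually_sifted ⌈3 / η⌉₊ (ε := ε / 3) (by positivity)] with X h1 h2 h3 h4
  obtain ⟨y, hy, h4⟩ := h4
  have h5 := card_T₂_large_ord_le hη (Nat.le_ceil (3 / η)) hy h2
  have h6 : (primesUpTo T₂ X).card ≤ (primesUpTo {p | p ∈ T₂ ∧ ¬(ord p).Prime} X).card +
      (primesUpTo {p | p ∈ T₂ ∧ (ord p).Prime ∧ (ord p : ℝ) ≤ η * X} X).card +
      (primesUpTo {p | p ∈ T₂ ∧ (ord p).Prime ∧ η * X < ord p} X).card := by
    refine le_trans (card_le_card ?_) ((card_union_le _ _).trans (Nat.add_le_add_right (card_union_le _ _) _))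
    intro p hp
    simp only [primesUpTo, mem_filter, mem_range, mem_union, Set.mem_ofPred_eq] at hp ⊢
    by_cases hl : (ord p).Prime
    · rcases le_or_gt ((ord p : ℕ) : ℝ) (η * X) with h | h
      · exact Or.inl (Or.inr ⟨hp.1, hp.2.1, hp.2.2, hl, h⟩)
      · exact Or.inr ⟨hp.1, hp.2.1, hp.2.2, hl, h⟩
    · exact Or.inl (Or.inl ⟨hp.1, hp.2.1, hp.2.2, hl⟩)
  have h6' : ((primesUpTo T₂ X).card : ℝ) ≤ (primesUpTo {p | p ∈ T₂ ∧ ¬(ord p).Prime} X).card +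
      (primesUpTo {p | p ∈ T₂ ∧ (ord p).Prime ∧ (ord p : ℝ) ≤ η * X} X).card +
      (primesUpTo {p | p ∈ T₂ ∧ (ord p).Prime ∧ η * X < ord p} X).card := by exact_mod_cast h6
  have h5' : ((primesUpTo {p | p ∈ T₂ ∧ (ord p).Prime ∧ η * X < ord p} X).card : ℝ) ≤ ε / 3 * (X / Real.log X) :=
    le_trans (by exact_mod_cast h5) h4
  linarith

end EC

end

namespace EC

theorem xc_even {n : ℕ} (hn : Even n) (h0 : n ≠ 0) : 0 < xc (n • P) := by
  have hd := (d_nsmul_P n).2 hn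
  have hne := nsmul_P_ne_zero h0
  rw [d_of_ne hne] at hd
  set x := xc (n • P)
  have h1 : 0 < x ^ 2 + 10 * x - 25 := by
    have := (div_pos_iff_of_pos_right (by positivity : (0 : ℚ) < x ^ 2 + 25)).1 hd
    exact this
  have h2 : 0 ≤ x ^ 3 - 25 * x := by
    have := yc_sq (n • P)
    rw [← this]
    positivity
  by_contra hx
  push Not at hx
  have h3 : x ≤ -5 ∨ x > -5 := le_or_gt _ _
  rcases h3 with h3 | h3
  · have h4 : x < -10 := by nlinarith
    nlinarith [mul_pos_of_neg_of_neg (show x < 0 by linarith) (show 5 + x < 0 by linarith)]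
  · nlinarith

theorem xc_nsmul_ne_zero {n : ℕ} (h0 : n ≠ 0) : xc (n • P) ≠ 0 := by
  rcases Nat.even_or_odd n with h | h
  · exact (xc_even h h0).ne'
  · have := (xc_odd (n := n) (by exact_mod_cast h)).2
    rw [natCast_zsmul] at this
    exact this.ne

theorem xc_add_mul_xc_sub {A B : Q} (hA : A ≠ 0) (hB : B ≠ 0) (h : xc A ≠ xc B) :
    xc (A + B) * xc (A - B) * (xc A - xc B) ^ 2 = (xc A * xc B + 25) ^ 2 := by
  obtain ⟨-, h1, -⟩ := add_of_xc_ne hA hB h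
  obtain ⟨-, h2, -⟩ := add_of_xc_ne (B := -B) hA (neg_ne_zero.2 hB) (by rwa [xc_neg])
  rw [sub_eq_add_neg A B, h1, h2, xc_neg, yc_neg]
  have hx : xc A - xc B ≠ 0 := sub_ne_zero.2 h
  have ha := yc_sq A
  have hb := yc_sq B
  generalize xc A = x at *
  generalize xc B = z at *
  generalize yc A = y at *
  generalize yc B = w at *
  have e1 : ((y - w) / (x - z)) ^ 2 - x - z = ((y - w) ^ 2 - (x + z) * (x - z) ^ 2) / (x - z) ^ 2 := by
    field_simp; ring
  have e2 : ((y - -w) / (x - z)) ^ 2 - x - z = ((y + w) ^ 2 - (x + z) * (x - z) ^ 2) / (x - z) ^ 2 := by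
    field_simp; ring
  rw [e1, e2, div_mul_div_comm, div_mul_eq_mul_div, div_eq_iff (by positivity)]
  have e3 : ((y - w) ^ 2 - (x + z) * (x - z) ^ 2) * ((y + w) ^ 2 - (x + z) * (x - z) ^ 2) =
      (y ^ 2 - w ^ 2) ^ 2 - 2 * (y ^ 2 + w ^ 2) * (x + z) * (x - z) ^ 2 + (x + z) ^ 2 * (x - z) ^ 4 := by ring
  rw [e3, ha, hb]
  ring

theorem xc_nsmul_ne {n : ℕ} (hn : 2 ≤ n) : xc (n • P) ≠ xc P := by
  intro h
  have hP : P ≠ 0 := P_ne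
  rcases eq_or_eq_neg_of_xc (nsmul_P_ne_zero (by omega)) hP h with h | h
  · have := @zsmul_P_injective (n : ℤ) 1 (by simpa using h)
    omega
  · have := @zsmul_P_injective (n : ℤ) (-1) (by simpa using h)
    omega

/-- The absolute difference of the two entries, or their sum, according to the sign. -/
def natComb (b : Bool) (u v : ℕ) : ℕ := cond b (u + v) ((u - v) + (v - u))

/-- Numerators and denominators of `|x|` at two consecutive multiples of `P`, starting with `P`. -/
def xState : ℕ → (ℕ × ℕ) × (ℕ × ℕ)
  | 0 => ((4, 1), (1681, 144))
  | k + 1 => ((xState k).2,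
      ((natComb (Nat.bodd k) (25 * (xState k).2.2) (4 * (xState k).2.1)) ^ 2 * (xState k).1.2,
       (natComb (!(Nat.bodd k)) (4 * (xState k).2.2) (xState k).2.1) ^ 2 * (xState k).1.1))

theorem natComb_true (u v : ℕ) : ((natComb true u v : ℕ) : ℚ) ^ 2 = (u + v) ^ 2 := by simp [natComb]

theorem natComb_false (u v : ℕ) : ((natComb false u v : ℕ) : ℚ) ^ 2 = (u - v) ^ 2 := by
  simp only [natComb, cond_false]
  rcases le_total u v with h | h
  · rw [Nat.sub_eq_zero_of_le h, zero_add, Nat.cast_sub h]; ring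
  · rw [Nat.sub_eq_zero_of_le h, add_zero, Nat.cast_sub h]

theorem xc_two : xc (2 • P) = 1681 / 144 := by
  rw [two_nsmul, (add_self_of_yc_ne (by rw [yc_P]; norm_num)).2.1, xc_P, yc_P]; norm_num

theorem xState_spec (k : ℕ) :
    (0 < (xState k).1.1 ∧ 0 < (xState k).1.2 ∧ |xc ((k + 1) • P)| = ((xState k).1.1 : ℚ) / (xState k).1.2) ∧
    (0 < (xState k).2.1 ∧ 0 < (xState k).2.2 ∧ |xc ((k + 2) • P)| = ((xState k).2.1 : ℚ) / (xState k).2.2) := by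
  induction k with
  | zero =>
    refine ⟨⟨by norm_num [xState], by norm_num [xState], ?_⟩, by norm_num [xState], by norm_num [xState], ?_⟩
    · rw [zero_add, one_nsmul, xc_P]; norm_num [xState]
    · rw [zero_add, xc_two]; norm_num [xState]
  | succ k ih =>
    obtain ⟨⟨a1, b1, h1⟩, a2, b2, h2⟩ := ih
    refine ⟨⟨a2, b2, h2⟩, ?_⟩
    have hrec := xc_add_mul_xc_sub (A := (k + 2) • P) (B := P) (nsmul_P_ne_zero (by omega)) P_ne (xc_nsmul_ne (by omega))
    have e1 : (k + 2) • P + P = (k + 1 + 2) • P := by rw [← succ_nsmul]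
    have e2 : (k + 2) • P - P = (k + 1) • P := by rw [show k + 2 = (k + 1) + 1 by rfl, succ_nsmul, add_sub_cancel_right]
    rw [e1, e2, xc_P] at hrec
    have hx := xc_nsmul_ne (n := k + 2) (by omega)
    rw [xc_P] at hx
    have hX := xc_nsmul_ne_zero (n := k + 1 + 2) (by omega)
    simp only [xState]
    set A := (xState k).2.1
    set B := (xState k).2.2
    set A' := (xState k).1.1
    set B' := (xState k).1.2
    set x := xc ((k + 2) • P)
    set X := xc ((k + 1 + 2) • P)
    have hB : (0 : ℚ) < B := by exact_mod_cast b2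
    have hA' : (0 : ℚ) < A' := by exact_mod_cast a1
    have hB' : (0 : ℚ) < B' := by exact_mod_cast b1
    have key : ((natComb (Nat.bodd k) (25 * B) (4 * A) : ℕ) : ℚ) ^ 2 = (25 - 4 * x) ^ 2 * B ^ 2 ∧
        ((natComb (!(Nat.bodd k)) (4 * B) A : ℕ) : ℚ) ^ 2 = (x + 4) ^ 2 * B ^ 2 := by
      rcases Nat.even_or_odd k with hk | hk
      · have hpos : 0 < x := xc_even (by rw [Nat.even_add]; simpa using hk) (by omega)
        rw [abs_of_pos hpos] at h2
        have hb : Nat.bodd k = false := by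
          obtain ⟨j, rfl⟩ := hk
          simp
        rw [hb, Bool.not_false, natComb_true, natComb_false, h2]
        push_cast
        constructor
        · field_simp
        · field_simp
          ring
      · have hneg : x < 0 := by
          have := (xc_odd (n := (k + 2 : ℕ)) (by exact_mod_cast (by rw [Nat.odd_add]; simpa using hk))).2
          rwa [natCast_zsmul] at this
        rw [abs_of_neg hneg] at h2
        have h2' : x = -((A : ℚ) / B) := by linarith
        have hb : Nat.bodd k = true := by
          obtain ⟨j, rfl⟩ := hk
          simp [show Nat.bodd 2 = false from rfl]
        rw [hb, Bool.not_true, natComb_true, natComb_false, h2']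
        push_cast
        constructor <;> (field_simp; ring)
    have hrec' : |X| * |xc ((k + 1) • P)| * (x + 4) ^ 2 = (25 - 4 * x) ^ 2 := by
      have := congrArg abs hrec
      rw [abs_mul, abs_mul, abs_of_nonneg (sq_nonneg (x - -4)), abs_of_nonneg (sq_nonneg (x * -4 + 25))] at this
      linear_combination this
    have hx4 : (x + 4) ^ 2 ≠ 0 := pow_ne_zero _ fun h => hx (by linarith)
    have hval : |X| = (((natComb (Nat.bodd k) (25 * B) (4 * A)) ^ 2 * B' : ℕ) : ℚ) /
        (((natComb (!(Nat.bodd k)) (4 * B) A) ^ 2 * A' : ℕ) : ℚ) := by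
      push_cast
      rw [key.1, key.2, eq_div_iff (by positivity), ← hrec', h1]
      field_simp
    have hXpos : 0 < |X| := abs_pos.2 hX
    have hden : (((natComb (!(Nat.bodd k)) (4 * B) A) ^ 2 * A' : ℕ) : ℚ) ≠ 0 := by
      push_cast
      rw [key.2]
      positivity
    refine ⟨?_, ?_, hval⟩
    · rw [Nat.pos_iff_ne_zero]
      intro h0
      rw [hval, h0, Nat.cast_zero, zero_div] at hXpos
      exact lt_irrefl _ hXpos
    · rw [Nat.pos_iff_ne_zero]
      intro h0
      exact hden (by rw [h0, Nat.cast_zero])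

end EC

namespace PrimrecAux

variable {α β : Type*} [Primcodable α] [Primcodable β]

theorem forall_mem {f : α → List β} {R : β → α → Prop} (hf : Primrec f) (hR : PrimrecRel R) :
    PrimrecPred fun a => ∀ b ∈ f a, R b a :=
  hR.forall_mem_list.comp hf Primrec.id

theorem exists_mem {f : α → List β} {R : β → α → Prop} (hf : Primrec f) (hR : PrimrecRel R) :
    PrimrecPred fun a => ∃ b ∈ f a, R b a :=
  hR.exists_mem_list.comp hf Primrec.id

theorem forall_lt {f : α → ℕ} {R : ℕ → α → Prop} (hf : Primrec f) (hR : PrimrecRel R) :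
    PrimrecPred fun a => ∀ n < f a, R n a :=
  (forall_mem (Primrec.list_range.comp hf) hR).of_eq fun a => by simp

theorem count {f : α → ℕ} {R : ℕ → α → Prop} [∀ a, DecidablePred fun n => R n a]
    (hf : Primrec f) (hR : PrimrecRel R) :
    Primrec fun a => ((Finset.range (f a)).filter fun n => R n a).card := by
  classical
  have h1 : Primrec₂ fun (L : List ℕ) (b : α) => List.filter (fun n => R n b) L := hR.listFilter
  have h2 : Primrec fun a => (List.filter (fun n => R n a) (List.range (f a))).length :=
    Primrec.list_length.comp (h1.comp (Primrec.list_range.comp hf) Primrec.id)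
  refine h2.of_eq fun a => ?_
  rw [← List.toFinset_card_of_nodup (List.nodup_range.filter _), List.toFinset_filter,
    List.toFinset_range]
  congr 1
  ext n
  simp

theorem dvd {f g : α → ℕ} (hf : Primrec f) (hg : Primrec g) : PrimrecPred fun a => f a ∣ g a :=
  (Primrec.eq.comp (Primrec.nat_mod.comp hg hf) (Primrec.const 0)).of_eq fun _ =>
    (Nat.dvd_iff_mod_eq_zero).symm

theorem nat_le {f g : α → ℕ} (hf : Primrec f) (hg : Primrec g) : PrimrecPred fun a => f a ≤ g a :=
  Primrec.nat_le.comp hf hg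

theorem nat_lt {f g : α → ℕ} (hf : Primrec f) (hg : Primrec g) : PrimrecPred fun a => f a < g a :=
  Primrec.nat_lt.comp hf hg

theorem nat_eq {f g : α → ℕ} (hf : Primrec f) (hg : Primrec g) : PrimrecPred fun a => f a = g a :=
  Primrec.eq.comp hf hg

theorem imp {p q : α → Prop} (hp : PrimrecPred p) (hq : PrimrecPred q) :
    PrimrecPred fun a => p a → q a :=
  (hp.not.or hq).of_eq fun _ => imp_iff_not_or.symm

theorem add {f g : α → ℕ} (hf : Primrec f) (hg : Primrec g) : Primrec fun a => f a + g a :=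
  Primrec.nat_add.comp hf hg

theorem sub {f g : α → ℕ} (hf : Primrec f) (hg : Primrec g) : Primrec fun a => f a - g a :=
  Primrec.nat_sub.comp hf hg

theorem mul {f g : α → ℕ} (hf : Primrec f) (hg : Primrec g) : Primrec fun a => f a * g a :=
  Primrec.nat_mul.comp hf hg

theorem pow {f : α → ℕ} (hf : Primrec f) (k : ℕ) : Primrec fun a => f a ^ k := by
  induction k with
  | zero => exact (Primrec.const 1).of_eq fun a => (pow_zero _).symm
  | succ k ih => exact (mul ih hf).of_eq fun a => (pow_succ _ _).symm

theorem prime {f : α → ℕ} (hf : Primrec f) : PrimrecPred fun a => (f a).Prime := by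
  refine PrimrecPred.comp (p := Nat.Prime) ?_ hf
  refine ((nat_le (Primrec.const 2) Primrec.id).and (forall_lt (R := fun m p => m ∣ p → m = 1) Primrec.id
    ?_)).of_eq fun p => (Nat.prime_def_lt).symm
  exact imp (dvd Primrec.fst Primrec.snd) (nat_eq Primrec.fst (Primrec.const 1))

theorem gcd {f g : α → ℕ} (hf : Primrec f) (hg : Primrec g) : Primrec fun a => Nat.gcd (f a) (g a) := by
  have h : Primrec fun a => Nat.findGreatest (fun d => d ∣ f a ∧ d ∣ g a) (f a + g a) :=
    Primrec.nat_findGreatest (add hf hg)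
      ((dvd Primrec.snd (hf.comp Primrec.fst)).and (dvd Primrec.snd (hg.comp Primrec.fst)))
  refine h.of_eq fun a => ?_
  rw [Nat.findGreatest_eq_iff]
  refine ⟨?_, fun _ => ⟨Nat.gcd_dvd_left _ _, Nat.gcd_dvd_right _ _⟩, fun n hn hle hd => ?_⟩
  · rcases Nat.eq_zero_or_pos (f a) with h0 | h0
    · rw [h0, Nat.gcd_zero_left]; omega
    · exact (Nat.gcd_le_left _ h0).trans (Nat.le_add_right _ _)
  · have h1 := Nat.dvd_gcd hd.1 hd.2
    rcases Nat.eq_zero_or_pos (Nat.gcd (f a) (g a)) with h0 | h0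
    · rw [Nat.gcd_eq_zero_iff] at h0; omega
    · exact absurd (Nat.le_of_dvd h0 h1) (by omega)

theorem factorial {f : α → ℕ} (hf : Primrec f) : Primrec fun a => (f a).factorial := by
  refine Primrec.comp (f := Nat.factorial) ?_ hf
  refine (Primrec.nat_rec₁ (f := fun n x => (n + 1) * x) 1
    (mul (Primrec.succ.comp Primrec.fst) Primrec.snd)).of_eq fun n => ?_
  induction n with
  | zero => rfl
  | succ n ih => rw [Nat.factorial_succ, ← ih]

end PrimrecAux

namespace EC
open PrimrecAux

lemma den_div_nat {a b : ℕ} (hb : 0 < b) : ((a : ℚ) / b).den = b / Nat.gcd a b := by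
  have h := Rat.den_div_eq_of_coprime (a := ((a / Nat.gcd a b : ℕ) : ℤ)) (b := ((b / Nat.gcd a b : ℕ) : ℤ))
    (by exact_mod_cast Nat.div_gcd_pos_of_pos_right a hb)
    (by rw [Int.natAbs_natCast, Int.natAbs_natCast]; exact Nat.coprime_div_gcd_div_gcd (Nat.gcd_pos_of_pos_right a hb))
  have hg : ((Nat.gcd a b : ℕ) : ℚ) ≠ 0 := by exact_mod_cast (Nat.gcd_pos_of_pos_right a hb).ne'
  have e : (a : ℚ) / b = (((a / Nat.gcd a b : ℕ) : ℤ) : ℚ) / (((b / Nat.gcd a b : ℕ) : ℤ) : ℚ) := by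
    rw [Int.cast_natCast, Int.cast_natCast, Nat.cast_div (Nat.gcd_dvd_left a b) hg,
      Nat.cast_div (Nat.gcd_dvd_right a b) hg, div_div_div_cancel_right₀ hg]
  rw [e]
  exact_mod_cast h

lemma dn_succ (k : ℕ) : dn (k + 1) = (xState k).1.2 / Nat.gcd (xState k).1.1 (xState k).1.2 := by
  obtain ⟨⟨-, hb, h⟩, -⟩ := xState_spec k
  rw [← den_div_nat hb, ← h, dn]
  rcases abs_choice (xc ((k + 1) • P)) with h' | h' <;> rw [h']
  rw [Rat.neg_den]

lemma dn_zero_eq : dn 0 = 1 := by rw [dn, zero_nsmul, xc_zero, Rat.den_zero]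

lemma primrec_xState : Primrec xState := by
  have hk : Primrec fun p : ℕ × ((ℕ × ℕ) × (ℕ × ℕ)) => Nat.bodd p.1 := Primrec.nat_bodd.comp Primrec.fst
  have h1 : Primrec fun p : ℕ × ((ℕ × ℕ) × (ℕ × ℕ)) => p.2.1 := Primrec.fst.comp Primrec.snd
  have h2 : Primrec fun p : ℕ × ((ℕ × ℕ) × (ℕ × ℕ)) => p.2.2 := Primrec.snd.comp Primrec.snd
  have hc : ∀ {b : ℕ × ((ℕ × ℕ) × (ℕ × ℕ)) → Bool} {u v : ℕ × ((ℕ × ℕ) × (ℕ × ℕ)) → ℕ}, Primrec b →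
      Primrec u → Primrec v → Primrec fun p => natComb (b p) (u p) (v p) := fun hb hu hv =>
    Primrec.cond hb (add hu hv) (add (sub hu hv) (sub hv hu))
  have h : Primrec₂ fun (k : ℕ) (q : (ℕ × ℕ) × (ℕ × ℕ)) => (q.2,
      ((natComb (Nat.bodd k) (25 * q.2.2) (4 * q.2.1)) ^ 2 * q.1.2,
       (natComb (!(Nat.bodd k)) (4 * q.2.2) q.2.1) ^ 2 * q.1.1)) := by
    refine Primrec.pair h2 (Primrec.pair (mul (pow (hc hk (mul (Primrec.const 25) (Primrec.snd.comp h2))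
      (mul (Primrec.const 4) (Primrec.fst.comp h2))) 2) (Primrec.snd.comp h1)) (mul (pow (hc
      (Primrec.not.comp hk) (mul (Primrec.const 4) (Primrec.snd.comp h2)) (Primrec.fst.comp h2)) 2)
      (Primrec.fst.comp h1)))
  refine (Primrec.nat_rec₁ ((4, 1), (1681, 144)) h).of_eq fun n => ?_
  induction n with
  | zero => rfl
  | succ n ih => simp only [xState, ih]

variable {α : Type*} [Primcodable α]

lemma primrec_dn {f : α → ℕ} (hf : Primrec f) : Primrec fun a => dn (f a) := by
  have h : Primrec fun n : ℕ => if n = 0 then 1 else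
      (xState (n - 1)).1.2 / Nat.gcd (xState (n - 1)).1.1 (xState (n - 1)).1.2 := by
    have hx : Primrec fun n : ℕ => (xState (n - 1)).1 :=
      Primrec.fst.comp (primrec_xState.comp (sub Primrec.id (Primrec.const 1)))
    exact Primrec.ite (nat_eq Primrec.id (Primrec.const 0)) (Primrec.const 1)
      (Primrec.nat_div.comp (Primrec.snd.comp hx) (gcd (Primrec.fst.comp hx) (Primrec.snd.comp hx)))
  refine Primrec.comp (f := dn) (h.of_eq fun n => ?_) hf
  cases n with
  | zero => exact dn_zero_eq.symm
  | succ n => exact (dn_succ n).symm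

/-- A search bounded by `2 p + 1` for the order of `P` modulo `p`. -/
noncomputable def ordB (p : ℕ) : ℕ := by
  classical
  exact ((Finset.range (2 * p + 2)).filter fun n => ∀ j < n + 1, 0 < j → ¬ p ∣ dn j).card

lemma ordB_eq {p : ℕ} (hp : p.Prime) (h5 : 5 < p) : ordB p = ord p := by
  classical
  have e : ((Finset.range (2 * p + 2)).filter fun n => ∀ j < n + 1, 0 < j → ¬ p ∣ dn j) =
      Finset.range (ord p) := by
    ext n
    have hle := ord_le hp h5
    rw [Finset.mem_filter, Finset.mem_range, Finset.mem_range]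
    constructor
    · rintro ⟨-, h⟩
      by_contra hn
      exact h (ord p) (by omega) (ord_pos hp h5) ((dvd_dn_iff hp h5 (ord_pos hp h5).ne').2 dvd_rfl)
    · intro h
      refine ⟨by omega, fun j hj h0 hd => ?_⟩
      have := Nat.le_of_dvd h0 ((dvd_dn_iff hp h5 h0.ne').1 hd)
      omega
  unfold ordB
  rw [e, Finset.card_range]

lemma primrec_ordB : Primrec ordB := by
  classical
  exact count (R := fun n p => ∀ j < n + 1, 0 < j → ¬ p ∣ dn j)
    (add (mul (Primrec.const 2) Primrec.id) (Primrec.const 2))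
    (forall_lt (R := fun j (q : ℕ × ℕ) => 0 < j → ¬ q.2 ∣ dn j) (Primrec.succ.comp Primrec.fst)
      (imp (nat_lt (Primrec.const 0) Primrec.fst)
        (dvd (Primrec.snd.comp Primrec.snd) (primrec_dn Primrec.fst)).not))

lemma primrec_nbr {f g : α → ℕ} (hf : Primrec f) (hg : Primrec g) : PrimrecPred fun a => Nbr (f a) (g a) :=
  (dvd hg (sub hf (Primrec.const 1))).or (dvd hg (add hf (Primrec.const 1)))

lemma condP_iff {m : ℕ} (hm : 2 ≤ m) : CondP m ↔ ∀ X < dn (m - 1) * dn (m + 1) + 1,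
    ((Finset.range (X + 1)).filter fun p => p.Prime ∧ 5 < p ∧ Nbr m (ordB p)).card ^ 8 ≤ X ^ 7 := by
  have e : ∀ X : ℕ, ((Finset.range (X + 1)).filter fun p => p.Prime ∧ 5 < p ∧ Nbr m (ordB p)) =
      (Finset.range (X + 1)).filter fun p => p.Prime ∧ 5 < p ∧ Nbr m (ord p) := fun X => by
    refine Finset.filter_congr fun p _ => ?_
    constructor <;> rintro ⟨h1, h2, h3⟩
    · exact ⟨h1, h2, ordB_eq h1 h2 ▸ h3⟩
    · exact ⟨h1, h2, (ordB_eq h1 h2).symm ▸ h3⟩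
  simp only [e]
  refine ⟨fun h X _ => h X, fun h X => ?_⟩
  rcases Nat.lt_or_ge X (dn (m - 1) * dn (m + 1) + 1) with hX | hX
  · exact h X hX
  · refine le_trans (Nat.pow_le_pow_left (Finset.card_le_card ?_) 8)
      ((h (dn (m - 1) * dn (m + 1)) (Nat.lt_succ_self _)).trans (Nat.pow_le_pow_left (by omega) 7))
    intro p hp
    rw [Finset.mem_filter, Finset.mem_range] at hp ⊢
    refine ⟨?_, hp.2⟩
    have hd : p ∣ dn (m - 1) * dn (m + 1) := by
      rcases hp.2.2.2 with h' | h'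
      · exact ((dvd_dn_iff hp.2.1 hp.2.2.1 (by omega)).2 h').mul_right _
      · exact ((dvd_dn_iff hp.2.1 hp.2.2.1 (by omega)).2 h').mul_left _
    have := Nat.le_of_dvd (mul_pos (dn_pos _) (dn_pos _)) hd
    omega

lemma condA_iff {m : ℕ} (hm : 2 ≤ m) : CondA m ↔ ∀ Y < m + 2,
    ((Finset.range (Y + 1)).filter fun a => 1 < a ∧ Nbr m a).card ^ 4 ≤ Y := by
  refine ⟨fun h Y _ => h Y, fun h Y => ?_⟩
  rcases Nat.lt_or_ge Y (m + 2) with hY | hY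
  · exact h Y hY
  · refine le_trans (Nat.pow_le_pow_left (Finset.card_le_card ?_) 4)
      ((h (m + 1) (Nat.lt_succ_self _)).trans (by omega))
    intro a ha
    rw [Finset.mem_filter, Finset.mem_range] at ha ⊢
    exact ⟨by have := ha.2.2.le hm; omega, ha.2⟩

lemma condN_iff {m : ℕ} (hm : 2 ≤ m) : CondN m ↔ ∀ n < m + 2, 1 < n → ¬ n = m - 1 → Nbr m n →
    ¬ Nbr m (n + 2) := by
  refine ⟨fun h n _ => h n, fun h n h1 h2 h3 => h n ?_ h1 h2 h3⟩
  have := h3.le hm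
  omega

lemma tgt_iff {i m : ℕ} (hm : 2 ≤ m) (h2 : 2 ∣ m) : Tgt (gi i) (m • P) ↔
    (xState (m - 1)).1.1 ^ 2 < 25 * (xState (m - 1)).1.2 ^ 2 +
      ((60 * (2 * i + 1)) ^ 2 + 1) * ((xState (m - 1)).1.1 * (xState (m - 1)).1.2) ∧
    25 * (xState (m - 1)).1.2 ^ 2 + (60 * (2 * i + 1)) ^ 2 * ((xState (m - 1)).1.1 * (xState (m - 1)).1.2) <
      (xState (m - 1)).1.1 ^ 2 + (xState (m - 1)).1.1 * (xState (m - 1)).1.2 := by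
  obtain ⟨⟨ha, hb, h⟩, -⟩ := xState_spec (m - 1)
  rw [Nat.sub_add_cancel (by omega)] at h
  have hpos : 0 < xc (m • P) := xc_even (even_iff_two_dvd.2 h2) (by omega)
  rw [abs_of_pos hpos] at h
  rw [Tgt, and_iff_right hpos, h]
  generalize (xState (m - 1)).1.1 = A at *
  generalize (xState (m - 1)).1.2 = B at *
  have hA : (0 : ℚ) < A := by exact_mod_cast ha
  have hB : (0 : ℚ) < B := by exact_mod_cast hb
  have e : (A : ℚ) / B - 25 / ((A : ℚ) / B) = ((A : ℚ) ^ 2 - 25 * B ^ 2) / (A * B) := by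
    field_simp
  rw [e, abs_sub_lt_iff, sub_lt_iff_lt_add, sub_lt_comm, div_lt_iff₀ (by positivity),
    lt_div_iff₀ (by positivity), gi]
  rw [← Nat.cast_lt (α := ℚ), ← Nat.cast_lt (α := ℚ)]
  push_cast
  constructor <;> rintro ⟨h1, h2⟩ <;> constructor <;> linarith

lemma two_le_of_ok {i z m : ℕ} (h : Ok i z m) : 2 ≤ m ∧ 2 ∣ m := by
  have h2 : 2 ∣ m := ((Nat.dvd_factorial (by norm_num) (by norm_num : 2 ≤ 101)).trans
    (Dvd.intro_left N₁ rfl : (101).factorial ∣ N₀)).trans ((Dvd.intro _ rfl).trans h.2.1)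
  exact ⟨Nat.le_of_dvd h.1 h2, h2⟩

lemma primrec_ok : PrimrecPred fun q : (ℕ × ℕ) × ℕ => Ok q.1.1 q.1.2 q.2 := by
  have hi : Primrec fun q : (ℕ × ℕ) × ℕ => q.1.1 := Primrec.fst.comp Primrec.fst
  have hz : Primrec fun q : (ℕ × ℕ) × ℕ => q.1.2 := Primrec.snd.comp Primrec.fst
  have hm : Primrec fun q : (ℕ × ℕ) × ℕ => q.2 := Primrec.snd
  have hx : Primrec fun q : (ℕ × ℕ) × ℕ => (xState (q.2 - 1)).1 :=
    Primrec.fst.comp (primrec_xState.comp (sub hm (Primrec.const 1)))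
  have hA := Primrec.fst.comp hx
  have hB := Primrec.snd.comp hx
  have hg : Primrec fun q : (ℕ × ℕ) × ℕ => (60 * (2 * q.1.1 + 1)) ^ 2 :=
    pow (mul (Primrec.const 60) (add (mul (Primrec.const 2) hi) (Primrec.const 1))) 2
  have hP := forall_lt (f := fun q : (ℕ × ℕ) × ℕ => dn (q.2 - 1) * dn (q.2 + 1) + 1) (R := fun X q =>
      ((Finset.range (X + 1)).filter fun p => p.Prime ∧ 5 < p ∧ Nbr q.2 (ordB p)).card ^ 8 ≤ X ^ 7)
    (add (mul (primrec_dn (sub hm (Primrec.const 1))) (primrec_dn (add hm (Primrec.const 1)))) (Primrec.const 1))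
    (nat_le (pow (count (R := fun p (r : ℕ × ((ℕ × ℕ) × ℕ)) => p.Prime ∧ 5 < p ∧ Nbr r.2.2 (ordB p))
      (Primrec.succ.comp Primrec.fst) ((prime Primrec.fst).and ((nat_lt (Primrec.const 5) Primrec.fst).and
        (primrec_nbr (Primrec.snd.comp (Primrec.snd.comp Primrec.snd)) (primrec_ordB.comp Primrec.fst))))) 8)
      (pow Primrec.fst 7))
  have hA' := forall_lt (f := fun q : (ℕ × ℕ) × ℕ => q.2 + 2) (R := fun Y q =>
      ((Finset.range (Y + 1)).filter fun a => 1 < a ∧ Nbr q.2 a).card ^ 4 ≤ Y)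
    (add hm (Primrec.const 2))
    (nat_le (pow (count (R := fun a (r : ℕ × ((ℕ × ℕ) × ℕ)) => 1 < a ∧ Nbr r.2.2 a)
      (Primrec.succ.comp Primrec.fst) ((nat_lt (Primrec.const 1) Primrec.fst).and
        (primrec_nbr (Primrec.snd.comp (Primrec.snd.comp Primrec.snd)) Primrec.fst))) 4)
      Primrec.fst)
  have hN := forall_lt (f := fun q : (ℕ × ℕ) × ℕ => q.2 + 2) (R := fun n q =>
      1 < n → ¬ n = q.2 - 1 → Nbr q.2 n → ¬ Nbr q.2 (n + 2))
    (add hm (Primrec.const 2))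
    (imp (nat_lt (Primrec.const 1) Primrec.fst) (imp (nat_eq Primrec.fst
      (sub (hm.comp Primrec.snd) (Primrec.const 1))).not (imp (primrec_nbr (hm.comp Primrec.snd) Primrec.fst)
      (primrec_nbr (hm.comp Primrec.snd) (add Primrec.fst (Primrec.const 2))).not)))
  have hT : PrimrecPred fun q : (ℕ × ℕ) × ℕ => (xState (q.2 - 1)).1.1 ^ 2 < 25 * (xState (q.2 - 1)).1.2 ^ 2 +
      ((60 * (2 * q.1.1 + 1)) ^ 2 + 1) * ((xState (q.2 - 1)).1.1 * (xState (q.2 - 1)).1.2) ∧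
    25 * (xState (q.2 - 1)).1.2 ^ 2 + (60 * (2 * q.1.1 + 1)) ^ 2 * ((xState (q.2 - 1)).1.1 * (xState (q.2 - 1)).1.2) <
      (xState (q.2 - 1)).1.1 ^ 2 + (xState (q.2 - 1)).1.1 * (xState (q.2 - 1)).1.2 :=
    (nat_lt (pow hA 2) (add (mul (Primrec.const 25) (pow hB 2)) (mul (add hg (Primrec.const 1)) (mul hA hB)))).and
      (nat_lt (add (mul (Primrec.const 25) (pow hB 2)) (mul hg (mul hA hB))) (add (pow hA 2) (mul hA hB)))
  refine (((nat_le (Primrec.const 2) hm).and (dvd (Primrec.const 2) hm)).and ((dvd (mul (Primrec.const N₀)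
    (factorial hz)) hm).and (hT.and (hP.and (hA'.and hN))))).of_eq fun q => ?_
  constructor
  · rintro ⟨⟨h, h'⟩, h1, h2, h3, h4, h5⟩
    exact ⟨by omega, h1, (tgt_iff h h').2 h2, (condP_iff h).2 h3, (condA_iff h).2 h4, (condN_iff h).2 h5⟩
  · intro hok
    obtain ⟨h, h'⟩ := two_le_of_ok hok
    obtain ⟨-, h1, h2, h3, h4, h5⟩ := hok
    exact ⟨⟨h, h'⟩, h1, (tgt_iff h h').1 h2, (condP_iff h).1 h3, (condA_iff h).1 h4, (condN_iff h).1 h5⟩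

end EC

namespace EC
open PrimrecAux

lemma computable_nextM : Computable fun q : ℕ × ℕ => nextM q.1 q.2 := by
  classical
  have h := Computable.find (P := fun (q : ℕ × ℕ) m => Ok q.1 q.2 m) primrec_ok.computablePred
    fun q => ⟨_, nextM_ok q.1 q.2⟩
  refine h.of_eq fun q => ?_
  refine Eq.trans ?_ (Nat.sInf_def (s := {m | Ok q.1 q.2 m}) ⟨_, nextM_ok q.1 q.2⟩).symm
  congr!

/-- The roughness bound `zs n` together with the list of the first `n` chosen multiples. -/
noncomputable def msList : ℕ → ℕ × List ℕ
  | 0 => (101, [])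
  | n + 1 => (nextM n (msList n).1 + 4, nextM n (msList n).1 :: (msList n).2)

lemma msList_fst (n : ℕ) : (msList n).1 = zs n := by
  induction n with
  | zero => rfl
  | succ n ih => rw [msList, ih]; rfl

lemma mem_msList {n m : ℕ} : m ∈ (msList n).2 ↔ ∃ j < n, m = ms j := by
  induction n with
  | zero => simp [msList]
  | succ n ih =>
    rw [msList, List.mem_cons, ih, msList_fst]
    constructor
    · rintro (h | ⟨j, hj, h⟩)
      · exact ⟨n, n.lt_succ_self, h⟩
      · exact ⟨j, by omega, h⟩
    · rintro ⟨j, hj, h⟩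
      rcases Nat.lt_succ_iff_lt_or_eq.1 hj with h' | rfl
      · exact Or.inr ⟨j, h', h⟩
      · exact Or.inl h

lemma computable_rec_list {F : ℕ × ℕ → ℕ} (hF : Computable F) {G : ℕ → ℕ × List ℕ} {c : ℕ × List ℕ}
    (h0 : G 0 = c) (hs : ∀ n, G (n + 1) = (F (n, (G n).1) + 4, F (n, (G n).1) :: (G n).2)) :
    Computable G := by
  have hn : Computable fun q : ℕ × (ℕ × (ℕ × List ℕ)) => F (q.2.1, q.2.2.1) :=
    hF.comp ((Primrec.fst.comp Primrec.snd).pair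
      (Primrec.fst.comp (Primrec.snd.comp Primrec.snd))).to_comp
  have hl : Computable fun q : ℕ × (ℕ × (ℕ × List ℕ)) => q.2.2.2 :=
    (Primrec.snd.comp (Primrec.snd.comp Primrec.snd)).to_comp
  have h4 : Computable fun q : ℕ × (ℕ × (ℕ × List ℕ)) => F (q.2.1, q.2.2.1) + 4 :=
    (add Primrec.id (Primrec.const 4)).to_comp.comp hn
  have hcons : Computable fun q : ℕ × (ℕ × (ℕ × List ℕ)) => F (q.2.1, q.2.2.1) :: q.2.2.2 :=
    Primrec.list_cons.to_comp.comp hn hl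
  have h : Computable₂ fun (_ : ℕ) (r : ℕ × (ℕ × List ℕ)) => (F (r.1, r.2.1) + 4, F (r.1, r.2.1) :: r.2.2) :=
    Computable.pair h4 hcons
  refine (Computable.nat_rec Computable.id (Computable.const c) h).of_eq fun n => ?_
  induction n with
  | zero => exact h0.symm
  | succ n ih =>
    rw [hs, ← ih]
    rfl

lemma computable_msList : Computable msList := computable_rec_list computable_nextM rfl fun _ => rfl

lemma isU_iff {a N : ℕ} (h : a < N) : IsU a ↔ ∃ m ∈ (msList N).2, Nbr m a := by
  constructor
  · rintro ⟨i, hi⟩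
    rcases Nat.lt_trichotomy a 1 with h1 | rfl | h1
    · have h2 := two_le_ms i
      obtain rfl : a = 0 := by omega
      rcases hi with hi | hi <;> rw [zero_dvd_iff] at hi <;> omega
    · exact ⟨ms 0, mem_msList.2 ⟨0, by omega, rfl⟩, Or.inl (one_dvd _)⟩
    · have hi' : i < N := by
        have := zs_le_of_nbr hi h1
        have := zs_mono.le_apply (x := i)
        omega
      exact ⟨ms i, mem_msList.2 ⟨i, hi', rfl⟩, hi⟩
  · rintro ⟨m, hm, hn⟩
    obtain ⟨j, -, rfl⟩ := mem_msList.1 hm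
    exact ⟨j, hn⟩

variable {α : Type*} [Primcodable α]

lemma primrec_exists_nbr {f : α → ℕ} {l : α → List ℕ} (hf : Primrec f) (hl : Primrec l) :
    PrimrecPred fun a => ∃ m ∈ l a, Nbr m (f a) :=
  exists_mem (R := fun m a => Nbr m (f a)) hl (primrec_nbr Primrec.fst (hf.comp Primrec.snd))

lemma computable_pair_msList : Computable fun p : ℕ => (p, (msList (2 * p + 2)).2) :=
  Computable.id.pair (Computable.snd.comp (computable_msList.comp
    (add (mul (Primrec.const 2) Primrec.id) (Primrec.const 2)).to_comp))

lemma _root_.ComputablePred.comp_computable {α β : Type*} [Primcodable α] [Primcodable β] {p : β → Prop}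
    {f : α → β} (hp : ComputablePred p) (hf : Computable f) : ComputablePred fun a => p (f a) := by
  classical
  exact (hp.decide.comp hf).computablePred

theorem computable_T₁ : ComputablePred fun p : ℕ => p ∈ T₁ := by
  have h : PrimrecPred fun q : ℕ × List ℕ => q.1.Prime ∧ (q.1 ≤ 5 ∨ ∃ m ∈ q.2, Nbr m (ordB q.1)) :=
    (prime Primrec.fst).and ((nat_le Primrec.fst (Primrec.const 5)).or
      (primrec_exists_nbr (primrec_ordB.comp Primrec.fst) Primrec.snd))
  refine (h.computablePred.comp_computable computable_pair_msList).of_eq fun p => ?_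
  refine and_congr_right fun (hp : p.Prime) => ?_
  rcases Nat.lt_or_ge 5 p with h5 | h5
  · have hle := ord_le hp h5
    dsimp only
    rw [ordB_eq hp h5, isU_iff (N := 2 * p + 2) (by omega)]
  · exact iff_of_true (Or.inl h5) (Or.inl h5)

theorem computable_T₂ : ComputablePred fun p : ℕ => p ∈ T₂ := by
  have ho : Primrec fun q : ℕ × List ℕ => ordB q.1 := primrec_ordB.comp Primrec.fst
  have h : PrimrecPred fun q : ℕ × List ℕ => q.1.Prime ∧ (5 < q.1 ∧
      (((∀ r < ordB q.1 + 1, r.Prime → r ∣ ordB q.1 → 101 ≤ r) ∧ (¬ (∃ m ∈ q.2, Nbr m (ordB q.1)) ∧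
        ∀ b < ordB q.1 + 1, b ∣ ordB q.1 → ¬ b = ordB q.1 → ∃ m ∈ q.2, Nbr m b)) ∧
        ∀ p' < q.1, p'.Prime → 5 < p' → ¬ ordB p' = ordB q.1)) := by
    refine (prime Primrec.fst).and ((nat_lt (Primrec.const 5) Primrec.fst).and
      (PrimrecPred.and (PrimrecPred.and ?_ (PrimrecPred.and (primrec_exists_nbr ho Primrec.snd).not ?_)) ?_))
    · exact forall_lt (R := fun r q => r.Prime → r ∣ ordB q.1 → 101 ≤ r) (Primrec.succ.comp ho)
        (imp (prime Primrec.fst) (imp (dvd Primrec.fst (ho.comp Primrec.snd))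
          (nat_le (Primrec.const 101) Primrec.fst)))
    · exact forall_lt (R := fun b q => b ∣ ordB q.1 → ¬ b = ordB q.1 → ∃ m ∈ q.2, Nbr m b)
        (Primrec.succ.comp ho) (imp (dvd Primrec.fst (ho.comp Primrec.snd))
          (imp (nat_eq Primrec.fst (ho.comp Primrec.snd)).not
            (primrec_exists_nbr Primrec.fst (Primrec.snd.comp Primrec.snd))))
    · exact forall_lt (R := fun p' q => p'.Prime → 5 < p' → ¬ ordB p' = ordB q.1) Primrec.fst
        (imp (prime Primrec.fst) (imp (nat_lt (Primrec.const 5) Primrec.fst)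
          (nat_eq (primrec_ordB.comp Primrec.fst) (ho.comp Primrec.snd)).not))
  refine (h.computablePred.comp_computable computable_pair_msList).of_eq fun p => ?_
  refine and_congr_right fun (hp : p.Prime) => and_congr_right fun (h5 : 5 < p) => ?_
  have hle := ord_le hp h5
  have hpos := ord_pos hp h5
  dsimp only
  rw [ordB_eq hp h5]
  refine and_congr (and_congr ?_ (and_congr ?_ ?_)) ?_
  · exact ⟨fun h q h1 h2 => h q (Nat.lt_succ_of_le (Nat.le_of_dvd hpos h2)) h1 h2, fun h q _ => h q⟩
  · rw [isU_iff (N := 2 * p + 2) (by omega)]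
  · constructor
    · intro h b h1 h2
      have hb := Nat.le_of_dvd hpos h1
      exact (isU_iff (N := 2 * p + 2) (by omega)).2 (h b (by omega) h1 h2)
    · intro h b hb h1 h2
      exact (isU_iff (by omega)).1 (h b h1 h2)
  · constructor <;> intro h p' h1 h2 h3
    · rw [← ordB_eq h2 h3]; exact h p' h1 h2 h3
    · rw [ordB_eq h2 h3]; exact h p' h1 h2 h3

end EC

/-- Polynomial functions on a power of a commutative ring. -/
def PolyFun {K ι : Type} [CommRing K] (f : (ι → K) → K) : Prop :=
  ∃ p : MvPolynomial ι K, ∀ t, f t = MvPolynomial.eval t p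

namespace PolyFun
variable {K ι κ : Type} [CommRing K] {f g : (ι → K) → K}

theorem const (c : K) : PolyFun fun _ : ι → K => c := ⟨MvPolynomial.C c, fun t => by simp⟩

theorem coord (i : ι) : PolyFun fun t : ι → K => t i := ⟨MvPolynomial.X i, fun t => by simp⟩

theorem add (hf : PolyFun f) (hg : PolyFun g) : PolyFun fun t => f t + g t := by
  obtain ⟨p, hp⟩ := hf
  obtain ⟨q, hq⟩ := hg
  exact ⟨p + q, fun t => by simp only [map_add, hp, hq]⟩

theorem sub (hf : PolyFun f) (hg : PolyFun g) : PolyFun fun t => f t - g t := by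
  obtain ⟨p, hp⟩ := hf
  obtain ⟨q, hq⟩ := hg
  exact ⟨p - q, fun t => by simp only [map_sub, hp, hq]⟩

theorem mul (hf : PolyFun f) (hg : PolyFun g) : PolyFun fun t => f t * g t := by
  obtain ⟨p, hp⟩ := hf
  obtain ⟨q, hq⟩ := hg
  exact ⟨p * q, fun t => by simp only [map_mul, hp, hq]⟩

theorem sq (hf : PolyFun f) : PolyFun fun t => f t ^ 2 := by
  obtain ⟨p, hp⟩ := hf
  exact ⟨p ^ 2, fun t => by simp only [map_pow, hp]⟩

theorem comp {h : (κ → K) → K} {g : κ → (ι → K) → K} (hh : PolyFun h) (hg : ∀ j, PolyFun (g j)) :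
    PolyFun fun t => h fun j => g j t := by
  obtain ⟨p, hp⟩ := hh
  choose q hq using hg
  refine ⟨MvPolynomial.bind₁ q p, fun t => ?_⟩
  simp only [hp, funext fun j => hq j t]
  exact (MvPolynomial.eval₂Hom_bind₁ (RingHom.id K) t q p).symm

theorem of_eq (hf : PolyFun f) (h : ∀ t, g t = f t) : PolyFun g := by
  rwa [funext h]

theorem inl (hf : PolyFun f) : PolyFun fun t : ι ⊕ κ → K => f fun i => t (Sum.inl i) :=
  hf.comp fun i => coord (Sum.inl i)

end PolyFun

/-- Diophantine predicates, with an arbitrary index type for the parameters. -/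
def Dio {K ι : Type} [CommRing K] (A : (ι → K) → Prop) : Prop :=
  ∃ (k : ℕ) (f : (ι ⊕ Fin k → K) → K), PolyFun f ∧ ∀ t, A t ↔ ∃ x, f (Sum.elim t x) = 0

theorem Dio.isDiophantine {K ι : Type} [CommRing K] [Fintype ι] {A : Set (ι → K)}
    (h : Dio fun t => t ∈ A) : IsDiophantine K ι A := by
  obtain ⟨k, f, ⟨p, hp⟩, h⟩ := h
  exact ⟨k, p, fun t => by simp only [h, hp]⟩

namespace Dio
variable {K ι κ : Type} [CommRing K]

theorem of_iff {A B : (ι → K) → Prop} (hA : Dio A) (h : ∀ t, B t ↔ A t) : Dio B := by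
  obtain ⟨k, f, hf, h'⟩ := hA
  exact ⟨k, f, hf, fun t => (h t).trans (h' t)⟩

theorem eq {f g : (ι → K) → K} (hf : PolyFun f) (hg : PolyFun g) : Dio fun t => f t = g t :=
  ⟨0, _, (hf.sub hg).inl, fun t => by simp [sub_eq_zero]⟩

theorem comp {A : (κ → K) → Prop} {g : κ → (ι → K) → K} (hA : Dio A) (hg : ∀ j, PolyFun (g j)) :
    Dio fun t => A fun j => g j t := by
  obtain ⟨k, f, hf, h⟩ := hA
  refine ⟨k, fun t => f (Sum.elim (fun j => g j fun i => t (Sum.inl i)) fun j => t (Sum.inr j)), ?_, fun t => ?_⟩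
  · refine (hf.comp (g := Sum.elim (fun j t => g j fun i => t (Sum.inl i)) fun j t => t (Sum.inr j)) ?_).of_eq fun t => ?_
    · rintro (j | j)
      · exact (hg j).inl
      · exact PolyFun.coord _
    · refine congrArg _ (funext ?_)
      rintro (j | j) <;> rfl
  · simp only [h]; rfl

theorem ex [Finite κ] {B : (ι → K) → (κ → K) → Prop}
    (h : Dio fun t : ι ⊕ κ → K => B (fun i => t (Sum.inl i)) fun j => t (Sum.inr j)) :
    Dio fun t => ∃ y, B t y := by
  obtain ⟨k, f, hf, h⟩ := h
  obtain ⟨n, ⟨e⟩⟩ := Finite.exists_equiv_fin κ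
  refine ⟨n + k, fun t => f (Sum.elim (Sum.elim (fun i => t (Sum.inl i))
    fun j => t (Sum.inr (Fin.castAdd k (e j)))) fun j => t (Sum.inr (Fin.natAdd n j))), ?_, fun t => ?_⟩
  · refine (hf.comp (g := Sum.elim (Sum.elim (fun i t => t (Sum.inl i))
      fun j t => t (Sum.inr (Fin.castAdd k (e j)))) fun j t => t (Sum.inr (Fin.natAdd n j))) ?_).of_eq fun t => ?_
    · rintro ((j | j) | j) <;> exact PolyFun.coord _
    · refine congrArg _ (funext ?_)
      rintro ((j | j) | j) <;> rfl
  · constructor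
    · rintro ⟨y, hy⟩
      obtain ⟨x, hx⟩ := (h (Sum.elim t y)).1 hy
      refine ⟨Fin.append (fun j => y (e.symm j)) x, ?_⟩
      rw [← hx]
      refine congrArg _ (funext ?_)
      rintro ((j | j) | j) <;> simp
    · rintro ⟨x, hx⟩
      refine ⟨fun j => x (Fin.castAdd k (e j)), (h (Sum.elim t _)).2 ⟨fun j => x (Fin.natAdd n j), ?_⟩⟩
      rw [← hx]
      refine congrArg _ (funext ?_)
      rintro ((j | j) | j) <;> rfl

variable [LinearOrder K] [IsStrictOrderedRing K]

theorem and {A B : (ι → K) → Prop} (hA : Dio A) (hB : Dio B) : Dio fun t => A t ∧ B t := by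
  obtain ⟨k, f, hf, hA⟩ := hA
  obtain ⟨l, g, hg, hB⟩ := hB
  refine of_iff (A := fun t => ∃ y : Fin k ⊕ Fin l → K, f (Sum.elim t fun j => y (Sum.inl j)) ^ 2 +
    g (Sum.elim t fun j => y (Sum.inr j)) ^ 2 = 0) (ex (eq (PolyFun.add ?_ ?_) (PolyFun.const 0))) fun t => ?_
  · refine PolyFun.sq ((hf.comp (g := Sum.elim (fun i t => t (Sum.inl i))
      fun j t => t (Sum.inr (Sum.inl j))) ?_).of_eq fun t => ?_)
    · rintro (j | j) <;> exact PolyFun.coord _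
    · refine congrArg _ (funext ?_)
      rintro (j | j) <;> rfl
  · refine PolyFun.sq ((hg.comp (g := Sum.elim (fun i t => t (Sum.inl i))
      fun j t => t (Sum.inr (Sum.inr j))) ?_).of_eq fun t => ?_)
    · rintro (j | j) <;> exact PolyFun.coord _
    · refine congrArg _ (funext ?_)
      rintro (j | j) <;> rfl
  · rw [hA, hB]
    constructor
    · rintro ⟨⟨x, hx⟩, y, hy⟩
      refine ⟨Sum.elim x y, ?_⟩
      simp only [Sum.elim_inl, Sum.elim_inr, hx, hy]
      ring
    · rintro ⟨y, hy⟩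
      have h1 := sq_nonneg (f (Sum.elim t fun j => y (Sum.inl j)))
      have h2 := sq_nonneg (g (Sum.elim t fun j => y (Sum.inr j)))
      exact ⟨⟨_, pow_eq_zero_iff two_ne_zero |>.1 (by linarith)⟩, _, pow_eq_zero_iff two_ne_zero |>.1 (by linarith)⟩

theorem forall_fin {n : ℕ} {A : Fin n → (ι → K) → Prop} (h : ∀ j, Dio (A j)) : Dio fun t => ∀ j, A j t := by
  induction n with
  | zero => exact of_iff (eq (PolyFun.const 0) (PolyFun.const 0)) fun t => by simp
  | succ n ih => exact of_iff ((h 0).and (ih fun j => h j.succ)) fun t => Fin.forall_fin_succ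

end Dio

namespace Dio
variable {S : Set ℕ} {ι σ τ : Type}

lemma exists_clear_denominators (p : MvPolynomial (σ ⊕ τ) ℚ) :
    ∃ F : (σ ⊕ (τ ⊕ Unit) → ringOfPrimes S) → ringOfPrimes S, PolyFun F ∧ ∃ c d : ℕ, c ≠ 0 ∧
      ∀ e, (e (Sum.inr (Sum.inr ())) : ℚ) ≠ 0 → (F e : ℚ) = c * (e (Sum.inr (Sum.inr ())) : ℚ) ^ d *
        MvPolynomial.eval (Sum.elim (fun i => (e (Sum.inl i) : ℚ))
          fun j => (e (Sum.inr (Sum.inl j)) : ℚ) / e (Sum.inr (Sum.inr ()))) p := by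
  have hpow : ∀ d : ℕ, PolyFun fun e : σ ⊕ (τ ⊕ Unit) → ringOfPrimes S => e (Sum.inr (Sum.inr ())) ^ d :=
    fun d => ⟨MvPolynomial.X (Sum.inr (Sum.inr ())) ^ d, fun e => by simp⟩
  induction p using MvPolynomial.induction_on with
  | C q =>
    refine ⟨fun _ => (q.num : ringOfPrimes S), PolyFun.const _, q.den, 0, q.den_nz, fun e _ => ?_⟩
    rw [MvPolynomial.eval_C, pow_zero, mul_one, mul_comm, Rat.mul_den_eq_num]
    simp
  | add p q hp hq =>
    obtain ⟨F, hF, c, d, hc, h⟩ := hp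
    obtain ⟨G, hG, c', d', hc', h'⟩ := hq
    refine ⟨fun e => (c' : ringOfPrimes S) * e (Sum.inr (Sum.inr ())) ^ d' * F e +
      (c : ringOfPrimes S) * e (Sum.inr (Sum.inr ())) ^ d * G e,
      (((PolyFun.const _).mul (hpow d')).mul hF).add (((PolyFun.const _).mul (hpow d)).mul hG),
      c * c', d + d', mul_ne_zero hc hc', fun e he => ?_⟩
    push_cast
    rw [h e he, h' e he, map_add]
    ring
  | mul_X p i hp =>
    obtain ⟨F, hF, c, d, hc, h⟩ := hp
    rcases i with i | j
    · refine ⟨fun e => F e * e (Sum.inl i), hF.mul (PolyFun.coord _), c, d, hc, fun e he => ?_⟩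
      push_cast
      rw [h e he, map_mul, MvPolynomial.eval_X, Sum.elim_inl]
      ring
    · refine ⟨fun e => F e * e (Sum.inr (Sum.inl j)), hF.mul (PolyFun.coord _), c, d + 1, hc, fun e he => ?_⟩
      push_cast
      rw [h e he, map_mul, MvPolynomial.eval_X, Sum.elim_inr]
      field_simp
      ring

lemma ne_zero {f : (ι → ringOfPrimes S) → ringOfPrimes S} (hf : PolyFun f) : Dio fun t => f t ≠ 0 := by
  refine of_iff (A := fun t => ∃ y : Fin 5 → ringOfPrimes S,
    f t ^ 2 * y 0 = 1 + (y 1 ^ 2 + y 2 ^ 2 + (y 3 ^ 2 + y 4 ^ 2))) (ex (eq (hf.inl.sq.mul (PolyFun.coord _))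
      ((PolyFun.const 1).add ((((PolyFun.coord _).sq.add (PolyFun.coord _).sq)).add
        ((PolyFun.coord _).sq.add (PolyFun.coord _).sq))))) fun t => ?_
  constructor
  · intro h
    have h' : (f t : ℚ) ≠ 0 := fun h0 => h (Subtype.ext h0)
    have hn : 0 < ((f t : ℚ) ^ 2).num := Rat.num_pos.2 (by positivity)
    obtain ⟨a, b, c, d, hs⟩ := Nat.sum_four_squares (((f t : ℚ) ^ 2).num.toNat - 1)
    have hs' : ((f t : ℚ) ^ 2).num = 1 + ((a : ℤ) ^ 2 + b ^ 2 + (c ^ 2 + d ^ 2)) := by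
      zify [show 1 ≤ ((f t : ℚ) ^ 2).num.toNat by omega] at hs
      rw [Int.toNat_of_nonneg hn.le] at hs
      linarith
    refine ⟨![((((f t : ℚ) ^ 2).den : ℕ) : ringOfPrimes S), (a : ringOfPrimes S), b, c, d], Subtype.ext ?_⟩
    have h1 : (f t : ℚ) ^ 2 * ((f t : ℚ) ^ 2).den = ((((f t : ℚ) ^ 2).num : ℤ) : ℚ) := Rat.mul_den_eq_num _
    rw [hs'] at h1
    push_cast at h1
    simpa using h1
  · rintro ⟨y, hy⟩ h0
    rw [h0] at hy
    nlinarith [sq_nonneg (y 1), sq_nonneg (y 2), sq_nonneg (y 3), sq_nonneg (y 4)]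

/-- The restriction to `O_{ℚ,S}` of a Diophantine predicate over `ℚ` is Diophantine. -/
theorem restrict {A : (ι → ℚ) → Prop} (hA : Dio A) :
    Dio fun t : ι → ringOfPrimes S => A fun i => (t i : ℚ) := by
  obtain ⟨k, f, ⟨p, hp⟩, h⟩ := hA
  obtain ⟨F, hF, c, d, hc, hFp⟩ := exists_clear_denominators (S := S) p
  refine of_iff (A := fun t => ∃ y : Fin k ⊕ Unit → ringOfPrimes S, y (Sum.inr ()) ≠ 0 ∧ F (Sum.elim t y) = 0)
    (ex ((ne_zero (PolyFun.coord _)).and (eq (hF.of_eq fun t => ?_) (PolyFun.const 0)))) fun t => ?_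
  · refine congrArg _ (funext ?_)
    rintro (j | j) <;> rfl
  rw [h]
  constructor
  · rintro ⟨x, hx⟩
    have hb : ∀ j, ∃ a : ℤ, x j * ((∏ i, (x i).den : ℕ) : ℚ) = a := fun j => by
      obtain ⟨c, hc⟩ := Finset.dvd_prod_of_mem (fun i => (x i).den) (Finset.mem_univ j)
      refine ⟨(x j).num * c, ?_⟩
      rw [hc]
      push_cast
      rw [← mul_assoc, Rat.mul_den_eq_num]
    choose a ha using hb
    have hb0 : ((∏ i, (x i).den : ℕ) : ℚ) ≠ 0 :=
      Nat.cast_ne_zero.2 (Finset.prod_ne_zero_iff.2 fun i _ => (x i).den_nz)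
    refine ⟨Sum.elim (fun j => (a j : ringOfPrimes S)) fun _ => ((∏ i, (x i).den : ℕ) : ringOfPrimes S), ?_, ?_⟩
    · intro h0
      exact hb0 (by simpa using congrArg (fun z : ringOfPrimes S => (z : ℚ)) h0)
    · apply Subtype.ext
      rw [hFp]
      · rw [ZeroMemClass.coe_zero]
        refine mul_eq_zero_of_right _ ?_
        rw [← hx, hp]
        refine congrArg (fun e => MvPolynomial.eval e p) (funext ?_)
        rintro (j | j)
        · rfl
        · simp only [Sum.elim_inr, Sum.elim_inl]
          rw [div_eq_iff (by simpa using hb0)]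
          have := ha j
          push_cast at this ⊢
          exact this.symm
      · simpa using hb0
  · rintro ⟨y, hy, h0⟩
    have hy' : (y (Sum.inr ()) : ℚ) ≠ 0 := fun h => hy (Subtype.ext h)
    have h1 := hFp (Sum.elim t y) hy'
    rw [h0, ZeroMemClass.coe_zero, eq_comm, mul_eq_zero] at h1
    rcases h1 with h1 | h1
    · exact absurd h1 (mul_ne_zero (Nat.cast_ne_zero.2 hc) (pow_ne_zero _ hy'))
    · exact ⟨_, (hp _).trans h1⟩

theorem nonneg {f : (ι → ℚ) → ℚ} (hf : PolyFun f) : Dio fun t => 0 ≤ f t := by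
  refine of_iff (A := fun t => ∃ y : Fin 4 → ℚ, f t = y 0 ^ 2 + y 1 ^ 2 + (y 2 ^ 2 + y 3 ^ 2))
    (ex (eq hf.inl (((PolyFun.coord _).sq.add (PolyFun.coord _).sq).add
        ((PolyFun.coord _).sq.add (PolyFun.coord _).sq)))) fun t => ?_
  constructor
  · intro h
    obtain ⟨a, b, c, d, hs⟩ := Nat.sum_four_squares ((f t).num.toNat * (f t).den)
    have hden : ((f t).den : ℚ) ≠ 0 := Nat.cast_ne_zero.2 (f t).den_nz
    refine ⟨![a / (f t).den, b / (f t).den, c / (f t).den, d / (f t).den], ?_⟩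
    have hs' : (a : ℚ) ^ 2 + b ^ 2 + c ^ 2 + d ^ 2 = f t * (f t).den * (f t).den := by
      rw [Rat.mul_den_eq_num]
      have : ((f t).num.toNat : ℤ) = (f t).num := Int.toNat_of_nonneg (Rat.num_nonneg.2 h)
      rw [← this]
      exact_mod_cast hs
    simp only [Matrix.cons_val]
    field_simp
    linear_combination -hs'
  · rintro ⟨y, hy⟩
    rw [hy]
    positivity

theorem pos {f : (ι → ℚ) → ℚ} (hf : PolyFun f) : Dio fun t => 0 < f t := by
  refine of_iff (A := fun t => ∃ y : Unit → ℚ, 0 ≤ f t ∧ f t * y () = 1)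
    (ex ((nonneg hf.inl).and (eq (hf.inl.mul (PolyFun.coord _)) (PolyFun.const 1)))) fun t => ?_
  constructor
  · intro h
    exact ⟨fun _ => (f t)⁻¹, h.le, mul_inv_cancel₀ h.ne'⟩
  · rintro ⟨y, h0, h1⟩
    exact lt_of_le_of_ne h0 fun h => by rw [← h, zero_mul] at h1; exact zero_ne_one h1

end Dio

namespace EC
open PolyFun

lemma two_sub_c_sub_d {A : Q} (h : A ≠ 0) : (2 - c A - d A) * (xc A ^ 2 + 25) = 100 := by
  rw [c_of_ne h, d_of_ne h]; field_simp; ring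

lemma d_sub_c {A : Q} (h : A ≠ 0) : (d A - c A) * (xc A ^ 2 + 25) = 20 * xc A := by
  rw [c_of_ne h, d_of_ne h]; field_simp; ring

lemma exists_scd {u v w : ℚ} (hv : v ^ 2 = 1 - 5 * u ^ 2) (hw : w ^ 2 = 1 + 5 * u ^ 2) :
    ∃ A : Q, s A = u ∧ c A = v ∧ d A = w := by
  by_cases h : 2 - v - w = 0
  · have hvw : v = w := by
      have : (v - w) ^ 2 = 0 := by linear_combination 2 * hv + 2 * hw + (2 + v + w) * h
      exact sub_eq_zero.1 (pow_eq_zero_iff two_ne_zero |>.1 this)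
    subst hvw
    obtain rfl : v = 1 := by linarith
    have hu : u = 0 := by
      have : u ^ 2 = 0 := by linarith
      exact pow_eq_zero_iff two_ne_zero |>.1 this
    exact ⟨0, by rw [s_zero, hu], c_zero, d_zero⟩
  · have e : (2 - v - w) ^ 2 + (w - v) ^ 2 = 4 * (2 - v - w) := by linear_combination 2 * hv + 2 * hw
    have he : (5 * (w - v) / (2 - v - w)) ^ 2 + 25 = 100 / (2 - v - w) := by
      field_simp
      linear_combination 25 * e
    have hns : (EC ℚ).Nonsingular (5 * (w - v) / (2 - v - w)) (50 * u / (2 - v - w)) := by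
      rw [EC_nonsingular_iff (by norm_num)]
      field_simp
      linear_combination (w - v) * (-125) * e + 250 * (2 - v - w) * (hv - hw)
    refine ⟨.some _ _ hns, ?_, ?_, ?_⟩
    · rw [s_some, he]; field_simp; ring
    · rw [c_some, he]; field_simp; linear_combination 25 * e
    · rw [d_some, he]; field_simp; linear_combination 25 * e

/-- The coordinates of a rational point on the intersection of two quadrics. -/
def enc (A : Q) : Fin 3 → ℚ := ![s A, c A, d A]

lemma eq_enc_iff {f : Fin 3 → ℚ} {A : Q} : (∀ j, f j = enc A j) ↔ f 0 = s A ∧ f 1 = c A ∧ f 2 = d A := by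
  rw [Fin.forall_fin_succ, Fin.forall_fin_succ, Fin.forall_fin_succ]
  simp [enc]

/-- The three equations of the addition law. -/
def AddRel (f g h : Fin 3 → ℚ) : Prop :=
  h 0 * (1 + 25 * f 0 ^ 2 * g 0 ^ 2) = f 0 * g 1 * g 2 + g 0 * f 1 * f 2 ∧
  h 1 * (1 + 25 * f 0 ^ 2 * g 0 ^ 2) = f 1 * g 1 - 5 * f 0 * g 0 * f 2 * g 2 ∧
  h 2 * (1 + 25 * f 0 ^ 2 * g 0 ^ 2) = f 2 * g 2 + 5 * f 0 * g 0 * f 1 * g 1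

lemma addRel_iff {A B : Q} {h : Fin 3 → ℚ} : AddRel (enc A) (enc B) h ↔ ∀ j, h j = enc (A + B) j := by
  have hΔ := (Δ_pos A B).ne'
  obtain ⟨h1, h2, h3⟩ := add_law A B
  rw [eq_enc_iff, ← mul_left_inj' hΔ, ← mul_left_inj' hΔ (b := c _), ← mul_left_inj' hΔ (b := d _), h1, h2, h3]
  exact Iff.rfl

variable {ι : Type} {f g h : Fin 3 → (ι → ℚ) → ℚ}

lemma dio_addRel (hf : ∀ j, PolyFun (f j)) (hg : ∀ j, PolyFun (g j)) (hh : ∀ j, PolyFun (h j)) :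
    Dio fun t => AddRel (fun j => f j t) (fun j => g j t) fun j => h j t := by
  have hD : PolyFun fun t => 1 + 25 * f 0 t ^ 2 * g 0 t ^ 2 :=
    (const 1).add (((const 25).mul (hf 0).sq).mul (hg 0).sq)
  have h5 : PolyFun fun t => 5 * f 0 t * g 0 t := ((const 5).mul (hf 0)).mul (hg 0)
  exact (Dio.eq ((hh 0).mul hD) ((((hf 0).mul (hg 1)).mul (hg 2)).add (((hg 0).mul (hf 1)).mul (hf 2)))).and
    ((Dio.eq ((hh 1).mul hD) (((hf 1).mul (hg 1)).sub ((h5.mul (hf 2)).mul (hg 2)))).and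
      (Dio.eq ((hh 2).mul hD) (((hf 2).mul (hg 2)).add ((h5.mul (hf 1)).mul (hg 1)))))

lemma dio_nsmul (N : ℕ) (hf : ∀ j, PolyFun (f j)) (hg : ∀ j, PolyFun (g j)) :
    Dio fun t => ∃ A : Q, (∀ j, f j t = enc A j) ∧ ∀ j, g j t = enc (N • A) j := by
  induction N generalizing ι with
  | zero =>
    refine Dio.of_iff (A := fun t => (f 1 t ^ 2 = 1 - 5 * f 0 t ^ 2 ∧ f 2 t ^ 2 = 1 + 5 * f 0 t ^ 2) ∧
      ∀ j, g j t = enc 0 j) (((Dio.eq (hf 1).sq ((const 1).sub ((const 5).mul (hf 0).sq))).and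
      (Dio.eq (hf 2).sq ((const 1).add ((const 5).mul (hf 0).sq)))).and
        (Dio.forall_fin fun j => Dio.eq (hg j) (const _))) fun t => ?_
    simp only [zero_nsmul, exists_and_right]
    refine and_congr_left fun _ => ?_
    constructor
    · rintro ⟨A, hA⟩
      have := hA
      rw [eq_enc_iff (f := fun j => f j t)] at this
      rw [this.1, this.2.1, this.2.2]
      exact ⟨c_sq A, d_sq A⟩
    · rintro ⟨h1, h2⟩
      obtain ⟨A, hs, hc, hd⟩ := exists_scd h1 h2
      exact ⟨A, eq_enc_iff.2 ⟨hs.symm, hc.symm, hd.symm⟩⟩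
  | succ N ih =>
    refine Dio.of_iff (A := fun t => ∃ y : Fin 3 → ℚ, (∃ A : Q, (∀ j, f j t = enc A j) ∧
      ∀ j, y j = enc (N • A) j) ∧ AddRel y (fun j => f j t) fun j => g j t)
      (Dio.ex ((ih (fun j => (hf j).inl) fun j => coord _).and
        (dio_addRel (fun j => coord _) (fun j => (hf j).inl) fun j => (hg j).inl))) fun t => ?_
    constructor
    · rintro ⟨A, h1, h2⟩
      refine ⟨enc (N • A), ⟨A, h1, fun _ => rfl⟩, ?_⟩
      rw [funext h1, addRel_iff, ← succ_nsmul]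
      exact h2
    · rintro ⟨y, ⟨A, h1, h2⟩, h3⟩
      refine ⟨A, h1, ?_⟩
      rw [funext h1, funext h2, addRel_iff, ← succ_nsmul] at h3
      exact h3

/-- `(x, y)` are the affine coordinates of the nonzero point encoded by `f`. -/
def CoordRel (f : Fin 3 → ℚ) (x y : ℚ) : Prop :=
  (∃ u : Unit → ℚ, (2 - f 1 - f 2) * u () = 1) ∧ x * (2 - f 1 - f 2) = 5 * (f 2 - f 1) ∧
    y * (2 - f 1 - f 2) = 50 * f 0

lemma coordRel_iff {A : Q} {x y : ℚ} : CoordRel (enc A) x y ↔ A ≠ 0 ∧ x = xc A ∧ y = yc A := by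
  change ((∃ u : Unit → ℚ, (2 - c A - d A) * u () = 1) ∧ x * (2 - c A - d A) = 5 * (d A - c A) ∧
    y * (2 - c A - d A) = 50 * s A) ↔ _
  by_cases h0 : A = 0
  · subst h0
    rw [c_zero, d_zero]
    norm_num
  · rw [and_iff_right h0]
    have hx : xc A ^ 2 + 25 ≠ 0 := by positivity
    have h1 := two_sub_c_sub_d h0
    have hne : 2 - c A - d A ≠ 0 := fun h => by rw [h, zero_mul] at h1; norm_num at h1
    rw [and_iff_right ⟨fun _ => (2 - c A - d A)⁻¹, mul_inv_cancel₀ hne⟩]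
    have e1 : 5 * (d A - c A) = xc A * (2 - c A - d A) := by
      rw [← mul_left_inj' hx]
      linear_combination 5 * d_sub_c h0 - xc A * h1
    have e2 : 50 * s A = yc A * (2 - c A - d A) := by
      rw [← mul_left_inj' hx, mul_assoc (yc A), h1, s_of_ne h0]
      field_simp
      ring
    rw [e1, e2, mul_left_inj' hne, mul_left_inj' hne]

lemma dio_coordRel (hf : ∀ j, PolyFun (f j)) {x y : (ι → ℚ) → ℚ} (hx : PolyFun x) (hy : PolyFun y) :
    Dio fun t => CoordRel (fun j => f j t) (x t) (y t) := by
  have hD : PolyFun fun t => 2 - f 1 t - f 2 t := ((const 2).sub (hf 1)).sub (hf 2)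
  exact (Dio.ex (Dio.eq (hD.inl.mul (coord _)) (const 1))).and
    ((Dio.eq (hx.mul hD) ((const 5).mul ((hf 2).sub (hf 1)))).and (Dio.eq (hy.mul hD) ((const 50).mul (hf 0))))

/-- The approximate index of a point: half of one more than `y / x` divided by `60`. -/
def wc (A : Q) : ℚ := (yc A / (60 * xc A) + 1) / 2

lemma xc_pos_of_zsmul {A : Q} (hA : A ≠ 0) {m : ℤ} (hm : Even m) (h : A = m • P) : 0 < xc A := by
  have h0 : m.natAbs ≠ 0 := by
    intro h0
    rw [Int.natAbs_eq_zero] at h0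
    rw [h0, zero_zsmul] at h
    exact hA h
  have h1 := xc_even (Int.natAbs_even.2 hm) h0
  rcases Int.natAbs_eq m with h2 | h2 <;> rw [h2] at h
  · rwa [h, natCast_zsmul]
  · rwa [h, neg_zsmul, xc_neg, natCast_zsmul]

lemma exists_zsmul (B : Q) : ∃ m : ℤ, ((101).factorial : ℤ) ∣ m ∧ N₀ • B = m • P := by
  obtain ⟨m, hm⟩ := N₁_spec B
  refine ⟨(101).factorial * m, Dvd.intro _ rfl, ?_⟩
  rw [N₀, mul_nsmul, hm, mul_zsmul, natCast_zsmul]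

lemma even_of_factorial_dvd {m : ℤ} (h : ((101).factorial : ℤ) ∣ m) : Even m := by
  rw [even_iff_two_dvd]
  exact dvd_trans (by exact_mod_cast Nat.dvd_factorial (by norm_num) (by norm_num : 2 ≤ 101)) h

lemma s_ne_and_xc_pos {B : Q} (h : N₀ • B ≠ 0) : s (N₀ • B) ≠ 0 ∧ 0 < xc (N₀ • B) := by
  obtain ⟨m, hm, h'⟩ := exists_zsmul B
  refine ⟨?_, xc_pos_of_zsmul h (even_of_factorial_dvd hm) h'⟩
  rw [h']
  refine s_zsmul_P_ne_zero ?_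
  rintro rfl
  exact h (by rw [h', zero_zsmul])

/-- `(x, y)` and `(x', y')` are the coordinates of `A ± P` for a nonzero point `A` in `N E(ℚ)`,
whose approximate index is `w`. -/
def PointRel (N : ℕ) (x y x' y' w : ℚ) : Prop := ∃ B : Q, N • B ≠ 0 ∧
  (N • B + P ≠ 0 ∧ x = xc (N • B + P) ∧ y = yc (N • B + P)) ∧
  (N • B + -P ≠ 0 ∧ x' = xc (N • B + -P) ∧ y' = yc (N • B + -P)) ∧ w = wc (N • B)

lemma wc_iff {A : Q} (h0 : A ≠ 0) (hx : 0 < xc A) (w : ℚ) :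
    w = wc A ↔ (2 * w - 1) * (6 * (d A - c A)) = s A := by
  have h1 := d_sub_c h0
  have hq : xc A ^ 2 + 25 ≠ 0 := by positivity
  rw [← mul_left_inj' hq (a := (2 * w - 1) * (6 * (d A - c A))), wc, s_of_ne h0, div_mul_cancel₀ _ hq,
    show (2 * w - 1) * (6 * (d A - c A)) * (xc A ^ 2 + 25) = (2 * w - 1) * 6 * (20 * xc A) by rw [← h1]; ring]
  constructor
  · rintro rfl
    field_simp
    ring
  · intro h
    field_simp
    linarith

lemma dio_pointRel {N : ℕ} (hN : ∀ B : Q, N • B ≠ 0 → s (N • B) ≠ 0 ∧ 0 < xc (N • B))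
    {x y x' y' w : (ι → ℚ) → ℚ} (hx : PolyFun x) (hy : PolyFun y) (hx' : PolyFun x')
    (hy' : PolyFun y') (hw : PolyFun w) : Dio fun t => PointRel N (x t) (y t) (x' t) (y' t) (w t) := by
  refine Dio.of_iff (A := fun t => ∃ z : Fin 4 × Fin 3 → ℚ,
    (∃ B : Q, (∀ j, z (0, j) = enc B j) ∧ ∀ j, z (1, j) = enc (N • B) j) ∧
    (∃ u : Unit → ℚ, z (1, 0) * u () = 1) ∧
    AddRel (fun j => z (1, j)) (enc P) (fun j => z (2, j)) ∧
    AddRel (fun j => z (1, j)) (enc (-P)) (fun j => z (3, j)) ∧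
    CoordRel (fun j => z (2, j)) (x t) (y t) ∧ CoordRel (fun j => z (3, j)) (x' t) (y' t) ∧
    (2 * w t - 1) * (6 * (z (1, 2) - z (1, 1))) = z (1, 0)) (Dio.ex (.and ?_ (.and ?_ (.and ?_ (.and ?_ (.and ?_
      (.and ?_ ?_))))))) fun t => ?_
  · exact dio_nsmul N (fun j => coord _) (fun j => coord _)
  · exact Dio.ex (Dio.eq ((coord _).mul (coord _)) (const 1))
  · exact dio_addRel (fun j => coord _) (fun j => const _) (fun j => coord _)
  · exact dio_addRel (fun j => coord _) (fun j => const _) (fun j => coord _)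
  · exact dio_coordRel (fun j => coord _) hx.inl hy.inl
  · exact dio_coordRel (fun j => coord _) hx'.inl hy'.inl
  · exact Dio.eq ((((const 2).mul hw.inl).sub (const 1)).mul ((const 6).mul ((coord _).sub (coord _)))) (coord _)
  · constructor
    · rintro ⟨B, h0, h1, h2, h3⟩
      refine ⟨fun p => enc (![B, N • B, N • B + P, N • B + -P] p.1) p.2, ⟨B, fun _ => rfl, fun _ => rfl⟩,
        ⟨fun _ => (s (N • B))⁻¹, mul_inv_cancel₀ ?_⟩, addRel_iff.2 fun _ => rfl, addRel_iff.2 fun _ => rfl,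
        coordRel_iff.2 h1, coordRel_iff.2 h2, (wc_iff h0 (hN B h0).2 _).1 h3⟩
      exact (hN B h0).1
    · rintro ⟨z, ⟨B, hB, hA⟩, ⟨u, hu⟩, h2, h3, h4, h5, h6⟩
      rw [funext hA, addRel_iff] at h2 h3
      rw [funext h2, coordRel_iff] at h4
      rw [funext h3, coordRel_iff] at h5
      rw [hA] at hu
      rw [hA, hA, hA] at h6
      have h0 : N • B ≠ 0 := fun h0 => by
        rw [h0] at hu
        change s 0 * u () = 1 at hu
        rw [s_zero, zero_mul] at hu
        exact zero_ne_one hu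
      exact ⟨B, h0, h4, h5, (wc_iff h0 (hN B h0).2 _).2 h6⟩

end EC

namespace EC

lemma den_xc_zsmul (m : ℤ) : (xc (m • P)).den = dn m.natAbs := by
  rcases Int.natAbs_eq m with h | h
  · conv_lhs => rw [h, natCast_zsmul]
    rfl
  · conv_lhs => rw [h, neg_zsmul, xc_neg, natCast_zsmul]
    rfl

lemma yc_mem {S : Set ℕ} {A : Q} (h : xc A ∈ ringOfPrimes S) : yc A ∈ ringOfPrimes S := by
  have h2 : yc A ^ 2 ∈ ringOfPrimes S := by
    rw [yc_sq]
    have h25 : (25 : ℚ) ∈ ringOfPrimes S := by exact_mod_cast natCast_mem (ringOfPrimes S) 25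
    exact sub_mem (pow_mem h 3) (mul_mem h25 h)
  intro p hp hd
  refine h2 p hp ?_
  rw [Rat.den_pow]
  exact dvd_pow hd two_ne_zero

lemma yc_div_xc_sq {A : Q} (h : xc A ≠ 0) : (yc A / xc A) ^ 2 = xc A - 25 / xc A := by
  rw [div_pow, yc_sq]
  field_simp

lemma yc_ms_ne_zero {m : ℤ} {i : ℕ} (h : m.natAbs = ms i) : yc (m • P) ≠ 0 := by
  have key : yc (ms i • P) ≠ 0 := by
    intro h0
    obtain ⟨h1, h2⟩ := tgt_ms i
    rw [← yc_div_xc_sq h1.ne', h0, gi, zero_div, zero_pow two_ne_zero, zero_sub, abs_neg, abs_of_nonneg (by positivity)] at h2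
    have : (0 : ℚ) ≤ i := Nat.cast_nonneg i
    nlinarith
  rcases Int.natAbs_eq m with h' | h' <;> rw [h', h]
  · rwa [natCast_zsmul]
  · rwa [neg_zsmul, yc_neg, natCast_zsmul, neg_ne_zero]

lemma xc_ms {m : ℤ} {i : ℕ} (h : m.natAbs = ms i) : xc (m • P) = xc (ms i • P) := by
  rcases Int.natAbs_eq m with h' | h' <;> rw [h', h]
  · rw [natCast_zsmul]
  · rw [neg_zsmul, xc_neg, natCast_zsmul]

lemma exists_index (k : ℤ) : ∃ m : ℤ, ∃ i : ℕ, m.natAbs = ms i ∧ (2 * k - 1).natAbs = 2 * i + 1 ∧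
    0 < (2 * k - 1 : ℚ) * yc (m • P) := by
  obtain ⟨i, hi⟩ : ∃ i, (2 * k - 1).natAbs = 2 * i + 1 := ⟨((2 * k - 1).natAbs - 1) / 2, by omega⟩
  have hk : (2 * k - 1 : ℚ) ≠ 0 := by exact_mod_cast (by omega : (2 * k - 1 : ℤ) ≠ 0)
  have h0 := mul_ne_zero hk (yc_ms_ne_zero (m := (ms i : ℤ)) (Int.natAbs_natCast _))
  rcases h0.lt_or_gt with h | h
  · refine ⟨-(ms i : ℤ), i, by simp, hi, ?_⟩
    rw [neg_zsmul, yc_neg]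
    linarith
  · exact ⟨ms i, i, by simp, hi, h⟩

/-- The multiple of `P` representing an integer. -/
noncomputable def pm (k : ℤ) : ℤ := (exists_index k).choose

lemma pm_spec (k : ℤ) : ∃ i : ℕ, (pm k).natAbs = ms i ∧ (2 * k - 1).natAbs = 2 * i + 1 ∧
    0 < (2 * k - 1 : ℚ) * yc (pm k • P) := (exists_index k).choose_spec

lemma exists_eq_pm {m : ℤ} {i : ℕ} (h : m.natAbs = ms i) : ∃ k, m = pm k := by
  have key : ∀ k : ℤ, (2 * k - 1).natAbs = 2 * i + 1 → 0 < (2 * k - 1 : ℚ) * yc (m • P) → m = pm k := by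
    intro k hk hpos
    obtain ⟨j, hj, hj', hpos'⟩ := pm_spec k
    obtain rfl : i = j := by omega
    rcases Int.natAbs_eq_natAbs_iff.1 (h.trans hj.symm) with h' | h'
    · exact h'
    · rw [h', neg_zsmul, yc_neg] at hpos
      linarith
  have hi : (0 : ℚ) ≤ i := Nat.cast_nonneg i
  rcases (yc_ms_ne_zero h).lt_or_gt with h0 | h0
  · refine ⟨-i, key _ (by omega) ?_⟩
    push_cast
    exact mul_pos_of_neg_of_neg (by linarith) h0
  · refine ⟨i + 1, key _ (by omega) ?_⟩
    push_cast
    exact mul_pos (by linarith) h0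

/-- The approximate index of a point representing `k` is close to `k`. -/
lemma wc_pm (k : ℤ) : |wc (pm k • P) - k| ≤ 1 / 100 ∧ |(wc (pm k • P) - k) * k| ≤ 1 / 100 := by
  obtain ⟨i, h1, h2, h3⟩ := pm_spec k
  obtain ⟨h4, h5⟩ := tgt_ms i
  rw [← xc_ms h1, gi] at h5
  rw [← xc_ms h1] at h4
  rw [← yc_div_xc_sq h4.ne'] at h5
  set q : ℚ := 2 * k - 1 with hq
  have hq2 : q ^ 2 = (2 * i + 1) ^ 2 := by
    have : (2 * k - 1) ^ 2 = (2 * i + 1 : ℤ) ^ 2 := by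
      rw [← Int.natAbs_pow_two (2 * k - 1), h2]; push_cast; ring
    rw [hq]
    exact_mod_cast this
  have hq1 : 1 ≤ q ^ 2 := by
    rw [hq2]
    have : (0 : ℚ) ≤ i := Nat.cast_nonneg i
    nlinarith
  have hk : (k : ℚ) = (q + 1) / 2 := by rw [hq]; ring
  have hw : wc (pm k • P) - k = (yc (pm k • P) / xc (pm k • P) - 60 * q) / 120 := by
    rw [wc, hk]
    field_simp
    ring
  rw [hw, hk]
  have hv : 0 < q * (yc (pm k • P) / xc (pm k • P)) := by
    rw [← mul_div_assoc]
    exact div_pos h3 h4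
  generalize yc (pm k • P) / xc (pm k • P) = v at h5 hv
  rw [mul_pow, ← hq2] at h5
  clear_value q
  have hd : |(v - 60 * q) * q| ≤ 1 / 60 := by
    have e : |v - 60 * q| * |v + 60 * q| < 1 := by
      rw [← abs_mul, show (v - 60 * q) * (v + 60 * q) = v ^ 2 - 60 ^ 2 * q ^ 2 by ring]
      exact h5
    have e2 : 60 * |q| ≤ |v + 60 * q| := by
      rcases lt_or_ge q 0 with h | h
      · have : v < 0 := by
          by_contra h'
          exact absurd hv (not_lt.2 (mul_nonpos_of_nonpos_of_nonneg h.le (not_lt.1 h')))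
        rw [abs_of_neg h, abs_of_neg (by linarith)]
        linarith
      · have : 0 < v := pos_of_mul_pos_right hv h
        rw [abs_of_nonneg h, abs_of_nonneg (by linarith)]
        linarith
    rw [abs_mul]
    have := mul_le_mul_of_nonneg_left e2 (abs_nonneg (v - 60 * q))
    linarith
  have hd' : |v - 60 * q| ≤ 1 / 60 := by
    have : 1 ≤ |q| := one_le_sq_iff_one_le_abs _ |>.1 hq1
    rw [abs_mul] at hd
    have := mul_le_mul_of_nonneg_left this (abs_nonneg (v - 60 * q))
    linarith
  rw [abs_le] at hd hd'
  refine ⟨abs_le.2 ⟨by linarith, by linarith⟩, abs_le.2 ⟨?_, ?_⟩⟩ <;>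
  · rw [show (v - 60 * q) / 120 * ((q + 1) / 2) = ((v - 60 * q) * q + (v - 60 * q)) / 240 by ring]
    linarith

variable {S : Set ℕ}

lemma xc_mem_of_index (hS : T₁ ⊆ S) {k m : ℤ} (hm : m = pm k + 1 ∨ m = pm k - 1) :
    m • P ≠ 0 ∧ xc (m • P) ∈ ringOfPrimes S := by
  obtain ⟨i, h1, -⟩ := pm_spec k
  have h2 := two_le_ms i
  refine ⟨fun h => ?_, fun p hp hd => ?_⟩
  · have := zsmul_P_eq_zero h
    omega
  · rw [den_xc_zsmul] at hd
    exact hS (mem_T₁_of_dvd (i := i) hp (by omega) hd)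

lemma pointRel_pm (k : ℤ) : PointRel N₀ (xc ((pm k + 1) • P)) (yc ((pm k + 1) • P)) (xc ((pm k - 1) • P))
    (yc ((pm k - 1) • P)) (wc (pm k • P)) := by
  have h1 := (xc_mem_of_index (k := k) subset_rfl (.inl rfl)).1
  have h2 := (xc_mem_of_index (k := k) subset_rfl (.inr rfl)).1
  obtain ⟨i, h3, -⟩ := pm_spec k
  obtain ⟨b, hb⟩ : (N₀ : ℤ) ∣ pm k := by
    rw [Int.natCast_dvd, h3]
    exact dvd_ms i
  have e : N₀ • b • P = pm k • P := by rw [hb, mul_zsmul, natCast_zsmul]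
  have h0 : pm k • P ≠ 0 := fun h => by
    have := zsmul_P_eq_zero h
    have := two_le_ms i
    omega
  refine ⟨b • P, ?_⟩
  rw [e, show pm k • P + P = (pm k + 1) • P by rw [add_zsmul, one_zsmul],
    show pm k • P + -P = (pm k - 1) • P by rw [sub_zsmul, one_zsmul]]
  exact ⟨h0, ⟨h1, rfl, rfl⟩, ⟨h2, rfl, rfl⟩, rfl⟩

lemma PointRel.exists_eq (hS : S ∩ T₂ = ∅) {x y x' y' w : ℚ} (h : PointRel N₀ x y x' y' w)
    (hx : x ∈ ringOfPrimes S) (hx' : x' ∈ ringOfPrimes S) :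
    ∃ k, x = xc ((pm k + 1) • P) ∧ y = yc ((pm k + 1) • P) ∧ w = wc (pm k • P) := by
  obtain ⟨B, h0, ⟨-, h1, h2⟩, ⟨-, h3, -⟩, h5⟩ := h
  obtain ⟨m, hm, e⟩ := exists_zsmul B
  rw [e] at h0 h1 h2 h3 h5
  rw [show m • P + P = (m + 1) • P by rw [add_zsmul, one_zsmul]] at h1 h2
  rw [show m • P + -P = (m - 1) • P by rw [sub_zsmul, one_zsmul]] at h3
  have hm0 : m ≠ 0 := by
    rintro rfl
    exact h0 (zero_zsmul _)
  have hd1 : ∀ p : ℕ, p.Prime → p ∣ dn (m + 1).natAbs → p ∈ S := fun p hp hd =>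
    hx p hp (by rwa [h1, den_xc_zsmul])
  have hd2 : ∀ p : ℕ, p.Prime → p ∣ dn (m - 1).natAbs → p ∈ S := fun p hp hd =>
    hx' p hp (by rwa [h3, den_xc_zsmul])
  have hmi : ∃ i, m.natAbs = ms i := by
    have hdv : Nat.factorial 101 ∣ m.natAbs := Int.natCast_dvd.1 hm
    clear hm
    refine eq_ms_of_survives hS (by omega) hdv ?_ ?_
    · rcases le_total 0 m with h | h
      · rwa [show m.natAbs - 1 = (m - 1).natAbs by omega]
      · rwa [show m.natAbs - 1 = (m + 1).natAbs by omega]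
    · rcases le_total 0 m with h | h
      · rwa [show m.natAbs + 1 = (m + 1).natAbs by omega]
      · rwa [show m.natAbs + 1 = (m - 1).natAbs by omega]
  obtain ⟨i, hi⟩ := hmi
  obtain ⟨k, rfl⟩ := exists_eq_pm hi
  exact ⟨k, h1, h2, h5⟩

/-- The Diophantine model: `k` is represented by the affine coordinates of a point. -/
noncomputable def model (hS : T₁ ⊆ S) (k : ℤ) : Fin 2 → ringOfPrimes S :=
  ![⟨xc ((pm k + 1) • P), (xc_mem_of_index hS (.inl rfl)).2⟩,
    ⟨yc ((pm k + 1) • P), yc_mem (xc_mem_of_index hS (.inl rfl)).2⟩]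

lemma eq_of_abs_sub_lt {a b : ℤ} (h : |(a : ℚ) - b| < 1) : a = b := by
  have : |a - b| < 1 := by exact_mod_cast h
  rw [Int.abs_lt_one_iff] at this
  omega

lemma pm_injective : Function.Injective pm := fun a b h => by
  have h1 := abs_le.1 (wc_pm a).1
  have h2 := abs_le.1 (wc_pm b).1
  rw [h] at h1
  exact eq_of_abs_sub_lt (abs_lt.2 ⟨by linarith, by linarith⟩)

lemma model_injective (hS : T₁ ⊆ S) : Function.Injective (model hS) := fun a b h => by
  have hx : xc ((pm a + 1) • P) = xc ((pm b + 1) • P) := congrArg Subtype.val (congrFun h 0)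
  have hy : yc ((pm a + 1) • P) = yc ((pm b + 1) • P) := congrArg Subtype.val (congrFun h 1)
  have := zsmul_P_injective (ext_xy (xc_mem_of_index hS (.inl rfl)).1 (xc_mem_of_index hS (.inl rfl)).1 hx hy)
  exact pm_injective (by omega)

end EC

lemma Dio.forall_finite {K ι κ : Type} [CommRing K] [LinearOrder K] [IsStrictOrderedRing K] [Finite κ]
    {A : κ → (ι → K) → Prop} (h : ∀ j, Dio (A j)) : Dio fun t => ∀ j, A j t := by
  obtain ⟨n, ⟨e⟩⟩ := Finite.exists_equiv_fin κ
  exact (Dio.forall_fin fun j => h (e.symm j)).of_iff fun t => (e.symm.forall_congr_right (q := fun j => A j t)).symm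

namespace EC
open PolyFun

variable {S : Set ℕ} {τ τ' κ : Type}

/-- A relation between integers whose image in the model is Diophantine. -/
def Rel (hS : T₁ ⊆ S) (B : (τ → ℤ) → Prop) : Prop :=
  Dio fun t : τ × Fin 2 → ringOfPrimes S => ∃ a : τ → ℤ, B a ∧ ∀ j i, t (j, i) = model hS (a j) i

variable {hS : T₁ ⊆ S} {A B : (τ → ℤ) → Prop}

namespace Rel

/-- A relation that can be decided approximately on the approximate indices. -/
lemma of_approx [Finite τ] (hS' : S ∩ T₂ = ∅) {C : (τ → ℚ) → Prop} (hC : Dio C)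
    (h : ∀ a : τ → ℤ, B a ↔ C fun j => wc (pm (a j) • P)) : Rel hS B := by
  have h1 : Dio fun s : (τ × Fin 2) ⊕ (τ × Fin 2) → ℚ => ∃ w : τ → ℚ,
      (∀ j, PointRel N₀ (s (.inl (j, 0))) (s (.inl (j, 1))) (s (.inr (j, 0))) (s (.inr (j, 1))) (w j)) ∧ C w :=
    Dio.ex ((Dio.forall_finite fun j => dio_pointRel (fun B => s_ne_and_xc_pos) (coord _) (coord _) (coord _)
      (coord _) (coord _)).and (hC.comp fun j => coord _))
  refine Dio.of_iff (A := fun t : τ × Fin 2 → ringOfPrimes S => ∃ z : τ × Fin 2 → ringOfPrimes S,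
    ∃ w : τ → ℚ, (∀ j, PointRel N₀ (t (j, 0)) (t (j, 1)) (z (j, 0)) (z (j, 1)) (w j)) ∧ C w)
    (Dio.ex h1.restrict) fun t => ?_
  constructor
  · rintro ⟨a, ha, ht⟩
    refine ⟨fun p => ![⟨xc ((pm (a p.1) - 1) • P), (xc_mem_of_index hS (.inr rfl)).2⟩,
      ⟨yc ((pm (a p.1) - 1) • P), yc_mem (xc_mem_of_index hS (.inr rfl)).2⟩] p.2, fun j => wc (pm (a j) • P),
      fun j => ?_, (h a).1 ha⟩
    rw [ht, ht]
    exact pointRel_pm (a j)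
  · rintro ⟨z, w, hz, hw⟩
    choose a h1 h2 h3 using fun j => (hz j).exists_eq hS' (t (j, 0)).2 (z (j, 0)).2
    refine ⟨a, (h a).2 (funext h3 ▸ hw), fun j => ?_⟩
    rw [Fin.forall_fin_two]
    exact ⟨Subtype.ext (h1 j), Subtype.ext (h2 j)⟩

lemma congr (hA : Rel hS A) (h : ∀ a, B a ↔ A a) : Rel hS B := by
  rwa [show B = A from funext fun a => propext (h a)]

lemma and (hA : Rel hS A) (hB : Rel hS B) : Rel hS fun a => A a ∧ B a :=
  (Dio.and hA hB).of_iff fun t => by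
    constructor
    · rintro ⟨a, ⟨h1, h2⟩, h⟩
      exact ⟨⟨a, h1, h⟩, a, h2, h⟩
    · rintro ⟨⟨a, h1, h⟩, b, h2, h'⟩
      obtain rfl : a = b := funext fun j => model_injective hS (funext fun i => (h j i).symm.trans (h' j i))
      exact ⟨a, ⟨h1, h2⟩, h⟩

lemma true [Finite τ] (hS' : S ∩ T₂ = ∅) : Rel hS fun _ : τ → ℤ => True :=
  of_approx hS' (C := fun _ => (0 : ℚ) = 0) (Dio.eq (const 0) (const 0)) fun _ => by simp

lemma comp [Finite τ'] (hS' : S ∩ T₂ = ∅) (hA : Rel hS A) (f : τ → τ') :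
    Rel hS fun a : τ' → ℤ => A fun j => a (f j) :=
  (Dio.and (Rel.true (hS := hS) hS') (Dio.comp hA fun p => coord (f p.1, p.2))).of_iff fun t => by
    constructor
    · rintro ⟨a, h, ht⟩
      exact ⟨⟨a, trivial, ht⟩, _, h, fun j i => ht _ i⟩
    · rintro ⟨⟨a, -, ht⟩, b, hb, h⟩
      obtain rfl : b = fun j => a (f j) :=
        funext fun j => model_injective hS (funext fun i => (h j i).symm.trans (ht (f j) i))
      exact ⟨a, hb, ht⟩

lemma ex [Finite κ] {B : (τ → ℤ) → (κ → ℤ) → Prop}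
    (h : Rel hS fun a : τ ⊕ κ → ℤ => B (fun j => a (.inl j)) fun j => a (.inr j)) :
    Rel hS fun a => ∃ b, B a b := by
  have h1 : Dio fun t : (τ × Fin 2) ⊕ (κ × Fin 2) → ringOfPrimes S => ∃ a : τ ⊕ κ → ℤ,
      B (fun j => a (.inl j)) (fun j => a (.inr j)) ∧
        ∀ j i, Sum.elim (fun k => t (Sum.inl (k, i))) (fun k => t (Sum.inr (k, i))) j = model hS (a j) i := by
    refine Dio.comp (g := fun (p : (τ ⊕ κ) × Fin 2) (t : (τ × Fin 2) ⊕ (κ × Fin 2) → ringOfPrimes S) =>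
      Sum.elim (fun k => t (.inl (k, p.2))) (fun k => t (.inr (k, p.2))) p.1) h ?_
    rintro ⟨j | j, i⟩
    · exact coord _
    · exact coord _
  refine Dio.of_iff (Dio.ex (B := fun (t : τ × Fin 2 → ringOfPrimes S) (z : κ × Fin 2 → ringOfPrimes S) =>
    ∃ a : τ ⊕ κ → ℤ, B (fun j => a (.inl j)) (fun j => a (.inr j)) ∧
        ∀ j i, Sum.elim (fun k => t (k, i)) (fun k => z (k, i)) j = model hS (a j) i) h1) fun t => ?_
  constructor
  · rintro ⟨a, ⟨b, hb⟩, ht⟩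
    refine ⟨fun p => model hS (b p.1) p.2, Sum.elim a b, hb, ?_⟩
    rintro (j | j) i
    · exact ht j i
    · rfl
  · rintro ⟨z, a, hb, ht⟩
    exact ⟨_, ⟨_, hb⟩, fun j i => ht (.inl j) i⟩

end Rel

lemma dio_near {ι : Type} {f g : (ι → ℚ) → ℚ} (hf : PolyFun f) (hg : PolyFun g) :
    Dio fun t => 0 < 1 / 2 + (f t - g t) ∧ 0 < 1 / 2 - (f t - g t) :=
  (Dio.pos ((const _).add (hf.sub hg))).and (Dio.pos ((const _).sub (hf.sub hg)))

lemma near_iff {a b : ℤ} {x : ℚ} (h : |x - (a - b : ℤ)| ≤ 1 / 10) : a = b ↔ 0 < 1 / 2 + x ∧ 0 < 1 / 2 - x := by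
  obtain ⟨h1, h2⟩ := abs_le.1 h
  push_cast at h1 h2
  constructor
  · rintro rfl
    constructor <;> linarith
  · rintro ⟨h3, h4⟩
    exact eq_of_abs_sub_lt (abs_lt.2 ⟨by linarith, by linarith⟩)

lemma rel_const (hS' : S ∩ T₂ = ∅) (c : ℤ) : Rel hS fun a : Unit → ℤ => a () = c :=
  .of_approx hS' (dio_near (coord ()) (const (c : ℚ))) fun a => near_iff (by
    obtain ⟨h1, h2⟩ := abs_le.1 (wc_pm (a ())).1
    rw [abs_le]
    push_cast
    constructor <;> linarith)

lemma rel_add (hS' : S ∩ T₂ = ∅) : Rel hS fun a : Fin 3 → ℤ => a 2 = a 0 + a 1 :=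
  .of_approx hS' (dio_near (coord 2) ((coord 0).add (coord 1))) fun a => near_iff (by
    obtain ⟨h1, h2⟩ := abs_le.1 (wc_pm (a 0)).1
    obtain ⟨h3, h4⟩ := abs_le.1 (wc_pm (a 1)).1
    obtain ⟨h5, h6⟩ := abs_le.1 (wc_pm (a 2)).1
    rw [abs_le]
    push_cast
    constructor <;> linarith)

lemma rel_sq (hS' : S ∩ T₂ = ∅) : Rel hS fun a : Fin 2 → ℤ => a 1 = a 0 ^ 2 :=
  .of_approx hS' (dio_near (coord 1) (coord 0).sq) fun a => near_iff (by
    obtain ⟨h1, h2⟩ := abs_le.1 (wc_pm (a 0)).1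
    obtain ⟨h3, h4⟩ := abs_le.1 (wc_pm (a 0)).2
    obtain ⟨h5, h6⟩ := abs_le.1 (wc_pm (a 1)).1
    have e : wc (pm (a 0) • P) ^ 2 = a 0 ^ 2 + 2 * ((wc (pm (a 0) • P) - a 0) * a 0) +
      (wc (pm (a 0) • P) - a 0) ^ 2 := by ring
    have h7 : (wc (pm (a 0) • P) - a 0) ^ 2 ≤ (1 / 100) ^ 2 := sq_le_sq' h1 h2
    have h8 := sq_nonneg (wc (pm (a 0) • P) - a 0)
    rw [abs_le]
    simp only [e]
    push_cast
    constructor <;> linarith)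

lemma rel_mul (hS' : S ∩ T₂ = ∅) : Rel hS fun a : Fin 3 → ℤ => a 2 = a 0 * a 1 := by
  refine .congr (A := fun a : Fin 3 → ℤ => ∃ z : Fin 6 → ℤ, z 0 = a 0 ^ 2 ∧ z 1 = a 1 ^ 2 ∧ z 2 = a 0 + a 1 ∧
    z 3 = z 2 ^ 2 ∧ z 4 = z 0 + z 1 ∧ z 5 = a 2 + a 2 ∧ z 3 = z 4 + z 5) (.ex ?_) fun a => ?_
  · exact ((rel_sq hS').comp hS' ![Sum.inl 0, Sum.inr 0]).and (((rel_sq hS').comp hS' ![Sum.inl 1, Sum.inr 1]).and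
      (((rel_add hS').comp hS' ![Sum.inl 0, Sum.inl 1, Sum.inr 2]).and (((rel_sq hS').comp hS' ![Sum.inr 2, Sum.inr 3]).and
      (((rel_add hS').comp hS' ![Sum.inr 0, Sum.inr 1, Sum.inr 4]).and
      (((rel_add hS').comp hS' ![Sum.inl 2, Sum.inl 2, Sum.inr 5]).and
      ((rel_add hS').comp hS' ![Sum.inr 4, Sum.inr 5, Sum.inr 3]))))))
  · constructor
    · intro h
      refine ⟨![a 0 ^ 2, a 1 ^ 2, a 0 + a 1, (a 0 + a 1) ^ 2, a 0 ^ 2 + a 1 ^ 2, a 2 + a 2],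
        rfl, rfl, rfl, rfl, rfl, rfl, ?_⟩
      change (a 0 + a 1) ^ 2 = a 0 ^ 2 + a 1 ^ 2 + (a 2 + a 2)
      rw [h]
      ring
    · rintro ⟨z, h0, h1, h2, h3, h4, h5, h6⟩
      rw [h3, h4, h5, h2, h0, h1] at h6
      linarith

lemma rel_eval (hS' : S ∩ T₂ = ∅) [Finite τ] (p : MvPolynomial τ ℤ) :
    Rel hS fun a : τ ⊕ Unit → ℤ => a (.inr ()) = MvPolynomial.eval (fun j => a (.inl j)) p := by
  induction p using MvPolynomial.induction_on with
  | C c => simpa using (rel_const hS' c).comp hS' fun u : Unit => (Sum.inr u : τ ⊕ Unit)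
  | add p q hp hq =>
    refine .congr (A := fun a => ∃ z : Fin 2 → ℤ, z 0 = MvPolynomial.eval (fun j => a (.inl j)) p ∧
      z 1 = MvPolynomial.eval (fun j => a (.inl j)) q ∧ a (.inr ()) = z 0 + z 1) (.ex ?_) fun a => ?_
    · exact (hp.comp hS' (Sum.elim (fun j => Sum.inl (Sum.inl j)) fun _ => Sum.inr 0)).and
        ((hq.comp hS' (Sum.elim (fun j => Sum.inl (Sum.inl j)) fun _ => Sum.inr 1)).and
          ((rel_add hS').comp hS' ![Sum.inr 0, Sum.inr 1, Sum.inl (Sum.inr ())]))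
    · rw [map_add]
      exact ⟨fun h => ⟨![_, _], rfl, rfl, h⟩, fun ⟨z, h1, h2, h⟩ => by rw [h, h1, h2]⟩
  | mul_X p i hp =>
    refine .congr (A := fun a => ∃ z : Unit → ℤ, z () = MvPolynomial.eval (fun j => a (.inl j)) p ∧
      a (.inr ()) = z () * a (.inl i)) (.ex ?_) fun a => ?_
    · exact (hp.comp hS' (Sum.elim (fun j => Sum.inl (Sum.inl j)) fun _ => Sum.inr ())).and
        ((rel_mul hS').comp hS' ![Sum.inr (), Sum.inl (Sum.inl i), Sum.inl (Sum.inr ())])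
    · rw [map_mul, MvPolynomial.eval_X]
      exact ⟨fun h => ⟨fun _ => _, rfl, h⟩, fun ⟨z, h1, h⟩ => by rw [h, h1]⟩

lemma rel_of_isDiophantine (hS' : S ∩ T₂ = ∅) [Fintype τ] {A : Set (τ → ℤ)} (hA : IsDiophantine ℤ τ A) :
    Rel hS fun a => a ∈ A := by
  obtain ⟨k, p, h⟩ := hA
  refine .congr (A := fun a => ∃ x : Fin k → ℤ, ∃ z : Unit → ℤ, z () = MvPolynomial.eval (Sum.elim a x) p ∧
    z () = 0) (.ex (.ex (.and ?_ ?_))) fun a => ?_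
  · refine (rel_eval hS' p).congr fun a => ?_
    rw [← Sum.elim_comp_inl_inr fun j => a (.inl j)]
    rfl
  · exact (rel_const hS' 0).comp hS' Sum.inr
  · rw [h]
    refine exists_congr fun x => ⟨fun h => ⟨fun _ => 0, h.symm, rfl⟩, ?_⟩
    rintro ⟨z, h1, h2⟩
    rw [← h1, h2]

end EC

/-- (Poonen) There are computable sets `T₁`, `T₂` of primes of natural density zero with
`T₁ ∩ T₂ = ∅` such that for every set `S` of primes with `T₁ ⊆ S` and `S ∩ T₂ = ∅`,
there is a Diophantine model `φ : ℤ → O_{ℚ,S}^k` of `ℤ` over `O_{ℚ,S}`: `φ` is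
injective, the images of the graphs of addition and multiplication are Diophantine over
`O_{ℚ,S}`, and the image of every Diophantine subset of `ℤ^m` is Diophantine over
`O_{ℚ,S}`. -/
theorem poonen_diophantine_model :
    ∃ T₁ T₂ : Set ℕ, (∀ p ∈ T₁, p.Prime) ∧ (∀ p ∈ T₂, p.Prime) ∧
      ComputablePred (fun p : ℕ => p ∈ T₁) ∧ ComputablePred (fun p : ℕ => p ∈ T₂) ∧
      HasNatDensity T₁ 0 ∧ HasNatDensity T₂ 0 ∧ T₁ ∩ T₂ = ∅ ∧
      ∀ S : Set ℕ, (∀ p ∈ S, p.Prime) → T₁ ⊆ S → S ∩ T₂ = ∅ →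
        ∃ (k : ℕ) (φ : ℤ → (Fin k → ringOfPrimes S)),
          Function.Injective φ ∧
          IsDiophantine (ringOfPrimes S) (Fin 3 × Fin k)
            {t | ∃ a b : ℤ, (∀ i, t (0, i) = φ a i) ∧ (∀ i, t (1, i) = φ b i) ∧
              ∀ i, t (2, i) = φ (a + b) i} ∧
          IsDiophantine (ringOfPrimes S) (Fin 3 × Fin k)
            {t | ∃ a b : ℤ, (∀ i, t (0, i) = φ a i) ∧ (∀ i, t (1, i) = φ b i) ∧
              ∀ i, t (2, i) = φ (a * b) i} ∧
          ∀ (m : ℕ) (A : Set (Fin m → ℤ)), IsDiophantine ℤ (Fin m) A →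
            IsDiophantine (ringOfPrimes S) (Fin m × Fin k)
              {t | ∃ a : Fin m → ℤ, a ∈ A ∧ ∀ j i, t (j, i) = φ (a j) i} := by
  refine ⟨EC.T₁, EC.T₂, fun p hp => hp.1, fun p hp => hp.1, EC.computable_T₁, EC.computable_T₂,
    EC.hasNatDensity_T₁, EC.hasNatDensity_T₂, EC.T₁_inter_T₂, fun S _ h₁ h₂ =>
    ⟨2, EC.model h₁, EC.model_injective h₁, Dio.isDiophantine ?_, Dio.isDiophantine ?_,
      fun m A hA => Dio.isDiophantine (EC.rel_of_isDiophantine h₂ hA)⟩⟩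
  · refine Dio.of_iff (EC.rel_add (hS := h₁) h₂) fun t => ?_
    constructor
    · rintro ⟨a, b, h0, h1, h2⟩
      refine ⟨![a, b, a + b], rfl, ?_⟩
      simp only [Fin.forall_fin_succ (n := 2), Fin.forall_fin_two]
      exact ⟨Fin.forall_fin_two.1 h0, Fin.forall_fin_two.1 h1, Fin.forall_fin_two.1 h2⟩
    · rintro ⟨a, h, ht⟩
      exact ⟨a 0, a 1, ht 0, ht 1, h ▸ ht 2⟩
  · refine Dio.of_iff (EC.rel_mul (hS := h₁) h₂) fun t => ?_
    constructor
    · rintro ⟨a, b, h0, h1, h2⟩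
      refine ⟨![a, b, a * b], rfl, ?_⟩
      simp only [Fin.forall_fin_succ (n := 2), Fin.forall_fin_two]
      exact ⟨Fin.forall_fin_two.1 h0, Fin.forall_fin_two.1 h1, Fin.forall_fin_two.1 h2⟩
    · rintro ⟨a, h, ht⟩
      exact ⟨a 0, a 1, ht 0, ht 1, h ▸ ht 2⟩
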